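/- For every 0 ≤ p < 1/2, the DaC model is critical at r = r_c(p): Θ(p, r_c(p)) = 0 and Θ*(p, 1 − r_c(p)) = 0, and under ℙ_{p,r_c(p)} both the mean size of the black r-cluster of the origin and the mean size of the white *-cluster of the origin are infinite. -/

import Mathlib

/-!
Common definitions for the Divide-and-Colour (DaC) model of
Bálint, Camia and Meester, "Sharp phase transition and critical
behaviour in 2D divide and colour models".

The model is built concretely: a single uniform random variable on `(0,1]`
is decomposed into countably many i.i.d. uniform random variables (via its
binary digits); one family of uniforms drives the Bernoulli(p) bond
percolation (the edge configuration), and an independent family of uniforms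
attaches an independent Bernoulli(r) colour to each bond cluster (the colour
of a cluster is determined by the uniform label of its canonical
representative, the vertex of minimal encoding).  The DaC measure
`ℙ_{p,r}` is the pushforward of Lebesgue measure on `(0,1]` under the map
producing the pair (edge configuration, colour configuration).
-/

open MeasureTheory ENNReal

namespace DaC

/-- Vertices of the lattice. -/
abbrev V : Type := ℤ × ℤ

/-- Square lattice adjacency: Euclidean distance `1`. -/
def SqAdj (u v : V) : Prop := (u.1 - v.1) ^ 2 + (u.2 - v.2) ^ 2 = 1

/-- `*`-adjacency (matching graph of the square lattice):
Euclidean distance `1` or `√2`. -/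
def StarAdj (u v : V) : Prop :=
  (u.1 - v.1) ^ 2 + (u.2 - v.2) ^ 2 = 1 ∨ (u.1 - v.1) ^ 2 + (u.2 - v.2) ^ 2 = 2

/-- Triangular lattice adjacency. -/
def TriAdj (u v : V) : Prop :=
  (u.1 - v.1, u.2 - v.2) ∈
    ({(1, 0), (-1, 0), (0, 1), (0, -1), (1, 1), (-1, -1)} : Set (ℤ × ℤ))

/-- Classical indicator of a proposition, as a boolean. -/
noncomputable def boolOf (P : Prop) : Bool := @decide P (Classical.propDecidable P)

/-- The `n`-th binary digit of a real number `x ∈ (0,1]`. -/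
noncomputable def bit (n : ℕ) (x : ℝ) : Bool := boolOf (⌊x * 2 ^ (n + 1)⌋ % 2 = 1)

/-- A countable family of i.i.d. uniform random variables on `[0,1]`, extracted
from a single uniform sample `x` by splitting its binary digits. -/
noncomputable def unif (i : ℕ) (x : ℝ) : ℝ :=
  ∑' k : ℕ, if bit (Nat.pair i k) x then ((2 : ℝ)⁻¹) ^ (k + 1) else 0

/-- A symmetric encoding of (unordered) pairs of vertices. -/
noncomputable def eIdx (u v : V) : ℕ :=
  min (Encodable.encode (u, v)) (Encodable.encode (v, u))

/-- The uniform label attached to the edge `{u,v}`. -/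
noncomputable def edgeU (u v : V) (x : ℝ) : ℝ := unif (2 * eIdx u v) x

/-- The uniform label attached to the vertex `v` (independent of the edge labels). -/
noncomputable def vtxU (v : V) (x : ℝ) : ℝ := unif (2 * Encodable.encode v + 1) x

/-- Edge configurations: a boolean (open/closed) for each (ordered) pair of
vertices; configurations arising from the model are symmetric and are
supported on pairs of adjacent vertices. -/
abbrev EdgeCfg : Type := V → V → Bool

/-- Colour configurations: a colour (black = `true`, white = `false`) for each vertex. -/
abbrev ColourCfg : Type := V → Bool

/-- Full configurations of the DaC model: an edge configuration together with
a colour configuration. -/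
abbrev Config : Type := EdgeCfg × ColourCfg

/-- The Bernoulli(p) edge configuration determined by the uniform sample `x`,
on the lattice with adjacency `adj`: an edge `{u,v}` of the lattice is open
iff its uniform label is `< p`. -/
noncomputable def edgeCfg (adj : V → V → Prop) (p : ℝ) (x : ℝ) : EdgeCfg :=
  fun u v => boolOf (adj u v) && boolOf (edgeU u v x < p)

/-- Connectivity through open edges of the edge configuration `η`. -/
def Conn (η : EdgeCfg) (u v : V) : Prop :=
  Relation.ReflTransGen (fun a b => η a b = true) u v

/-- The `p`-cluster of the vertex `v`: its connected component in the graph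
retaining only open edges. -/
def pCluster (η : EdgeCfg) (v : V) : Set V := {w | Conn η v w}

/-- Canonical representative of the `p`-cluster of `v`: the vertex of the
cluster with minimal encoding. -/
noncomputable def clusterRep (η : EdgeCfg) (v : V) : V :=
  (Encodable.decode (α := V) (sInf (Encodable.encode '' pCluster η v))).getD v

/-- The colour configuration with parameters `p, r` determined by the uniform
sample `x`: every `p`-cluster is coloured black (with probability `r`)
or white, independently of all other `p`-clusters, according to the uniform
label of its canonical representative. -/
noncomputable def colourCfg (adj : V → V → Prop) (p r : ℝ) (x : ℝ) : ColourCfg :=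
  fun v => boolOf (vtxU (clusterRep (edgeCfg adj p x) v) x < r)

/-- The uniform sample: Lebesgue measure on `(0,1]`. -/
noncomputable def base : Measure ℝ := volume.restrict (Set.Ioc 0 1)

/-- `ν_p`: the product Bernoulli(p) measure on edge configurations of the
lattice with adjacency `adj`. -/
noncomputable def edgeMeasure (adj : V → V → Prop) (p : ℝ) : Measure EdgeCfg :=
  base.map (edgeCfg adj p)

/-- `ℙ_{p,r}`: the DaC measure on pairs (edge configuration, colour
configuration) for the lattice with adjacency `adj`. -/
noncomputable def DaCMeasure (adj : V → V → Prop) (p r : ℝ) : Measure Config :=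
  base.map (fun x => (edgeCfg adj p x, colourCfg adj p r x))

/-- Monochromatic connectivity: `u` and `v` are joined by a path (for the
adjacency `adj`) all of whose vertices have colour `c`. -/
def MonoConn (adj : V → V → Prop) (ξ : ColourCfg) (c : Bool) (u v : V) : Prop :=
  Relation.ReflTransGen (fun a b => adj a b ∧ ξ a = c ∧ ξ b = c) u v

/-- The colour-`c` cluster of `v` (for the adjacency `adj`): empty if `v` does
not have colour `c`, and otherwise the maximal `adj`-connected set of
`c`-coloured vertices containing `v`. -/
def monoCluster (adj : V → V → Prop) (ξ : ColourCfg) (c : Bool) (v : V) : Set V :=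
  {w | ξ v = c ∧ MonoConn adj ξ c v w}

/-- The origin. -/
def origin : V := (0, 0)

/-- The size (cardinality) of a set of vertices, with values in `ℝ≥0∞`. -/
noncomputable def sizeE (S : Set V) : ℝ≥0∞ := S.encard

/-- The probability, under the DaC measure with edge adjacency `eadj` and
parameters `p, r`, that the origin lies in an infinite colour-`c` cluster for
the adjacency `cadj`. -/
noncomputable def percProb (eadj cadj : V → V → Prop) (c : Bool) (p r : ℝ) : ℝ≥0∞ :=
  DaCMeasure eadj p r {ω | (monoCluster cadj ω.2 c origin).Infinite}

/-- `Θ(p,r)` for the square lattice: probability that the origin lies in an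
infinite black `r`-cluster. -/
noncomputable def thetaSq (p r : ℝ) : ℝ≥0∞ := percProb SqAdj SqAdj true p r

/-- `Θ*(p,s)` for the square lattice: the `ℙ_{p,1-s}`-probability that the
origin lies in an infinite white `*`-cluster. -/
noncomputable def thetaStarSq (p s : ℝ) : ℝ≥0∞ := percProb SqAdj StarAdj false p (1 - s)

/-- `Θ(p,r)` for the triangular lattice. -/
noncomputable def thetaTri (p r : ℝ) : ℝ≥0∞ := percProb TriAdj TriAdj true p r

/-- The critical colouring density `r_c(p)` of the square lattice DaC model. -/
noncomputable def rcSq (p : ℝ) : ℝ :=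
  sSup {r : ℝ | r ∈ Set.Icc (0 : ℝ) 1 ∧ thetaSq p r = 0}

/-- The critical colouring density `r_c*(p)` for white `*`-percolation. -/
noncomputable def rcStarSq (p : ℝ) : ℝ :=
  sSup {s : ℝ | s ∈ Set.Icc (0 : ℝ) 1 ∧ thetaStarSq p s = 0}

/-- The critical colouring density `r_c(p)` of the triangular lattice DaC model. -/
noncomputable def rcTri (p : ℝ) : ℝ :=
  sSup {r : ℝ | r ∈ Set.Icc (0 : ℝ) 1 ∧ thetaTri p r = 0}

/-! ### Rectangles and crossings -/

/-- The rectangle `S_{n,m} = ([0,n] × [0,m]) ∩ ℤ²`. -/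
def Rect (n m : ℕ) : Set V :=
  {v | 0 ≤ v.1 ∧ v.1 ≤ (n : ℤ) ∧ 0 ≤ v.2 ∧ v.2 ≤ (m : ℤ)}

/-- The top side of `S_{n,m}`. -/
def TopSide (n m : ℕ) : Set V := {v | v ∈ Rect n m ∧ v.2 = (m : ℤ)}

/-- The bottom side of `S_{n,m}`. -/
def BotSide (n m : ℕ) : Set V := {v | v ∈ Rect n m ∧ v.2 = 0}

/-- The left side of `S_{n,m}`. -/
def LeftSide (n m : ℕ) : Set V := {v | v ∈ Rect n m ∧ v.1 = 0}

/-- The right side of `S_{n,m}`. -/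
def RightSide (n m : ℕ) : Set V := {v | v ∈ Rect n m ∧ v.1 = (n : ℤ)}

/-- There is a path (for the adjacency `adj`), all of whose vertices lie in the
region `R` and satisfy the predicate `good`, from the set `A` to the set `B`. -/
def HasCrossing (adj : V → V → Prop) (good : V → Prop) (R A B : Set V) : Prop :=
  ∃ (k : ℕ) (f : Fin (k + 1) → V),
    (∀ i, f i ∈ R ∧ good (f i)) ∧
    (∀ i : Fin k, adj (f i.castSucc) (f i.succ)) ∧
    f 0 ∈ A ∧ f (Fin.last k) ∈ B

/-- `V^b_{n,m}` as a set of colour configurations: there is a black vertical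
crossing of `S_{n,m}` (for the adjacency `adj`). -/
def VertBC (adj : V → V → Prop) (n m : ℕ) : Set ColourCfg :=
  {ξ | HasCrossing adj (fun v => ξ v = true) (Rect n m) (TopSide n m) (BotSide n m)}

/-- `V^{w*}_{n,m}` as a set of colour configurations: there is a white vertical
`*`-crossing of `S_{n,m}`. -/
def VertWStarC (n m : ℕ) : Set ColourCfg :=
  {ξ | HasCrossing StarAdj (fun v => ξ v = false) (Rect n m) (TopSide n m) (BotSide n m)}

/-- `H^{w*}_{n,m}` as a set of colour configurations: there is a white
horizontal `*`-crossing of `S_{n,m}`. -/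
def HorizWStarC (n m : ℕ) : Set ColourCfg :=
  {ξ | HasCrossing StarAdj (fun v => ξ v = false) (Rect n m) (LeftSide n m) (RightSide n m)}

/-- The event (set of full configurations) determined by a set of colour
configurations. -/
def colourEvent (C : Set ColourCfg) : Set Config := {ω | ω.2 ∈ C}

/-! ### Events depending on colours, increasing events, pivotal clusters -/

/-- The event `A` is defined in terms of the colours of the vertices in `W`. -/
def DependsOnColoursIn (A : Set Config) (W : Set V) : Prop :=
  ∀ ω ω' : Config, (∀ v ∈ W, ω.2 v = ω'.2 v) → (ω ∈ A ↔ ω' ∈ A)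

/-- The event `A` is increasing (for the partial order comparing colour
configurations pointwise, black = `true` above white = `false`). -/
def IncreasingColourEvent (A : Set Config) : Prop :=
  ∀ ω ω' : Config, (∀ v : V, ω.2 v = true → ω'.2 v = true) → ω ∈ A → ω' ∈ A

/-- Flip the colours of the vertices of `C`. -/
noncomputable def flipOn (C : Set V) (ξ : ColourCfg) : ColourCfg :=
  fun v => @ite _ (v ∈ C) (Classical.propDecidable _) (!ξ v) (ξ v)

/-- The set `C` is a pivotal `p`-cluster for the event `A` in the
configuration `ω`: `C` is a `p`-cluster of the edge configuration of `ω`, and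
flipping the colour of (all the vertices of) `C` changes whether the
configuration belongs to `A`. -/
def IsPivotal (A : Set Config) (ω : Config) (C : Set V) : Prop :=
  (∃ v : V, C = pCluster ω.1 v) ∧ ¬ (ω ∈ A ↔ (ω.1, flipOn C ω.2) ∈ A)

/-- `n(A)`: the number of pivotal `p`-clusters for the event `A`, with values
in `ℝ≥0∞`. -/
noncomputable def numPivotal (A : Set Config) (ω : Config) : ℝ≥0∞ :=
  {C : Set V | IsPivotal A ω C}.encard

/-! ### Barriers -/

/-- Connectivity in the square lattice avoiding the edges of `E`. -/
def AvoidConn (E : Set (V × V)) (u v : V) : Prop :=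
  Relation.ReflTransGen (fun a b => SqAdj a b ∧ (a, b) ∉ E ∧ (b, a) ∉ E) u v

/-- `E` is a barrier: a set of edges of the square lattice whose removal
(keeping the end-vertices) separates `ℤ²` into two or more connected
components, exactly one of which is infinite. -/
def IsBarrier (E : Set (V × V)) : Prop :=
  (∀ e ∈ E, SqAdj e.1 e.2) ∧
  (∃ v, {w | AvoidConn E v w}.Infinite) ∧
  (∀ v w, {x | AvoidConn E v x}.Infinite → {x | AvoidConn E w x}.Infinite → AvoidConn E v w) ∧
  (∃ v, {w | AvoidConn E v w}.Finite)

/-- The exterior of a barrier: its unique infinite complementary component. -/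
def barrierExt (E : Set (V × V)) : Set V := {v | {w | AvoidConn E v w}.Infinite}

/-- The interior of a barrier: the union of the finite complementary components. -/
def barrierInt (E : Set (V × V)) : Set V := {v | {w | AvoidConn E v w}.Finite}

/-- The event `A ⊆ EdgeCfg` is increasing (opening edges preserves it). -/
def IncreasingEdgeEvent (A : Set EdgeCfg) : Prop :=
  ∀ η η' : EdgeCfg, (∀ a b : V, η a b = true → η' a b = true) → η ∈ A → η' ∈ A

/-- The event `A ⊆ EdgeCfg` depends only on the states of the edges both of
whose endpoints lie in `W`. -/
def DependsOnEdgesIn (A : Set EdgeCfg) (W : Set V) : Prop :=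
  ∀ η η' : EdgeCfg, (∀ a b : V, a ∈ W → b ∈ W → η a b = η' a b) → (η ∈ A ↔ η' ∈ A)

/-! ### Translations -/

/-- Translation of configurations by the vector `u`. -/
def shift (u : V) (ω : Config) : Config :=
  (fun a b => ω.1 (a + u) (b + u), fun a => ω.2 (a + u))

end DaC

set_option linter.all false
set_option linter.deprecated false

namespace DaC

section Wsum
variable {ι : Type*} [DecidableEq ι]

/-- Expectation of `f` of a random subset of `E`. -/
noncomputable def wsum (p : ι → ℝ) (E : Finset ι) (f : Finset ι → ℝ) : ℝ :=
  ∑ η ∈ E.powerset, ((∏ i ∈ η, p i) * (∏ i ∈ E \ η, (1 - p i))) * f η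

lemma wsum_empty (p : ι → ℝ) (f : Finset ι → ℝ) : wsum p ∅ f = f ∅ := by
  simp [wsum]

lemma wsum_insert (p : ι → ℝ) {E : Finset ι} {e : ι} (he : e ∉ E) (f : Finset ι → ℝ) :
    wsum p (insert e E) f
      = p e * wsum p E (fun η => f (insert e η)) + (1 - p e) * wsum p E f := by
  unfold wsum
  rw [Finset.sum_powerset_insert he, add_comm, Finset.mul_sum, Finset.mul_sum]
  congr 1
  · refine Finset.sum_congr rfl fun η hη => ?_
    have h1 : e ∉ η := fun h => he (Finset.mem_powerset.1 hη h)
    have h2 : insert e E \ insert e η = E \ η := by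
      ext x; simp only [Finset.mem_sdiff, Finset.mem_insert]
      constructor
      · rintro ⟨h | h, h'⟩
        · exact absurd (Or.inl h) h'
        · exact ⟨h, fun h3 => h' (Or.inr h3)⟩
      · rintro ⟨h, h'⟩
        refine ⟨Or.inr h, ?_⟩
        rintro (rfl | h3)
        · exact he h
        · exact h' h3
    rw [Finset.prod_insert h1, h2]; ring
  · refine Finset.sum_congr rfl fun η hη => ?_
    have h1 : e ∉ η := fun h => he (Finset.mem_powerset.1 hη h)
    rw [Finset.insert_sdiff_of_notMem _ h1, Finset.prod_insert (by simp [he])]; ring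

lemma wsum_congr {p : ι → ℝ} {E : Finset ι} {f g : Finset ι → ℝ}
    (h : ∀ η ⊆ E, f η = g η) : wsum p E f = wsum p E g := by
  unfold wsum
  exact Finset.sum_congr rfl fun η hη => by rw [h η (Finset.mem_powerset.1 hη)]

lemma wsum_add (p : ι → ℝ) (E : Finset ι) (f g : Finset ι → ℝ) :
    wsum p E (fun η => f η + g η) = wsum p E f + wsum p E g := by
  simp [wsum, mul_add, Finset.sum_add_distrib]

lemma wsum_sub (p : ι → ℝ) (E : Finset ι) (f g : Finset ι → ℝ) :
    wsum p E (fun η => f η - g η) = wsum p E f - wsum p E g := by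
  simp [wsum, mul_sub, Finset.sum_sub_distrib]

lemma wsum_mul_left (p : ι → ℝ) (E : Finset ι) (c : ℝ) (f : Finset ι → ℝ) :
    wsum p E (fun η => c * f η) = c * wsum p E f := by
  simp only [wsum, Finset.mul_sum]
  exact Finset.sum_congr rfl fun η _ => by ring

lemma wsum_sum {κ : Type*} (p : ι → ℝ) (E : Finset ι) (s : Finset κ) (f : κ → Finset ι → ℝ) :
    wsum p E (fun η => ∑ k ∈ s, f k η) = ∑ k ∈ s, wsum p E (f k) := by
  simp only [wsum, Finset.mul_sum]
  exact Finset.sum_comm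

lemma wsum_const (p : ι → ℝ) (E : Finset ι) (c : ℝ) : wsum p E (fun _ => c) = c := by
  induction E using Finset.induction_on with
  | empty => exact wsum_empty _ _
  | insert e E he ih => rw [wsum_insert p he, ih]; ring

lemma wsum_nonneg {p : ι → ℝ} {E : Finset ι} {f : Finset ι → ℝ}
    (hp : ∀ i, 0 ≤ p i ∧ p i ≤ 1) (h : ∀ η ⊆ E, 0 ≤ f η) : 0 ≤ wsum p E f := by
  unfold wsum
  refine Finset.sum_nonneg fun η hη => ?_
  refine mul_nonneg (mul_nonneg ?_ ?_) (h η (Finset.mem_powerset.1 hη))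
  · exact Finset.prod_nonneg fun i _ => (hp i).1
  · exact Finset.prod_nonneg fun i _ => by linarith [(hp i).2]

lemma wsum_le_wsum {p : ι → ℝ} {E : Finset ι} {f g : Finset ι → ℝ}
    (hp : ∀ i, 0 ≤ p i ∧ p i ≤ 1) (h : ∀ η ⊆ E, f η ≤ g η) : wsum p E f ≤ wsum p E g := by
  have := wsum_nonneg (E := E) (f := fun η => g η - f η) hp (fun η hη => sub_nonneg.2 (h η hη))
  rw [wsum_sub] at this; linarith

/-- product structure -/
lemma wsum_union (p : ι → ℝ) {E F : Finset ι} (hd : Disjoint E F) (f : Finset ι → ℝ) :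
    wsum p (E ∪ F) f = wsum p E (fun η => wsum p F (fun ζ => f (η ∪ ζ))) := by
  induction E using Finset.induction_on generalizing f with
  | empty => simp [wsum_empty]
  | insert e E he ih =>
    rw [Finset.disjoint_insert_left] at hd
    rw [Finset.insert_union, wsum_insert p (by simp [he, hd.1]), wsum_insert p he, ih hd.2, ih hd.2]
    simp only [Finset.insert_union]

/-- independence -/
lemma wsum_union_mul (p : ι → ℝ) {E F : Finset ι} (hd : Disjoint E F) (f g : Finset ι → ℝ) :
    wsum p (E ∪ F) (fun η => f (η ∩ E) * g (η ∩ F)) = wsum p E f * wsum p F g := by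
  rw [wsum_union p hd, mul_comm (wsum p E f), ← wsum_mul_left]
  refine wsum_congr fun η hη => ?_
  rw [mul_comm, ← wsum_mul_left]
  refine wsum_congr fun ζ hζ => ?_
  have h1 : (η ∪ ζ) ∩ E = η := by
    rw [Finset.union_inter_distrib_right, Finset.inter_eq_left.2 hη,
      Finset.disjoint_iff_inter_eq_empty.1 (hd.symm.mono_left hζ), Finset.union_empty]
  have h2 : (η ∪ ζ) ∩ F = ζ := by
    rw [Finset.union_inter_distrib_right, Finset.inter_eq_left.2 hζ,
      Finset.disjoint_iff_inter_eq_empty.1 (hd.mono_left hη), Finset.empty_union]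
  rw [h1, h2]

/-- extra coordinates are irrelevant -/
lemma wsum_subset (p : ι → ℝ) {E F : Finset ι} (h : E ⊆ F) (f : Finset ι → ℝ) :
    wsum p F (fun η => f (η ∩ E)) = wsum p E f := by
  have := wsum_union_mul p (E := E) (F := F \ E) Finset.disjoint_sdiff f (fun _ => 1)
  rw [wsum_const, mul_one, Finset.union_sdiff_of_subset h] at this
  simpa using this

lemma wsum_mono_p {p q : ι → ℝ} {E : Finset ι} {f : Finset ι → ℝ}
    (hp : ∀ i, 0 ≤ p i) (hpq : ∀ i, p i ≤ q i) (hq : ∀ i, q i ≤ 1) (hf : Monotone f) :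
    wsum p E f ≤ wsum q E f := by
  induction E using Finset.induction_on generalizing f with
  | empty => simp [wsum_empty]
  | insert e E he ih =>
    rw [wsum_insert p he, wsum_insert q he]
    have h1 : wsum p E (fun η => f (insert e η)) ≤ wsum q E (fun η => f (insert e η)) :=
      ih fun a b hab => hf (Finset.insert_subset_insert e hab)
    have h2 := ih hf
    have h3 : wsum q E f ≤ wsum q E (fun η => f (insert e η)) :=
      wsum_le_wsum (fun i => ⟨(hp i).trans (hpq i), hq i⟩) fun η _ => hf (Finset.subset_insert e η)
    nlinarith [hp e, hpq e, hq e, mul_le_mul_of_nonneg_left h1 (hp e),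
      mul_le_mul_of_nonneg_left h2 (by linarith [hpq e, hq e] : 0 ≤ 1 - p e),
      mul_nonneg (sub_nonneg.2 (hpq e)) (sub_nonneg.2 h3)]

lemma wsum_flip (p : ι → ℝ) (E : Finset ι) (f : Finset ι → ℝ) :
    wsum p E (fun η => f (E \ η)) = wsum (fun i => 1 - p i) E f := by
  induction E using Finset.induction_on generalizing f with
  | empty => simp [wsum_empty]
  | insert e E he ih =>
    rw [wsum_insert p he, wsum_insert _ he, ← ih, ← ih]
    have h1 : wsum p E (fun η => f (insert e E \ insert e η)) = wsum p E (fun η => f (E \ η)) :=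
      wsum_congr fun η hη => by
        congr 1; ext x; simp only [Finset.mem_sdiff, Finset.mem_insert]
        by_cases hx : x = e
        · subst hx; simp [he]
        · simp [hx]
    have h2 : wsum p E (fun η => f (insert e E \ η)) = wsum p E (fun η => f (insert e (E \ η))) :=
      wsum_congr fun η hη => by
        rw [Finset.insert_sdiff_of_notMem _ fun h => he (hη h)]
    rw [h1, h2]; ring

/-- conditioning on one coordinate -/
lemma wsum_erase (p : ι → ℝ) {E : Finset ι} {e : ι} (he : e ∈ E) (f : Finset ι → ℝ) :
    wsum p E f = p e * wsum p (E.erase e) (fun η => f (insert e η))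
      + (1 - p e) * wsum p (E.erase e) f := by
  rw [← wsum_insert p (Finset.notMem_erase e E), Finset.insert_erase he]

lemma wsum_continuous (E : Finset ι) (f : Finset ι → ℝ) {X : Type*} [TopologicalSpace X]
    (P : X → ι → ℝ) (hP : ∀ i, Continuous fun x => P x i) :
    Continuous fun x => wsum (P x) E f := by
  unfold wsum
  refine continuous_finsetSum _ fun η _ => ?_
  refine Continuous.mul (Continuous.mul ?_ ?_) continuous_const
  · exact continuous_finsetProd _ fun i _ => hP i
  · exact continuous_finsetProd _ fun i _ => continuous_const.sub (hP i)

lemma wsum_hasDerivAt (E : Finset ι) (f : Finset ι → ℝ) (p : ℝ) :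
    HasDerivAt (fun p : ℝ => wsum (fun _ => p) E f)
      (∑ e ∈ E, wsum (fun _ => p) (E.erase e) (fun η => f (insert e η) - f η)) p := by
  induction E using Finset.induction_on generalizing f with
  | empty => simp only [wsum_empty, Finset.sum_empty]; exact hasDerivAt_const _ _
  | insert e E he ih =>
    have h := ((hasDerivAt_id p).mul (ih (fun η => f (insert e η)))).add
      (((hasDerivAt_const p (1 : ℝ)).sub (hasDerivAt_id p)).mul (ih f))
    have h0 : (fun p : ℝ => wsum (fun _ => p) (insert e E) f) = (id * fun p : ℝ =>
        wsum (fun _ => p) E (fun η => f (insert e η))) + (((fun _ => (1 : ℝ)) - id) *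
        fun p : ℝ => wsum (fun _ => p) E f) := by
      funext q; simp [wsum_insert _ he]
    rw [h0]
    refine h.congr_deriv ?_
    rw [Finset.sum_insert he, Finset.erase_insert he, wsum_sub]
    have h1 : ∀ x ∈ E, wsum (fun _ => p) ((insert e E).erase x) (fun η => f (insert x η) - f η)
      = p * wsum (fun _ => p) (E.erase x) (fun η => f (insert e (insert x η)) - f (insert e η))
       + (1 - p) * wsum (fun _ => p) (E.erase x) (fun η => f (insert x η) - f η) := by
      intro x hx
      have hxe : e ≠ x := fun h => he (h ▸ hx)
      rw [Finset.erase_insert_of_ne hxe, wsum_insert _ (by simp [he])]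
      simp only [Finset.insert_comm e x]
    rw [Finset.sum_congr rfl h1, Finset.sum_add_distrib, ← Finset.mul_sum, ← Finset.mul_sum]
    simp; ring

end Wsum
end DaC

namespace DaC

section FKG
lemma wsum_one {ι : Type*} [DecidableEq ι] (E : Finset ι) (f : Finset ι → ℝ) :
    wsum (fun _ => (1 : ℝ)) E f = f E := by
  induction E using Finset.induction_on generalizing f with
  | empty => simp [wsum_empty]
  | insert e E he ih => rw [wsum_insert _ he, ih]; simp

variable {α : Type*}

/-- finite-volume connectivity -/
def Cn (η : Finset (Sym2 α)) (a b : α) : Prop := Relation.ReflTransGen (fun a b => s(a, b) ∈ η) a b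

lemma Cn.symm {η : Finset (Sym2 α)} {a b : α} (h : Cn η a b) : Cn η b a := by
  induction h with
  | refl => exact .refl
  | tail _ h ih => exact Relation.ReflTransGen.head (by rwa [Sym2.eq_swap]) ih

lemma Cn.trans {η : Finset (Sym2 α)} {a b c : α} (h : Cn η a b) (h' : Cn η b c) : Cn η a c :=
  Relation.ReflTransGen.trans h h'

lemma Cn.mono {η ζ : Finset (Sym2 α)} (hs : η ⊆ ζ) {a b : α} (h : Cn η a b) : Cn ζ a b :=
  Relation.ReflTransGen.mono (fun _ _ h => hs h) _ _ h

def To (η : Finset (Sym2 α)) (S : Finset α) (v : α) : Prop := ∃ s ∈ S, Cn η s v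

def Dj (η : Finset (Sym2 α)) (S T : Finset α) : Prop := ∀ t ∈ T, ¬ To η S t

lemma Dj.symm {η : Finset (Sym2 α)} {S T : Finset α} (h : Dj η S T) : Dj η T S :=
  fun s hs ⟨t, ht, hc⟩ => h t ht ⟨s, hs, hc.symm⟩

variable [DecidableEq α]

lemma To_insert {η : Finset (Sym2 α)} {S : Finset α} {x v : α} :
    To η (insert x S) v ↔ Cn η x v ∨ To η S v := by
  simp [To]

lemma To_edge {η : Finset (Sym2 α)} {S : Finset α} {s y v : α} (hs : s ∈ S) :
    To (insert s(s, y) η) S v ↔ To η (insert y S) v := by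
  constructor
  · rintro ⟨s0, hs0, h⟩
    induction h with
    | refl => exact ⟨s0, Finset.mem_insert_of_mem hs0, .refl⟩
    | @tail b c _ h ih =>
      rcases Finset.mem_insert.1 h with h | h
      · rcases Sym2.eq_iff.1 h with ⟨_, rfl⟩ | ⟨_, rfl⟩
        · exact ⟨_, Finset.mem_insert_self _ _, .refl⟩
        · exact ⟨_, Finset.mem_insert_of_mem hs, .refl⟩
      · obtain ⟨z, hz, hc⟩ := ih
        exact ⟨z, hz, hc.tail h⟩
  · rintro ⟨z, hz, h⟩
    have h' := h.mono (Finset.subset_insert s(s, y) η)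
    rcases Finset.mem_insert.1 hz with rfl | hz
    · exact ⟨s, hs, Relation.ReflTransGen.head (Finset.mem_insert_self _ _) h'⟩
    · exact ⟨z, hz, h'⟩

lemma Cn_edge {η : Finset (Sym2 α)} {s y v w : α} (h1 : ¬ Cn η v s) (h2 : ¬ Cn η v y) :
    Cn (insert s(s, y) η) v w ↔ Cn η v w := by
  refine ⟨fun h => ?_, fun h => h.mono (Finset.subset_insert _ _)⟩
  induction h with
  | refl => exact .refl
  | @tail b c _ h ih =>
    rcases Finset.mem_insert.1 h with h | h
    · rcases Sym2.eq_iff.1 h with ⟨rfl, _⟩ | ⟨rfl, _⟩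
      · exact absurd ih h1
      · exact absurd ih h2
    · exact ih.tail h

def col (W : Finset α) (c : Set α → α) (η : Finset (Sym2 α)) (S T B : Finset α) : Set α :=
  {v | v ∈ W ∧ (To η S v ∨ (¬ To η T v ∧ c {w | Cn η v w} ∈ B))}

open Classical in
noncomputable def GG (W : Finset α) (c : Set α → α) (r : ℝ) (η : Finset (Sym2 α)) (S T : Finset α)
    (f : Set α → ℝ) : ℝ :=
  if Dj η S T then wsum (fun _ => r) W (fun B => f (col W c η S T B)) else 0

noncomputable def ZZ (W : Finset α) (c : Set α → α) (p r : ℝ) (E : Finset (Sym2 α)) (S T : Finset α)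
    (f : Set α → ℝ) : ℝ :=
  wsum (fun _ => p) E (fun η => GG W c r η S T f)

open Classical in
noncomputable def zz (p : ℝ) (E : Finset (Sym2 α)) (S T : Finset α) : ℝ :=
  wsum (fun _ => p) E (fun η => if Dj η S T then 1 else 0)

variable {W : Finset α} {c : Set α → α} {p r : ℝ}

lemma GG_edgeS {η : Finset (Sym2 α)} {S T : Finset α} {s y : α} (hs : s ∈ S) (f : Set α → ℝ) :
    GG W c r (insert s(s, y) η) S T f = GG W c r η (insert y S) T f := by
  have hd : Dj (insert s(s, y) η) S T ↔ Dj η (insert y S) T := by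
    simp only [Dj, To_edge hs]
  unfold GG
  by_cases h : Dj η (insert y S) T
  · rw [if_pos h, if_pos (hd.2 h)]
    congr 1; funext B; congr 1; ext v
    have hT : To (insert s(s, y) η) T v ↔ To η T v := by
      unfold To
      refine exists_congr fun t => and_congr_right fun ht => Cn_edge ?_ ?_
      · exact fun hc => h t ht ⟨s, Finset.mem_insert_of_mem hs, hc.symm⟩
      · exact fun hc => h t ht ⟨y, Finset.mem_insert_self _ _, hc.symm⟩
    simp only [col, Set.mem_ofPred_eq, To_edge hs, hT]
    by_cases hv : To η (insert y S) v
    · simp [hv]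
    · have : {w | Cn (insert s(s, y) η) v w} = {w | Cn η v w} := by
        ext w; refine Cn_edge ?_ ?_
        · exact fun hc => hv ⟨s, Finset.mem_insert_of_mem hs, hc.symm⟩
        · exact fun hc => hv ⟨y, Finset.mem_insert_self _ _, hc.symm⟩
      rw [this]
  · rw [if_neg h, if_neg (fun h' => h (hd.1 h'))]

lemma GG_edgeT {η : Finset (Sym2 α)} {S T : Finset α} {t y : α} (ht : t ∈ T) (f : Set α → ℝ) :
    GG W c r (insert s(t, y) η) S T f = GG W c r η S (insert y T) f := by
  have hd : Dj (insert s(t, y) η) S T ↔ Dj η S (insert y T) := by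
    constructor
    · intro h; refine Dj.symm fun s hs => ?_
      rw [← To_edge ht]; exact h.symm s hs
    · intro h; refine Dj.symm fun s hs => ?_
      rw [To_edge ht]; exact h.symm s hs
  unfold GG
  by_cases h : Dj η S (insert y T)
  · rw [if_pos h, if_pos (hd.2 h)]
    congr 1; funext B; congr 1; ext v
    have hT : To (insert s(t, y) η) S v ↔ To η S v := by
      unfold To
      refine exists_congr fun s => and_congr_right fun hs => Cn_edge ?_ ?_
      · exact fun hc => h t (Finset.mem_insert_of_mem ht) ⟨s, hs, hc⟩
      · exact fun hc => h y (Finset.mem_insert_self _ _) ⟨s, hs, hc⟩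
    simp only [col, Set.mem_ofPred_eq, To_edge ht, hT]
    by_cases hv : To η (insert y T) v
    · simp [hv]
    · have : {w | Cn (insert s(t, y) η) v w} = {w | Cn η v w} := by
        ext w; refine Cn_edge ?_ ?_
        · exact fun hc => hv ⟨t, Finset.mem_insert_of_mem ht, hc.symm⟩
        · exact fun hc => hv ⟨y, Finset.mem_insert_self _ _, hc.symm⟩
      rw [this]
  · rw [if_neg h, if_neg (fun h' => h (hd.1 h'))]

lemma ZZ_stepS {E : Finset (Sym2 α)} {S T : Finset α} {s y : α} (hs : s ∈ S) (he : s(s, y) ∈ E)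
    (f : Set α → ℝ) : ZZ W c p r E S T f = p * ZZ W c p r (E.erase s(s, y)) (insert y S) T f
      + (1 - p) * ZZ W c p r (E.erase s(s, y)) S T f := by
  unfold ZZ; rw [wsum_erase _ he]; simp only [GG_edgeS hs]

lemma ZZ_stepT {E : Finset (Sym2 α)} {S T : Finset α} {t y : α} (ht : t ∈ T) (he : s(t, y) ∈ E)
    (f : Set α → ℝ) : ZZ W c p r E S T f = p * ZZ W c p r (E.erase s(t, y)) S (insert y T) f
      + (1 - p) * ZZ W c p r (E.erase s(t, y)) S T f := by
  unfold ZZ; rw [wsum_erase _ he]; simp only [GG_edgeT ht]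

lemma ZZ_one (E : Finset (Sym2 α)) (S T : Finset α) :
    ZZ W c p r E S T (fun _ => 1) = zz p E S T := by
  unfold ZZ zz GG; simp only [wsum_const]

lemma zz_eq (E : Finset (Sym2 α)) (S T : Finset α) :
    zz p E S T = ZZ ∅ c p 0 E S T (fun _ => 1) := (ZZ_one _ _ _).symm

lemma zz_nonneg (hp : 0 ≤ p ∧ p ≤ 1) (E : Finset (Sym2 α)) (S T : Finset α) : 0 ≤ zz p E S T :=
  wsum_nonneg (fun _ => hp) fun η _ => by split_ifs <;> norm_num

lemma zz_mono (hp : 0 ≤ p ∧ p ≤ 1) (E : Finset (Sym2 α)) {S T S' T' : Finset α} (hS : S ⊆ S')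
    (hT : T ⊆ T') : zz p E S' T' ≤ zz p E S T := by
  refine wsum_le_wsum (fun _ => hp) fun η _ => ?_
  have : Dj η S' T' → Dj η S T := fun h t ht ⟨s, hs, hc⟩ => h t (hT ht) ⟨s, hS hs, hc⟩
  split_ifs with h1 h2
  · norm_num
  · exact absurd (this h1) h2
  · norm_num
  · norm_num

lemma ZZ_nonneg (hp : 0 ≤ p ∧ p ≤ 1) (hr : 0 ≤ r ∧ r ≤ 1) (E : Finset (Sym2 α)) (S T : Finset α)
    {f : Set α → ℝ} (hf : ∀ X, 0 ≤ f X) : 0 ≤ ZZ W c p r E S T f :=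
  wsum_nonneg (fun _ => hp) fun η _ => by
    unfold GG; split_ifs
    · exact wsum_nonneg (fun _ => hr) fun _ _ => hf _
    · norm_num

lemma ZZ_le (hp : 0 ≤ p ∧ p ≤ 1) (hr : 0 ≤ r ∧ r ≤ 1) (E : Finset (Sym2 α)) (S T : Finset α)
    {f g : Set α → ℝ} (hf : ∀ X, f X ≤ g X) : ZZ W c p r E S T f ≤ ZZ W c p r E S T g :=
  wsum_le_wsum (fun _ => hp) fun η _ => by
    unfold GG; split_ifs
    · exact wsum_le_wsum (fun _ => hr) fun _ _ => hf _
    · norm_num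

lemma ZZ_le_zz (hp : 0 ≤ p ∧ p ≤ 1) (hr : 0 ≤ r ∧ r ≤ 1) (E : Finset (Sym2 α)) (S T : Finset α)
    {f : Set α → ℝ} (hf : ∀ X, f X ≤ 1) : ZZ W c p r E S T f ≤ zz p E S T := by
  rw [← ZZ_one (W := W) (c := c) (r := r)]; exact ZZ_le hp hr _ _ _ hf

def EIn (W : Finset α) (E : Finset (Sym2 α)) : Prop := ∀ e ∈ E, ∀ v ∈ e, v ∈ W

lemma Cn_mem {η : Finset (Sym2 α)} (hE : EIn W η) {v w : α} (hv : v ∈ W) (h : Cn η v w) :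
    w ∈ W := by
  induction h with
  | refl => exact hv
  | tail _ h _ => exact hE _ h _ (Sym2.mem_mk_right _ _)

lemma EIn.mono {E F : Finset (Sym2 α)} (hE : EIn W E) (h : F ⊆ E) : EIn W F :=
  fun e he => hE e (h he)

lemma rep_mem (hc : ∀ C : Set α, C.Nonempty → c C ∈ C) (η : Finset (Sym2 α)) (v : α) :
    Cn η v (c {w | Cn η v w}) := hc {w | Cn η v w} ⟨v, .refl⟩

/-- colour flip -/
lemma ZZ_flip (hc : ∀ C : Set α, C.Nonempty → c C ∈ C) {E : Finset (Sym2 α)} (hE : EIn W E)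
    (S T : Finset α) (f : Set α → ℝ) :
    ZZ W c p r E S T f = ZZ W c p (1 - r) E T S (fun X => f (↑W \ X)) := by
  unfold ZZ
  refine wsum_congr fun η hη => ?_
  unfold GG
  by_cases h : Dj η S T
  · rw [if_pos h, if_pos h.symm, ← wsum_flip]
    refine wsum_congr fun B hB => ?_
    congr 1; ext v
    simp only [col, Set.mem_ofPred_eq, Set.mem_sdiff, Finset.mem_coe, Finset.mem_sdiff]
    by_cases hv : v ∈ W
    · have h1 := Cn_mem (hE.mono hη) hv (rep_mem hc η v)
      have h2 : To η S v → ¬ To η T v := by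
        rintro ⟨s, hs, h3⟩ ⟨t, ht, h4⟩
        exact h t ht ⟨s, hs, h3.trans h4.symm⟩
      simp only [hv, true_and, h1]
      tauto
    · simp [hv]
  · rw [if_neg h, if_neg (fun h' => h h'.symm)]

lemma Dj_insert {η : Finset (Sym2 α)} {S T : Finset α} {x : α} :
    Dj η (insert x S) T ↔ Dj η S T ∧ ¬ To η T x := by
  unfold Dj
  simp only [To_insert, not_or]
  constructor
  · intro h
    exact ⟨fun t ht => (h t ht).2, fun ⟨t, ht, hc⟩ => (h t ht).1 hc.symm⟩
  · rintro ⟨h1, h2⟩ t ht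
    exact ⟨fun hc => h2 ⟨t, ht, hc.symm⟩, h1 t ht⟩

open Classical in
lemma ZZ_ind (hc : ∀ C : Set α, C.Nonempty → c C ∈ C) {E : Finset (Sym2 α)} (hE : EIn W E)
    (S T : Finset α) {x : α} (hx : x ∈ W) :
    ZZ W c p 1 E S T (fun X => if x ∈ X then 1 else 0) = zz p E (insert x S) T := by
  unfold ZZ zz
  refine wsum_congr fun η hη => ?_
  unfold GG
  rw [Dj_insert]
  by_cases h : Dj η S T
  · rw [if_pos h]
    refine (wsum_one W _).trans ?_
    have h1 := Cn_mem (hE.mono hη) hx (rep_mem hc η x)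
    have h2 : To η S x → ¬ To η T x := by
      rintro ⟨s, hs, h3⟩ ⟨t, ht, h4⟩
      exact h t ht ⟨s, hs, h3.trans h4.symm⟩
    have : x ∈ col W c η S T W ↔ (Dj η S T ∧ ¬ To η T x) := by
      simp only [col, Set.mem_ofPred_eq, hx, h1, h, true_and]; tauto
    show (if x ∈ col W c η S T W then (1 : ℝ) else 0) = _
    split_ifs with h1 h2 h2
    · rfl
    · exact absurd (this.1 h1) h2
    · exact absurd (this.2 h2) h1
    · rfl
  · simp [h]

lemma alg_ge {A B C D a b c d : ℝ} (ha : 0 ≤ a) (hab : a ≤ b) (hac : a ≤ c) (hbd : b ≤ d)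
    (hcd : c ≤ d) (hA : 0 ≤ A) (hB : 0 ≤ B) (hC : 0 ≤ C) (hD : 0 ≤ D) (hA' : A ≤ a) (hB' : B ≤ b)
    (hC' : C ≤ c) (hD' : D ≤ d)
    (h1 : C * a ≤ A * c) (h2 : D * b ≤ B * d) (h3 : B * a ≤ A * b) (h4 : D * c ≤ C * d)
    (h5 : b * c ≤ a * d) : C * b + D * a ≤ A * d + B * c := by
  rcases ha.eq_or_lt with h | h
  · have hbc : b * c = 0 := le_antisymm (by rw [← h] at h5; linarith) (by nlinarith)
    have : C * b ≤ 0 := by nlinarith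
    rw [← h]; nlinarith [mul_nonneg hA (by linarith : 0 ≤ d), mul_nonneg hB (by linarith : 0 ≤ c)]
  · have hb : 0 < b := by linarith
    have hc : 0 < c := by linarith
    have hd : 0 < d := by linarith
    obtain ⟨α, rfl⟩ : ∃ α, A = α * a := ⟨A / a, by field_simp⟩
    obtain ⟨β, rfl⟩ : ∃ α, B = α * b := ⟨B / b, by field_simp⟩
    obtain ⟨γ, rfl⟩ : ∃ α, C = α * c := ⟨C / c, by field_simp⟩
    obtain ⟨δ, rfl⟩ : ∃ α, D = α * d := ⟨D / d, by field_simp⟩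
    have e1 : γ ≤ α := le_of_mul_le_mul_right (by linarith : γ * (a * c) ≤ α * (a * c)) (by positivity)
    have e2 : δ ≤ β := le_of_mul_le_mul_right (by linarith : δ * (b * d) ≤ β * (b * d)) (by positivity)
    have e4 : δ ≤ γ := le_of_mul_le_mul_right (by linarith : δ * (c * d) ≤ γ * (c * d)) (by positivity)
    nlinarith [mul_nonneg (sub_nonneg.2 h5) (by linarith : 0 ≤ α - δ),
      mul_nonneg (mul_nonneg hb.le hc.le) (by linarith : 0 ≤ (α - γ) + (β - δ))]

lemma alg_le {A B C D a b c d : ℝ} (ha : 0 ≤ a) (hab : a ≤ b) (hac : a ≤ c) (hbd : b ≤ d)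
    (hcd : c ≤ d) (hA : 0 ≤ A) (hB : 0 ≤ B) (hC : 0 ≤ C) (hD : 0 ≤ D) (hA' : A ≤ a) (hB' : B ≤ b)
    (hC' : C ≤ c) (hD' : D ≤ d)
    (h1 : C * a ≤ A * c) (h2 : D * b ≤ B * d) (h3 : A * b ≤ B * a) (h4 : C * d ≤ D * c)
    (h5 : a * d ≤ b * c) : C * b + D * a ≤ A * d + B * c := by
  rcases (ha.trans hab).eq_or_lt with hb | hb
  · have : B = 0 := by linarith
    have ha0 : a = 0 := by linarith
    have hA0 : A = 0 := by linarith
    rw [ha0, ← hb, hA0, this]; simp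
  rcases (ha.trans hac).eq_or_lt with hc | hc
  · have : C = 0 := by linarith
    have ha0 : a = 0 := by linarith
    have hA0 : A = 0 := by linarith
    rw [ha0, ← hc, hA0, this]; simp
  have hd : 0 < d := by linarith
  obtain ⟨β, rfl⟩ : ∃ α, B = α * b := ⟨B / b, by field_simp⟩
  obtain ⟨γ, rfl⟩ : ∃ α, C = α * c := ⟨C / c, by field_simp⟩
  obtain ⟨δ, rfl⟩ : ∃ α, D = α * d := ⟨D / d, by field_simp⟩
  have e2 : δ ≤ β := le_of_mul_le_mul_right (by linarith : δ * (b * d) ≤ β * (b * d)) (by positivity)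
  have e4 : γ ≤ δ := le_of_mul_le_mul_right (by linarith : γ * (c * d) ≤ δ * (c * d)) (by positivity)
  rcases ha.eq_or_lt with h | h
  · have : A = 0 := by linarith
    subst this; rw [← h]; nlinarith [mul_pos hb hc]
  obtain ⟨α, rfl⟩ : ∃ α, A = α * a := ⟨A / a, by field_simp⟩
  have e1 : γ ≤ α := le_of_mul_le_mul_right (by linarith : γ * (a * c) ≤ α * (a * c)) (by positivity)
  nlinarith [mul_nonneg (sub_nonneg.2 h5) (by linarith : 0 ≤ β - γ),
      mul_nonneg (mul_nonneg h.le hd.le) (by linarith : 0 ≤ (α - γ) + (β - δ))]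

def Good (f : Set α → ℝ) : Prop := (∀ X Y, X ⊆ Y → f X ≤ f Y) ∧ (∀ X, 0 ≤ f X) ∧ (∀ X, f X ≤ 1)

lemma ZZ_compl (E : Finset (Sym2 α)) (S T : Finset α) (f : Set α → ℝ) :
    ZZ W c p r E S T (fun X => 1 - f X) = zz p E S T - ZZ W c p r E S T f := by
  rw [← ZZ_one (W := W) (c := c) (r := r)]
  unfold ZZ
  rw [← wsum_sub]
  congr 1; funext η; unfold GG
  split_ifs
  · rw [wsum_sub]
  · simp

lemma zz_flip (E : Finset (Sym2 α)) (S T : Finset α) : zz p E S T = zz p E T S := by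
  unfold zz; congr 1; funext η
  have : Dj η S T ↔ Dj η T S := ⟨Dj.symm, Dj.symm⟩
  classical exact if_congr this rfl rfl

def M1At (W : Finset α) (c : Set α → α) (p : ℝ) (E : Finset (Sym2 α)) : Prop :=
  ∀ r : ℝ, 0 ≤ r ∧ r ≤ 1 → ∀ f : Set α → ℝ, Good f → ∀ S T : Finset α, ∀ x ∈ W,
    ZZ W c p r E S T f * zz p E (insert x S) T ≤ ZZ W c p r E (insert x S) T f * zz p E S T

lemma M2_of_M1 (hc : ∀ C : Set α, C.Nonempty → c C ∈ C) {E : Finset (Sym2 α)} (hE : EIn W E)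
    (h : M1At W c p E) (hr : 0 ≤ r ∧ r ≤ 1) {f : Set α → ℝ} (hf : Good f) (S T : Finset α) {x : α}
    (hx : x ∈ W) :
    ZZ W c p r E S (insert x T) f * zz p E S T ≤ ZZ W c p r E S T f * zz p E S (insert x T) := by
  have h1 := h (1 - r) ⟨by linarith [hr.2], by linarith [hr.1]⟩ (fun X => 1 - f (↑W \ X))
    ⟨fun X Y hXY => by linarith [hf.1 _ _ (Set.sdiff_subset_sdiff_right hXY : (W : Set α) \ Y ⊆ _)],
      fun X => by linarith [hf.2.2 (↑W \ X)], fun X => by linarith [hf.2.1 (↑W \ X)]⟩ T S x hx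
  rw [ZZ_compl, ZZ_compl, ← ZZ_flip hc hE, ← ZZ_flip hc hE, zz_flip E T S,
    zz_flip E (insert x T) S] at h1
  linarith

lemma isol {E η : Finset (Sym2 α)} (hη : η ⊆ E) {a b : α} (h : ∀ e ∈ E, a ∉ e) (hc : Cn η a b) :
    b = a := by
  induction hc with
  | refl => rfl
  | tail _ h' ih => subst ih; exact absurd (Sym2.mem_mk_left _ _) (h _ (hη h'))

lemma M1_all (hc : ∀ C : Set α, C.Nonempty → c C ∈ C) (hp : 0 ≤ p ∧ p ≤ 1) (n : ℕ) :
    ∀ E : Finset (Sym2 α), E.card = n → EIn W E → M1At W c p E := by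
  induction n using Nat.strong_induction_on with
  | _ n ih =>
  intro E hn hE r hr f hf S T x hx
  have IH : ∀ e ∈ E, M1At W c p (E.erase e) ∧ EIn W (E.erase e) := fun e he =>
    ⟨ih _ (by rw [← hn]; exact Finset.card_erase_lt_of_mem he) _ rfl
      (hE.mono (Finset.erase_subset _ _)), hE.mono (Finset.erase_subset _ _)⟩
  have hind : ∀ y, Good (fun X : Set α => (open Classical in if y ∈ X then (1 : ℝ) else 0)) := by
    intro y
    refine ⟨fun X Y hXY => ?_, fun X => ?_, fun X => ?_⟩
    · dsimp only; split_ifs with h1 h2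
      · norm_num
      · exact absurd (hXY h1) h2
      · norm_num
      · norm_num
    · dsimp only; split_ifs <;> norm_num
    · dsimp only; split_ifs <;> norm_num
  by_cases hS : ∃ s ∈ S, ∃ e ∈ E, s ∈ e
  · obtain ⟨s, hs, e, he, y, rfl⟩ := hS
    obtain ⟨m1, hE'⟩ := IH _ he
    have hy : y ∈ W := hE _ he _ (Sym2.mem_mk_right _ _)
    have hs' : s ∈ insert x S := Finset.mem_insert_of_mem hs
    rw [ZZ_stepS hs he, ZZ_stepS hs' he, zz_eq (c := c), zz_eq (c := c), ZZ_stepS hs he,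
      ZZ_stepS hs' he]
    simp only [← zz_eq]
    set E' := E.erase s(s, y)
    have hcm : insert y (insert x S) = insert x (insert y S) := Finset.insert_comm _ _ _
    have sm := m1 1 ⟨by norm_num, le_rfl⟩ _ (hind x) S T y hy
    rw [ZZ_ind hc hE' _ _ hx, ZZ_ind hc hE' _ _ hx] at sm
    have k1 := m1 r hr f hf (insert y S) T x hx
    have k2 := m1 r hr f hf S T x hx
    have k3 := m1 r hr f hf (insert x S) T y hy
    have k4 := m1 r hr f hf S T y hy
    rw [hcm] at k3 ⊢
    have sub1 : insert x S ⊆ insert x (insert y S) :=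
      Finset.insert_subset_insert _ (Finset.subset_insert _ _)
    have key := alg_ge (zz_nonneg hp E' (insert x (insert y S)) T) (zz_mono hp E' sub1 le_rfl)
      (zz_mono hp E' (Finset.subset_insert _ _) le_rfl)
      (zz_mono hp E' (Finset.subset_insert _ _) le_rfl)
      (zz_mono hp E' (Finset.subset_insert _ _) le_rfl)
      (ZZ_nonneg (W := W) (c := c) hp hr E' _ T hf.2.1) (ZZ_nonneg (W := W) (c := c) hp hr E' _ T hf.2.1)
      (ZZ_nonneg (W := W) (c := c) hp hr E' _ T hf.2.1) (ZZ_nonneg (W := W) (c := c) hp hr E' _ T hf.2.1)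
      (ZZ_le_zz hp hr E' _ T hf.2.2) (ZZ_le_zz hp hr E' _ T hf.2.2) (ZZ_le_zz hp hr E' _ T hf.2.2)
      (ZZ_le_zz hp hr E' _ T hf.2.2) k1 k2 k3 k4 (by linarith)
    nlinarith [mul_le_mul_of_nonneg_left k1 (mul_nonneg hp.1 hp.1),
      mul_le_mul_of_nonneg_left k2 (mul_nonneg (sub_nonneg.2 hp.2) (sub_nonneg.2 hp.2)),
      mul_le_mul_of_nonneg_left key (mul_nonneg hp.1 (sub_nonneg.2 hp.2))]
  by_cases hT : ∃ s ∈ T, ∃ e ∈ E, s ∈ e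
  · obtain ⟨t, ht, e, he, y, rfl⟩ := hT
    obtain ⟨m1, hE'⟩ := IH _ he
    have hy : y ∈ W := hE _ he _ (Sym2.mem_mk_right _ _)
    rw [ZZ_stepT ht he, ZZ_stepT ht he, zz_eq (c := c), zz_eq (c := c), ZZ_stepT ht he,
      ZZ_stepT ht he]
    simp only [← zz_eq]
    set E' := E.erase s(t, y)
    have sm := M2_of_M1 hc hE' m1 ⟨zero_le_one, le_rfl⟩ (hind x) S T hy
    rw [ZZ_ind hc hE' _ _ hx, ZZ_ind hc hE' _ _ hx] at sm
    have k1 := m1 r hr f hf S (insert y T) x hx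
    have k2 := m1 r hr f hf S T x hx
    have k3 := M2_of_M1 hc hE' m1 hr hf (insert x S) T hy
    have k4 := M2_of_M1 hc hE' m1 hr hf S T hy
    have key := alg_le (zz_nonneg hp E' (insert x S) (insert y T))
      (zz_mono hp E' le_rfl (Finset.subset_insert _ _))
      (zz_mono hp E' (Finset.subset_insert _ _) le_rfl)
      (zz_mono hp E' (Finset.subset_insert _ _) le_rfl)
      (zz_mono hp E' le_rfl (Finset.subset_insert _ _))
      (ZZ_nonneg (W := W) (c := c) hp hr E' _ _ hf.2.1) (ZZ_nonneg (W := W) (c := c) hp hr E' _ T hf.2.1)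
      (ZZ_nonneg (W := W) (c := c) hp hr E' _ _ hf.2.1) (ZZ_nonneg (W := W) (c := c) hp hr E' _ T hf.2.1)
      (ZZ_le_zz hp hr E' _ _ hf.2.2) (ZZ_le_zz hp hr E' _ T hf.2.2) (ZZ_le_zz hp hr E' _ _ hf.2.2)
      (ZZ_le_zz hp hr E' _ T hf.2.2) k1 k2 k3 k4 (by linarith)
    nlinarith [mul_le_mul_of_nonneg_left k1 (mul_nonneg hp.1 hp.1),
      mul_le_mul_of_nonneg_left k2 (mul_nonneg (sub_nonneg.2 hp.2) (sub_nonneg.2 hp.2)),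
      mul_le_mul_of_nonneg_left key (mul_nonneg hp.1 (sub_nonneg.2 hp.2))]
  push Not at hS hT
  have htoT : ∀ η ⊆ E, ∀ v, To η T v ↔ v ∈ T := fun η hη v =>
    ⟨fun ⟨t, ht, h⟩ => (isol hη (hT t ht) h) ▸ ht, fun h => ⟨v, h, .refl⟩⟩
  by_cases hxT : x ∈ T
  · have : ∀ η ⊆ E, ¬ Dj η (insert x S) T := fun η _ h =>
      h x hxT ⟨x, Finset.mem_insert_self _ _, .refl⟩
    have z1 : zz p E (insert x S) T = 0 := by
      rw [← wsum_const (fun _ => p) E 0]; unfold zz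
      refine wsum_congr fun η hη => if_neg (this η hη)
    have z2 : ZZ W c p r E (insert x S) T f = 0 := by
      rw [← wsum_const (fun _ => p) E 0]; unfold ZZ
      refine wsum_congr fun η hη => if_neg (this η hη)
    rw [z1, z2]; simp
  · have hdj : ∀ η ⊆ E, (Dj η (insert x S) T ↔ Dj η S T) := fun η hη => by
      rw [Dj_insert, htoT η hη]; simp [hxT]
    have z1 : zz p E (insert x S) T = zz p E S T := by
      unfold zz; exact wsum_congr fun η hη => by classical exact if_congr (hdj η hη) rfl rfl
    rw [z1]
    refine mul_le_mul_of_nonneg_right ?_ (zz_nonneg hp _ _ _)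
    refine wsum_le_wsum (fun _ => hp) fun η hη => ?_
    unfold GG; classical rw [if_congr (hdj η hη) rfl rfl]
    split_ifs
    · refine wsum_le_wsum (fun _ => hr) fun B _ => hf.1 _ _ ?_
      rintro v ⟨h1, h2⟩
      refine ⟨h1, h2.imp_left ?_⟩
      rintro ⟨s, hs, h⟩
      exact ⟨s, Finset.mem_insert_of_mem hs, h⟩
    · exact le_rfl

lemma alg_mix {A A' A'' B B' B'' a b t : ℝ} (ht : 0 ≤ t ∧ t ≤ 1) (ha : 0 ≤ a) (hb : 0 ≤ b)
    (hA : 0 ≤ A ∧ A ≤ a) (hA' : 0 ≤ A' ∧ A' ≤ a) (hA'' : 0 ≤ A'')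
    (hB : 0 ≤ B ∧ B ≤ b) (hB' : 0 ≤ B' ∧ B' ≤ b) (hB'' : 0 ≤ B'')
    (h1 : A * A' ≤ A'' * a) (h2 : B * B' ≤ B'' * b)
    (h3 : 0 ≤ (A * b - B * a) * (A' * b - B' * a)) :
    (t * A + (1 - t) * B) * (t * A' + (1 - t) * B')
      ≤ (t * A'' + (1 - t) * B'') * (t * a + (1 - t) * b) := by
  have key : A * B' + B * A' ≤ A'' * b + B'' * a := by
    rcases ha.eq_or_lt with h | h
    · have e1 : A = 0 := by linarith [hA.1, hA.2]
      have e2 : A' = 0 := by linarith [hA'.1, hA'.2]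
      rw [e1, e2, ← h]; nlinarith
    rcases hb.eq_or_lt with h' | h'
    · have e1 : B = 0 := by linarith [hB.1, hB.2]
      have e2 : B' = 0 := by linarith [hB'.1, hB'.2]
      rw [e1, e2, ← h']; nlinarith
    have hab : 0 < a * b := mul_pos h h'
    refine le_of_mul_le_mul_left ?_ hab
    nlinarith [mul_le_mul_of_nonneg_right h1 (mul_nonneg hb hb),
      mul_le_mul_of_nonneg_right h2 (mul_nonneg ha ha)]
  nlinarith [mul_le_mul_of_nonneg_left h1 (mul_nonneg ht.1 ht.1),
    mul_le_mul_of_nonneg_left h2 (mul_nonneg (sub_nonneg.2 ht.2) (sub_nonneg.2 ht.2)),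
    mul_le_mul_of_nonneg_left key (mul_nonneg ht.1 (sub_nonneg.2 ht.2))]

lemma ZZ_label (hc : ∀ C : Set α, C.Nonempty → c C ∈ C) {E : Finset (Sym2 α)} (hE : EIn W E)
    {S T : Finset α} (hS : ∀ s ∈ S, ∀ e ∈ E, s ∉ e) (hT : ∀ s ∈ T, ∀ e ∈ E, s ∉ e)
    {x : α} (hx : x ∈ W) (hxS : x ∉ S) (hxT : x ∉ T) (f : Set α → ℝ) :
    ZZ W c p r E S T f = r * ZZ W c p r E (insert x S) T f
      + (1 - r) * ZZ W c p r E S (insert x T) f := by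
  unfold ZZ
  rw [← wsum_mul_left, ← wsum_mul_left, ← wsum_add]
  refine wsum_congr fun η hη => ?_
  have htoT : ∀ v, To η T v ↔ v ∈ T := fun v =>
    ⟨fun ⟨t, ht, h⟩ => (isol hη (hT t ht) h) ▸ ht, fun h => ⟨v, h, .refl⟩⟩
  have htoS : ∀ v, To η S v ↔ v ∈ S := fun v =>
    ⟨fun ⟨t, ht, h⟩ => (isol hη (hS t ht) h) ▸ ht, fun h => ⟨v, h, .refl⟩⟩
  have hd1 : Dj η (insert x S) T ↔ Dj η S T := by rw [Dj_insert, htoT]; simp [hxT]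
  have hd2 : Dj η S (insert x T) ↔ Dj η S T := by
    have : Dj η (insert x T) S ↔ Dj η T S := by rw [Dj_insert, htoS]; simp [hxS]
    exact ⟨fun h => (this.1 h.symm).symm, fun h => (this.2 h.symm).symm⟩
  unfold GG
  by_cases h : Dj η S T
  swap
  · rw [if_neg h, if_neg (fun h' => h (hd1.1 h')), if_neg (fun h' => h (hd2.1 h'))]; simp
  rw [if_pos h, if_pos (hd1.2 h), if_pos (hd2.2 h)]
  set m := c {w | Cn η x w} with hm
  have hxm : Cn η x m := rep_mem hc η x
  have hmW : m ∈ W := Cn_mem (hE.mono hη) hx hxm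
  have hin : ∀ v, Cn η x v → c {w | Cn η v w} = m := fun v hv => by
    rw [hm]; congr 1; ext w; exact ⟨fun h => hv.trans h, fun h => hv.symm.trans h⟩
  have hout : ∀ v, ¬ Cn η x v → c {w | Cn η v w} ≠ m := fun v hv h => by
    have := rep_mem hc η v
    rw [h] at this
    exact hv (hxm.trans this.symm)
  have hvT : ∀ v, Cn η x v → v ∉ T := fun v hv hvT =>
    hxT ((isol hη (hT v hvT) hv.symm) ▸ hvT)
  have hvS : ∀ v, Cn η x v → v ∉ S := fun v hv hvS =>
    hxS ((isol hη (hS v hvS) hv.symm) ▸ hvS)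
  have c1 : ∀ B, col W c η S T (insert m B) = col W c η (insert x S) T B := fun B => by
    ext v; simp only [col, Set.mem_ofPred_eq, To_insert, htoT, htoS, Finset.mem_insert]
    by_cases hv : Cn η x v
    · simp [hv, hin v hv, hvT v hv]
    · simp [hv, hout v hv]
  have c1' : ∀ B, col W c η (insert x S) T (insert m B) = col W c η (insert x S) T B := fun B => by
    ext v; simp only [col, Set.mem_ofPred_eq, To_insert, htoT, htoS, Finset.mem_insert]
    by_cases hv : Cn η x v
    · simp [hv]
    · simp [hv, hout v hv]
  have c2 : ∀ B, m ∉ B → col W c η S T B = col W c η S (insert x T) B := fun B hB => by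
    ext v; simp only [col, Set.mem_ofPred_eq, To_insert, htoT, htoS]
    by_cases hv : Cn η x v
    · simp [hv, hin v hv, hB]
    · simp [hv]
  have c2' : ∀ B, col W c η S (insert x T) (insert m B) = col W c η S (insert x T) B := fun B => by
    ext v; simp only [col, Set.mem_ofPred_eq, To_insert, htoT, htoS, Finset.mem_insert]
    by_cases hv : Cn η x v
    · simp [hv]
    · simp [hv, hout v hv]
  rw [wsum_erase _ hmW, wsum_erase (f := fun B => f (col W c η (insert x S) T B)) _ hmW,
    wsum_erase (f := fun B => f (col W c η S (insert x T) B)) _ hmW]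
  simp only [c1, c1', c2']
  have : wsum (fun _ => r) (W.erase m) (fun B => f (col W c η S T B))
      = wsum (fun _ => r) (W.erase m) (fun B => f (col W c η S (insert x T) B)) :=
    wsum_congr fun B hB => by rw [c2 B fun h => Finset.notMem_erase m W (hB h)]
  rw [this]; ring

lemma PA (hc : ∀ C : Set α, C.Nonempty → c C ∈ C) (hp : 0 ≤ p ∧ p ≤ 1) (hr : 0 ≤ r ∧ r ≤ 1)
    {f g : Set α → ℝ} (hf : Good f) (hg : Good g) (n : ℕ) :
    ∀ (E : Finset (Sym2 α)) (S T : Finset α), E.card + (W \ (S ∪ T)).card = n → EIn W E →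
      ZZ W c p r E S T f * ZZ W c p r E S T g ≤ ZZ W c p r E S T (fun X => f X * g X) * zz p E S T := by
  have hfg : ∀ X, 0 ≤ f X * g X := fun X => mul_nonneg (hf.2.1 X) (hg.2.1 X)
  have bd : ∀ {f : Set α → ℝ}, Good f → ∀ E S T, 0 ≤ ZZ W c p r E S T f ∧
      ZZ W c p r E S T f ≤ zz p E S T := fun hf E S T =>
    ⟨ZZ_nonneg hp hr _ _ _ hf.2.1, ZZ_le_zz hp hr _ _ _ hf.2.2⟩
  induction n using Nat.strong_induction_on with
  | _ n ih =>
  intro E S T hn hE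
  by_cases hS : ∃ s ∈ S, ∃ e ∈ E, s ∈ e
  · obtain ⟨s, hs, e, he, y, rfl⟩ := hS
    have hE' := hE.mono (Finset.erase_subset s(s, y) E)
    have m1 := M1_all hc hp _ (E.erase s(s, y)) rfl hE'
    have hy : y ∈ W := hE _ he _ (Sym2.mem_mk_right _ _)
    rw [ZZ_stepS hs he, ZZ_stepS hs he, ZZ_stepS hs he, zz_eq (c := c), ZZ_stepS hs he]
    simp only [← zz_eq]
    have hlt := Finset.card_erase_lt_of_mem he
    have i1 := ih _ (lt_of_lt_of_le (add_lt_add_of_lt_of_le hlt (Finset.card_le_card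
      (Finset.sdiff_subset_sdiff le_rfl (Finset.union_subset_union
        (Finset.subset_insert y S) le_rfl)))) hn.le) _ (insert y S) T rfl hE'
    have i2 := ih _ (lt_of_lt_of_le (add_lt_add_of_lt_of_le hlt le_rfl) hn.le) _ S T rfl hE'
    refine alg_mix hp (zz_nonneg hp _ _ _) (zz_nonneg hp _ _ _) (bd hf _ _ _) (bd hg _ _ _)
      (ZZ_nonneg hp hr _ _ _ hfg) (bd hf _ _ _) (bd hg _ _ _) (ZZ_nonneg hp hr _ _ _ hfg) i1 i2 ?_
    exact mul_nonneg (sub_nonneg.2 (m1 r hr f hf S T y hy)) (sub_nonneg.2 (m1 r hr g hg S T y hy))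
  by_cases hT : ∃ s ∈ T, ∃ e ∈ E, s ∈ e
  · obtain ⟨s, hs, e, he, y, rfl⟩ := hT
    have hE' := hE.mono (Finset.erase_subset s(s, y) E)
    have m1 := M1_all hc hp _ (E.erase s(s, y)) rfl hE'
    have hy : y ∈ W := hE _ he _ (Sym2.mem_mk_right _ _)
    rw [ZZ_stepT hs he, ZZ_stepT hs he, ZZ_stepT hs he, zz_eq (c := c), ZZ_stepT hs he]
    simp only [← zz_eq]
    have hlt := Finset.card_erase_lt_of_mem he
    have i1 := ih _ (lt_of_lt_of_le (add_lt_add_of_lt_of_le hlt (Finset.card_le_card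
      (Finset.sdiff_subset_sdiff le_rfl (Finset.union_subset_union le_rfl
        (Finset.subset_insert y T))))) hn.le) _ S (insert y T) rfl hE'
    have i2 := ih _ (lt_of_lt_of_le (add_lt_add_of_lt_of_le hlt le_rfl) hn.le) _ S T rfl hE'
    refine alg_mix hp (zz_nonneg hp _ _ _) (zz_nonneg hp _ _ _) (bd hf _ _ _) (bd hg _ _ _)
      (ZZ_nonneg hp hr _ _ _ hfg) (bd hf _ _ _) (bd hg _ _ _) (ZZ_nonneg hp hr _ _ _ hfg) i1 i2 ?_
    exact mul_nonneg_of_nonpos_of_nonpos (sub_nonpos.2 (M2_of_M1 hc hE' m1 hr hf S T hy))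
      (sub_nonpos.2 (M2_of_M1 hc hE' m1 hr hg S T hy))
  push Not at hS hT
  by_cases hx : ∃ x ∈ W, x ∉ S ∪ T
  · obtain ⟨x, hx, hxST⟩ := hx
    have hxS : x ∉ S := fun h => hxST (Finset.mem_union_left _ h)
    have hxT : x ∉ T := fun h => hxST (Finset.mem_union_right _ h)
    have m1 := M1_all hc hp _ E rfl hE
    have lt1 : (W \ (insert x S ∪ T)).card < (W \ (S ∪ T)).card := by
      refine Finset.card_lt_card (Finset.ssubset_iff_subset_ne.2 ⟨Finset.sdiff_subset_sdiff le_rfl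
        (Finset.union_subset_union (Finset.subset_insert x S) le_rfl), fun h => ?_⟩)
      have : x ∈ W \ (insert x S ∪ T) := h ▸ Finset.mem_sdiff.2 ⟨hx, hxST⟩
      simp at this
    have lt2 : (W \ (S ∪ insert x T)).card < (W \ (S ∪ T)).card := by
      refine Finset.card_lt_card (Finset.ssubset_iff_subset_ne.2 ⟨Finset.sdiff_subset_sdiff le_rfl
        (Finset.union_subset_union le_rfl (Finset.subset_insert x T)), fun h => ?_⟩)
      have : x ∈ W \ (S ∪ insert x T) := h ▸ Finset.mem_sdiff.2 ⟨hx, hxST⟩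
      simp at this
    have i1 := ih _ (by rw [← hn]; exact Nat.add_lt_add_left lt1 _) E (insert x S) T rfl hE
    have i2 := ih _ (by rw [← hn]; exact Nat.add_lt_add_left lt2 _) E S (insert x T) rfl hE
    have ord : ∀ f, Good f → 0 ≤ ZZ W c p r E (insert x S) T f * zz p E S (insert x T)
        - ZZ W c p r E S (insert x T) f * zz p E (insert x S) T := by
      intro f hf
      have k1 := m1 r hr f hf S T x hx
      have k2 := M2_of_M1 hc hE m1 hr hf S T hx
      have a1 := zz_mono hp E (Finset.subset_insert x S) (le_refl T)
      have a2 := zz_mono hp E (le_refl S) (Finset.subset_insert x T)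
      have n1 := zz_nonneg hp E (insert x S) T
      have n2 := zz_nonneg hp E S (insert x T)
      rcases (n1.trans a1).eq_or_lt with h0 | h0
      · have e1 : zz p E (insert x S) T = 0 := by linarith
        have e2 : zz p E S (insert x T) = 0 := by linarith
        rw [e1, e2]; simp
      · rw [sub_nonneg]
        refine le_of_mul_le_mul_right ?_ h0
        nlinarith [mul_le_mul_of_nonneg_right k1 n2, mul_le_mul_of_nonneg_right k2 n1]
    have hz : zz p E S T = r * zz p E (insert x S) T + (1 - r) * zz p E S (insert x T) := by
      have := ZZ_label (p := p) (r := r) hc hE hS hT hx hxS hxT (fun _ => 1)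
      simpa only [ZZ_one] using this
    rw [ZZ_label hc hE hS hT hx hxS hxT f, ZZ_label hc hE hS hT hx hxS hxT g,
      ZZ_label hc hE hS hT hx hxS hxT (fun X => f X * g X), hz]
    exact alg_mix hr (zz_nonneg hp _ _ _) (zz_nonneg hp _ _ _) (bd hf _ _ _) (bd hg _ _ _)
      (ZZ_nonneg hp hr _ _ _ hfg) (bd hf _ _ _) (bd hg _ _ _) (ZZ_nonneg hp hr _ _ _ hfg) i1 i2
      (mul_nonneg (ord f hf) (ord g hg))
  · push Not at hx
    have hE0 : E = ∅ := by
      refine Finset.eq_empty_of_forall_notMem fun e he => ?_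
      obtain ⟨a, b⟩ := e
      have ha : a ∈ W := hE _ he _ (Sym2.mem_mk_left a b)
      rcases Finset.mem_union.1 (hx a ha) with h | h
      · exact hS a h _ he (Sym2.mem_mk_left a b)
      · exact hT a h _ he (Sym2.mem_mk_left a b)
    subst hE0
    unfold ZZ zz
    simp only [wsum_empty]
    unfold GG
    split_ifs with hd
    swap
    · simp
    have hcol : ∀ B, col W c ∅ S T B = {v | v ∈ W ∧ v ∈ S} := fun B => by
      have hto : ∀ (S : Finset α) v, To (∅ : Finset (Sym2 α)) S v ↔ v ∈ S := fun S v =>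
        ⟨fun ⟨t, ht, h⟩ => (isol (E := ∅) le_rfl (by simp) h) ▸ ht, fun h => ⟨v, h, .refl⟩⟩
      ext v; simp only [col, Set.mem_ofPred_eq, hto]
      refine and_congr_right fun hv => ⟨fun h => ?_, fun h => Or.inl h⟩
      rcases h with h | h
      · exact h
      · exact (Finset.mem_union.1 (hx v hv)).resolve_right h.1
    simp only [hcol, wsum_const, mul_one]; exact le_rfl

/-- Positive association of the finite-volume divide and colour model. -/
lemma fkg_finite (hc : ∀ C : Set α, C.Nonempty → c C ∈ C) (hp : 0 ≤ p ∧ p ≤ 1)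
    (hr : 0 ≤ r ∧ r ≤ 1) {f g : Set α → ℝ} (hf : Good f) (hg : Good g) {E : Finset (Sym2 α)}
    (hE : EIn W E) :
    wsum (fun _ => p) E (fun η => wsum (fun _ => r) W
        (fun B => f {v | v ∈ W ∧ c {w | Cn η v w} ∈ B})) *
      wsum (fun _ => p) E (fun η => wsum (fun _ => r) W
        (fun B => g {v | v ∈ W ∧ c {w | Cn η v w} ∈ B})) ≤
      wsum (fun _ => p) E (fun η => wsum (fun _ => r) W
        (fun B => f {v | v ∈ W ∧ c {w | Cn η v w} ∈ B} *
          g {v | v ∈ W ∧ c {w | Cn η v w} ∈ B})) := by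
  have h := PA hc hp hr hf hg _ E ∅ ∅ rfl hE
  have h0 : ∀ η : Finset (Sym2 α), Dj η ∅ ∅ := fun η t ht => by simp at ht
  have h1 : ∀ (η : Finset (Sym2 α)) v, ¬ To η ∅ v := fun η v ⟨s, hs, _⟩ => by simp at hs
  simpa [ZZ, zz, GG, h0, h1, col, wsum_const] using h

end FKG
end DaC

namespace DaC

section Topo

def Near (a b : V) : Prop := a.1 - b.1 ≤ 1 ∧ b.1 - a.1 ≤ 1 ∧ a.2 - b.2 ≤ 1 ∧ b.2 - a.2 ≤ 1

lemma Near.symm {a b : V} (h : Near a b) : Near b a := by unfold Near at *; omega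

lemma sq_cases {x y : ℤ} (h : x ^ 2 + y ^ 2 ≤ 2) : -1 ≤ x ∧ x ≤ 1 ∧ -1 ≤ y ∧ y ≤ 1 := by
  refine ⟨?_, ?_, ?_, ?_⟩ <;> by_contra h' <;> push Not at h' <;> nlinarith [sq_nonneg x, sq_nonneg y]

lemma starAdj_iff (a b : V) : StarAdj a b ↔ Near a b ∧ ¬ (a.1 = b.1 ∧ a.2 = b.2) := by
  unfold StarAdj Near
  obtain ⟨x, hx⟩ : ∃ x, x = a.1 - b.1 := ⟨_, rfl⟩
  obtain ⟨y, hy⟩ : ∃ y, y = a.2 - b.2 := ⟨_, rfl⟩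
  rw [← hx, ← hy]
  constructor
  · intro h
    have := sq_cases (x := x) (y := y) (by omega)
    refine ⟨by omega, fun h' => ?_⟩
    have : x = 0 := by omega
    have : y = 0 := by omega
    subst_vars; simp_all
  · rintro ⟨h, h'⟩
    have h1 : -1 ≤ x ∧ x ≤ 1 ∧ -1 ≤ y ∧ y ≤ 1 := by omega
    obtain ⟨h1, h2, h3, h4⟩ := h1
    have h0 : ¬ (x = 0 ∧ y = 0) := by omega
    clear hx hy h h'
    interval_cases x <;> interval_cases y <;> simp_all

lemma sqAdj_iff (a b : V) : SqAdj a b ↔ Near a b ∧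
    ((a.1 = b.1 ∧ a.2 ≠ b.2) ∨ (a.1 ≠ b.1 ∧ a.2 = b.2)) := by
  unfold SqAdj Near
  obtain ⟨x, hx⟩ : ∃ x, x = a.1 - b.1 := ⟨_, rfl⟩
  obtain ⟨y, hy⟩ : ∃ y, y = a.2 - b.2 := ⟨_, rfl⟩
  rw [← hx, ← hy]
  constructor
  · intro h
    obtain ⟨h1, h2, h3, h4⟩ := sq_cases (x := x) (y := y) (by omega)
    have : (x = 0 ∧ y ≠ 0) ∨ (x ≠ 0 ∧ y = 0) := by
      clear hx hy
      interval_cases x <;> interval_cases y <;> simp_all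
    omega
  · rintro ⟨h, h'⟩
    have h1 : -1 ≤ x ∧ x ≤ 1 ∧ -1 ≤ y ∧ y ≤ 1 := by omega
    obtain ⟨h1, h2, h3, h4⟩ := h1
    have h0 : (x = 0 ∧ y ≠ 0) ∨ (x ≠ 0 ∧ y = 0) := by omega
    clear hx hy h h'
    interval_cases x <;> interval_cases y <;> simp_all

lemma SqAdj.near {a b : V} (h : SqAdj a b) : Near a b := ((sqAdj_iff a b).1 h).1
lemma StarAdj.near {a b : V} (h : StarAdj a b) : Near a b := ((starAdj_iff a b).1 h).1
lemma SqAdj.star {a b : V} (h : SqAdj a b) : StarAdj a b := Or.inl h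
lemma SqAdj.symm {a b : V} (h : SqAdj a b) : SqAdj b a := by
  unfold SqAdj at *; rw [← h]; ring
lemma StarAdj.symm {a b : V} (h : StarAdj a b) : StarAdj b a := by
  rw [starAdj_iff] at *; unfold Near at *; omega

lemma rtg_seq {β : Type*} {r : β → β → Prop} {a b : β} (h : Relation.ReflTransGen r a b) :
    ∃ (k : ℕ) (f : ℕ → β), f 0 = a ∧ f k = b ∧ ∀ i < k, r (f i) (f (i + 1)) := by
  induction h with
  | refl => exact ⟨0, fun _ => a, rfl, rfl, by simp⟩
  | @tail b c _ h ih =>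
    obtain ⟨k, f, h0, hk, hs⟩ := ih
    refine ⟨k + 1, fun i => if i ≤ k then f i else c, by simp [h0], by simp, fun i hi => ?_⟩
    rcases Nat.lt_succ_iff_lt_or_eq.1 hi with h' | h'
    · have h1 : i ≤ k := h'.le
      have h2 : i + 1 ≤ k := h'
      simp only [h1, h2, if_true]; exact hs i h'
    · subst h'; simp [hk, h]

lemma seq_rtg {β : Type*} {r : β → β → Prop} {k : ℕ} {f : ℕ → β}
    (hs : ∀ i < k, r (f i) (f (i + 1))) {i j : ℕ} (hij : i ≤ j) (hj : j ≤ k) :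
    Relation.ReflTransGen r (f i) (f j) := by
  induction j, hij using Nat.le_induction with
  | base => exact .refl
  | succ j hij ih => exact (ih (by omega)).tail (hs j (by omega))

/-- signed crossing indicator -/
def cr (a b : V) (x y : ℤ) : ℤ :=
  (if a.2 = y ∧ b.2 = y + 1 ∧ a.1 < x then 1 else 0) - (if b.2 = y ∧ a.2 = y + 1 ∧ b.1 < x then 1 else 0)

def NN (f : ℕ → V) (k : ℕ) (x y : ℤ) : ℤ := ∑ i ∈ Finset.range k, cr (f i) (f (i + 1)) x y

lemma cr_h {a b : V} {x y : ℤ} (ha : ¬ (a.1 = x ∧ a.2 = y)) (hb : ¬ (b.1 = x ∧ b.2 = y)) :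
    cr a b x y = cr a b (x + 1) y := by
  unfold cr; split_ifs <;> omega

lemma cr_v {a b : V} {x y : ℤ} (hn : Near a b) (ha : ¬ (a.1 = x ∧ a.2 = y))
    (hb : ¬ (b.1 = x ∧ b.2 = y)) (ha' : ¬ (a.1 = x ∧ a.2 = y + 1)) (hb' : ¬ (b.1 = x ∧ b.2 = y + 1)) :
    cr a b x y - cr a b x (y + 1) = (if b.2 = y + 1 ∧ b.1 < x then 1 else 0)
      - (if a.2 = y + 1 ∧ a.1 < x then 1 else 0) := by
  unfold Near at hn; unfold cr; split_ifs <;> omega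

variable {f : ℕ → V} {k : ℕ}

def Off (f : ℕ → V) (k : ℕ) (x y : ℤ) : Prop := ∀ i ≤ k, ¬ ((f i).1 = x ∧ (f i).2 = y)

lemma NN_h {x y : ℤ} (h : Off f k x y) : NN f k x y = NN f k (x + 1) y := by
  unfold NN
  refine Finset.sum_congr rfl fun i hi => ?_
  have := Finset.mem_range.1 hi
  exact cr_h (h i (by omega)) (h (i + 1) (by omega))

lemma NN_v (hs : ∀ i < k, Near (f i) (f (i + 1))) {x y : ℤ} (h : Off f k x y)
    (h' : Off f k x (y + 1)) (h0 : ¬ ((f 0).2 = y + 1 ∧ (f 0).1 < x))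
    (hk : ¬ ((f k).2 = y + 1 ∧ (f k).1 < x)) : NN f k x y = NN f k x (y + 1) := by
  rw [← sub_eq_zero]; unfold NN
  rw [← Finset.sum_sub_distrib]
  have : ∀ i ∈ Finset.range k, cr (f i) (f (i + 1)) x y - cr (f i) (f (i + 1)) x (y + 1)
      = (fun i => if (f i).2 = y + 1 ∧ (f i).1 < x then (1 : ℤ) else 0) (i + 1)
       - (fun i => if (f i).2 = y + 1 ∧ (f i).1 < x then (1 : ℤ) else 0) i := by
    intro i hi
    have := Finset.mem_range.1 hi
    exact cr_v (hs i this) (h i (by omega)) (h (i + 1) (by omega)) (h' i (by omega))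
      (h' (i + 1) (by omega))
  rw [Finset.sum_congr rfl this]
  refine (Finset.sum_range_sub (fun i => if (f i).2 = y + 1 ∧ (f i).1 < x then (1 : ℤ) else 0) k).trans ?_
  rw [if_neg h0, if_neg hk]; rfl

lemma NN_near (hs : ∀ i < k, Near (f i) (f (i + 1))) {a b : V} (hab : Near a b)
    (h1 : Off f k a.1 a.2) (h2 : Off f k b.1 a.2) (h3 : Off f k b.1 b.2)
    (he : a.2 ≠ b.2 → ∀ q ∈ ({f 0, f k} : Set V), ¬ (q.2 = max a.2 b.2 ∧ q.1 < b.1)) :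
    NN f k a.1 a.2 = NN f k b.1 b.2 := by
  unfold Near at hab
  have e1 : NN f k a.1 a.2 = NN f k b.1 a.2 := by
    rcases (by omega : b.1 = a.1 ∨ b.1 = a.1 + 1 ∨ a.1 = b.1 + 1) with h | h | h
    · rw [h]
    · rw [h]; exact NN_h h1
    · rw [h]; exact (NN_h h2).symm
  rw [e1]
  rcases (by omega : b.2 = a.2 ∨ b.2 = a.2 + 1 ∨ a.2 = b.2 + 1) with h | h | h
  · rw [h]
  · have := he (by omega)
    rw [h] at h3 ⊢
    have hm : max a.2 b.2 = a.2 + 1 := by omega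
    rw [hm] at this
    exact NN_v hs h2 h3 (this _ (by simp)) (this _ (by simp))
  · have := he (by omega)
    rw [h] at h2 ⊢
    have hm : max a.2 b.2 = b.2 + 1 := by omega
    rw [hm] at this
    exact (NN_v hs h3 h2 (this _ (by simp)) (this _ (by simp))).symm

/-- The path from `u` (relation `r`) hits the sequence `f`, up to corners. -/
def Hits (r : V → V → Prop) (u : V) (f : ℕ → V) (k : ℕ) : Prop :=
  ∃ x i, i ≤ k ∧ Relation.ReflTransGen r u x ∧ (x = f i ∨ ∃ y, r x y ∧ f i = (y.1, x.2))

lemma NN_path {r : V → V → Prop} (hr : ∀ a b, r a b → Near a b)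
    (hs : ∀ i < k, Near (f i) (f (i + 1))) {u v : V} (hnot : ¬ Hits r u f k)
    (he : ∀ a b, r a b → a.2 ≠ b.2 → ∀ q ∈ ({f 0, f k} : Set V), ¬ (q.2 = max a.2 b.2 ∧ q.1 < b.1))
    (h : Relation.ReflTransGen r u v) : NN f k u.1 u.2 = NN f k v.1 v.2 ∧ Off f k v.1 v.2 := by
  have hoff : ∀ x, Relation.ReflTransGen r u x → Off f k x.1 x.2 := fun x hx i hi h =>
    hnot ⟨x, i, hi, hx, Or.inl (Prod.ext h.1.symm h.2.symm)⟩
  refine ⟨?_, hoff v h⟩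
  induction h with
  | refl => rfl
  | @tail b c hb hbc ih =>
    rw [ih]
    refine NN_near hs (hr _ _ hbc) (hoff b hb) ?_ (hoff c (hb.tail hbc)) (he _ _ hbc)
    exact fun i hi h => hnot ⟨b, i, hi, hb, Or.inr ⟨c, hbc, Prod.ext h.1 h.2⟩⟩

lemma cr_left {a b : V} {x y : ℤ} (ha : x ≤ a.1) (hb : x ≤ b.1) : cr a b x y = 0 := by
  unfold cr; split_ifs <;> omega

lemma cr_right {a b : V} {x y : ℤ} (hn : Near a b) (ha : a.1 ≤ x) (hb : b.1 ≤ x)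
    (ha' : ¬ (a.1 = x ∧ a.2 = y)) (hb' : ¬ (b.1 = x ∧ b.2 = y)) :
    cr a b x y = (if y < b.2 then 1 else 0) - (if y < a.2 then 1 else 0) := by
  unfold Near at hn; unfold cr; split_ifs <;> omega

lemma NN_left {x y : ℤ} (h : ∀ i ≤ k, x ≤ (f i).1) : NN f k x y = 0 := by
  unfold NN
  refine Finset.sum_eq_zero fun i hi => ?_
  have := Finset.mem_range.1 hi
  exact cr_left (h i (by omega)) (h (i + 1) (by omega))

lemma NN_right (hs : ∀ i < k, Near (f i) (f (i + 1))) {x y : ℤ} (h : ∀ i ≤ k, (f i).1 ≤ x)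
    (ho : Off f k x y) :
    NN f k x y = (if y < (f k).2 then 1 else 0) - (if y < (f 0).2 then 1 else 0) := by
  unfold NN
  have : ∀ i ∈ Finset.range k, cr (f i) (f (i + 1)) x y
      = (fun i => if y < (f i).2 then (1 : ℤ) else 0) (i + 1)
       - (fun i => if y < (f i).2 then (1 : ℤ) else 0) i := by
    intro i hi
    have := Finset.mem_range.1 hi
    exact cr_right (hs i this) (h i (by omega)) (h (i + 1) (by omega)) (ho i (by omega))
      (ho (i + 1) (by omega))
  rw [Finset.sum_congr rfl this]
  exact Finset.sum_range_sub (fun i => if y < (f i).2 then (1 : ℤ) else 0) k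

/-- a left-right path hits a bottom-top path -/
lemma hits_cross {r : V → V → Prop} (hr : ∀ a b, r a b → Near a b) {u v : V} {a b c d : ℤ}
    (hrow : ∀ x y, r x y → (c ≤ x.2 ∧ x.2 ≤ d) ∧ (c ≤ y.2 ∧ y.2 ≤ d))
    (h : Relation.ReflTransGen r u v) (hu : u.1 ≤ a) (hv : b ≤ v.1) (huv : a < b)
    (hs : ∀ i < k, Near (f i) (f (i + 1))) (hcol : ∀ i ≤ k, a ≤ (f i).1 ∧ (f i).1 ≤ b)
    (h0 : (f 0).2 ≤ c) (hk : d ≤ (f k).2) : Hits r u f k := by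
  by_contra hnot
  set g : ℕ → V := fun i => if i ≤ k then f i else ((f k).1, (f k).2 + 1) with hg
  have g1 : ∀ i ≤ k, g i = f i := fun i hi => by simp [hg, hi]
  have g2 : g (k + 1) = ((f k).1, (f k).2 + 1) := by simp [hg]
  have hvrow : c ≤ v.2 ∧ v.2 ≤ d := by
    rcases h.cases_tail with h | ⟨w, _, h⟩
    · subst h; omega
    · exact (hrow _ _ h).2
  have hsg : ∀ i < k + 1, Near (g i) (g (i + 1)) := by
    intro i hi
    rcases Nat.lt_succ_iff_lt_or_eq.1 hi with h | h
    · rw [g1 i h.le, g1 (i + 1) h]; exact hs i h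
    · subst h; rw [g1 _ le_rfl, g2]; unfold Near; simp
  have hcg : ∀ i ≤ k + 1, a ≤ (g i).1 ∧ (g i).1 ≤ b := by
    intro i hi
    rcases Nat.le_succ_iff_eq_or_le.1 hi with h | h
    · subst h; rw [g2]; exact hcol k le_rfl
    · rw [g1 i h]; exact hcol i h
  have hnotg : ¬ Hits r u g (k + 1) := by
    rintro ⟨x, i, hi, hx, hh⟩
    rcases Nat.le_succ_iff_eq_or_le.1 hi with h' | h'
    · subst h'; rw [g2] at hh
      rcases hh with hh | ⟨y, hy, hh⟩
      · have : x.2 = (f k).2 + 1 := by rw [hh]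
        rcases hx.cases_tail with h'' | ⟨w, _, h''⟩
        · rcases h.cases_head with e | ⟨w, h3, _⟩
          · subst e; omega
          · have := hrow _ _ h3; rw [← h''] at this; omega
        · have := hrow _ _ h''; omega
      · have h3 : (f k).2 + 1 = x.2 := congrArg Prod.snd hh
        have := hrow _ _ hy; omega
    · rw [g1 i h'] at hh
      exact hnot ⟨x, i, h', hx, hh⟩
  have key := NN_path hr hsg hnotg ?_ h
  · rw [NN_left (fun i hi => by have := hcg i hi; omega),
      NN_right hsg (fun i hi => by have := hcg i hi; omega) key.2] at key
    rw [g1 0 (by omega), g2] at key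
    have := key.1
    simp only at this
    rw [if_pos (by omega), if_neg (by omega)] at this
    omega
  · intro x y hxy hne q hq hh
    have := hrow _ _ hxy
    rw [g1 0 (by omega), g2] at hq
    rcases hq with rfl | hq
    · omega
    · rw [Set.mem_singleton_iff] at hq; subst hq; simp only at hh; omega

/-- the hook version -/
lemma hits_hook {r : V → V → Prop} (hr : ∀ a b, r a b → Near a b) {u v : V} {a s : ℤ}
    (hcolr : ∀ x y, r x y → y.1 ≤ s)
    (h : Relation.ReflTransGen r u v) (hu : u.1 ≤ a) (hv : v.1 = s)
    (hs : ∀ i < k, Near (f i) (f (i + 1))) (hcol : ∀ i ≤ k, a ≤ (f i).1 ∧ (f i).1 ≤ s)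
    (h0 : (f 0).1 = s) (hk : (f k).1 = s) (h0' : v.2 ≤ (f 0).2) (hk' : (f k).2 ≤ v.2) :
    Hits r u f k := by
  by_contra hnot
  have key := NN_path hr hs hnot ?_ h
  · rw [NN_left (fun i hi => by have := hcol i hi; omega),
      NN_right hs (fun i hi => by have := hcol i hi; omega) key.2] at key
    have h1 := key.1
    have h2 := key.2 0 (Nat.zero_le _)
    rw [if_neg (by omega), if_pos (by omega)] at h1
    omega
  · intro x y hxy hne q hq hh
    have := hcolr _ _ hxy
    rcases hq with rfl | hq
    · omega
    · rw [Set.mem_singleton_iff] at hq; subst hq; omega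

/-- connection inside a region -/
def CI (η : V → V → Prop) (R : Set V) (u v : V) : Prop :=
  Relation.ReflTransGen (fun a b => η a b ∧ a ∈ R ∧ b ∈ R) u v

/-- sure properties of the configurations -/
structure GoodCfg (η : V → V → Prop) : Prop where
  symm : ∀ a b, η a b → η b a
  star : ∀ a b, η a b → StarAdj a b
  corner : ∀ a b c d, η a b → ¬ SqAdj a b → SqAdj a c → SqAdj c b → η c d → η a c

variable {η : V → V → Prop} {R R' : Set V} {u v w : V}

lemma CI.symm (hη : GoodCfg η) (h : CI η R u v) : CI η R v u := by
  induction h with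
  | refl => exact .refl
  | tail _ h ih => exact Relation.ReflTransGen.head ⟨hη.symm _ _ h.1, h.2.2, h.2.1⟩ ih

lemma CI.trans (h : CI η R u v) (h' : CI η R v w) : CI η R u w := Relation.ReflTransGen.trans h h'

lemma CI.mono (hR : R ⊆ R') (h : CI η R u v) : CI η R' u v :=
  Relation.ReflTransGen.mono (fun _ _ h => ⟨h.1, hR h.2.1, hR h.2.2⟩) _ _ h

lemma CI.mem_right (h : CI η R u v) (huv : u ≠ v) : v ∈ R := by
  rcases h.cases_tail with h | ⟨w, _, h⟩
  · exact absurd h.symm huv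
  · exact h.2.2

lemma CI.mem_left (h : CI η R u v) (huv : u ≠ v) : u ∈ R := by
  rcases h.cases_head with h | ⟨w, h, _⟩
  · exact absurd h huv
  · exact h.2.1

lemma meet_of_hits (hη : GoodCfg η) {R1 R2 : Set V} {s t : V} (hst : s ≠ t)
    (hf0 : f 0 = s) (hfk : f k = t)
    (hf : ∀ i < k, η (f i) (f (i + 1)) ∧ f i ∈ R2 ∧ f (i + 1) ∈ R2)
    (h : Hits (fun a b => η a b ∧ a ∈ R1 ∧ b ∈ R1) u f k) : CI η (R1 ∪ R2) u s := by
  obtain ⟨x, i, hi, hx, hh⟩ := h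
  have hk : 0 < k := Nat.pos_of_ne_zero fun h => by subst h; exact hst (hf0.symm.trans hfk)
  have hsi : CI η R2 s (f i) := by rw [← hf0]; exact seq_rtg hf (Nat.zero_le i) hi
  have hsi' : CI η (R1 ∪ R2) (f i) s := (hsi.symm hη).mono Set.subset_union_right
  have hux : CI η (R1 ∪ R2) u x := CI.mono Set.subset_union_left hx
  have hd : ∃ d, η (f i) d ∧ f i ∈ R2 := by
    rcases hi.eq_or_lt with h | h
    · subst h
      obtain ⟨j, rfl⟩ : ∃ j, i = j + 1 := ⟨i - 1, by omega⟩
      exact ⟨f j, hη.symm _ _ (hf j (by omega)).1, (hf j (by omega)).2.2⟩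
    · exact ⟨_, (hf i h).1, (hf i h).2.1⟩
  rcases hh with rfl | ⟨y, hy, hz⟩
  · exact hux.trans hsi'
  · by_cases hsq : SqAdj x y
    · rcases ((sqAdj_iff x y).1 hsq).2 with h | h
      · have : f i = x := by rw [hz]; exact Prod.ext h.1.symm rfl
        rw [this] at hsi'; exact hux.trans hsi'
      · have : f i = y := by rw [hz]; exact Prod.ext rfl h.2
        rw [this] at hsi'
        exact (hux.tail ⟨hy.1, Or.inl hy.2.1, Or.inl hy.2.2⟩).trans hsi'
    · obtain ⟨d, hd, hm⟩ := hd
      have hst := hη.star _ _ hy.1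
      rw [starAdj_iff] at hst
      have hsq' := hsq
      rw [sqAdj_iff] at hsq
      unfold Near at hst hsq
      have c1 : SqAdj x (f i) := by rw [hz, sqAdj_iff]; unfold Near; dsimp only; omega
      have c2 : SqAdj (f i) y := by rw [hz, sqAdj_iff]; unfold Near; dsimp only; omega
      have := hη.corner x y (f i) d hy.1 hsq' c1 c2 hd
      exact (hux.tail ⟨this, Or.inl hy.2.1, Or.inr hm⟩).trans hsi'

lemma meet_cross (hη : GoodCfg η) {R1 R2 : Set V} {s t : V} {a b c d : ℤ}
    (hR1 : ∀ x ∈ R1, c ≤ x.2 ∧ x.2 ≤ d) (hR2 : ∀ x ∈ R2, a ≤ x.1 ∧ x.1 ≤ b)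
    (h : CI η R1 u v) (hu : u.1 ≤ a) (hv : b ≤ v.1) (hab : a < b)
    (h' : CI η R2 s t) (hs : s.2 ≤ c) (ht : d ≤ t.2) (hcd : c < d) : CI η (R1 ∪ R2) u s := by
  obtain ⟨k, f, hf0, hfk, hf⟩ := rtg_seq h'
  have hst : s ≠ t := fun h => by subst h; omega
  refine meet_of_hits hη hst hf0 hfk hf ?_
  refine hits_cross (fun a b h => (hη.star a b h.1).near) (fun x y h => ⟨hR1 _ h.2.1, hR1 _ h.2.2⟩)
    h hu hv hab (fun i hi => (hη.star _ _ (hf i hi).1).near) (fun i hi => ?_) (by rw [hf0]; exact hs)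
    (by rw [hfk]; exact ht)
  rcases hi.eq_or_lt with h2 | h2
  · subst h2; rw [hfk]; exact hR2 _ (h'.mem_right hst)
  · exact hR2 _ (hf i h2).2.1

lemma meet_hook (hη : GoodCfg η) {R1 R2 : Set V} {s t : V} {a b : ℤ}
    (hR1 : ∀ x ∈ R1, x.1 ≤ b) (hR2 : ∀ x ∈ R2, a ≤ x.1 ∧ x.1 ≤ b)
    (h : CI η R1 u v) (hu : u.1 ≤ a) (hv : v.1 = b)
    (h' : CI η R2 s t) (hst : s ≠ t) (hs : s.1 = b) (ht : t.1 = b) (hs' : v.2 ≤ s.2) (ht' : t.2 ≤ v.2) :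
    CI η (R1 ∪ R2) u s := by
  obtain ⟨k, f, hf0, hfk, hf⟩ := rtg_seq h'
  refine meet_of_hits hη hst hf0 hfk hf ?_
  refine hits_hook (fun a b h => (hη.star a b h.1).near) (fun x y h => hR1 _ h.2.2)
    h hu hv (fun i hi => (hη.star _ _ (hf i hi).1).near) (fun i hi => ?_) (by rw [hf0]; exact hs)
    (by rw [hfk]; exact ht) (by rw [hf0]; exact hs') (by rw [hfk]; exact ht')
  rcases hi.eq_or_lt with h2 | h2
  · subst h2; rw [hfk]; exact hR2 _ (h'.mem_right hst)
  · exact hR2 _ (hf i h2).2.1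

end Topo
end DaC

namespace DaC

section Topo2
variable {η : V → V → Prop} {R R' : Set V} {u v w : V}

lemma CI.exit {N : V → ℤ} (hN : ∀ a b, η a b → N b ≤ N a + 1) {b : ℤ} (hu : N u ≤ b)
    (h : CI η R u v) : (∃ w, N w = b ∧ CI η (R ∩ {x | N x ≤ b}) u w) ∨
      (N v < b ∧ CI η (R ∩ {x | N x ≤ b}) u v) := by
  induction h with
  | refl =>
    rcases hu.eq_or_lt with h | h
    · exact Or.inl ⟨u, h, .refl⟩
    · exact Or.inr ⟨h, .refl⟩
  | @tail x y _ hxy ih =>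
    rcases ih with h | ⟨h1, h2⟩
    · exact Or.inl h
    · have hn := hN _ _ hxy.1
      have : CI η (R ∩ {x | N x ≤ b}) u y :=
        h2.tail ⟨hxy.1, ⟨hxy.2.1, by simp; omega⟩, ⟨hxy.2.2, by simp; omega⟩⟩
      rcases (by omega : N y = b ∨ N y < b) with h | h
      · exact Or.inl ⟨y, h, this⟩
      · exact Or.inr ⟨h, this⟩

lemma CI.exit' {N : V → ℤ} (hN : ∀ a b, η a b → N b ≤ N a + 1) {b : ℤ} (hu : N u ≤ b)
    (hv : b ≤ N v) (h : CI η R u v) : ∃ w, N w = b ∧ CI η (R ∩ {x | N x ≤ b}) u w := by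
  rcases h.exit hN hu with h | h
  · exact h
  · omega

def blkR (ξ : V → Prop) (a b : V) : Prop := SqAdj a b ∧ ξ a ∧ ξ b
def whtR (ξ : V → Prop) (a b : V) : Prop := StarAdj a b ∧ ¬ ξ a ∧ ¬ ξ b

def Box4 (a b c d : ℤ) : Set V := {x | a ≤ x.1 ∧ x.1 ≤ b ∧ c ≤ x.2 ∧ x.2 ≤ d}

lemma blkR_good (ξ : V → Prop) : GoodCfg (blkR ξ) where
  symm := fun _ _ h => ⟨h.1.symm, h.2.2, h.2.1⟩
  star := fun _ _ h => h.1.star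
  corner := fun _ _ _ _ h h' _ _ _ => absurd h.1 h'

lemma whtR_good (ξ : V → Prop) : GoodCfg (whtR ξ) where
  symm := fun _ _ h => ⟨h.1.symm, h.2.2, h.2.1⟩
  star := fun _ _ h => h.1
  corner := fun _ _ _ _ h _ h1 _ h2 => ⟨h1.star, h.2.1, h2.2.1⟩

/-- a black left-right crossing and a white *-crossing bottom-top exclude each other -/
lemma no_both {ξ : V → Prop} {R1 R2 : Set V} {s t : V} {a b c d : ℤ}
    (hR1 : ∀ x ∈ R1, c ≤ x.2 ∧ x.2 ≤ d) (hR2 : ∀ x ∈ R2, a ≤ x.1 ∧ x.1 ≤ b)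
    (h : CI (blkR ξ) R1 u v) (hu : u.1 ≤ a) (hv : b ≤ v.1) (hab : a < b)
    (h' : CI (whtR ξ) R2 s t) (hs : s.2 ≤ c) (ht : d ≤ t.2) (hcd : c < d) : False := by
  obtain ⟨k, f, hf0, hfk, hf⟩ := rtg_seq h'
  have hst : s ≠ t := fun h => by subst h; omega
  have hk : 0 < k := Nat.pos_of_ne_zero fun h => by subst h; exact hst (hf0.symm.trans hfk)
  have hw : ∀ i ≤ k, ¬ ξ (f i) := fun i hi => by
    rcases hi.eq_or_lt with h | h
    · subst h
      obtain ⟨j, rfl⟩ : ∃ j, i = j + 1 := ⟨i - 1, by omega⟩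
      exact (hf j (by omega)).1.2.2
    · exact (hf i h).1.2.1
  have huv : u ≠ v := fun h => by subst h; omega
  have hub : ξ u := by
    rcases h.cases_head with h | ⟨w, h, _⟩
    · exact absurd h huv
    · exact h.1.2.1
  obtain ⟨x, i, hi, hx, hh⟩ := hits_cross (k := k) (f := f) (a := a) (b := b) (c := c) (d := d)
    (fun a b h => h.1.1.near)
    (fun x y h => ⟨hR1 _ h.2.1, hR1 _ h.2.2⟩) h hu hv hab (fun i hi => (hf i hi).1.1.near)
    (fun i hi => by
      rcases hi.eq_or_lt with h2 | h2
      · subst h2; rw [hfk]; exact hR2 _ (h'.mem_right hst)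
      · exact hR2 _ (hf i h2).2.1) (by rw [hf0]; exact hs) (by rw [hfk]; exact ht)
  have hxb : ξ x := by
    rcases hx.cases_tail with h | ⟨w, _, h⟩
    · rw [h]; exact hub
    · exact h.1.2.2
  rcases hh with rfl | ⟨y, hy, hz⟩
  · exact hw i hi hxb
  · rcases ((sqAdj_iff x y).1 hy.1.1).2 with h | h
    · have : f i = x := by rw [hz]; exact Prod.ext h.1.symm rfl
      exact hw i hi (this ▸ hxb)
    · have : f i = y := by rw [hz]; exact Prod.ext rfl h.2
      exact hw i hi (this ▸ hy.1.2.2)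

lemma face_parity (s1 s2 s3 s4 t1 t2 t3 t4 : Prop) [Decidable s1] [Decidable s2] [Decidable s3]
    [Decidable s4] [Decidable t1] [Decidable t2] [Decidable t3] [Decidable t4]
    (h1 : t1 → ¬ s1) (h2 : t2 → ¬ s2) (h3 : t3 → ¬ s3) (h4 : t4 → ¬ s4)
    (h12 : s1 → ¬ s2 → (t1 ∨ t2 ∨ t3 ∨ t4) → t2) (h21 : s2 → ¬ s1 → (t1 ∨ t2 ∨ t3 ∨ t4) → t1)
    (h23 : s2 → ¬ s3 → (t1 ∨ t2 ∨ t3 ∨ t4) → t3) (h32 : s3 → ¬ s2 → (t1 ∨ t2 ∨ t3 ∨ t4) → t2)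
    (h34 : s3 → ¬ s4 → (t1 ∨ t2 ∨ t3 ∨ t4) → t4) (h43 : s4 → ¬ s3 → (t1 ∨ t2 ∨ t3 ∨ t4) → t3)
    (h41 : s4 → ¬ s1 → (t1 ∨ t2 ∨ t3 ∨ t4) → t1) (h14 : s1 → ¬ s4 → (t1 ∨ t2 ∨ t3 ∨ t4) → t4) :
    ((if (s1 ∧ t2) ∨ (s2 ∧ t1) then (1 : ℤ) else 0) + (if (s2 ∧ t3) ∨ (s3 ∧ t2) then (1 : ℤ) else 0)
      + (if (s4 ∧ t3) ∨ (s3 ∧ t4) then (1 : ℤ) else 0)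
      + (if (s1 ∧ t4) ∨ (s4 ∧ t1) then (1 : ℤ) else 0)) % 2 = 0 := by
  by_cases s1 <;> by_cases s2 <;> by_cases s3 <;> by_cases s4 <;>
    by_cases t1 <;> by_cases t2 <;> by_cases t3 <;> by_cases t4 <;> simp_all

open Classical in
lemma dual_crossing (ξ : V → Prop) {a b c d : ℤ} (hab : a < b) (hcd : c < d)
    (hno : ¬ ∃ u v : V, u.1 = a ∧ v.1 = b ∧ CI (blkR ξ) (Box4 a b c d) u v) :
    ∃ s t : V, s.2 = c ∧ t.2 = d ∧ CI (whtR ξ) (Box4 a b c d) s t := by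
  set Q := Box4 a b c d with hQ
  have memQ : ∀ x : V, x ∈ Q ↔ a ≤ x.1 ∧ x.1 ≤ b ∧ c ≤ x.2 ∧ x.2 ≤ d := fun x => Iff.rfl
  set S : V → Prop := fun v => v.1 < a ∨ (v ∈ Q ∧ ξ v ∧ ∃ u, u.1 = a ∧ CI (blkR ξ) Q u v) with hS
  set D : V → Prop := fun v => v ∈ Q ∧ ¬ S v ∧ ∃ w, SqAdj v w ∧ S w with hD
  have hDw : ∀ v, D v → ¬ ξ v := by
    rintro v ⟨hv, hnS, w, hvw, hw⟩ hb
    apply hnS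
    have hn := hvw.near; unfold Near at hn
    have hv' := (memQ v).1 hv
    rcases hw with hw | ⟨hwQ, hwb, u, hu, hc⟩
    · exact Or.inr ⟨hv, hb, v, by omega, .refl⟩
    · exact Or.inr ⟨hv, hb, u, hu, hc.tail ⟨⟨hvw.symm, hwb, hb⟩, hwQ, hv⟩⟩
  have hSb : ∀ v : V, b ≤ v.1 → ¬ S v := by
    rintro v hv (h | ⟨h1, _, u, hu, hc⟩)
    · omega
    · have := (memQ v).1 h1
      exact hno ⟨u, v, hu, by omega, hc⟩
  set r : V → V → Prop := fun x y => StarAdj x y ∧ D x ∧ D y with hr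
  set t : V → Prop := fun v => D v ∧ ∃ s : V, s.2 = d ∧ Relation.ReflTransGen r s v with ht
  by_contra hcon
  have htc : ∀ v, t v → v.2 ≠ c := by
    rintro v ⟨hv, s, hs, hsv⟩ hvc
    apply hcon
    have : CI (whtR ξ) Q s v := Relation.ReflTransGen.mono
      (fun x y h => ⟨⟨h.1, hDw _ h.2.1, hDw _ h.2.2⟩, h.2.1.1, h.2.2.1⟩) _ _ hsv
    exact ⟨v, s, hvc, hs, this.symm (whtR_good ξ)⟩
  have htS : ∀ v, t v → ¬ S v := fun v h => h.1.2.1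
  set I : V → V → ℤ := fun p q => if (S p ∧ t q) ∨ (S q ∧ t p) then 1 else 0 with hI
  have hface : ∀ x y : ℤ, x + 1 ≤ b → c ≤ y → y + 1 ≤ d →
      (I (x, y) (x + 1, y) + I (x + 1, y) (x + 1, y + 1) + I (x, y + 1) (x + 1, y + 1)
        + I (x, y) (x, y + 1)) % 2 = 0 := by
    intro x y hx hy hy'
    have key : ∀ p q : V, (x ≤ p.1 ∧ p.1 ≤ x + 1 ∧ y ≤ p.2 ∧ p.2 ≤ y + 1) →
        (x ≤ q.1 ∧ q.1 ≤ x + 1 ∧ y ≤ q.2 ∧ q.2 ≤ y + 1) → SqAdj p q → S p → ¬ S q →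
        (t (x, y) ∨ t (x + 1, y) ∨ t (x + 1, y + 1) ∨ t (x, y + 1)) → t q := by
      intro p q hp hq hpq hSp hSq hor
      have hDq : D q := by
        refine ⟨(memQ q).2 ⟨?_, by omega, by omega, by omega⟩, hSq, p, hpq.symm, hSp⟩
        by_contra h; exact hSq (Or.inl (by omega))
      have : ∃ z : V, t z ∧ (x ≤ z.1 ∧ z.1 ≤ x + 1 ∧ y ≤ z.2 ∧ z.2 ≤ y + 1) := by
        rcases hor with h | h | h | h
        · exact ⟨_, h, by dsimp only; omega⟩
        · exact ⟨_, h, by dsimp only; omega⟩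
        · exact ⟨_, h, by dsimp only; omega⟩
        · exact ⟨_, h, by dsimp only; omega⟩
      obtain ⟨z, hz, hzb⟩ := this
      by_cases hzq : z = q
      · exact hzq ▸ hz
      · obtain ⟨hzD, s, hs, hsz⟩ := hz
        refine ⟨hDq, s, hs, hsz.tail ⟨?_, hzD, hDq⟩⟩
        rw [starAdj_iff]
        refine ⟨by unfold Near; omega, fun h => hzq (Prod.ext h.1 h.2)⟩
    have adj1 : SqAdj (x, y) (x + 1, y) := by simp [SqAdj]
    have adj2 : SqAdj (x + 1, y) (x + 1, y + 1) := by simp [SqAdj]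
    have adj3 : SqAdj (x + 1, y + 1) (x, y + 1) := by simp [SqAdj]
    have adj4 : SqAdj (x, y + 1) (x, y) := by simp [SqAdj]
    have b1 : x ≤ ((x, y) : V).1 ∧ ((x, y) : V).1 ≤ x + 1 ∧ y ≤ ((x, y) : V).2 ∧ ((x, y) : V).2 ≤ y + 1 := by
      dsimp only; omega
    have b2 : x ≤ ((x + 1, y) : V).1 ∧ ((x + 1, y) : V).1 ≤ x + 1 ∧ y ≤ ((x + 1, y) : V).2 ∧
        ((x + 1, y) : V).2 ≤ y + 1 := by dsimp only; omega
    have b3 : x ≤ ((x + 1, y + 1) : V).1 ∧ ((x + 1, y + 1) : V).1 ≤ x + 1 ∧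
        y ≤ ((x + 1, y + 1) : V).2 ∧ ((x + 1, y + 1) : V).2 ≤ y + 1 := by dsimp only; omega
    have b4 : x ≤ ((x, y + 1) : V).1 ∧ ((x, y + 1) : V).1 ≤ x + 1 ∧ y ≤ ((x, y + 1) : V).2 ∧
        ((x, y + 1) : V).2 ≤ y + 1 := by dsimp only; omega
    exact face_parity _ _ _ _ _ _ _ _ (htS _) (htS _) (htS _) (htS _)
      (key _ _ b1 b2 adj1) (key _ _ b2 b1 adj1.symm) (key _ _ b2 b3 adj2) (key _ _ b3 b2 adj2.symm)
      (key _ _ b3 b4 adj3) (key _ _ b4 b3 adj3.symm) (key _ _ b4 b1 adj4) (key _ _ b1 b4 adj4.symm)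
  set J : ℕ → ℤ → ℤ := fun n y => ∑ m ∈ Finset.range n, I (a - 1 + m, y) (a - 1 + m + 1, y) with hJ
  have hJs : ∀ n y, J (n + 1) y = J n y + I (a - 1 + n, y) (a - 1 + n + 1, y) := fun n y => by
    simp [hJ, Finset.sum_range_succ]
  have strip : ∀ y, c ≤ y → y + 1 ≤ d → ∀ n : ℕ, a - 1 + n ≤ b →
      (J n y + J n (y + 1) + I (a - 1 + n, y) (a - 1 + n, y + 1)) % 2 = 0 := by
    intro y hy hy' n
    induction n with
    | zero =>
      intro _
      have s1 : S (a - 1, y) := Or.inl (by dsimp only; omega)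
      have s2 : S (a - 1, y + 1) := Or.inl (by dsimp only; omega)
      have t1 : ¬ t (a - 1, y) := fun h => htS _ h s1
      have t2 : ¬ t (a - 1, y + 1) := fun h => htS _ h s2
      simp [hJ, hI, t1, t2]
    | succ n ih =>
      intro hn
      push_cast at hn
      have h1 := ih (by omega)
      have h2 := hface (a - 1 + n) y (by omega) hy hy'
      rw [hJs, hJs]
      have e : (a - 1 + ((n + 1 : ℕ) : ℤ)) = a - 1 + n + 1 := by push_cast; ring
      rw [e]
      omega
  obtain ⟨N, hN⟩ : ∃ N : ℕ, a - 1 + (N : ℤ) = b := ⟨(b - a + 1).toNat, by omega⟩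
  have hrow : ∀ y, c ≤ y → y + 1 ≤ d → J N y % 2 = J N (y + 1) % 2 := by
    intro y hy hy'
    have h := strip y hy hy' N hN.le
    rw [hN] at h
    have s1 : ¬ S (b, y) := hSb _ le_rfl
    have s2 : ¬ S (b, y + 1) := hSb _ le_rfl
    have : I (b, y) (b, y + 1) = 0 := by simp [hI, s1, s2]
    omega
  have hall : ∀ n : ℕ, c + n ≤ d → J N (c + n) % 2 = 0 := by
    intro n
    induction n with
    | zero =>
      intro _
      have t1 : ∀ x, ¬ t (x, c) := fun x h => htc _ h rfl
      simp [hJ, hI, t1]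
    | succ n ih =>
      intro hn
      push_cast at hn ⊢
      rw [← add_assoc, ← hrow _ (by omega) (by omega)]
      exact ih (by omega)
  have htop : ∀ n : ℕ, a - 1 + n ≤ b → J n d % 2 = if S (a - 1 + n, d) then 0 else 1 := by
    intro n
    induction n with
    | zero =>
      intro _
      have s1 : S (a - 1, d) := Or.inl (by dsimp only; omega)
      simp [hJ, s1]
    | succ n ih =>
      intro hn
      push_cast at hn
      have h1 := ih (by omega)
      rw [hJs]
      have e : (a - 1 + ((n + 1 : ℕ) : ℤ)) = a - 1 + n + 1 := by push_cast; ring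
      rw [e]
      have adj : SqAdj (a - 1 + n, d) (a - 1 + n + 1, d) := by simp [SqAdj]
      have key : ∀ p q : V, SqAdj p q → p.2 = d → q.2 = d → q.1 ≤ b → S p → ¬ S q → t q := by
        intro p q hpq hp hq hqb hSp hSq
        refine ⟨⟨(memQ q).2 ⟨?_, by omega, by omega, by omega⟩, hSq, p, hpq.symm, hSp⟩, q, hq, .refl⟩
        by_contra h; exact hSq (Or.inl (by omega))
      have k1 := key _ _ adj rfl rfl (by dsimp only; omega)
      have k2 := key _ _ adj.symm rfl rfl (by dsimp only; omega)
      have k3 := htS (a - 1 + n, d)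
      have k4 := htS (a - 1 + n + 1, d)
      by_cases q1 : S (a - 1 + n, d)
      · by_cases q2 : S (a - 1 + n + 1, d)
        · have q3 : ¬ t (a - 1 + n, d) := fun h => k3 h q1
          have q4 : ¬ t (a - 1 + n + 1, d) := fun h => k4 h q2
          rw [if_pos q1] at h1; rw [if_pos q2]
          simp only [hI, q3, q4, and_false, or_false, if_false]; omega
        · have q3 := k1 q1 q2
          rw [if_pos q1] at h1; rw [if_neg q2]
          have : I (a - 1 + n, d) (a - 1 + n + 1, d) = 1 := if_pos (Or.inl ⟨q1, q3⟩)
          omega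
      · by_cases q2 : S (a - 1 + n + 1, d)
        · have q3 := k2 q2 q1
          rw [if_neg q1] at h1; rw [if_pos q2]
          have : I (a - 1 + n, d) (a - 1 + n + 1, d) = 1 := if_pos (Or.inr ⟨q2, q3⟩)
          omega
        · rw [if_neg q1] at h1; rw [if_neg q2]
          simp only [hI, q1, q2, false_and, or_false, if_false]; omega
  have f1 := htop N hN.le
  rw [hN, if_neg (hSb _ le_rfl)] at f1
  have f2 := hall (d - c).toNat (by omega)
  have e : c + ((d - c).toNat : ℤ) = d := by omega
  rw [e] at f2
  omega

end Topo2
end DaC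

namespace DaC

abbrev Cfg : Type := V → V → Prop

def Local (D : Finset V) (A : Set Cfg) : Prop :=
  ∀ η η' : Cfg, (∀ u ∈ D, ∀ v ∈ D, (η u v ↔ η' u v)) → (η ∈ A → η' ∈ A)

def Inc (A : Set Cfg) : Prop := ∀ η η' : Cfg, (∀ u v, η u v → η' u v) → η ∈ A → η' ∈ A

def sqd (u v : V) : ℤ := (u.1 - v.1) ^ 2 + (u.2 - v.2) ^ 2

def pull (g : V → V) (η : Cfg) : Cfg := fun u v => η (g u) (g v)

def Far (k : ℕ) (D D' : Finset V) : Prop := ∀ u ∈ D, ∀ v ∈ D',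
  (k : ℤ) ≤ u.1 - v.1 ∨ (k : ℤ) ≤ v.1 - u.1 ∨ (k : ℤ) ≤ u.2 - v.2 ∨ (k : ℤ) ≤ v.2 - u.2

/-- sup-norm box -/
noncomputable def bx (c : V) (n : ℤ) : Finset V :=
  Finset.Icc (c.1 - n) (c.1 + n) ×ˢ Finset.Icc (c.2 - n) (c.2 + n)

lemma mem_bx {c v : V} {n : ℤ} : v ∈ bx c n ↔
    c.1 - n ≤ v.1 ∧ v.1 ≤ c.1 + n ∧ c.2 - n ≤ v.2 ∧ v.2 ≤ c.2 + n := by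
  simp [bx, and_assoc]

/-- all square edges in the box are open -/
def Seed (c : V) (m : ℤ) : Set Cfg := {η | ∀ u ∈ bx c m, ∀ v ∈ bx c m, SqAdj u v → η u v}

structure IsModel (μ : Measure Cfg) (e : ℕ → ℝ) : Prop where
  prob : IsProbabilityMeasure μ
  good : ∀ᵐ η ∂μ, GoodCfg η
  inv : ∀ g : V ≃ V, (∀ u v, sqd (g u) (g v) = sqd u v) → ∀ D A, Local D A →
    μ.real (pull g ⁻¹' A) = μ.real A
  fkg : ∀ D A B, Local D A → Local D B → Inc A → Inc B → μ.real A * μ.real B ≤ μ.real (A ∩ B)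
  mix : ∀ k D D' A B, Local D A → Local D' B → Far k D D' →
    μ.real (A ∩ B) ≤ μ.real A * μ.real B + ((D.card : ℝ) + D'.card) * e k
  e_nonneg : ∀ k, 0 ≤ e k
  e_lim : Filter.Tendsto e Filter.atTop (nhds 0)
  seed : ∀ m : ℕ, 0 < μ.real (Seed 0 m)
  iso : 0 < μ.real {η | ∀ v, StarAdj 0 v → ¬ η 0 v}

section basic

lemma Local.mono {D D' : Finset V} {A : Set Cfg} (h : Local D A) (hD : D ⊆ D') : Local D' A :=
  fun η η' hh => h η η' fun u hu v hv => hh u (hD hu) v (hD hv)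

lemma Local.inter {D : Finset V} {A B : Set Cfg} (h : Local D A) (h' : Local D B) :
    Local D (A ∩ B) := fun η η' hh hη => ⟨h η η' hh hη.1, h' η η' hh hη.2⟩

lemma Local.union {D : Finset V} {A B : Set Cfg} (h : Local D A) (h' : Local D B) :
    Local D (A ∪ B) := fun η η' hh hη => hη.imp (h η η' hh) (h' η η' hh)

lemma Local.compl {D : Finset V} {A : Set Cfg} (h : Local D A) : Local D Aᶜ :=
  fun η η' hh hη hη' => hη (h η' η (fun u hu v hv => (hh u hu v hv).symm) hη')

lemma Local.iUnion {ι : Sort*} {D : Finset V} {A : ι → Set Cfg} (h : ∀ i, Local D (A i)) :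
    Local D (⋃ i, A i) := fun η η' hh hη => by
  obtain ⟨i, hi⟩ := Set.mem_iUnion.1 hη
  exact Set.mem_iUnion.2 ⟨i, h i η η' hh hi⟩

lemma Local.iInter {ι : Sort*} {D : Finset V} {A : ι → Set Cfg} (h : ∀ i, Local D (A i)) :
    Local D (⋂ i, A i) := fun η η' hh hη => by
  exact Set.mem_iInter.2 fun i => h i η η' hh (Set.mem_iInter.1 hη i)

lemma Inc.inter {A B : Set Cfg} (h : Inc A) (h' : Inc B) :
    Inc (A ∩ B) := fun η η' hh hη => ⟨h η η' hh hη.1, h' η η' hh hη.2⟩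

lemma Inc.union {A B : Set Cfg} (h : Inc A) (h' : Inc B) :
    Inc (A ∪ B) := fun η η' hh hη => hη.imp (h η η' hh) (h' η η' hh)

lemma Inc.iUnion {ι : Sort*} {A : ι → Set Cfg} (h : ∀ i, Inc (A i)) :
    Inc (⋃ i, A i) := fun η η' hh hη => by
  obtain ⟨i, hi⟩ := Set.mem_iUnion.1 hη
  exact Set.mem_iUnion.2 ⟨i, h i η η' hh hi⟩

lemma Inc.iInter {ι : Sort*} {A : ι → Set Cfg} (h : ∀ i, Inc (A i)) :
    Inc (⋂ i, A i) := fun η η' hh hη => by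
  exact Set.mem_iInter.2 fun i => h i η η' hh (Set.mem_iInter.1 hη i)

lemma Local.measurable {D : Finset V} {A : Set Cfg} (h : Local D A) : MeasurableSet A := by
  let ρ : Cfg → (D → D → Prop) := fun η u v => η u v
  have hρ : Measurable ρ := by
    refine measurable_pi_lambda _ fun u => measurable_pi_lambda _ fun v => ?_
    exact (measurable_pi_apply (v : V)).comp (measurable_pi_apply (u : V))
  have : A = ρ ⁻¹' (ρ '' A) := by
    ext η
    refine ⟨fun hη => ⟨η, hη, rfl⟩, ?_⟩
    rintro ⟨η', hη', he⟩
    exact h η' η (fun u hu v hv => iff_of_eq (congrFun (congrFun he ⟨u, hu⟩) ⟨v, hv⟩)) hη'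
  rw [this]
  exact hρ (Set.toFinite _).measurableSet

lemma measurableSet_edge (u v : V) : MeasurableSet {η : Cfg | η u v} := by
  have : Local {u, v} {η : Cfg | η u v} := fun η η' h hη => (h u (by simp) v (by simp)).1 hη
  exact this.measurable

lemma CI.lift_local {η η' : Cfg} {R : Set V} {u v : V} (h : ∀ a ∈ R, ∀ b ∈ R, (η a b → η' a b))
    (hc : CI η R u v) : CI η' R u v :=
  Relation.ReflTransGen.mono (fun a b hab => ⟨h a hab.2.1 b hab.2.2 hab.1, hab.2⟩) _ _ hc

/-- connection event -/
def CE (R A B : Set V) : Set Cfg := {η | ∃ u v, u ∈ A ∧ v ∈ B ∧ CI η R u v}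

lemma CE_local {D : Finset V} {R A B : Set V} (h : R ⊆ D) : Local D (CE R A B) := by
  rintro η η' hh ⟨u, v, hu, hv, hc⟩
  exact ⟨u, v, hu, hv, hc.lift_local fun a ha b hb => (hh a (h ha) b (h hb)).1⟩

lemma CE_inc (R A B : Set V) : Inc (CE R A B) := by
  rintro η η' hh ⟨u, v, hu, hv, hc⟩
  exact ⟨u, v, hu, hv, hc.lift_local fun a ha b hb => hh a b⟩

lemma Seed_local (c : V) (m : ℤ) : Local (bx c m) (Seed c m) :=
  fun η η' hh h u hu v hv hs => (hh u hu v hv).1 (h u hu v hv hs)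

lemma Seed_inc (c : V) (m : ℤ) : Inc (Seed c m) :=
  fun η η' hh h u hu v hv hs => hh u v (h u hu v hv hs)

lemma Seed.CI {c : V} {m : ℤ} {η : Cfg} (h : η ∈ Seed c m) : ∀ {u v : V}, u ∈ bx c m → v ∈ bx c m →
    CI η (bx c m) u v := by
  have key : ∀ (n : ℕ) (u v : V), u ∈ bx c m → v ∈ bx c m →
      (u.1 - v.1).natAbs + (u.2 - v.2).natAbs ≤ n → DaC.CI η (bx c m) u v := by
    intro n
    induction n with
    | zero =>
      intro u v _ _ hn
      have : u = v := Prod.ext (by omega) (by omega)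
      exact this ▸ .refl
    | succ n ih =>
      intro u v hu hv hn
      have hu' := mem_bx.1 hu
      have hv' := mem_bx.1 hv
      have step : ∀ w : V, w ∈ bx c m → SqAdj u w →
          (w.1 - v.1).natAbs + (w.2 - v.2).natAbs ≤ n → DaC.CI η (bx c m) u v := fun w hw hs hn =>
        Relation.ReflTransGen.head ⟨h u hu w hw hs, hu, hw⟩ (ih w v hw hv hn)
      rcases lt_trichotomy u.1 v.1 with h1 | h1 | h1
      · refine step (u.1 + 1, u.2) (mem_bx.2 (by simp only; omega)) (by simp [SqAdj]) (by simp only; omega)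
      · rcases lt_trichotomy u.2 v.2 with h2 | h2 | h2
        · refine step (u.1, u.2 + 1) (mem_bx.2 (by simp only; omega)) (by simp [SqAdj]) (by simp only; omega)
        · have : u = v := Prod.ext h1 h2
          exact this ▸ .refl
        · refine step (u.1, u.2 - 1) (mem_bx.2 (by simp only; omega)) (by simp [SqAdj]) (by simp only; omega)
      · refine step (u.1 - 1, u.2) (mem_bx.2 (by simp only; omega)) (by simp [SqAdj]) (by simp only; omega)
  exact fun {u v} hu hv => key _ _ _ hu hv le_rfl

lemma CI.of_pull {g : V → V} {η : Cfg} {R R' : Set V} {u v : V} (h : CI (pull g η) R u v)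
    (hg : ∀ x ∈ R, g x ∈ R') : CI η R' (g u) (g v) :=
  Relation.ReflTransGen.lift g (fun a b hab => ⟨hab.1, hg a hab.2.1, hg b hab.2.2⟩) _ _ h

/-- translations, reflections, swap -/
def tr (w : V) : V ≃ V := Equiv.addRight w
def rfx (c : ℤ) : V ≃ V := ⟨fun v => (c - v.1, v.2), fun v => (c - v.1, v.2), fun v => by simp, fun v => by simp⟩
def rfy : V ≃ V := ⟨fun v => (v.1, -v.2), fun v => (v.1, -v.2), fun v => by simp, fun v => by simp⟩
def swp : V ≃ V := ⟨fun v => (v.2, v.1), fun v => (v.2, v.1), fun v => rfl, fun v => rfl⟩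

def Iso (g : V ≃ V) : Prop := ∀ u v, sqd (g u) (g v) = sqd u v
lemma iso_tr (w : V) : Iso (tr w) := fun u v => by simp [sqd, tr]
lemma iso_rfx (c : ℤ) : Iso (rfx c) := fun u v => by simp [sqd, rfx]; ring
lemma iso_rfy : Iso rfy := fun u v => by simp [sqd, rfy]; ring
lemma iso_swp : Iso swp := fun u v => by simp [sqd, swp]; ring
lemma Iso.trans {g h : V ≃ V} (hg : Iso g) (hh : Iso h) : Iso (g.trans h) := fun u v => by
  simp [hh _ _, hg u v]
lemma tr_1 (w v : V) : (tr w v).1 = v.1 + w.1 := rfl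
lemma tr_2 (w v : V) : (tr w v).2 = v.2 + w.2 := rfl
lemma rfx_1 (c : ℤ) (v : V) : (rfx c v).1 = c - v.1 := rfl
lemma rfx_2 (c : ℤ) (v : V) : (rfx c v).2 = v.2 := rfl
lemma rfy_1 (v : V) : (rfy v).1 = v.1 := rfl
lemma rfy_2 (v : V) : (rfy v).2 = -v.2 := rfl
lemma swp_1 (v : V) : (swp v).1 = v.2 := rfl
lemma swp_2 (v : V) : (swp v).2 = v.1 := rfl

lemma Iso.sq {g : V ≃ V} (hg : Iso g) (u v : V) : SqAdj (g u) (g v) ↔ SqAdj u v := by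
  have := hg u v; unfold sqd at this; unfold SqAdj; rw [this]
lemma Iso.star {g : V ≃ V} (hg : Iso g) (u v : V) : StarAdj (g u) (g v) ↔ StarAdj u v := by
  have := hg u v; unfold sqd at this; unfold StarAdj; rw [this]
lemma Iso.symm {g : V ≃ V} (hg : Iso g) : Iso g.symm := fun u v => by
  have := hg (g.symm u) (g.symm v); simpa using this.symm

end basic

namespace IsModel
variable {μ : Measure Cfg} {e : ℕ → ℝ} (hm : IsModel μ e)
include hm

lemma mono {A B : Set Cfg} (h : ∀ η, GoodCfg η → η ∈ A → η ∈ B) : μ.real A ≤ μ.real B := by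
  haveI := hm.prob
  refine ENNReal.toReal_mono (measure_ne_top _ _) (measure_mono_ae ?_)
  filter_upwards [hm.good] with η hη hA using h η hη hA

lemma le_one (A : Set Cfg) : μ.real A ≤ 1 := by
  haveI := hm.prob
  exact measureReal_le_one

lemma le_pull {D : Finset V} {A B : Set Cfg} (hA : Local D A) {g : V ≃ V} (hg : Iso g)
    (h : ∀ η, GoodCfg η → pull g η ∈ A → η ∈ B) : μ.real A ≤ μ.real B := by
  rw [← hm.inv g hg D A hA]
  exact hm.mono h

lemma compl {D : Finset V} {A : Set Cfg} (hA : Local D A) : μ.real Aᶜ = 1 - μ.real A := by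
  haveI := hm.prob
  exact probReal_compl_eq_one_sub hA.measurable

lemma fkg_union {D : Finset V} {A B : Set Cfg} (hA : Local D A) (hB : Local D B) (hA' : Inc A)
    (hB' : Inc B) : (1 - μ.real A) * (1 - μ.real B) ≤ 1 - μ.real (A ∪ B) := by
  haveI := hm.prob
  have h1 := hm.fkg D A B hA hB hA' hB'
  have h2 := measureReal_union_add_inter (μ := μ) (s := A) hB.measurable
  nlinarith

lemma fkg_iUnion {ι : Type*} {D : Finset V} (s : Finset ι) {A : ι → Set Cfg}
    (hA : ∀ i, Local D (A i)) (hA' : ∀ i, Inc (A i)) :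
    ∏ i ∈ s, (1 - μ.real (A i)) ≤ 1 - μ.real (⋃ i ∈ s, A i) := by
  classical
  haveI := hm.prob
  induction s using Finset.induction_on with
  | empty => simp
  | insert i s hi ih =>
    rw [Finset.prod_insert hi, Finset.set_biUnion_insert]
    refine le_trans ?_ (hm.fkg_union (hA i) (Local.iUnion fun i => Local.iUnion fun _ => hA i)
      (hA' i) (Inc.iUnion fun i => Inc.iUnion fun _ => hA' i))
    exact mul_le_mul_of_nonneg_left ih (by have := hm.le_one (A i); linarith)

lemma fkg_iInter {ι : Type*} {D : Finset V} (s : Finset ι) {A : ι → Set Cfg}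
    (hA : ∀ i, Local D (A i)) (hA' : ∀ i, Inc (A i)) :
    ∏ i ∈ s, μ.real (A i) ≤ μ.real (⋂ i ∈ s, A i) := by
  classical
  haveI := hm.prob
  induction s using Finset.induction_on with
  | empty => simp
  | insert i s hi ih =>
    rw [Finset.prod_insert hi, Finset.set_biInter_insert]
    refine le_trans ?_ (hm.fkg D _ _ (hA i) (Local.iInter fun i => Local.iInter fun _ => hA i)
      (hA' i) (Inc.iInter fun i => Inc.iInter fun _ => hA' i))
    exact mul_le_mul_of_nonneg_left ih measureReal_nonneg

/-- square root trick -/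
lemma sqrt_trick {D : Finset V} {n : ℕ} {A : Fin n → Set Cfg} {B : Set Cfg} {κ : ℝ} (hκ : 0 ≤ κ)
    (hA : ∀ i, Local D (A i)) (hA' : ∀ i, Inc (A i)) (hB : 1 - κ ^ n ≤ μ.real B) (hn : n ≠ 0)
    (h : ∀ η, GoodCfg η → η ∈ B → ∃ i, η ∈ A i) : ∃ i, 1 - κ ≤ μ.real (A i) := by
  by_contra hcon
  push Not at hcon
  have h1 := hm.fkg_iUnion Finset.univ hA hA'
  have h2 : μ.real B ≤ μ.real (⋃ i ∈ Finset.univ, A i) := hm.mono fun η hg hη => by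
    obtain ⟨i, hi⟩ := h η hg hη
    simp only [Finset.mem_univ, Set.iUnion_true, Set.mem_iUnion]
    exact ⟨i, hi⟩
  have h3 : κ ^ n < ∏ i : Fin n, (1 - μ.real (A i)) := by
    calc κ ^ n = ∏ i : Fin n, κ := by simp
      _ < _ := by
        rcases hκ.eq_or_lt with h0 | h0
        · rw [← h0]; simp only [Finset.prod_const, Finset.card_univ, Fintype.card_fin, zero_pow hn]
          exact Finset.prod_pos fun i _ => by have := hcon i; linarith
        · haveI : Nonempty (Fin n) := ⟨⟨0, Nat.pos_of_ne_zero hn⟩⟩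
          exact Finset.prod_lt_prod_of_nonempty (fun _ _ => h0) (fun i _ => by have := hcon i; linarith)
            Finset.univ_nonempty
  linarith

end IsModel
end DaC

namespace DaC

lemma seed_lemma {Ω : Type*} [MeasurableSpace Ω] (μ : Measure Ω) [IsProbabilityMeasure μ] {N : ℕ}
    (hN : 0 < N) {A B : Fin N → Set Ω} (hA : ∀ i, MeasurableSet (A i)) (hB : ∀ i, MeasurableSet (B i))
    {v η' β : ℝ} (hv : 0 < v) (hη : 0 ≤ η') (h1 : ∀ i, μ.real (A i) = v)
    (h2 : ∀ i j, i ≠ j → μ.real (A i ∩ A j) ≤ v ^ 2 + η')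
    (h3 : ∀ i, μ.real (A i ∩ B i) ≤ β * v) :
    μ.real {ω | ∀ i, ω ∈ A i → ω ∈ B i} ≤ 4 / (N * v) + 4 * η' / v ^ 2 + 2 * β := by
  classical
  set I : Set Ω → Ω → ℝ := fun s => s.indicator 1 with hI
  have Iint : ∀ s, MeasurableSet s → Integrable (I s) μ := fun s hs =>
    (integrable_const (1 : ℝ)).indicator hs
  have Ival : ∀ s, MeasurableSet s → ∫ ω, I s ω ∂μ = μ.real s := fun s hs => integral_indicator_one hs
  set G := {ω | ∀ i, ω ∈ A i → ω ∈ B i} with hG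
  have hGm : MeasurableSet G := by
    have : G = ⋂ i, ((A i)ᶜ ∪ B i) := by
      ext ω; simp [hG, imp_iff_not_or]
    rw [this]
    exact MeasurableSet.iInter fun i => (hA i).compl.union (hB i)
  have hN' : (0 : ℝ) < N := by exact_mod_cast hN
  set c := (N : ℝ) * v with hc
  have hcp : 0 < c := by positivity
  set S : Ω → ℝ := fun ω => ∑ i, I (A i) ω with hS
  set T : Ω → ℝ := fun ω => ∑ i, I (A i ∩ B i) ω with hT
  have hSS : ∀ ω, (S ω) ^ 2 = ∑ i, ∑ j, I (A i ∩ A j) ω := fun ω => by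
    rw [sq, hS]; simp only [Finset.sum_mul_sum]
    refine Finset.sum_congr rfl fun i _ => Finset.sum_congr rfl fun j _ => ?_
    simp only [hI, Set.inter_indicator_one]; rfl
  have hpt : ∀ ω, I G ω ≤ 4 / c ^ 2 * ((∑ i, ∑ j, I (A i ∩ A j) ω) - 2 * c * S ω + c ^ 2) + 2 / c * T ω := by
    intro ω
    rw [← hSS]
    have hT0 : 0 ≤ T ω := Finset.sum_nonneg fun i _ => Set.indicator_nonneg (by simp) _
    have e1 : (S ω) ^ 2 - 2 * c * S ω + c ^ 2 = (S ω - c) ^ 2 := by ring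
    rw [e1]
    by_cases hω : ω ∈ G
    · have hIG : I G ω = 1 := by simp [hI, hω]
      have hST : S ω = T ω := Finset.sum_congr rfl fun i _ => by
        simp only [hI, Set.indicator_apply, Set.mem_inter_iff]
        by_cases h : ω ∈ A i
        · simp [h, hω i h]
        · simp [h]
      rw [hIG]
      by_cases h : c / 2 ≤ T ω
      · have : 1 ≤ 2 / c * T ω := by
          rw [div_mul_eq_mul_div, le_div_iff₀ hcp]; linarith
        have : 0 ≤ 4 / c ^ 2 * (S ω - c) ^ 2 := by positivity
        linarith
      · push Not at h
        have : 1 ≤ 4 / c ^ 2 * (S ω - c) ^ 2 := by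
          rw [div_mul_eq_mul_div, le_div_iff₀ (by positivity)]
          nlinarith
        have : 0 ≤ 2 / c * T ω := by positivity
        linarith
    · have hIG : I G ω = 0 := by simp [hI, hω]
      rw [hIG]; positivity
  have hAA : ∀ i j, MeasurableSet (A i ∩ A j) := fun i j => (hA i).inter (hA j)
  have i1 : Integrable (fun ω => ∑ i, ∑ j, I (A i ∩ A j) ω) μ :=
    integrable_finset_sum _ fun i _ => integrable_finset_sum _ fun j _ => Iint _ (hAA i j)
  have i2 : Integrable S μ := integrable_finset_sum _ fun i _ => Iint _ (hA i)
  have i3 : Integrable T μ := integrable_finset_sum _ fun i _ => Iint _ ((hA i).inter (hB i))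
  have j0 : Integrable (fun ω => (∑ i, ∑ j, I (A i ∩ A j) ω) - 2 * c * S ω) μ :=
    i1.sub (i2.const_mul (2 * c))
  have j1 : Integrable (fun ω => (∑ i, ∑ j, I (A i ∩ A j) ω) - 2 * c * S ω + c ^ 2) μ :=
    j0.add (integrable_const (c ^ 2))
  have j2 : Integrable (fun ω => 4 / c ^ 2 * ((∑ i, ∑ j, I (A i ∩ A j) ω) - 2 * c * S ω + c ^ 2)) μ :=
    j1.const_mul _
  have hIneq := integral_mono (Iint G hGm) (j2.add (i3.const_mul (2 / c))) hpt
  rw [Ival G hGm] at hIneq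
  simp only [Pi.add_apply] at hIneq
  rw [integral_add j2 (i3.const_mul (2 / c)), integral_const_mul, integral_const_mul,
    integral_add j0 (integrable_const (c ^ 2)),
    integral_sub i1 (i2.const_mul (2 * c)), integral_const_mul] at hIneq
  have v2 : ∫ ω, S ω ∂μ = c := by
    rw [hS, integral_finset_sum _ fun i _ => Iint _ (hA i)]
    simp only [Ival _ (hA _), h1]; simp [hc]
  have v3 : ∫ ω, T ω ∂μ ≤ N * (β * v) := by
    rw [hT, integral_finset_sum _ fun i _ => Iint _ ((hA i).inter (hB i))]
    simp only [Ival _ ((hA _).inter (hB _))]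
    exact (Finset.sum_le_sum fun i _ => h3 i).trans (by simp)
  have v1 : ∫ ω, ∑ i, ∑ j, I (A i ∩ A j) ω ∂μ ≤ N * v + N ^ 2 * (v ^ 2 + η') := by
    rw [integral_finset_sum _ fun i _ => integrable_finset_sum _ fun j _ => Iint _ (hAA i j)]
    have : ∀ i ∈ (Finset.univ : Finset (Fin N)), ∫ ω, ∑ j, I (A i ∩ A j) ω ∂μ ≤ v + N * (v ^ 2 + η') := by
      intro i _
      rw [integral_finset_sum _ fun j _ => Iint _ (hAA i j)]
      simp only [Ival _ (hAA _ _)]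
      have : ∀ j ∈ (Finset.univ : Finset (Fin N)), μ.real (A i ∩ A j) ≤ (if i = j then v else 0) + (v ^ 2 + η') := by
        intro j _
        split_ifs with h
        · subst h; rw [Set.inter_self, h1]; nlinarith
        · have := h2 i j h; linarith
      refine (Finset.sum_le_sum this).trans ?_
      rw [Finset.sum_add_distrib]; simp; linarith
    refine (Finset.sum_le_sum this).trans ?_
    simp; nlinarith
  rw [v2] at hIneq
  simp only [integral_const, probReal_univ, smul_eq_mul, one_mul] at hIneq
  refine hIneq.trans ?_
  have b1 : 4 / c ^ 2 * ((∫ ω, ∑ i, ∑ j, I (A i ∩ A j) ω ∂μ) - 2 * c * c + c ^ 2)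
      ≤ 4 / c ^ 2 * (c + N ^ 2 * η') := by
    refine mul_le_mul_of_nonneg_left ?_ (by positivity)
    rw [hc] at *; nlinarith
  have b2 : 2 / c * ∫ ω, T ω ∂μ ≤ 2 / c * (N * (β * v)) := mul_le_mul_of_nonneg_left v3 (by positivity)
  refine (add_le_add b1 b2).trans (le_of_eq ?_)
  rw [hc]; field_simp
end DaC

namespace DaC

lemma GoodCfg.pull {η : Cfg} (h : GoodCfg η) {g : V ≃ V} (hg : Iso g) : GoodCfg (pull g η) where
  symm := fun a b hab => h.symm _ _ hab
  star := fun a b hab => (hg.star a b).1 (h.star _ _ hab)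
  corner := fun a b c d hab hn h1 h2 hcd => h.corner _ _ _ _ hab (fun h' => hn ((hg.sq a b).1 h'))
    ((hg.sq _ _).2 h1) ((hg.sq _ _).2 h2) hcd

lemma Local.pull {D : Finset V} {A : Set Cfg} (h : Local D A) [DecidableEq V] (g : V ≃ V) :
    Local (D.image g) (DaC.pull g ⁻¹' A) := fun η η' hh hη =>
  h (DaC.pull g η) (DaC.pull g η') (fun u hu v hv => hh _ (Finset.mem_image_of_mem g hu) _ (Finset.mem_image_of_mem g hv)) hη

lemma Inc.pull {A : Set Cfg} (h : Inc A) (g : V → V) : Inc (DaC.pull g ⁻¹' A) :=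
  fun η η' hh hη => h (DaC.pull g η) (DaC.pull g η') (fun u v => hh _ _) hη

def supN (v : V) : ℤ := max (max v.1 (-v.1)) (max v.2 (-v.2))

lemma supN_le {v : V} {n : ℤ} : supN v ≤ n ↔ v ∈ bx 0 n := by
  rw [mem_bx]; unfold supN; simp only [Prod.fst_zero, Prod.snd_zero]; omega

lemma supN_step {η : Cfg} (h : GoodCfg η) : ∀ a b, η a b → supN b ≤ supN a + 1 := fun a b hab => by
  have := (h.star a b hab).near
  unfold Near at this; unfold supN; omega

def sph (n : ℤ) : Set V := {v | supN v = n}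

/-- one-arm to distance n -/
def Arm (n : ℤ) : Set Cfg := CE (bx 0 n) {0} (sph n)

lemma arm_exit {η : Cfg} (h : GoodCfg η) {R : Set V} {A : Set V} {u v : V} {n : ℤ} (hA : u ∈ A)
    (hu : u ∈ bx 0 n) (hv : n ≤ supN v) (hc : CI η R u v) : η ∈ CE (bx 0 n) A (sph n) := by
  obtain ⟨w, hw, hc'⟩ := hc.exit' (supN_step h) (supN_le.2 hu) hv
  exact ⟨u, w, hA, hw, hc'.mono fun x hx => supN_le.1 hx.2⟩

namespace IsModel
variable {μ : Measure Cfg} {e : ℕ → ℝ} (hm : IsModel μ e)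
include hm

lemma seeds_many {A B : Set Cfg} {D D1 : Finset V} (hA : Local D A) (hB : Local D1 B) {N k : ℕ}
    (hN : 0 < N) {L : ℤ} (hfar : ∀ u ∈ D, ∀ v ∈ D, ∀ i j : ℤ, 0 ≤ i → i < N → 0 ≤ j → j < N → i < j →
      (k : ℤ) ≤ (v.1 + j * L) - (u.1 + i * L) ∨ (k : ℤ) ≤ (u.1 + i * L) - (v.1 + j * L))
    {β : ℝ} (hv : 0 < μ.real A) (h3 : μ.real (A ∩ B) ≤ β * μ.real A) :
    μ.real {η | ∀ i : Fin N, pull (tr ((i : ℤ) * L, 0)) η ∈ A → pull (tr ((i : ℤ) * L, 0)) η ∈ B}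
      ≤ 4 / (N * μ.real A) + 4 * (2 * D.card * e k) / μ.real A ^ 2 + 2 * β := by
  classical
  haveI := hm.prob
  have key : ∀ i j : Fin N, (i : ℤ) < j → μ.real (pull (tr ((i : ℤ) * L, 0)) ⁻¹' A ∩ pull (tr ((j : ℤ) * L, 0)) ⁻¹' A)
      ≤ μ.real A ^ 2 + 2 * D.card * e k := by
    intro i j hij
    have hf : Far k (D.image (tr ((i : ℤ) * L, 0))) (D.image (tr ((j : ℤ) * L, 0))) := by
      intro u0 hu0 v0 hv0
      obtain ⟨u, hu, rfl⟩ := Finset.mem_image.1 hu0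
      obtain ⟨v, hv, rfl⟩ := Finset.mem_image.1 hv0
      have := hfar u hu v hv i j (by omega) (by omega) (by omega) (by omega) hij
      simp only [tr_1, tr_2]
      omega
    have := hm.mix k _ _ _ _ (hA.pull (tr ((i : ℤ) * L, 0))) (hA.pull (tr ((j : ℤ) * L, 0))) hf
    rw [hm.inv _ (iso_tr _) _ _ hA, hm.inv _ (iso_tr _) _ _ hA] at this
    refine this.trans ?_
    have c1 : ((D.image (tr ((i : ℤ) * L, 0))).card : ℝ) ≤ D.card := by exact_mod_cast Finset.card_image_le
    have c2 : ((D.image (tr ((j : ℤ) * L, 0))).card : ℝ) ≤ D.card := by exact_mod_cast Finset.card_image_le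
    have := mul_le_mul_of_nonneg_right (add_le_add c1 c2) (hm.e_nonneg k)
    nlinarith
  refine seed_lemma μ hN (A := fun i : Fin N => pull (tr ((i : ℤ) * L, 0)) ⁻¹' A)
    (B := fun i : Fin N => pull (tr ((i : ℤ) * L, 0)) ⁻¹' B) (fun i => (hA.pull _).measurable)
    (fun i => (hB.pull _).measurable) hv (by have := hm.e_nonneg k; positivity)
    (fun i => hm.inv _ (iso_tr _) _ _ hA) ?_ ?_
  · intro i j hij
    have : (i : ℤ) ≠ j := fun h => hij (Fin.ext (by omega))
    rcases lt_or_gt_of_ne this with h | h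
    · exact key i j h
    · have := key j i h
      rwa [Set.inter_comm]
  · intro i
    have := hm.inv (tr ((i : ℤ) * L, 0)) (iso_tr _) (D ∪ D1) (A ∩ B)
      ((hA.mono Finset.subset_union_left).inter (hB.mono Finset.subset_union_right))
    rw [Set.preimage_inter] at this
    exact this.le.trans h3

lemma arm_local (n : ℤ) : Local (bx 0 n) (Arm n) := CE_local (le_refl _)

lemma arm_anti {m n : ℤ} (h0 : 0 ≤ m) (h : m ≤ n) {η : Cfg} (hη : GoodCfg η) (ha : η ∈ Arm n) :
    η ∈ Arm m := by
  obtain ⟨u, v, hu, hv, hc⟩ := ha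
  have hv' : supN v = n := hv
  exact arm_exit hη hu (by rw [Set.mem_singleton_iff.1 hu, mem_bx]; simp [h0]) (by omega) hc

lemma armA {θ : ℝ} (hθ : 0 < θ) (h : ∀ n : ℕ, θ ≤ μ.real (Arm n)) {δ : ℝ} (hδ : 0 < δ) :
    ∃ m : ℕ, ∀ n : ℕ, m < n → 1 - δ ≤ μ.real (CE (bx 0 n) (bx 0 m) (sph n)) := by
  classical
  haveI := hm.prob
  set L := ⨅ n : ℕ, μ.real (Arm n) with hL
  have hbd : BddBelow (Set.range fun n : ℕ => μ.real (Arm n)) := ⟨θ, by rintro _ ⟨n, rfl⟩; exact h n⟩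
  obtain ⟨l, hl⟩ : ∃ l : ℕ, μ.real (Arm l) < L + δ / 6 * θ := exists_lt_of_ciInf_lt (by rw [← hL]; linarith [mul_pos (by positivity : 0 < δ / 6) hθ])
  have hLn : ∀ n : ℕ, L ≤ μ.real (Arm n) := fun n => ciInf_le hbd n
  obtain ⟨N, hN⟩ := exists_nat_gt (4 / θ / (δ / 3))
  have hN0 : 0 < N := by
    have : (0 : ℝ) < N := lt_of_le_of_lt (by positivity) hN
    exact_mod_cast this
  have hN' : (0 : ℝ) < N := by exact_mod_cast hN0
  obtain ⟨k, hk⟩ : ∃ k, 4 * (2 * ((bx 0 l).card : ℝ) * e k) / θ ^ 2 < δ / 3 := by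
    have ht : Filter.Tendsto (fun k => 4 * (2 * ((bx 0 l).card : ℝ) * e k) / θ ^ 2) Filter.atTop (nhds 0) := by
      have := ((hm.e_lim.const_mul (2 * ((bx 0 l).card : ℝ))).const_mul 4).div_const (θ ^ 2)
      simpa using this
    exact (ht.eventually_lt_const (by positivity)).exists
  set K : ℕ := k + 2 * l with hK
  refine ⟨N * K, fun n hn => ?_⟩
  have hn' : (N : ℤ) * K < n := by exact_mod_cast hn
  set n' : ℕ := n + N * K + l with hn'd
  have hv := h l
  have hAB : μ.real (Arm l ∩ (Arm n')ᶜ) ≤ δ / 6 * μ.real (Arm l) := by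
    have h1 : μ.real (Arm l ∩ (Arm n')ᶜ) + μ.real (Arm n') ≤ μ.real (Arm l) := by
      have := measureReal_inter_add_diff (μ := μ) (s := Arm l) (arm_local hm n').measurable
      rw [Set.diff_eq] at this
      have h2 : μ.real (Arm n') ≤ μ.real (Arm l ∩ Arm n') := hm.mono fun η hg hη =>
        ⟨arm_anti hm (by omega) (by omega) hg hη, hη⟩
      linarith
    have := hLn n'
    have := mul_le_mul_of_nonneg_left hv (by positivity : 0 ≤ δ / 6)
    linarith
  have main := hm.seeds_many (arm_local hm l) (arm_local hm n').compl (N := N) (k := k) hN0 (L := K)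
    (by
      intro u hu v hv i j hi hi' hj hj' hij
      left
      have hu := mem_bx.1 hu
      have hv := mem_bx.1 hv
      have : (K : ℤ) ≤ (j - i) * K := by nlinarith
      simp only [Prod.fst_zero, Prod.snd_zero] at hu hv
      nlinarith) (lt_of_lt_of_le hθ hv) hAB
  have hcov : 1 - μ.real (CE (bx 0 n) (bx 0 (N * K : ℕ)) (sph n)) ≤
      μ.real {η | ∀ i : Fin N, pull (tr ((i : ℤ) * K, 0)) η ∈ Arm l → pull (tr ((i : ℤ) * K, 0)) η ∈ (Arm n')ᶜ} := by
    rw [← hm.compl (CE_local (le_refl _))]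
    refine hm.mono fun η hg hη i hi hi' => hη ?_
    obtain ⟨u, v, hu, hv, hc⟩ := hi'
    have hc' := hc.of_pull (R' := Set.univ) (fun _ _ => trivial)
    have hu0 : u = 0 := hu
    subst hu0
    have hiK : (i : ℤ) * K ≤ N * K := mul_le_mul_of_nonneg_right (by omega) (by omega)
    have hiK0 : 0 ≤ (i : ℤ) * K := by positivity
    have hnd : (n' : ℤ) = n + N * K + l := by rw [hn'd]; push_cast; ring
    refine arm_exit hg (u := tr ((i : ℤ) * K, 0) 0) (v := tr ((i : ℤ) * K, 0) v) ?_ ?_ ?_ hc'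
    · refine Finset.mem_coe.2 (mem_bx.2 ?_)
      simp only [tr_1, tr_2, Prod.fst_zero, Prod.snd_zero]
      push_cast
      refine ⟨?_, ?_, ?_, ?_⟩ <;> nlinarith
    · refine (mem_bx.2 ?_)
      simp only [tr_1, tr_2, Prod.fst_zero, Prod.snd_zero]
      refine ⟨?_, ?_, ?_, ?_⟩ <;> nlinarith
    · have hv' : supN v = n' := hv
      unfold supN at *
      simp only [tr_1, tr_2]
      generalize (i : ℤ) * K = x at *
      generalize (N : ℤ) * K = y at *
      omega
  have hv0 : 0 < μ.real (Arm l) := lt_of_lt_of_le hθ hv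
  have b1 : 4 / (N * μ.real (Arm l)) ≤ δ / 3 := by
    rw [div_lt_iff₀ (by positivity), div_lt_iff₀ hθ] at hN
    rw [div_le_iff₀ (by positivity)]
    have := mul_le_mul_of_nonneg_left hv (by positivity : 0 ≤ δ / 3 * N)
    nlinarith
  have b2 : 4 * (2 * ((bx 0 l).card : ℝ) * e k) / μ.real (Arm l) ^ 2 ≤ δ / 3 := by
    refine le_trans ?_ hk.le
    have := hm.e_nonneg k
    gcongr
  linarith

end IsModel
end DaC

namespace DaC

def HH (m n a b : ℤ) : Set Cfg := CE (bx 0 n) (bx 0 m) {v | v.1 = n ∧ a ≤ v.2 ∧ v.2 ≤ b}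

lemma HH_local (m n a b : ℤ) : Local (bx 0 n) (HH m n a b) := CE_local (le_refl _)
lemma HH_inc (m n a b : ℤ) : Inc (HH m n a b) := CE_inc _ _ _

namespace IsModel
variable {μ : Measure Cfg} {e : ℕ → ℝ} (hm : IsModel μ e)
include hm

lemma sqrt_CE {D : Finset V} {R A S S' : Set V} (hR : R ⊆ D) {g : V ≃ V} (hg : Iso g)
    (hgg : ∀ x, g (g x) = x) (hgR : ∀ x ∈ R, g x ∈ R) (hgA : ∀ x ∈ A, g x ∈ A)
    (hS : ∀ v ∈ S, v ∈ S' ∨ g v ∈ S') {κ : ℝ} (hκ : 0 ≤ κ) (h : 1 - κ ^ 2 ≤ μ.real (CE R A S)) :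
    1 - κ ≤ μ.real (CE R A S') := by
  classical
  have hloc := CE_local (A := A) (B := S') hR
  obtain ⟨i, hi⟩ := hm.sqrt_trick (D := D ∪ D.image g) (n := 2)
    (A := fun i => if i = 0 then CE R A S' else pull g ⁻¹' CE R A S') (B := CE R A S) hκ
    (fun i => by
      split_ifs
      · exact hloc.mono Finset.subset_union_left
      · exact (hloc.pull g).mono Finset.subset_union_right)
    (fun i => by
      split_ifs
      · exact CE_inc _ _ _
      · exact (CE_inc _ _ _).pull _) h (by norm_num) (by
      rintro η hη ⟨u, v, hu, hv, hc⟩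
      rcases hS v hv with h | h
      · exact ⟨0, by simpa using ⟨u, v, hu, h, hc⟩⟩
      · refine ⟨1, ?_⟩
        simp only [one_ne_zero, if_false]
        refine ⟨g u, g v, hgA u hu, h, ?_⟩
        have e1 : η = pull g (pull g η) := by
          funext a b; simp [pull, hgg]
        rw [e1] at hc
        exact hc.of_pull hgR)
  split_ifs at hi
  · exact hi
  · rwa [hm.inv g hg _ _ hloc] at hi

lemma armB {m : ℕ} {κ : ℝ} (hκ : 0 < κ) (hκ1 : κ ≤ 1) (hiso : κ < μ.real {η | ∀ v, StarAdj 0 v → ¬ η 0 v}) {n : ℕ}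
    (hmn : m < n) (h : 1 - (((κ ^ 2) ^ 2) ^ 2) ^ 2 ≤ μ.real (CE (bx 0 n) (bx 0 m) (sph n))) :
    ∃ α : ℕ, 1 ≤ α ∧ α ≤ n ∧ 1 - κ ≤ μ.real (HH m n 0 α) ∧ 1 - κ ≤ μ.real (HH m n α n) := by
  classical
  haveI := hm.prob
  have bxs : ∀ (k : ℤ) (x : V), x ∈ bx 0 k → swp x ∈ bx 0 k := fun k x hx => by
    rw [mem_bx] at *; simp only [swp_1, swp_2, Prod.fst_zero, Prod.snd_zero] at *; omega
  have bxx : ∀ (k : ℤ) (x : V), x ∈ bx 0 k → rfx 0 x ∈ bx 0 k := fun k x hx => by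
    rw [mem_bx] at *; simp only [rfx_1, rfx_2, Prod.fst_zero, Prod.snd_zero] at *; omega
  have bxy : ∀ (k : ℤ) (x : V), x ∈ bx 0 k → rfy x ∈ bx 0 k := fun k x hx => by
    rw [mem_bx] at *; simp only [rfy_1, rfy_2, Prod.fst_zero, Prod.snd_zero] at *; omega
  have s1 := hm.sqrt_CE (le_refl _) (S' := {v | supN v ≤ n ∧ (v.1 = n ∨ v.1 = -n)}) iso_swp (fun x => rfl) (fun x hx => bxs n x hx) (fun x hx => bxs m x hx)
    (fun v hv => by
      have hv' : supN v = n := hv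
      simp only [Set.mem_ofPred_eq, swp_1, swp_2]
      unfold supN at *; simp only [swp_1, swp_2]; omega) (by positivity) h
  have s2 := hm.sqrt_CE (le_refl _) (S' := {v | supN v ≤ n ∧ (v.1 = n)}) (iso_rfx 0) (fun x => by simp [rfx]) (fun x hx => bxx n x hx) (fun x hx => bxx m x hx)
    (fun v hv => by
      obtain ⟨hv1, hv2⟩ := hv
      simp only [Set.mem_ofPred_eq, rfx_1, rfx_2]
      unfold supN at *; simp only [rfx_1, rfx_2]; omega) (by positivity) s1
  have s3 := hm.sqrt_CE (le_refl _) (S' := {v | v.1 = n ∧ 0 ≤ v.2 ∧ v.2 ≤ (n : ℤ)}) iso_rfy (fun x => by simp [rfy]) (fun x hx => bxy n x hx) (fun x hx => bxy m x hx)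
    (fun v hv => by
      obtain ⟨hv1, hv2⟩ := hv
      simp only [Set.mem_ofPred_eq, rfy_1, rfy_2]
      unfold supN at *; omega) (by positivity) s2
  have hex : ∃ α : ℕ, 1 - κ ≤ μ.real (HH m n 0 α) := ⟨n, le_trans (by nlinarith) s3⟩
  have hmin : ∀ b < Nat.find hex, ¬ 1 - κ ≤ μ.real (HH m n 0 b) := fun b hb => Nat.find_min hex hb
  have hspec := Nat.find_spec hex
  have hle : Nat.find hex ≤ n := Nat.find_min' hex (le_trans (by nlinarith) s3)
  set α := Nat.find hex
  have h1 : 1 ≤ α := by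
    by_contra h0
    have h0 : α = 0 := by omega
    rw [h0] at hspec
    have hI : Local (bx 0 1) {η : Cfg | ∀ v, StarAdj 0 v → ¬ η 0 v} := by
      intro η η' hh hη v hv hv'
      refine hη v hv ((hh 0 ?_ v ?_).2 hv') <;> rw [mem_bx]
      · simp
      · have := hv.near; unfold Near at this; simp only [Prod.fst_zero, Prod.snd_zero] at *; omega
    have := hm.compl hI
    have h2 : μ.real (HH m n 0 (0 : ℕ)) ≤ μ.real {η : Cfg | ∀ v, StarAdj 0 v → ¬ η 0 v}ᶜ := by
      refine hm.le_pull (HH_local _ _ _ _) (iso_tr (-(n : ℤ), 0)) ?_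
      rintro η hη ⟨u, v, hu, ⟨hv1, hv2, hv3⟩, hc⟩ hi
      have hne : u ≠ v := fun h => by
        have := mem_bx.1 (Finset.mem_coe.1 hu); subst h; simp only [Prod.fst_zero, Prod.snd_zero] at *; omega
      rcases hc.cases_tail with h | ⟨w, _, hw⟩
      · exact hne h.symm
      · have hv0 : tr (-(n : ℤ), 0) v = 0 := by
          apply Prod.ext <;> simp only [tr_1, tr_2, Prod.fst_zero, Prod.snd_zero] <;> push_cast at * <;> omega
        have hw1 : η (tr (-(n : ℤ), 0) w) (tr (-(n : ℤ), 0) v) := hw.1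
        rw [hv0] at hw1
        have := hη.symm _ _ hw1
        exact hi _ (hη.star _ _ this) this
    linarith
  refine ⟨α, h1, hle, hspec, ?_⟩
  have h2 := hmin (α - 1) (by omega)
  push Not at h2
  have hu := hm.fkg_union (HH_local m n 0 (α - 1 : ℕ)) (HH_local m n α n) (HH_inc _ _ _ _) (HH_inc _ _ _ _)
  have hu2 : μ.real (CE (bx 0 n) (bx 0 m) {v | v.1 = n ∧ 0 ≤ v.2 ∧ v.2 ≤ (n : ℤ)}) ≤
      μ.real (HH m n 0 (α - 1 : ℕ) ∪ HH m n α n) := by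
    refine hm.mono ?_
    rintro η hη ⟨u, v, hu, ⟨hv1, hv2, hv3⟩, hc⟩
    rcases le_or_gt (α : ℤ) v.2 with h | h
    · exact Or.inr ⟨u, v, hu, ⟨hv1, h, hv3⟩, hc⟩
    · exact Or.inl ⟨u, v, hu, ⟨hv1, hv2, by omega⟩, hc⟩
  by_contra h3
  push Not at h3
  nlinarith

end IsModel

def Slab (c d : ℤ) : Set V := {x | c ≤ x.2 ∧ x.2 ≤ d}

lemma Seed_pull {η : Cfg} {c c' : V} {m : ℤ} {g : V ≃ V} (hg : Iso g)
    (hc : ∀ x ∈ bx c m, g x ∈ bx c' m) (h : η ∈ Seed c' m) : pull g η ∈ Seed c m :=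
  fun u hu v hv hs => h _ (hc u hu) _ (hc v hv) ((hg.sq u v).2 hs)

lemma hook_pair {η : Cfg} (hη : GoodCfg η) {m t : ℤ} {i α : ℤ} (hm : 0 ≤ m) (hmt : m < t) (hα : 1 ≤ α)
    (hαt : α ≤ t) (hi : 0 ≤ i) (hi' : i < 8) (h1 : η ∈ HH m (4 * t) (i * α) ((i + 1) * α))
    (h2 : pull (tr (3 * t, i * α)) η ∈ HH m t α t)
    (h3 : pull (rfy.trans (tr (3 * t, i * α))) η ∈ HH m t α t)
    (hs0 : η ∈ Seed 0 m) (hs1 : η ∈ Seed (3 * t, i * α) m) :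
    CI η (Slab (-4 * t) (8 * t)) 0 (3 * t, i * α) := by
  obtain ⟨u, v, hu, ⟨hv1, hv2, hv3⟩, hc⟩ := h1
  obtain ⟨u2, v2, hu2, ⟨hv21, hv22, hv23⟩, hc2⟩ := h2
  obtain ⟨u3, v3, hu3, ⟨hv31, hv32, hv33⟩, hc3⟩ := h3
  have e : (i + 1) * α = i * α + α := by ring
  rw [e] at hv3
  have hd1 : 0 ≤ i * α := by positivity
  have hd2 : i * α ≤ 7 * t := by nlinarith
  clear e
  set y := i * α with hy
  clear_value y
  set d : V := (3 * t, y) with hd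
  have d1 : d.1 = 3 * t := rfl
  have d2 : d.2 = y := rfl
  have hu := mem_bx.1 (Finset.mem_coe.1 hu)
  have hu2 := mem_bx.1 (Finset.mem_coe.1 hu2)
  have hu3 := mem_bx.1 (Finset.mem_coe.1 hu3)
  simp only [Prod.fst_zero, Prod.snd_zero] at hu hu2 hu3
  have c2 : CI η (bx d t) (tr d u2) (tr d v2) := hc2.of_pull fun x hx => by
    have := mem_bx.1 (Finset.mem_coe.1 hx)
    refine Finset.mem_coe.2 (mem_bx.2 ?_)
    simp only [tr_1, tr_2, Prod.fst_zero, Prod.snd_zero] at *; omega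
  have c3 : CI η (bx d t) (rfy.trans (tr d) u3) (rfy.trans (tr d) v3) := hc3.of_pull fun x hx => by
    have := mem_bx.1 (Finset.mem_coe.1 hx)
    refine Finset.mem_coe.2 (mem_bx.2 ?_)
    simp only [Equiv.trans_apply, tr_1, tr_2, rfy_1, rfy_2, Prod.fst_zero, Prod.snd_zero] at *; omega
  have sub : (bx d m : Set V) ⊆ bx d t := fun x hx => by
    have := mem_bx.1 (Finset.mem_coe.1 hx)
    exact Finset.mem_coe.2 (mem_bx.2 (by omega))
  have m2 : tr d u2 ∈ bx d m := mem_bx.2 (by simp only [tr_1, tr_2]; omega)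
  have m3 : rfy.trans (tr d) u3 ∈ bx d m := mem_bx.2 (by simp only [Equiv.trans_apply, tr_1, tr_2, rfy_1, rfy_2]; omega)
  have c23 : CI η (bx d t) (tr d v2) (rfy.trans (tr d) v3) :=
    (c2.symm hη).trans (((Seed.CI hs1 m2 m3).mono sub).trans c3)
  have hook := meet_hook hη (R1 := (bx 0 (4 * t) : Set V)) (R2 := (bx d t : Set V)) (a := 2 * t) (b := 4 * t)
    (fun x hx => by have := mem_bx.1 (Finset.mem_coe.1 hx); simp only [Prod.fst_zero, Prod.snd_zero] at *; omega)
    (fun x hx => by have := mem_bx.1 (Finset.mem_coe.1 hx); omega) hc (by omega) hv1 c23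
    (fun h => by
      have := congrArg Prod.snd h
      simp only [Equiv.trans_apply, tr_1, tr_2, rfy_1, rfy_2] at this; omega)
    (by simp only [tr_1]; omega) (by simp only [Equiv.trans_apply, tr_1, rfy_1]; omega)
    (by simp only [tr_2]; omega) (by simp only [Equiv.trans_apply, tr_2, rfy_2]; omega)
  have sl1 : (bx 0 (4 * t) ∪ bx d t : Set V) ⊆ Slab (-4 * t) (8 * t) := by
    rintro x (hx | hx) <;> have := mem_bx.1 (Finset.mem_coe.1 hx) <;>
      simp only [Slab, Set.mem_ofPred_eq, Prod.fst_zero, Prod.snd_zero] at * <;> omega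
  have z0 : (0 : V) ∈ bx 0 m := mem_bx.2 (by simp only [Prod.fst_zero, Prod.snd_zero]; omega)
  have u0 : u ∈ bx 0 m := mem_bx.2 (by simp only [Prod.fst_zero, Prod.snd_zero]; omega)
  have zd : d ∈ bx d m := mem_bx.2 (by omega)
  have sub0 : (bx 0 m : Set V) ⊆ bx 0 (4 * t) := fun x hx => by
    have := mem_bx.1 (Finset.mem_coe.1 hx)
    exact Finset.mem_coe.2 (mem_bx.2 (by simp only [Prod.fst_zero, Prod.snd_zero] at *; omega))
  refine ((Seed.CI hs0 z0 u0).mono (sub0.trans (Set.subset_union_left.trans sl1))).trans ?_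
  refine (hook.mono sl1).trans ?_
  refine CI.mono (Set.subset_union_right.trans sl1) ((c2.symm hη).trans ((Seed.CI hs1 m2 zd).mono sub))

end DaC

namespace DaC

def LR (a b c d : ℤ) : Set Cfg := CE (Box4 a b c d) {v | v.1 = a} {v | v.1 = b}

noncomputable def fbox (a b c d : ℤ) : Finset V := Finset.Icc a b ×ˢ Finset.Icc c d
lemma mem_fbox {a b c d : ℤ} {v : V} : v ∈ fbox a b c d ↔ a ≤ v.1 ∧ v.1 ≤ b ∧ c ≤ v.2 ∧ v.2 ≤ d := by
  simp [fbox, and_assoc]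

lemma LR_local (a b c d : ℤ) : Local (fbox a b c d) (LR a b c d) :=
  CE_local fun x hx => Finset.mem_coe.2 (mem_fbox.2 hx)

lemma LR_inc (a b c d : ℤ) : Inc (LR a b c d) := CE_inc _ _ _

lemma LR_of {η : Cfg} (hη : GoodCfg η) {R : Set V} {u v : V} {a b c d : ℤ} (h : CI η R u v)
    (hR : ∀ x ∈ R, c ≤ x.2 ∧ x.2 ≤ d) (hu : u.1 ≤ a) (hv : b ≤ v.1) (hab : a ≤ b) : η ∈ LR a b c d := by
  obtain ⟨w, hw, h1⟩ := h.exit' (N := fun x => x.1) (fun x y hxy => by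
    have := (hη.star x y hxy).near; unfold Near at this; omega) (b := b) (by omega) hv
  obtain ⟨w', hw', h2⟩ := (h1.symm hη).exit' (N := fun x => -x.1) (fun x y hxy => by
    have := (hη.star x y hxy).near; unfold Near at this; omega) (b := -a) (by have hw : w.1 = b := hw; omega) (by have hu := hu; omega)
  refine ⟨w', w, by simp only [Set.mem_ofPred_eq]; omega, hw, (h2.symm hη).mono ?_⟩
  rintro x ⟨⟨hx1, hx2⟩, hx3⟩
  have := hR x hx1
  simp only [Set.mem_ofPred_eq] at hx2 hx3
  exact ⟨by omega, by omega, this.1, this.2⟩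

lemma card_bx (c : V) (m : ℕ) : (bx c m).card = (2 * m + 1) ^ 2 := by
  simp only [bx, Finset.card_product, Int.card_Icc]
  have : (c.1 + m + 1 - (c.1 - m)).toNat = 2 * m + 1 := by omega
  rw [this]
  have : (c.2 + m + 1 - (c.2 - m)).toNat = 2 * m + 1 := by omega
  rw [this, sq]

lemma exists_slow (α : ℕ → ℕ) (t0 : ℕ) (ht0 : 0 < t0) (h : ∀ n, t0 ≤ n → 1 ≤ α n ∧ α n ≤ n) :
    ∃ t, t0 ≤ t ∧ α (4 * t) ≤ 8 * α t := by
  by_contra hcon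
  push Not at hcon
  have key : ∀ j : ℕ, 8 ^ j ≤ α (4 ^ j * t0) := by
    intro j
    induction j with
    | zero => simpa using (h t0 le_rfl).1
    | succ j ih =>
      have h4 : 1 ≤ 4 ^ j := Nat.one_le_pow _ _ (by norm_num)
      have := hcon (4 ^ j * t0) (by nlinarith)
      rw [show 4 * (4 ^ j * t0) = 4 ^ (j + 1) * t0 by ring] at this
      rw [pow_succ]; omega
  have h1 := key t0
  have h4 : 1 ≤ 4 ^ t0 := Nat.one_le_pow _ _ (by norm_num)
  have h2 := (h (4 ^ t0 * t0) (by nlinarith)).2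
  have h3 : t0 < 2 ^ t0 := Nat.lt_two_pow_self
  have h5 : (8 : ℕ) ^ t0 = 4 ^ t0 * 2 ^ t0 := by rw [← mul_pow]; norm_num
  nlinarith

/-- chain points -/
def zc (t y : ℤ) (j : ℕ) : V := (3 * t * j, if j % 2 = 0 then 0 else y)
def gc (t : ℤ) (j : ℕ) : V ≃ V := if j % 2 = 0 then tr (3 * t * j, 0) else rfx (3 * t * (j + 1))
lemma gc_iso (t : ℤ) (j : ℕ) : Iso (gc t j) := by
  unfold gc; split_ifs
  · exact iso_tr _
  · exact iso_rfx _

def FF (m t i α : ℤ) : Set Cfg := HH m (4 * t) (i * α) ((i + 1) * α) ∩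
    (pull (tr (3 * t, i * α)) ⁻¹' HH m t α t ∩ pull (rfy.trans (tr (3 * t, i * α))) ⁻¹' HH m t α t)

lemma chain_step {η : Cfg} (hη : GoodCfg η) {m t : ℤ} {i α : ℤ} (hm : 0 ≤ m) (hmt : m < t) (hα : 1 ≤ α)
    (hαt : α ≤ t) (hi : 0 ≤ i) (hi' : i < 8) (j : ℕ) (hF : pull (gc t j) η ∈ FF m t i α)
    (hs0 : η ∈ Seed (zc t (i * α) j) m) (hs1 : η ∈ Seed (zc t (i * α) (j + 1)) m) :
    CI η (Slab (-4 * t) (8 * t)) (zc t (i * α) j) (zc t (i * α) (j + 1)) := by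
  have hη' := hη.pull (gc_iso t j)
  by_cases hj : j % 2 = 0
  · have hj' : ¬ (j + 1) % 2 = 0 := by omega
    have hg : gc t j = tr (3 * t * j, 0) := by simp [gc, hj]
    have e0 : gc t j 0 = zc t (i * α) j := by
      rw [hg]; apply Prod.ext <;> simp [tr_1, tr_2, zc, hj]
    have e1 : gc t j (3 * t, i * α) = zc t (i * α) (j + 1) := by
      rw [hg]; apply Prod.ext <;> simp [tr_1, tr_2, zc, hj']; ring
    have hc : ∀ c x, x ∈ bx c m → gc t j x ∈ bx (gc t j c) m := fun c x hx => by
      rw [mem_bx] at *; rw [hg]; simp only [tr_1, tr_2]; omega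
    have := hook_pair hη' hm hmt hα hαt hi hi' hF.1 hF.2.1 hF.2.2
      (Seed_pull (gc_iso t j) (hc 0) (by rw [e0]; exact hs0))
      (Seed_pull (gc_iso t j) (hc _) (by rw [e1]; exact hs1))
    have := this.of_pull (R' := Slab (-4 * t) (8 * t)) (fun x hx => by
      rw [hg]; simp only [Slab, Set.mem_ofPred_eq, tr_2] at *; omega)
    rwa [e0, e1] at this
  · have hj' : (j + 1) % 2 = 0 := by omega
    have hg : gc t j = rfx (3 * t * (j + 1)) := by simp [gc, hj]
    have e0 : gc t j 0 = zc t (i * α) (j + 1) := by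
      rw [hg]; apply Prod.ext <;> simp [rfx_1, rfx_2, zc, hj']
    have e1 : gc t j (3 * t, i * α) = zc t (i * α) j := by
      rw [hg]; apply Prod.ext <;> simp [rfx_1, rfx_2, zc, hj]; ring
    have hc : ∀ c x, x ∈ bx c m → gc t j x ∈ bx (gc t j c) m := fun c x hx => by
      rw [mem_bx] at *; rw [hg]; simp only [rfx_1, rfx_2]; omega
    have := hook_pair hη' hm hmt hα hαt hi hi' hF.1 hF.2.1 hF.2.2
      (Seed_pull (gc_iso t j) (hc 0) (by rw [e0]; exact hs1))
      (Seed_pull (gc_iso t j) (hc _) (by rw [e1]; exact hs0))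
    have := this.of_pull (R' := Slab (-4 * t) (8 * t)) (fun x hx => by
      rw [hg]; simp only [Slab, Set.mem_ofPred_eq, rfx_2] at *; omega)
    rw [e0, e1] at this
    exact this.symm hη

lemma chain_all {η : Cfg} (hη : GoodCfg η) {m t : ℤ} {i α : ℤ} (hm : 0 ≤ m) (hmt : m < t) (hα : 1 ≤ α)
    (hαt : α ≤ t) (hi : 0 ≤ i) (hi' : i < 8) {K : ℕ} (hF : ∀ j < K, pull (gc t j) η ∈ FF m t i α)
    (hs : ∀ j < K + 1, η ∈ Seed (zc t (i * α) j) m) :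
    CI η (Slab (-4 * t) (8 * t)) 0 (zc t (i * α) K) := by
  have key : ∀ j ≤ K, CI η (Slab (-4 * t) (8 * t)) 0 (zc t (i * α) j) := by
    intro j hj
    induction j with
    | zero => 
      have : zc t (i * α) 0 = 0 := by apply Prod.ext <;> simp [zc]
      rw [this]; exact .refl
    | succ j ih =>
      exact (ih (by omega)).trans (chain_step hη hm hmt hα hαt hi hi' j (hF j (by omega)) (hs j (by omega)) (hs _ (by omega)))
  exact key K le_rfl

lemma piece {y a A : ℤ} (ha : 1 ≤ a) (hy : 0 ≤ y) (hyA : y ≤ A) (hA : A ≤ 8 * a) :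
    ∃ i : Fin 8, (i : ℤ) * a ≤ y ∧ y ≤ ((i : ℤ) + 1) * a := by
  by_cases h : y < 8 * a
  · have h1 : 0 ≤ y / a := Int.ediv_nonneg hy (by omega)
    have h2 : y / a < 8 := Int.ediv_lt_of_lt_mul (by omega) h
    refine ⟨⟨(y / a).toNat, by omega⟩, ?_, ?_⟩
    · simp only [Int.toNat_of_nonneg h1]; exact Int.ediv_mul_le y (by omega)
    · simp only [Int.toNat_of_nonneg h1]; exact (Int.lt_ediv_add_one_mul_self y (by omega)).le
  · exact ⟨7, by show (7 : ℤ) * a ≤ y; omega, by show y ≤ ((7 : ℤ) + 1) * a; omega⟩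

namespace IsModel
variable {μ : Measure Cfg} {e : ℕ → ℝ} (hm : IsModel μ e)
include hm

lemma FF_prob {m t i α : ℤ} {κ : ℝ} (h1 : 1 - κ ≤ μ.real (HH m (4 * t) (i * α) ((i + 1) * α)))
    (h2 : 1 - κ ≤ μ.real (HH m t α t)) : 1 - 3 * κ ≤ μ.real (FF m t i α) := by
  classical
  haveI := hm.prob
  have i1 := hm.inv (tr (3 * t, i * α)) (iso_tr _) _ _ (HH_local m t α t)
  have i2 := hm.inv (rfy.trans (tr (3 * t, i * α))) (iso_rfy.trans (iso_tr _)) _ _ (HH_local m t α t)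
  have m2 := ((HH_local m t α t).pull (tr (3 * t, i * α))).measurable
  have m3 := ((HH_local m t α t).pull (rfy.trans (tr (3 * t, i * α)))).measurable
  have u1 := measureReal_union_add_inter (μ := μ) (s := HH m (4 * t) (i * α) ((i + 1) * α)) (m2.inter m3)
  have u2 := measureReal_union_add_inter (μ := μ) (s := pull (tr (3 * t, i * α)) ⁻¹' HH m t α t) m3
  have l1 := hm.le_one (HH m (4 * t) (i * α) ((i + 1) * α) ∪ (pull (tr (3 * t, i * α)) ⁻¹' HH m t α t ∩ pull (rfy.trans (tr (3 * t, i * α))) ⁻¹' HH m t α t))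
  have l2 := hm.le_one (pull (tr (3 * t, i * α)) ⁻¹' HH m t α t ∪ pull (rfy.trans (tr (3 * t, i * α))) ⁻¹' HH m t α t)
  unfold FF
  linarith

set_option maxHeartbeats 2000000 in
theorem Qthm {θ : ℝ} (hθ : 0 < θ) (h : ∀ n : ℕ, θ ≤ μ.real (Arm n)) {ε : ℝ} (hε : 0 < ε) (n0 : ℕ) :
    ∃ n : ℕ, n0 ≤ n ∧ 1 - ε ≤ μ.real (LR 0 (4 * n) 0 n) := by
  classical
  haveI := hm.prob
  obtain ⟨κ, hκ0, hκ1, hκi, hκε⟩ : ∃ κ : ℝ, 0 < κ ∧ κ ≤ 1 ∧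
      κ < μ.real {η | ∀ v, StarAdj 0 v → ¬ η 0 v} ∧ 102 * κ ≤ ε / 3 := by
    have hi := hm.iso
    refine ⟨min 1 (min (μ.real {η | ∀ v, StarAdj 0 v → ¬ η 0 v} / 2) (ε / 306)), ?_, ?_, ?_, ?_⟩
    · exact lt_min one_pos (lt_min (by linarith) (by linarith))
    · exact min_le_left _ _
    · exact lt_of_le_of_lt ((min_le_right _ _).trans (min_le_left _ _)) (by linarith)
    · have := (min_le_right 1 (min (μ.real {η : Cfg | ∀ v, StarAdj 0 v → ¬ η 0 v} / 2) (ε / 306))).trans (min_le_right _ _)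
      linarith
  have hκ8 : κ ^ 8 ≤ κ := by
    calc κ ^ 8 ≤ κ ^ 1 := pow_le_pow_of_le_one hκ0.le hκ1 (by norm_num)
      _ = κ := pow_one κ
  obtain ⟨m, hm0⟩ := hm.armA hθ h (δ := ((((κ ^ 8) ^ 2) ^ 2) ^ 2) ^ 2) (by positivity)
  have hB : ∀ n : ℕ, ∃ α : ℕ, m < n → 1 ≤ α ∧ α ≤ n ∧ 1 - κ ^ 8 ≤ μ.real (HH m n 0 α) ∧
      1 - κ ^ 8 ≤ μ.real (HH m n α n) := by
    intro n
    by_cases hn : m < n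
    · obtain ⟨α, hα⟩ := hm.armB (κ := κ ^ 8) (by positivity) (hκ8.trans hκ1) (lt_of_le_of_lt hκ8 hκi) hn (hm0 n hn)
      exact ⟨α, fun _ => hα⟩
    · exact ⟨0, fun h => absurd h hn⟩
  choose α hα using hB
  set σ := μ.real (Seed 0 m) with hσ
  have hσ0 : 0 < σ := hm.seed m
  set v0 := σ ^ 18 with hv0
  have hv0p : 0 < v0 := by positivity
  obtain ⟨N, hN⟩ := exists_nat_gt (4 / v0 / (ε / 3))
  have hN0 : 0 < N := by
    have : (0 : ℝ) < N := lt_of_le_of_lt (by positivity) hN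
    exact_mod_cast this
  have hN' : (0 : ℝ) < N := by exact_mod_cast hN0
  set C : ℝ := 18 * (2 * (m : ℝ) + 1) ^ 2 with hC
  obtain ⟨k, hk⟩ : ∃ k, 4 * (2 * C * e k) / v0 ^ 2 < ε / 3 := by
    have ht : Filter.Tendsto (fun k => 4 * (2 * C * e k) / v0 ^ 2) Filter.atTop (nhds 0) := by
      have := ((hm.e_lim.const_mul (2 * C)).const_mul 4).div_const (v0 ^ 2)
      simpa using this
    exact (ht.eventually_lt_const (by positivity)).exists
  set L : ℕ := k + 2 * m with hL
  obtain ⟨t, ht, hαt⟩ := exists_slow α (N * L + 2 * m + k + n0 + 1) (by omega) (fun n hn =>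
    ⟨(hα n (by nlinarith)).1, (hα n (by nlinarith)).2.1⟩)
  have hmt : m < t := by nlinarith
  obtain ⟨ha1, ha2, ha3, ha4⟩ := hα t hmt
  obtain ⟨hb1, hb2, hb3, hb4⟩ := hα (4 * t) (by omega)
  set a := α t with ha
  obtain ⟨i, hi⟩ := hm.sqrt_trick (D := bx 0 (4 * t : ℕ)) (n := 8)
    (A := fun i : Fin 8 => HH m (4 * t : ℕ) ((i : ℤ) * a) (((i : ℤ) + 1) * a)) (B := HH m (4 * t : ℕ) 0 (α (4 * t)))
    hκ0.le (fun i => HH_local _ _ _ _) (fun i => HH_inc _ _ _ _) hb3 (by norm_num) (by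
      rintro η hη ⟨u, v, hu, ⟨hv1, hv2, hv3⟩, hc⟩
      obtain ⟨i, hi1, hi2⟩ := piece (y := v.2) (a := a) (A := α (4 * t)) (by omega) hv2 hv3 (by omega)
      exact ⟨i, u, v, hu, ⟨hv1, hi1, hi2⟩, hc⟩)
  have hi8 : (i : ℤ) < 8 := by omega
  have hi0 : 0 ≤ (i : ℤ) := by omega
  have hF := hm.FF_prob (m := m) (t := t) (i := i) (α := a) (κ := κ) (by
    have := hi; push_cast at this; exact this) (by linarith)
  set F := FF m t i a with hFd
  obtain ⟨DF, hDF⟩ : ∃ D, Local D F := by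
    refine ⟨bx 0 (4 * t) ∪ ((bx 0 t).image (tr (3 * t, i * a)) ∪ (bx 0 t).image (rfy.trans (tr (3 * t, i * a)))), ?_⟩
    refine ((HH_local _ _ _ _).mono Finset.subset_union_left).inter (Local.mono ?_ Finset.subset_union_right)
    exact (((HH_local _ _ _ _).pull _).mono Finset.subset_union_left).inter
      (((HH_local _ _ _ _).pull _).mono Finset.subset_union_right)
  have hFi : Inc F := (HH_inc _ _ _ _).inter (((HH_inc _ _ _ _).pull _).inter ((HH_inc _ _ _ _).pull _))
  set y : ℤ := i * a with hy
  set D0 : Finset V := (Finset.range 18).biUnion fun j => bx (zc t y j) m with hD0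
  set A0 : Set Cfg := ⋂ j ∈ Finset.range 18, Seed (zc t y j) m with hA0
  set B0 : Set Cfg := ⋃ j ∈ Finset.range 17, (pull (gc t j) ⁻¹' F)ᶜ with hB0
  have hA0l : Local D0 A0 := by
    intro η η' hh hη
    simp only [hA0, Set.mem_iInter] at hη ⊢
    exact fun j hj => (Seed_local _ _).mono (fun x hx => Finset.mem_biUnion.2 ⟨j, hj, hx⟩) η η' hh (hη j hj)
  have hA0i : Inc A0 := Inc.iInter fun j => Inc.iInter fun _ => Seed_inc _ _
  set D1 : Finset V := (Finset.range 17).biUnion fun j => DF.image (gc t j) with hD1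
  have hloc1 : ∀ j ∈ Finset.range 17, Local D1 (pull (gc t j) ⁻¹' F) := fun j hj =>
    (hDF.pull (gc t j)).mono fun x hx => Finset.mem_biUnion.2 ⟨j, hj, hx⟩
  have hB0l : Local D1 B0 := Local.iUnion fun j => Local.iUnion fun hj => (hloc1 j hj).compl
  have hvA : v0 ≤ μ.real A0 := by
    refine le_trans ?_ (hm.fkg_iInter (D := D0) (A := fun j => if j ∈ Finset.range 18 then Seed (zc t y j) m else Set.univ) (Finset.range 18) ?_ ?_ |>.trans (le_of_eq ?_))
    · rw [hv0]
      have : ∀ j ∈ Finset.range 18, μ.real (if j ∈ Finset.range 18 then Seed (zc t y j) m else Set.univ) = σ := by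
        intro j hj
        rw [if_pos hj]
        refine le_antisymm ?_ ?_
        · refine hm.le_pull (Seed_local _ _) (g := tr (-(zc t y j))) (iso_tr _) fun η _ hη => ?_
          have := Seed_pull (η := pull (tr (-(zc t y j))) η) (c := 0) (c' := zc t y j) (m := m) (iso_tr (zc t y j)) (fun x hx => by
            rw [mem_bx] at *; simp only [tr_1, tr_2, Prod.fst_zero, Prod.snd_zero] at *; omega) hη
          have e1 : pull (tr (zc t y j)) (pull (tr (-(zc t y j))) η) = η := by
            funext a b; simp [pull, tr]
          rwa [e1] at this
        · refine hm.le_pull (Seed_local _ _) (g := tr (zc t y j)) (iso_tr _) fun η _ hη => ?_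
          have := Seed_pull (η := pull (tr (zc t y j)) η) (c := zc t y j) (c' := 0) (m := m) (iso_tr (-(zc t y j))) (fun x hx => by
            rw [mem_bx] at *; simp only [tr_1, tr_2, Prod.fst_zero, Prod.snd_zero, Prod.fst_neg, Prod.snd_neg] at *; omega) hη
          have e1 : pull (tr (-(zc t y j))) (pull (tr (zc t y j)) η) = η := by
            funext a b; simp [pull, tr]
          rwa [e1] at this
      rw [Finset.prod_congr rfl this]; simp
    · intro j
      split_ifs with hj
      · exact (Seed_local _ _).mono fun x hx => Finset.mem_biUnion.2 ⟨j, hj, hx⟩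
      · intro _ _ _ _; trivial
    · intro j
      split_ifs with hj
      · exact Seed_inc _ _
      · intro _ _ _ _; trivial
    · congr 1
      refine Set.iInter_congr fun j => Set.iInter_congr fun hj => ?_
      rw [if_pos hj]
  have hAp : 0 < μ.real A0 := lt_of_lt_of_le hv0p hvA
  have hAB : μ.real (A0 ∩ B0) ≤ (51 * κ) * μ.real A0 := by
    have h1 : A0 ∩ B0 = ⋃ j ∈ Finset.range 17, (A0 ∩ (pull (gc t j) ⁻¹' F)ᶜ) := by
      rw [hB0, Set.inter_iUnion₂]
    rw [h1]
    refine (measureReal_biUnion_finset_le _ _).trans ?_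
    have : ∀ j ∈ Finset.range 17, μ.real (A0 ∩ (pull (gc t j) ⁻¹' F)ᶜ) ≤ 3 * κ * μ.real A0 := by
      intro j hj
      have f1 := hm.fkg (D0 ∪ D1) A0 (pull (gc t j) ⁻¹' F) (hA0l.mono Finset.subset_union_left)
        ((hloc1 j hj).mono Finset.subset_union_right) hA0i (hFi.pull _)
      rw [hm.inv _ (gc_iso t j) _ _ hDF] at f1
      have f2 := measureReal_inter_add_diff (μ := μ) (s := A0) (hloc1 j hj).measurable
      rw [Set.diff_eq] at f2
      have := mul_le_mul_of_nonneg_left hF hAp.le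
      nlinarith
    refine (Finset.sum_le_sum this).trans (le_of_eq ?_)
    simp; ring
  have hD0c : (D0.card : ℝ) ≤ C := by
    have : D0.card ≤ ∑ j ∈ Finset.range 18, (bx (zc t y j) m).card := Finset.card_biUnion_le
    simp only [card_bx, Finset.sum_const, Finset.card_range, smul_eq_mul] at this
    rw [hC]; exact_mod_cast this
  have ht' : (N : ℤ) * L + 2 * m + k + n0 + 1 ≤ t := by exact_mod_cast ht
  have main := hm.seeds_many hA0l hB0l (N := N) (k := k) hN0 (L := L) (by
      intro u hu v hv p q hp hp' hq hq' hpq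
      obtain ⟨j1, hj1, hu⟩ := Finset.mem_biUnion.1 hu
      obtain ⟨j2, hj2, hv⟩ := Finset.mem_biUnion.1 hv
      have hu := (mem_bx.1 hu)
      have hv := (mem_bx.1 hv)
      simp only [zc] at hu hv
      have hpL : (L : ℤ) ≤ (q - p) * L := by nlinarith
      have hqp : (q - p) * (L : ℤ) ≤ N * L := mul_le_mul_of_nonneg_right (by omega) (by omega)
      have ee : (v.1 + q * L) - (u.1 + p * L) = v.1 - u.1 + (q - p) * L := by ring
      have ee' : (u.1 + p * L) - (v.1 + q * L) = u.1 - v.1 - (q - p) * L := by ring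
      rw [ee, ee']
      have hLL : (L : ℤ) = k + 2 * m := by rw [hL]; push_cast; ring
      rcases lt_trichotomy j1 j2 with hj | hj | hj
      · left
        have : 3 * (t : ℤ) * j1 + 3 * t ≤ 3 * t * j2 := by
          have : (j1 : ℤ) + 1 ≤ j2 := by omega
          nlinarith
        have : (0 : ℤ) ≤ N * L := by positivity
        linarith
      · left; subst hj; linarith
      · right
        have : 3 * (t : ℤ) * j2 + 3 * t ≤ 3 * t * j1 := by
          have : (j2 : ℤ) + 1 ≤ j1 := by omega
          nlinarith
        have : (0 : ℤ) ≤ N * L := by positivity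
        linarith) hAp hAB
  refine ⟨12 * t, by nlinarith, ?_⟩
  have htr : μ.real (LR t (49 * t) (-4 * t) (8 * t)) ≤ μ.real (LR 0 (4 * (12 * t : ℕ)) 0 (12 * t : ℕ)) := by
    refine hm.le_pull (LR_local _ _ _ _) (iso_tr (-(t : ℤ), 4 * t)) ?_
    rintro η hη ⟨u, v, hu, hv, hc⟩
    have hu : u.1 = t := hu
    have hv : v.1 = 49 * t := hv
    refine ⟨tr (-(t : ℤ), 4 * t) u, tr (-(t : ℤ), 4 * t) v, ?_, ?_, hc.of_pull ?_⟩
    · simp only [Set.mem_ofPred_eq, tr_1]; omega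
    · simp only [Set.mem_ofPred_eq, tr_1]; push_cast; omega
    · rintro x ⟨h1, h2, h3, h4⟩
      refine ⟨?_, ?_, ?_, ?_⟩ <;> simp only [tr_1, tr_2] <;> push_cast <;> omega
  refine le_trans ?_ htr
  have hcov : 1 - μ.real (LR t (49 * t) (-4 * t) (8 * t)) ≤
      μ.real {η | ∀ i : Fin N, pull (tr ((i : ℤ) * L, 0)) η ∈ A0 → pull (tr ((i : ℤ) * L, 0)) η ∈ B0} := by
    rw [← hm.compl (LR_local _ _ _ _)]
    refine hm.mono fun η hg hη p hp => ?_
    by_contra hpB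
    apply hη
    have hg' := hg.pull (iso_tr ((p : ℤ) * L, 0))
    simp only [hB0, Set.mem_iUnion, not_exists, Set.mem_compl_iff, not_not] at hpB
    simp only [hA0, Set.mem_iInter] at hp
    have hc := chain_all hg' (m := m) (t := t) (i := i) (α := a) (by omega) (by omega) (by omega) (by omega) hi0 hi8
      (K := 17) (fun j hj => hpB j (Finset.mem_range.2 hj)) (fun j hj => hp j (Finset.mem_range.2 hj))
    have hc' := hc.of_pull (R' := Slab (-4 * t) (8 * t)) (fun x hx => by
      simp only [Slab, Set.mem_ofPred_eq, tr_2] at *; omega)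
    have hiK : (p : ℤ) * L ≤ N * L := mul_le_mul_of_nonneg_right (by omega) (by omega)
    have hiK0 : 0 ≤ (p : ℤ) * L := by positivity
    refine LR_of hg hc' (fun x hx => hx) ?_ ?_ (by omega)
    · simp only [tr_1, Prod.fst_zero]; omega
    · simp only [tr_1, zc]; push_cast; omega
  have b1 : 4 / (N * μ.real A0) ≤ ε / 3 := by
    rw [div_lt_iff₀ (by positivity), div_lt_iff₀ hv0p] at hN
    rw [div_le_iff₀ (by positivity)]
    have := mul_le_mul_of_nonneg_left hvA (by positivity : 0 ≤ ε / 3 * N)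
    nlinarith
  have b2 : 4 * (2 * (D0.card : ℝ) * e k) / μ.real A0 ^ 2 ≤ ε / 3 := by
    refine le_trans ?_ hk.le
    have := hm.e_nonneg k
    gcongr
  linarith

end IsModel
end DaC

namespace DaC

def Ann (n : ℤ) : Set Cfg := CE (bx 0 (2 * n)) (bx 0 n) (sph (2 * n))
lemma ann_local (n : ℤ) : Local (bx 0 (2 * n)) (Ann n) := CE_local (le_refl _)

lemma CI.to_pull {g : V ≃ V} {η : Cfg} {R : Set V} {u v : V} (h : CI η R u v) :
    CI (pull g η) Set.univ (g.symm u) (g.symm v) :=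
  Relation.ReflTransGen.lift g.symm (fun a b hab => ⟨by simpa [pull] using hab.1, trivial, trivial⟩) _ _ h

lemma tr_symm_1 (w v : V) : ((tr w).symm v).1 = v.1 - w.1 := by simp [tr, sub_eq_add_neg]
lemma tr_symm_2 (w v : V) : ((tr w).symm v).2 = v.2 - w.2 := by simp [tr, sub_eq_add_neg]

lemma ann_at {η : Cfg} (hη : GoodCfg η) {R : Set V} {u v x : V} {n : ℤ} (hn : 0 ≤ n) (h : CI η R u v)
    (hu : u ∈ bx x n) (hv : 2 * n ≤ v.1 - x.1 ∨ 2 * n ≤ x.1 - v.1 ∨ 2 * n ≤ v.2 - x.2 ∨ 2 * n ≤ x.2 - v.2) :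
    pull (tr x) η ∈ Ann n := by
  rw [mem_bx] at hu
  refine arm_exit (hη.pull (iso_tr x)) (A := bx 0 n) (u := (tr x).symm u) (v := (tr x).symm v) ?_ ?_ ?_ h.to_pull
  · rw [Finset.mem_coe, mem_bx, tr_symm_1, tr_symm_2]; simp only [Prod.fst_zero, Prod.snd_zero]; omega
  · rw [mem_bx, tr_symm_1, tr_symm_2]; simp only [Prod.fst_zero, Prod.snd_zero]; omega
  · unfold supN; rw [tr_symm_1, tr_symm_2]; omega

lemma arm_at {η : Cfg} (hη : GoodCfg η) {R : Set V} {v x : V} {n : ℤ} (hn : 0 ≤ n) (h : CI η R x v)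
    (hv : n ≤ v.1 - x.1 ∨ n ≤ x.1 - v.1 ∨ n ≤ v.2 - x.2 ∨ n ≤ x.2 - v.2) :
    pull (tr x) η ∈ Arm n := by
  refine arm_exit (hη.pull (iso_tr x)) (A := {0}) (u := (tr x).symm x) (v := (tr x).symm v) ?_ ?_ ?_ h.to_pull
  · simp [tr]
  · rw [mem_bx, tr_symm_1, tr_symm_2]; simp only [Prod.fst_zero, Prod.snd_zero]; omega
  · unfold supN; rw [tr_symm_1, tr_symm_2]; omega

lemma floor_near (n y : ℤ) (hn : 0 < n) : n * (y / n) ≤ y ∧ y ≤ n * (y / n) + n := by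
  have h1 := Int.mul_ediv_add_emod y n
  have h2 := Int.emod_nonneg y hn.ne'
  have h3 := Int.emod_lt_of_pos y hn
  omega

lemma floor_bd (n y k : ℤ) (hn : 0 < n) (h1 : -(k * n) ≤ y) (h2 : y ≤ k * n) : -k ≤ y / n ∧ y / n ≤ k := by
  constructor
  · apply Int.le_ediv_of_mul_le hn; linarith
  · apply Int.ediv_le_of_le_mul hn h2

def bdp (n i : ℤ) (k : Fin 4) : V := if k = 0 then (n, i) else if k = 1 then (-n, i) else if k = 2 then (i, n) else (i, -n)

namespace IsModel
variable {μ : Measure Cfg} {e : ℕ → ℝ} (hm : IsModel μ e)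
include hm

lemma pull_tr {D : Finset V} {A : Set Cfg} (hA : Local D A) (x : V) :
    μ.real (pull (tr x) ⁻¹' A) = μ.real A := hm.inv _ (iso_tr x) _ _ hA

set_option maxHeartbeats 1000000 in
lemma ann_rec (n : ℕ) (hn : 0 < n) : μ.real (Ann (10 * n)) ≤
    (41 : ℝ) ^ 4 * (μ.real (Ann n) ^ 2 + 2 * (4 * n + 1) ^ 2 * e n) := by
  classical
  haveI := hm.prob
  set I : Finset V := bx 0 20 with hI
  have hIc : I.card = 41 ^ 2 := by
    have := card_bx 0 20
    rw [hI]; exact_mod_cast this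
  have hn' : (0 : ℤ) < n := by exact_mod_cast hn
  set S := (I ×ˢ I).filter (fun q : V × V => 8 * (n : ℤ) ≤ n * q.1.1 - n * q.2.1 ∨ 8 * (n : ℤ) ≤ n * q.2.1 - n * q.1.1
    ∨ 8 * (n : ℤ) ≤ n * q.1.2 - n * q.2.2 ∨ 8 * (n : ℤ) ≤ n * q.2.2 - n * q.1.2) with hS
  have h1 : μ.real (Ann (10 * n)) ≤ μ.real (⋃ q ∈ S, (pull (tr (n * q.1.1, n * q.1.2)) ⁻¹' Ann n ∩
      pull (tr (n * q.2.1, n * q.2.2)) ⁻¹' Ann n)) := by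
    refine hm.mono ?_
    rintro η hg ⟨u, v, hu, hv, hc⟩
    obtain ⟨a1, a2, a3, a4⟩ := mem_bx.1 hu
    simp only [Prod.fst_zero, Prod.snd_zero] at a1 a2 a3 a4
    have hv' : supN v = 2 * (10 * n) := hv
    obtain ⟨b1, b2, b3, b4⟩ := mem_bx.1 (supN_le.1 hv'.le)
    simp only [Prod.fst_zero, Prod.snd_zero] at b1 b2 b3 b4
    have hv2 : v.1 = 20 * n ∨ v.1 = - 20 * n ∨ v.2 = 20 * n ∨ v.2 = -20 * n := by
      unfold supN at hv'; omega
    have fu1 := floor_near n u.1 hn'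
    have fu2 := floor_near n u.2 hn'
    have fv1 := floor_near n v.1 hn'
    have fv2 := floor_near n v.2 hn'
    have gu1 := floor_bd n u.1 20 hn' (by omega) (by omega)
    have gu2 := floor_bd n u.2 20 hn' (by omega) (by omega)
    have gv1 := floor_bd n v.1 20 hn' (by omega) (by omega)
    have gv2 := floor_bd n v.2 20 hn' (by omega) (by omega)
    simp only [Set.mem_iUnion]
    refine ⟨((u.1 / n, u.2 / n), (v.1 / n, v.2 / n)), ?_, ?_, ?_⟩
    · rw [hS, Finset.mem_filter, Finset.mem_product]
      refine ⟨⟨mem_bx.2 ?_, mem_bx.2 ?_⟩, ?_⟩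
      · simp only [Prod.fst_zero, Prod.snd_zero]; omega
      · simp only [Prod.fst_zero, Prod.snd_zero]; omega
      · simp only
        omega
    · refine ann_at hg hn'.le hc (mem_bx.2 ?_) ?_
      · simp only; omega
      · simp only; omega
    · refine ann_at hg hn'.le (hc.symm hg) (mem_bx.2 ?_) ?_
      · simp only; omega
      · simp only; omega
  refine h1.trans ((measureReal_biUnion_finset_le _ _).trans ?_)
  have h2 : ∀ q ∈ S, μ.real (pull (tr (n * q.1.1, n * q.1.2)) ⁻¹' Ann n ∩
      pull (tr (n * q.2.1, n * q.2.2)) ⁻¹' Ann n) ≤ μ.real (Ann n) ^ 2 + 2 * (4 * n + 1) ^ 2 * e n := by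
    intro q hq
    rw [hS, Finset.mem_filter] at hq
    obtain ⟨_, hq⟩ := hq
    have := hm.mix n _ _ _ _ ((ann_local n).pull (tr (n * q.1.1, n * q.1.2))) ((ann_local n).pull (tr (n * q.2.1, n * q.2.2))) (by
      intro x hx y hy
      obtain ⟨x, hx1, rfl⟩ := Finset.mem_image.1 hx
      obtain ⟨y, hy1, rfl⟩ := Finset.mem_image.1 hy
      clear hx hy
      have hx := mem_bx.1 hx1
      have hy := mem_bx.1 hy1
      simp only [tr_1, tr_2, Prod.fst_zero, Prod.snd_zero] at *
      omega)
    rw [hm.pull_tr (ann_local n), hm.pull_tr (ann_local n), Finset.card_image_of_injective _ (Equiv.injective _),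
      Finset.card_image_of_injective _ (Equiv.injective _)] at this
    have hc : (bx 0 (2 * (n : ℤ))).card = (2 * (2 * n) + 1) ^ 2 := by
      have := card_bx 0 (2 * n); push_cast at this; exact this
    rw [hc] at this
    push_cast at this
    refine this.trans (le_of_eq ?_)
    ring
  refine (Finset.sum_le_sum h2).trans ?_
  rw [Finset.sum_const, nsmul_eq_mul]
  refine mul_le_mul_of_nonneg_right ?_ (by have := hm.e_nonneg n; positivity)
  have : S.card ≤ 41 ^ 4 := by
    refine (Finset.card_filter_le _ _).trans ?_
    rw [Finset.card_product, hIc]; norm_num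
  exact_mod_cast this

/-- finite size criterion -/
lemma criterion {C : ℝ} (hC : 0 ≤ C) (he : ∀ k : ℕ, 0 < k → e k ≤ C / (k : ℝ) ^ 3) {n : ℕ} (hn : 0 < n)
    (hn0 : 800 * (41 : ℝ) ^ 8 * C ≤ n) (ha : μ.real (Ann n) ≤ 1 / (4 * 41 ^ 4)) (j : ℕ) :
    μ.real (Ann (10 ^ j * n : ℕ)) ≤ 1 / (4 * 41 ^ 4) * (1 / 2) ^ j := by
  induction j with
  | zero => simpa using ha
  | succ j ih =>
    have hN : 0 < 10 ^ j * n := by positivity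
    have h1 := hm.ann_rec (10 ^ j * n) hN
    have h2 := he _ hN
    have e1 : ((10 ^ (j + 1) * n : ℕ) : ℤ) = 10 * (10 ^ j * n : ℕ) := by push_cast; ring
    rw [e1]
    set N := 10 ^ j * n with hNd
    set a := μ.real (Ann (N : ℕ)) with ha
    have ha0 : 0 ≤ a := measureReal_nonneg
    have hNr : (1 : ℝ) ≤ N := by exact_mod_cast hN
    have h3 : 2 * (4 * (N : ℝ) + 1) ^ 2 * e N ≤ 50 * C / N := by
      calc 2 * (4 * (N : ℝ) + 1) ^ 2 * e N ≤ 2 * (5 * (N : ℝ)) ^ 2 * (C / (N : ℝ) ^ 3) := by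
            have := hm.e_nonneg N
            gcongr; linarith
        _ = 50 * C / N := by field_simp; ring
    have h4 : 50 * C / N ≤ 1 / (16 * 41 ^ 8) * (1 / 2) ^ j := by
      have hn' : (0 : ℝ) < n := by exact_mod_cast hn
      have e2 : (N : ℝ) = 10 ^ j * n := by rw [hNd]; push_cast; ring
      rw [div_le_iff₀ (by positivity), e2]
      have : (1 : ℝ) ≤ (1 / 2) ^ j * 10 ^ j := by
        rw [← mul_pow]; exact one_le_pow₀ (by norm_num)
      calc 50 * C ≤ 1 / (16 * 41 ^ 8) * n := by norm_num at hn0 ⊢; linarith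
        _ ≤ 1 / (16 * 41 ^ 8) * n * ((1 / 2) ^ j * 10 ^ j) := le_mul_of_one_le_right (by positivity) this
        _ = _ := by ring
    have h5 : a ^ 2 ≤ 1 / (16 * 41 ^ 8) * (1 / 2) ^ j := by
      calc a ^ 2 ≤ (1 / (4 * 41 ^ 4) * (1 / 2) ^ j) ^ 2 := by gcongr
        _ = 1 / (16 * 41 ^ 8) * ((1 / 2) ^ j * (1 / 2) ^ j) := by ring
        _ ≤ 1 / (16 * 41 ^ 8) * ((1 / 2) ^ j * 1) := by
          gcongr; exact pow_le_one₀ (by norm_num) (by norm_num)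
        _ = _ := by ring
    refine h1.trans ?_
    have h6 : a ^ 2 + 2 * (4 * (N : ℝ) + 1) ^ 2 * e N ≤ 1 / (8 * 41 ^ 8) * (1 / 2) ^ j := by
      have : (1 : ℝ) / (8 * 41 ^ 8) * (1 / 2) ^ j = 1 / (16 * 41 ^ 8) * (1 / 2) ^ j + 1 / (16 * 41 ^ 8) * (1 / 2) ^ j := by ring
      linarith
    calc (41 : ℝ) ^ 4 * _ ≤ 41 ^ 4 * (1 / (8 * 41 ^ 8) * (1 / 2) ^ j) := by gcongr
      _ = _ := by rw [pow_succ]; ring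

lemma arm_le_ann (n : ℕ) : μ.real (Arm (2 * n)) ≤ μ.real (Ann n) := by
  refine hm.mono ?_
  rintro η hg ⟨u, v, hu, hv, hc⟩
  refine ⟨u, v, ?_, hv, hc⟩
  rw [Set.mem_singleton_iff.1 hu, Finset.mem_coe, mem_bx]; simp

lemma ann_le_arm (n : ℕ) (hn : 0 < n) : μ.real (Ann n) ≤ 12 * n * μ.real (Arm n) := by
  classical
  haveI := hm.prob
  set I := Finset.Icc (-(n : ℤ)) n with hI
  have h1 : μ.real (Ann n) ≤ μ.real (⋃ i ∈ I, ⋃ k ∈ (Finset.univ : Finset (Fin 4)),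
      pull (tr (bdp n i k)) ⁻¹' Arm n) := by
    refine hm.mono ?_
    rintro η hg ⟨u, v, hu, hv, hc⟩
    have hv' : supN v = 2 * n := hv
    obtain ⟨w, hw, hcw⟩ := hc.exit' (supN_step hg) (b := n) (supN_le.2 hu) (by omega)
    have hwv : CI η (bx 0 (2 * n)) w v := ((hcw.mono (fun x hx => hx.1)).symm hg).trans hc
    have := arm_at hg (n := n) (by omega) hwv (by unfold supN at hv' hw; omega)
    have hw2 : w.1 = n ∨ w.1 = - n ∨ w.2 = n ∨ w.2 = -n := by unfold supN at hw; omega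
    have hw3 := mem_bx.1 (supN_le.1 hw.le)
    simp only [Prod.fst_zero, Prod.snd_zero] at hw3
    simp only [Set.mem_iUnion]
    rcases hw2 with h | h | h | h
    · refine ⟨w.2, Finset.mem_Icc.2 (by omega), 0, Finset.mem_univ _, ?_⟩
      have e : bdp n (w.2) 0 = w := by unfold bdp; exact Prod.ext (by simp [h]) (by simp [h])
      show pull (tr (bdp n (w.2) 0)) η ∈ Arm n
      rw [e]; exact this
    · refine ⟨w.2, Finset.mem_Icc.2 (by omega), 1, Finset.mem_univ _, ?_⟩
      have e : bdp n (w.2) 1 = w := by unfold bdp; exact Prod.ext (by simp [h]) (by simp [h])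
      show pull (tr (bdp n (w.2) 1)) η ∈ Arm n
      rw [e]; exact this
    · refine ⟨w.1, Finset.mem_Icc.2 (by omega), 2, Finset.mem_univ _, ?_⟩
      have e : bdp n (w.1) 2 = w := by unfold bdp; exact Prod.ext (by simp [h]) (by simp [h])
      show pull (tr (bdp n (w.1) 2)) η ∈ Arm n
      rw [e]; exact this
    · refine ⟨w.1, Finset.mem_Icc.2 (by omega), 3, Finset.mem_univ _, ?_⟩
      have e : bdp n (w.1) 3 = w := by unfold bdp; exact Prod.ext (by simp [h]) (by simp [h])
      show pull (tr (bdp n (w.1) 3)) η ∈ Arm n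
      rw [e]; exact this
  refine h1.trans ((measureReal_biUnion_finset_le _ _).trans ?_)
  refine (Finset.sum_le_sum (g := fun _ => 4 * μ.real (Arm n)) fun i hi => ?_).trans ?_
  · refine (measureReal_biUnion_finset_le _ _).trans ?_
    refine (Finset.sum_le_sum (g := fun _ => μ.real (Arm n)) fun k hk => ?_).trans ?_
    · exact (hm.pull_tr (hm.arm_local n) _).le
    · simp
  · rw [Finset.sum_const, nsmul_eq_mul, hI, Int.card_Icc]
    have : (((n : ℤ) + 1 - -n).toNat : ℝ) = 2 * n + 1 := by
      have : ((n : ℤ) + 1 - -n).toNat = 2 * n + 1 := by omega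
      rw [this]; push_cast; ring
    rw [this]
    have hn' : (1 : ℝ) ≤ n := by exact_mod_cast hn
    have := measureReal_nonneg (μ := μ) (s := Arm n)
    nlinarith

end IsModel
end DaC

namespace DaC

abbrev Col : Type := V → Prop

lemma blkR_meas : Measurable blkR := by
  refine measurable_pi_lambda _ fun a => measurable_pi_lambda _ fun b => ?_
  exact Measurable.and measurable_const ((measurable_pi_apply a).and (measurable_pi_apply b))
lemma whtR_meas : Measurable whtR := by
  refine measurable_pi_lambda _ fun a => measurable_pi_lambda _ fun b => ?_
  exact Measurable.and measurable_const ((measurable_pi_apply a).not.and (measurable_pi_apply b).not)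

lemma blkR_comp {g : V ≃ V} (hg : Iso g) (ξ : Col) : blkR (ξ ∘ g) = pull g (blkR ξ) := by
  funext a b; simp [blkR, pull, hg.sq]
lemma whtR_comp {g : V ≃ V} (hg : Iso g) (ξ : Col) : whtR (ξ ∘ g) = pull g (whtR ξ) := by
  funext a b; simp [whtR, pull, hg.star]

lemma CI.to_pull' {g : V ≃ V} {η : Cfg} {R R' : Set V} {u v : V} (h : CI η R u v)
    (hR : ∀ x ∈ R, g.symm x ∈ R') : CI (pull g η) R' (g.symm u) (g.symm v) :=
  Relation.ReflTransGen.lift g.symm (fun a b hab => ⟨by simpa [pull] using hab.1, hR _ hab.2.1, hR _ hab.2.2⟩) _ _ h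

/-- F, G configurations which never cross -/
structure NoCross (F G : Col → Cfg) : Prop where
  measF : Measurable F
  measG : Measurable G
  compF : ∀ (g : V ≃ V), Iso g → ∀ ξ : Col, F (ξ ∘ g) = pull g (F ξ)
  compG : ∀ (g : V ≃ V), Iso g → ∀ ξ : Col, G (ξ ∘ g) = pull g (G ξ)
  goodF : ∀ ξ, GoodCfg (F ξ)
  goodG : ∀ ξ, GoodCfg (G ξ)
  nb : ∀ (ξ : Col) (R1 R2 : Set V) (u v s t : V) (a b c d : ℤ), (∀ x ∈ R1, c ≤ x.2 ∧ x.2 ≤ d) →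
    (∀ x ∈ R2, a ≤ x.1 ∧ x.1 ≤ b) → CI (F ξ) R1 u v → u.1 ≤ a → b ≤ v.1 → a < b →
    CI (G ξ) R2 s t → s.2 ≤ c → d ≤ t.2 → c < d → False

lemma nocross_bw : NoCross blkR whtR := ⟨blkR_meas, whtR_meas, fun g hg => blkR_comp hg, fun g hg => whtR_comp hg,
  blkR_good, whtR_good, fun ξ R1 R2 u v s t a b c d h1 h2 h3 h4 h5 h6 h7 h8 h9 h10 =>
    no_both h1 h2 h3 h4 h5 h6 h7 h8 h9 h10⟩

lemma nocross_wb : NoCross whtR blkR := ⟨whtR_meas, blkR_meas, fun g hg => whtR_comp hg, fun g hg => blkR_comp hg,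
  whtR_good, blkR_good, fun ξ R1 R2 u v s t a b c d h1 h2 h3 h4 h5 h6 h7 h8 h9 h10 => by
    have k3 := h3.to_pull' (g := swp) (R' := swp.symm '' R1) (fun x hx => ⟨x, hx, rfl⟩)
    have k7 := h7.to_pull' (g := swp) (R' := swp.symm '' R2) (fun x hx => ⟨x, hx, rfl⟩)
    rw [← whtR_comp iso_swp] at k3
    rw [← blkR_comp iso_swp] at k7
    refine no_both (a := c) (b := d) (c := a) (d := b) ?_ ?_ k7 h8 h9 h10 k3 h4 h5 h6
    · rintro _ ⟨x, hx, rfl⟩; exact h2 x hx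
    · rintro _ ⟨x, hx, rfl⟩; exact h1 x hx⟩

lemma NoCross.top {F G : Col → Cfg} (h : NoCross F G) {ξ : Col} {n : ℤ} (hn : 0 < n) {u v : V}
    (hc : CI (G ξ) (bx 0 (2 * n)) u v) (hu : u.2 ≤ n) (hv : v.2 = 2 * n) :
    pull (tr (-2 * n, n)) (F ξ) ∉ LR 0 (4 * n) 0 n := by
  rintro ⟨s, t, hs, ht, hst⟩
  have hs : s.1 = 0 := hs
  have ht : t.1 = 4 * n := ht
  have h1 := hst.of_pull (R' := Box4 (-2 * n) (2 * n) n (2 * n)) (fun x hx => by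
    obtain ⟨h1, h2, h3, h4⟩ := hx
    refine ⟨?_, ?_, ?_, ?_⟩ <;> simp only [tr_1, tr_2] <;> omega)
  refine h.nb ξ _ _ _ _ _ _ (-2 * n) (2 * n) n (2 * n) (fun x hx => ⟨hx.2.2.1, hx.2.2.2⟩) (fun x hx => ?_) h1 ?_ ?_ ?_ hc hu hv.ge ?_
  · have := mem_bx.1 hx; simp only [Prod.fst_zero, Prod.snd_zero] at this; omega
  · simp only [tr_1]; omega
  · simp only [tr_1]; omega
  · omega
  · omega

lemma NoCross.ann {F G : Col → Cfg} (h : NoCross F G) {ξ : Col} {n : ℤ} (hn : 0 < n) (ha : G ξ ∈ Ann n) :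
    ∃ i : Fin 4, pull ((tr (-2 * n, n)).trans (![Equiv.refl V, rfy, swp, swp.trans (rfx 0)] i)) (F ξ) ∉ LR 0 (4 * n) 0 n := by
  obtain ⟨u, v, hu, hv, hc⟩ := ha
  have hv' : supN v = 2 * n := hv
  have hv2 : v.2 = 2 * n ∨ -v.2 = 2 * n ∨ v.1 = 2 * n ∨ -v.1 = 2 * n := by unfold supN at hv'; omega
  have hu := mem_bx.1 hu
  simp only [Prod.fst_zero, Prod.snd_zero] at hu
  have key : ∀ g : V ≃ V, Iso g → (∀ x ∈ bx 0 (2 * n), g.symm x ∈ bx 0 (2 * n)) → (g.symm u).2 ≤ n → (g.symm v).2 = 2 * n →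
      pull ((tr (-2 * n, n)).trans g) (F ξ) ∉ LR 0 (4 * n) 0 n := by
    intro g hg hb h1 h2
    have := h.top (ξ := ξ ∘ g) hn (u := g.symm u) (v := g.symm v) (by
      rw [h.compG g hg]; exact hc.to_pull' hb) h1 h2
    rw [h.compF g hg] at this
    exact this
  rcases hv2 with h2 | h2 | h2 | h2
  · exact ⟨0, key (Equiv.refl V) (fun _ _ => rfl) (fun x hx => hx) (by simp; omega) h2⟩
  · refine ⟨1, key rfy iso_rfy (fun x hx => ?_) ?_ h2⟩
    · have := mem_bx.1 hx; rw [mem_bx]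
      show _ ≤ x.1 ∧ x.1 ≤ _ ∧ _ ≤ -x.2 ∧ -x.2 ≤ _
      simp only [Prod.fst_zero, Prod.snd_zero] at *; omega
    · show -u.2 ≤ n; omega
  · refine ⟨2, key swp iso_swp (fun x hx => ?_) ?_ h2⟩
    · have := mem_bx.1 hx; rw [mem_bx]
      show _ ≤ x.2 ∧ x.2 ≤ _ ∧ _ ≤ x.1 ∧ x.1 ≤ _
      simp only [Prod.fst_zero, Prod.snd_zero] at *; omega
    · show u.1 ≤ n; omega
  · refine ⟨3, key (swp.trans (rfx 0)) (iso_swp.trans (iso_rfx 0)) (fun x hx => ?_) ?_ ?_⟩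
    · have := mem_bx.1 hx; rw [mem_bx]
      show _ ≤ x.2 ∧ x.2 ≤ _ ∧ _ ≤ 0 - x.1 ∧ 0 - x.1 ≤ _
      simp only [Prod.fst_zero, Prod.snd_zero] at *; omega
    · show 0 - u.1 ≤ n; omega
    · show 0 - v.1 = _; omega

lemma NoCross.small {F G : Col → Cfg} (h : NoCross F G) {lam : Measure Col} {e : ℕ → ℝ} (hm : IsModel (lam.map F) e)
    {θ : ℝ} (hθ : 0 < θ) (ha : ∀ n : ℕ, θ ≤ (lam.map F).real (Arm n)) {δ : ℝ} (hδ : 0 < δ) (n0 : ℕ) :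
    ∃ n : ℕ, n0 ≤ n ∧ (lam.map G).real (Ann n) ≤ δ := by
  classical
  obtain ⟨n, hn, hq⟩ := hm.Qthm hθ ha (ε := δ / 4) (by linarith) (n0 + 1)
  haveI := hm.prob
  haveI : IsProbabilityMeasure lam := by
    refine ⟨?_⟩
    have := hm.prob.measure_univ
    rwa [Measure.map_apply h.measF MeasurableSet.univ, Set.preimage_univ] at this
  refine ⟨n, by omega, ?_⟩
  have hn' : (0 : ℤ) < n := by omega
  rw [map_measureReal_apply h.measG (ann_local n).measurable]
  set g : Fin 4 → V ≃ V := fun i => (tr (-2 * n, n)).trans (![Equiv.refl V, rfy, swp, swp.trans (rfx 0)] i) with hg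
  have hgi : ∀ i, Iso (g i) := by
    intro i
    refine (iso_tr _).trans ?_
    fin_cases i
    · exact fun _ _ => rfl
    · exact iso_rfy
    · exact iso_swp
    · exact iso_swp.trans (iso_rfx 0)
  calc lam.real (G ⁻¹' Ann n) ≤ lam.real (⋃ i ∈ (Finset.univ : Finset (Fin 4)), F ⁻¹' (pull (g i) ⁻¹' LR 0 (4 * n) 0 n)ᶜ) := by
        refine measureReal_mono ?_ (measure_ne_top _ _)
        intro ξ hξ
        obtain ⟨i, hi⟩ := h.ann hn' hξ
        simp only [Set.mem_iUnion]
        exact ⟨i, Finset.mem_univ _, hi⟩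
    _ ≤ ∑ i : Fin 4, lam.real (F ⁻¹' (pull (g i) ⁻¹' LR 0 (4 * n) 0 n)ᶜ) := measureReal_biUnion_finset_le _ _
    _ ≤ ∑ i : Fin 4, δ / 4 := Finset.sum_le_sum fun i _ => by
        rw [← map_measureReal_apply h.measF ((LR_local _ _ _ _).pull (g i)).compl.measurable,
          hm.compl ((LR_local _ _ _ _).pull (g i)), hm.inv _ (hgi i) _ _ (LR_local _ _ _ _)]
        linarith
    _ = δ := by simp; ring

/-- small white annulus probability at one scale gives black percolation -/
lemma wsmall_perc {lam : Measure Col} {e : ℕ → ℝ} (hb : IsModel (lam.map blkR) e) (hw : IsModel (lam.map whtR) e)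
    {C : ℝ} (hC : 0 ≤ C) (he : ∀ k : ℕ, 0 < k → e k ≤ C / (k : ℝ) ^ 3) {n : ℕ} (hn : 0 < n)
    (hn0 : 800 * (41 : ℝ) ^ 8 * C ≤ n) (ha : (lam.map whtR).real (Ann n) ≤ 1 / (4 * 41 ^ 4)) :
    ∃ θ : ℝ, 0 < θ ∧ ∀ N : ℕ, θ ≤ (lam.map blkR).real (Arm N) := by
  classical
  haveI := hb.prob
  haveI := hw.prob
  haveI : IsProbabilityMeasure lam := by
    refine ⟨?_⟩
    have := hb.prob.measure_univ
    rwa [Measure.map_apply blkR_meas MeasurableSet.univ, Set.preimage_univ] at this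
  have hcr := hw.criterion hC he hn hn0 ha
  set μ := lam.map blkR with hμ
  set m : ℕ → ℕ := fun j => 10 ^ j * n with hmd
  have hm0 : ∀ j, 0 < m j := fun j => by positivity
  have hm1 : ∀ j, m (j + 1) = 10 * m j := fun j => by simp only [hmd]; ring
  have hmj : ∀ j, j ≤ m j := fun j => by
    have : j < 10 ^ j := Nat.lt_pow_self (by norm_num)
    simp only [hmd]; nlinarith
  set H : ℕ → Set Cfg := fun j => LR 0 (30 * m j) 0 (3 * m j) with hH
  have hHl : ∀ j, Local (fbox 0 (30 * m j) 0 (3 * m j)) (H j) := fun j => LR_local _ _ _ _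
  have hHc : ∀ j, μ.real (H j)ᶜ ≤ 31 * (1 / (4 * 41 ^ 4) * (1 / 2) ^ j) := by
    intro j
    have hmz : (0 : ℤ) < m j := by exact_mod_cast hm0 j
    rw [hμ, map_measureReal_apply blkR_meas (hHl j).compl.measurable]
    calc lam.real (blkR ⁻¹' (H j)ᶜ) ≤ lam.real (⋃ i ∈ Finset.range 31, whtR ⁻¹' (pull (tr ((m j : ℤ) * i, 0)) ⁻¹' Ann (m j))) := by
          refine measureReal_mono ?_ (measure_ne_top _ _)
          intro ξ hξ
          obtain ⟨s, t, hs, ht, hc⟩ := dual_crossing ξ (a := 0) (b := 30 * m j) (c := 0) (d := 3 * m j) (by omega) (by omega) (by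
            rintro ⟨u, v, hu, hv, hc⟩
            exact hξ ⟨u, v, hu, hv, hc⟩)
          have hst : s ≠ t := fun h => by subst h; omega
          obtain ⟨k1, k2, _, _⟩ := hc.mem_left hst
          have f1 := floor_near (m j) s.1 hmz
          have f2 := floor_bd (m j) s.1 30 hmz (by omega) (by omega)
          have f3 : 0 ≤ s.1 / m j := Int.ediv_nonneg k1 hmz.le
          simp only [Set.mem_iUnion]
          refine ⟨(s.1 / m j).toNat, Finset.mem_range.2 (by omega), ?_⟩
          refine ann_at (whtR_good ξ) hmz.le hc (mem_bx.2 ?_) ?_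
          · simp only [Int.toNat_of_nonneg f3]; omega
          · simp only; omega
      _ ≤ ∑ i ∈ Finset.range 31, lam.real (whtR ⁻¹' (pull (tr ((m j : ℤ) * i, 0)) ⁻¹' Ann (m j))) := measureReal_biUnion_finset_le _ _
      _ ≤ ∑ i ∈ Finset.range 31, 1 / (4 * 41 ^ 4) * (1 / 2) ^ j := Finset.sum_le_sum fun i _ => by
          rw [← map_measureReal_apply whtR_meas ((ann_local _).pull (tr _)).measurable, hw.pull_tr (ann_local _)]
          exact hcr j
      _ = _ := by simp
  refine ⟨1 / (2 * (3 * n + 1)), by positivity, fun N => ?_⟩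
  set B : Set Cfg := ⋃ j ∈ Finset.range (N + 1), ((H j)ᶜ ∪ (pull swp ⁻¹' H j)ᶜ) with hB
  have hBm : MeasurableSet B := by
    refine Finset.measurableSet_biUnion _ fun j _ => ((hHl j).compl.measurable).union ((hHl j).pull swp).compl.measurable
  have hBp : μ.real B ≤ 1 / 2 := by
    refine (measureReal_biUnion_finset_le _ _).trans ?_
    refine (Finset.sum_le_sum (g := fun j => 62 / (4 * 41 ^ 4) * (1 / 2 : ℝ) ^ j) fun j _ => ?_).trans ?_
    · refine (measureReal_union_le _ _).trans ?_
      have h2 : μ.real (pull swp ⁻¹' H j)ᶜ = μ.real (H j)ᶜ := by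
        rw [hb.compl (hHl j), hb.compl ((hHl j).pull swp), hb.inv _ iso_swp _ _ (hHl j)]
      rw [h2]
      have := hHc j
      linarith
    · rw [← Finset.mul_sum]
      have : ∑ j ∈ Finset.range (N + 1), (1 / 2 : ℝ) ^ j ≤ 2 := by
        rw [geom_sum_eq (by norm_num)]
        have : (0 : ℝ) ≤ (1 / 2) ^ (N + 1) := by positivity
        rw [div_le_iff_of_neg (by norm_num)]; linarith
      calc _ ≤ 62 / (4 * 41 ^ 4) * (2 : ℝ) := by gcongr
        _ ≤ 1 / 2 := by norm_num
  have hcov : μ.real Bᶜ ≤ (3 * n + 1) * μ.real (Arm N) := by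
    have h1 : μ.real Bᶜ ≤ μ.real (⋃ y ∈ Finset.range (3 * n + 1), pull (tr (0, (y : ℤ))) ⁻¹' Arm N) := by
      refine hb.mono fun η hg hη => ?_
      simp only [hB, Set.mem_compl_iff, Set.mem_iUnion, not_exists, Set.mem_union, not_or, not_not, Finset.mem_range] at hη
      have hη1 : ∀ j, ∃ u v : V, j < N + 1 → u.1 = 0 ∧ v.1 = 30 * m j ∧ CI η (Box4 0 (30 * m j) 0 (3 * m j)) u v := by
        intro j
        by_cases hj : j < N + 1
        · obtain ⟨u, v, hu, hv, hc⟩ := (hη j hj).1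
          exact ⟨u, v, fun _ => ⟨hu, hv, hc⟩⟩
        · exact ⟨0, 0, fun h => absurd h hj⟩
      have hη2 : ∀ j, ∃ s t : V, j < N + 1 → s.2 = 0 ∧ t.2 = 30 * m j ∧ CI η (Box4 0 (3 * m j) 0 (30 * m j)) s t := by
        intro j
        by_cases hj : j < N + 1
        · obtain ⟨u, v, hu, hv, hc⟩ := (hη j hj).2
          refine ⟨swp u, swp v, fun _ => ⟨hu, hv, hc.of_pull ?_⟩⟩
          rintro x ⟨h1, h2, h3, h4⟩
          exact ⟨h3, h4, h1, h2⟩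
        · exact ⟨0, 0, fun h => absurd h hj⟩
      choose u v huv using hη1
      choose s t hst using hη2
      have key : ∀ j, j < N + 1 → CI η Set.univ (u 0) (u j) := by
        intro j
        induction j with
        | zero => exact fun _ => .refl
        | succ j ih =>
          intro hj
          have hmz : (0 : ℤ) < m j := by exact_mod_cast hm0 j
          obtain ⟨a1, a2, a3⟩ := huv j (by omega)
          obtain ⟨b1, b2, b3⟩ := hst j (by omega)
          obtain ⟨c1, c2, c3⟩ := huv (j + 1) hj
          have e1 := hm1 j
          have x1 := meet_cross hg (a := 0) (b := 3 * m j) (c := 0) (d := 3 * m j) (fun x hx => ⟨hx.2.2.1, hx.2.2.2⟩) (fun x hx => ⟨hx.1, hx.2.1⟩)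
            a3 (by omega) (by omega) (by omega) b3 (by omega) (by omega) (by omega)
          have x2 := meet_cross hg (a := 0) (b := 3 * m j) (c := 0) (d := 3 * m (j + 1)) (fun x hx => ⟨hx.2.2.1, hx.2.2.2⟩) (fun x hx => ⟨hx.1, hx.2.1⟩)
            c3 (by omega) (by omega) (by omega) b3 (by omega) (by omega) (by omega)
          exact (ih (by omega)).trans ((x1.mono (Set.subset_univ _)).trans ((x2.mono (Set.subset_univ _)).symm hg))
      have hz := key N (by omega)
      obtain ⟨a1, a2, a3⟩ := huv N (by omega)
      obtain ⟨b1, b2, b3⟩ := huv 0 (by omega)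
      have hm00 : m 0 = n := by simp [hmd]
      rw [hm00] at b2 b3
      have hne : u 0 ≠ v 0 := fun h => by rw [h] at b1; omega
      obtain ⟨k1, k2, k3, k4⟩ := b3.mem_left hne
      simp only [Set.mem_iUnion]
      refine ⟨(u 0).2.toNat, Finset.mem_range.2 (by omega), ?_⟩
      have e2 : ((0 : ℤ), ((u 0).2.toNat : ℤ)) = u 0 := Prod.ext b1.symm (by simp; omega)
      show pull (tr ((0 : ℤ), ((u 0).2.toNat : ℤ))) η ∈ Arm N
      rw [e2]
      have := hmj N
      exact arm_at hg (by omega) (hz.trans (a3.mono (Set.subset_univ _))) (Or.inl (by omega))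
    refine h1.trans ((measureReal_biUnion_finset_le _ _).trans ?_)
    refine (Finset.sum_le_sum (g := fun _ => μ.real (Arm N)) fun i hi => ?_).trans ?_
    · exact (hb.pull_tr (hb.arm_local N) _).le
    · simp
  have h3 : μ.real Bᶜ = 1 - μ.real B := probReal_compl_eq_one_sub hBm
  rw [div_le_iff₀ (by positivity)]
  linarith

end DaC

namespace DaC

noncomputable def cl01 (p : ℝ) : ℝ := max 0 (min p 1)

lemma cl01_nonneg (p : ℝ) : 0 ≤ cl01 p := le_max_left _ _
lemma cl01_le (p : ℝ) : cl01 p ≤ 1 := max_le zero_le_one (min_le_right _ _)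
lemma cl01_eq {p : ℝ} (h : 0 ≤ p ∧ p ≤ 1) : cl01 p = p := by
  unfold cl01; rw [min_eq_left h.2, max_eq_right h.1]

noncomputable def bern (p : ℝ) : Measure Prop :=
  ENNReal.ofReal (cl01 p) • Measure.dirac True + ENNReal.ofReal (1 - cl01 p) • Measure.dirac False

lemma bern_true (p : ℝ) : bern p {True} = ENNReal.ofReal (cl01 p) := by
  simp [bern]

lemma bern_false (p : ℝ) : bern p {False} = ENNReal.ofReal (1 - cl01 p) := by
  simp [bern]

instance bern_prob (p : ℝ) : IsProbabilityMeasure (bern p) := by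
  constructor
  simp only [bern, Measure.coe_add, Measure.coe_smul, Pi.add_apply, Pi.smul_apply, measure_univ,
    smul_eq_mul, mul_one]
  rw [← ENNReal.ofReal_add (cl01_nonneg p) (by linarith [cl01_le p])]
  simp

noncomputable def Bm (ι : Type*) (p : ℝ) : Measure (ι → Prop) :=
  Measure.infinitePi (fun _ : ι => bern p)

instance Bm_prob (ι : Type*) (p : ℝ) : IsProbabilityMeasure (Bm ι p) := by
  unfold Bm; infer_instance

/-- dependence on finitely many coordinates -/
def Dep {ι β : Type*} (J : Finset ι) (f : (ι → Prop) → β) : Prop :=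
  ∀ x y : ι → Prop, (∀ i ∈ J, x i = y i) → f x = f y

lemma Dep.measurable {ι β : Type*} [MeasurableSpace β] {J : Finset ι} {f : (ι → Prop) → β}
    (h : Dep J f) : Measurable f := by
  have hρ : Measurable (fun (x : ι → Prop) (i : J) => x i) :=
    measurable_pi_lambda _ fun u => measurable_pi_apply (u : ι)
  let g : (J → Prop) → β := fun y => f (fun i => ∃ hi : i ∈ J, y ⟨i, hi⟩)
  have hg : Measurable g := measurable_of_finite g
  have : f = g ∘ (fun (x : ι → Prop) (i : J) => x i) := by
    funext x
    refine h _ _ fun i hi => ?_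
    simp [hi]
  rw [this]
  exact hg.comp hρ

variable {ι : Type*} [DecidableEq ι]

def cyl (J η : Finset ι) : Set (ι → Prop) := {x | ∀ i ∈ J, (x i ↔ i ∈ η)}

lemma cyl_measurable (J η : Finset ι) : MeasurableSet (cyl J η) := by
  have : Dep J (fun x => x ∈ cyl J η) := by
    intro x y h
    refine propext ⟨fun hx i hi => ?_, fun hx i hi => ?_⟩
    · rw [← h i hi]; exact hx i hi
    · rw [h i hi]; exact hx i hi
  exact measurableSet_setOf.2 this.measurable

lemma Bm_cyl {p : ℝ} (hp : 0 ≤ p ∧ p ≤ 1) {J η : Finset ι} (h : η ⊆ J) :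
    (Bm ι p).real (cyl J η) = (∏ i ∈ η, p) * ∏ i ∈ J \ η, (1 - p) := by
  classical
  have e : cyl J η = Set.pi (J : Set ι) (fun i => if i ∈ η then {True} else {False}) := by
    ext x
    simp only [cyl, Set.mem_ofPred_eq, Set.mem_pi, Finset.mem_coe]
    refine forall₂_congr fun i hi => ?_
    by_cases h : i ∈ η <;> simp [h]
  rw [e, Measure.real, Bm, Measure.infinitePi_pi]
  · rw [ENNReal.toReal_prod, ← Finset.prod_sdiff h, mul_comm]
    congr 1
    · refine Finset.prod_congr rfl fun i hi => ?_
      simp only [hi, if_true]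
      rw [bern_true, cl01_eq hp, ENNReal.toReal_ofReal hp.1]
    · refine Finset.prod_congr rfl fun i hi => ?_
      simp only [(Finset.mem_sdiff.1 hi).2, if_false]
      rw [bern_false, cl01_eq hp, ENNReal.toReal_ofReal (by linarith [hp.2])]
  · intro i hi
    exact (Set.toFinite _).measurableSet

lemma Dep.eq_sum {J : Finset ι} {f : (ι → Prop) → ℝ} (h : Dep J f) :
    f = fun x => ∑ η ∈ J.powerset, (cyl J η).indicator (fun _ => f (fun i => i ∈ η)) x := by
  classical
  funext x
  have hx : x ∈ cyl J (J.filter fun i => x i) := by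
    intro i hi; simp [hi]
  rw [Finset.sum_eq_single (J.filter fun i => x i)]
  · rw [Set.indicator_of_mem hx]
    refine h _ _ fun i hi => ?_
    simp [hi]
  · intro η hη hne
    refine Set.indicator_of_notMem (fun hx' => hne ?_) _
    ext i
    rw [Finset.mem_filter]
    refine ⟨fun hi => ?_, fun hi => (hx' i hi.1).1 hi.2⟩
    have hiJ := Finset.mem_powerset.1 hη hi
    exact ⟨hiJ, (hx' i hiJ).2 hi⟩
  · intro hn
    exact absurd (Finset.mem_powerset.2 (Finset.filter_subset _ _)) hn

lemma Bm_integral {p : ℝ} (hp : 0 ≤ p ∧ p ≤ 1) {J : Finset ι} {f : (ι → Prop) → ℝ} (h : Dep J f) :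
    ∫ x, f x ∂(Bm ι p) = wsum (fun _ => p) J (fun η => f (fun i => i ∈ η)) := by
  rw [h.eq_sum]
  rw [integral_finsetSum]
  · unfold wsum
    refine Finset.sum_congr rfl fun η hη => ?_
    rw [integral_indicator (cyl_measurable J η), setIntegral_const,
      Bm_cyl hp (Finset.mem_powerset.1 hη), smul_eq_mul]
    congr 1
    exact congrFun h.eq_sum _
  · intro η hη
    exact (integrable_const _).indicator (cyl_measurable J η)

lemma Dep.integrable {J : Finset ι} {f : (ι → Prop) → ℝ} (h : Dep J f) (p : ℝ) :
    Integrable f (Bm ι p) := by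
  rw [h.eq_sum]
  exact integrable_finsetSum _ fun η hη => (integrable_const _).indicator (cyl_measurable J η)

/-- indicator of a proposition -/
noncomputable def ind (A : Prop) : ℝ := by classical exact if A then 1 else 0

lemma ind_true {A : Prop} (h : A) : ind A = 1 := by simp [ind, h]
lemma ind_false {A : Prop} (h : ¬ A) : ind A = 0 := by simp [ind, h]
lemma ind_nonneg (A : Prop) : 0 ≤ ind A := by
  by_cases h : A <;> simp [ind, h]
lemma ind_le_one (A : Prop) : ind A ≤ 1 := by
  by_cases h : A <;> simp [ind, h]
lemma ind_mono {A B : Prop} (h : A → B) : ind A ≤ ind B := by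
  by_cases hA : A
  · rw [ind_true hA, ind_true (h hA)]
  · rw [ind_false hA]; exact ind_nonneg _
lemma ind_and (A B : Prop) : ind (A ∧ B) = ind A * ind B := by
  by_cases hA : A <;> by_cases hB : B <;> simp [ind, hA, hB]
lemma ind_not (A : Prop) : ind (¬ A) = 1 - ind A := by
  by_cases hA : A <;> simp [ind, hA]

lemma real_eq_integral_ind {Ω : Type*} [MeasurableSpace Ω] (μ : Measure Ω) {A : Set Ω}
    (hA : MeasurableSet A) : μ.real A = ∫ x, ind (x ∈ A) ∂μ := by
  classical
  have : (fun x => ind (x ∈ A)) = A.indicator (fun _ => (1:ℝ)) := by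
    funext x
    by_cases h : x ∈ A
    · rw [ind_true h, Set.indicator_of_mem h]
    · rw [ind_false h, Set.indicator_of_notMem h]
  rw [this, integral_indicator hA, setIntegral_const, smul_eq_mul, mul_one]

lemma Bm_real {p : ℝ} (hp : 0 ≤ p ∧ p ≤ 1) {J : Finset ι} {A : Set (ι → Prop)}
    (h : Dep J (fun x => x ∈ A)) :
    (Bm ι p).real A = wsum (fun _ => p) J (fun η => ind ((fun i => i ∈ η) ∈ A)) := by
  have hA : MeasurableSet A := measurableSet_setOf.2 h.measurable
  rw [real_eq_integral_ind _ hA]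
  exact Bm_integral hp (f := fun x => ind (x ∈ A)) fun x y hh => congrArg ind (h x y hh)

/-! product -/

abbrev Om : Type := (Sym2 V → Prop) × (V → Prop)

noncomputable def PP (p r : ℝ) : Measure Om := (Bm (Sym2 V) p).prod (Bm V r)

instance PP_prob (p r : ℝ) : IsProbabilityMeasure (PP p r) := by unfold PP; infer_instance

def Dep2 {β : Type*} (J : Finset (Sym2 V)) (K : Finset V) (f : Om → β) : Prop :=
  ∀ x y : Om, (∀ i ∈ J, x.1 i = y.1 i) → (∀ i ∈ K, x.2 i = y.2 i) → f x = f y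

lemma Dep2.measurable {β : Type*} [MeasurableSpace β] {J : Finset (Sym2 V)} {K : Finset V}
    {f : Om → β} (h : Dep2 J K f) : Measurable f := by
  have hρ : Measurable (fun (x : Om) => ((fun i : J => x.1 i, fun i : K => x.2 i) :
      (J → Prop) × (K → Prop))) := by
    refine Measurable.prodMk ?_ ?_
    · exact measurable_pi_lambda _ fun u => (measurable_pi_apply (u : Sym2 V)).comp measurable_fst
    · exact measurable_pi_lambda _ fun u => (measurable_pi_apply (u : V)).comp measurable_snd
  let g : (J → Prop) × (K → Prop) → β := fun y =>
    f (fun i => ∃ hi : i ∈ J, y.1 ⟨i, hi⟩, fun i => ∃ hi : i ∈ K, y.2 ⟨i, hi⟩)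
  have hg : Measurable g := measurable_of_finite g
  have : f = g ∘ (fun (x : Om) => ((fun i : J => x.1 i, fun i : K => x.2 i) :
      (J → Prop) × (K → Prop))) := by
    funext x
    refine h _ _ (fun i hi => ?_) (fun i hi => ?_) <;> simp [hi]
  rw [this]
  exact hg.comp hρ

lemma PP_real {p r : ℝ} (hp : 0 ≤ p ∧ p ≤ 1) (hr : 0 ≤ r ∧ r ≤ 1) {J : Finset (Sym2 V)}
    {K : Finset V} {A : Set Om} (h : Dep2 J K (fun x => x ∈ A)) :
    (PP p r).real A = wsum (fun _ => p) J (fun η => wsum (fun _ => r) K (fun B =>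
      ind (((fun i => i ∈ η), (fun i => i ∈ B)) ∈ A))) := by
  have hA : MeasurableSet A := measurableSet_setOf.2 h.measurable
  rw [real_eq_integral_ind _ hA, PP, integral_prod]
  · have : ∀ x : Sym2 V → Prop, ∫ y, ind ((x, y) ∈ A) ∂(Bm V r) =
        wsum (fun _ => r) K (fun B => ind ((x, (fun i => i ∈ B)) ∈ A)) := fun x =>
      Bm_integral hr (f := fun y => ind ((x, y) ∈ A)) fun y z hh =>
        congrArg ind (h (x, y) (x, z) (fun _ _ => rfl) hh)
    simp_rw [this]
    refine Bm_integral hp (f := fun x => wsum (fun _ => r) K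
      (fun B => ind ((x, (fun i => i ∈ B)) ∈ A))) fun x y hh => ?_
    refine wsum_congr fun B _ => congrArg ind (h _ _ hh fun _ _ => rfl)
  · refine Integrable.of_bound (C := 1) ?_ (Filter.Eventually.of_forall fun x => ?_)
    · have : Measurable (fun x : Om => ind (x ∈ A)) :=
        Dep2.measurable (J := J) (K := K) fun x y h1 h2 => congrArg ind (h x y h1 h2)
      exact this.aestronglyMeasurable
    · rw [Real.norm_of_nonneg (ind_nonneg _)]
      exact ind_le_one _

end DaC

namespace DaC

def bondR (ω : Sym2 V → Prop) (a b : V) : Prop := SqAdj a b ∧ ω s(a, b)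

lemma bondR_good (ω : Sym2 V → Prop) : GoodCfg (bondR ω) where
  symm := fun a b h => ⟨h.1.symm, by rw [Sym2.eq_swap]; exact h.2⟩
  star := fun a b h => h.1.star
  corner := fun a b c d h h' => absurd h.1 h'

lemma bondR_meas : Measurable bondR := by
  refine measurable_pi_lambda _ fun a => measurable_pi_lambda _ fun b => ?_
  exact Measurable.and measurable_const (measurable_pi_apply _)

lemma bondR_comp {g : V ≃ V} (hg : Iso g) (ω : Sym2 V → Prop) :
    bondR (ω ∘ Sym2.map g) = pull g (bondR ω) := by
  funext a b; simp [bondR, pull, hg.sq]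

lemma bond_dep {D : Finset V} {A : Set Cfg} (h : Local D A) : Dep D.sym2 (fun ω => bondR ω ∈ A) := by
  have : ∀ x y : Sym2 V → Prop, (∀ i ∈ D.sym2, x i = y i) → bondR x ∈ A → bondR y ∈ A := by
    intro x y hxy
    refine h _ _ fun u hu v hv => ?_
    unfold bondR
    rw [hxy s(u, v) (Finset.mk_mem_sym2_iff.2 ⟨hu, hv⟩)]
  exact fun x y hxy => propext ⟨this x y hxy, this y x fun i hi => (hxy i hi).symm⟩

/-- canonical representative -/
noncomputable def crep (S : Set V) : V := (Encodable.decode (α := V) (sInf (Encodable.encode '' S))).getD 0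

lemma cr_spec {S : Set V} (h : S.Nonempty) : ∃ w ∈ S, Encodable.encode w = sInf (Encodable.encode '' S) :=
  Nat.sInf_mem (h.image _)

lemma cr_of {S : Set V} {w : V} (h : Encodable.encode w = sInf (Encodable.encode '' S)) : crep S = w := by
  unfold crep; rw [← h, Encodable.encodek]; rfl

lemma cr_mem {S : Set V} (h : S.Nonempty) : crep S ∈ S := by
  obtain ⟨w, hw, he⟩ := cr_spec h
  rw [cr_of he]; exact hw

lemma cr_iff {S : Set V} (h : S.Nonempty) (w : V) :
    crep S = w ↔ (w ∈ S ∧ ∀ u, u ∈ S → Encodable.encode w ≤ Encodable.encode u) := by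
  constructor
  · rintro rfl
    refine ⟨cr_mem h, fun u hu => ?_⟩
    obtain ⟨w, hw, he⟩ := cr_spec h
    rw [cr_of he, he]
    exact Nat.sInf_le ⟨u, hu, rfl⟩
  · rintro ⟨h1, h2⟩
    refine cr_of (le_antisymm ?_ (Nat.sInf_le ⟨w, h1, rfl⟩))
    obtain ⟨u, hu, he⟩ := cr_spec h
    rw [← he]; exact h2 u hu

def clu (η : Cfg) (R : Set V) (v : V) : Set V := {w | CI η R v w}

lemma clu_ne (η : Cfg) (R : Set V) (v : V) : (clu η R v).Nonempty := ⟨v, .refl⟩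

lemma CI.fin {η : Cfg} {u v : V} (h : CI η Set.univ u v) : ∃ n : ℕ, CI η (bx 0 n) u v := by
  induction h with
  | refl => exact ⟨0, .refl⟩
  | @tail b c hab hbc ih =>
    obtain ⟨n, hn⟩ := ih
    refine ⟨n + (supN b).toNat + (supN c).toNat, Relation.ReflTransGen.tail (hn.mono ?_) ⟨hbc.1, ?_, ?_⟩⟩
    · intro x hx
      have := supN_le.2 (Finset.mem_coe.1 hx)
      exact supN_le.1 (by push_cast; omega)
    · exact supN_le.1 (by push_cast; omega)
    · exact supN_le.1 (by push_cast; omega)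

lemma meas_CI (u v : V) : MeasurableSet {η : Cfg | CI η Set.univ u v} := by
  have : {η : Cfg | CI η Set.univ u v} = ⋃ n : ℕ, CE (bx 0 n) {u} {v} := by
    ext η
    rw [Set.mem_iUnion]
    constructor
    · intro h
      obtain ⟨n, hn⟩ := CI.fin h
      exact ⟨n, u, v, rfl, rfl, hn⟩
    · rintro ⟨n, a, b, ha, hb, hc⟩
      rw [Set.mem_singleton_iff.1 ha, Set.mem_singleton_iff.1 hb] at hc
      exact hc.mono (Set.subset_univ _)
  rw [this]
  exact MeasurableSet.iUnion fun n => (CE_local (D := bx 0 n) (le_refl _)).measurable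

lemma meas_cr (v w : V) : MeasurableSet {η : Cfg | crep (clu η Set.univ v) = w} := by
  have : {η : Cfg | crep (clu η Set.univ v) = w} = {η : Cfg | CI η Set.univ v w} ∩
      ⋂ u : V, ({η : Cfg | CI η Set.univ v u}ᶜ ∪ {η | Encodable.encode w ≤ Encodable.encode u}) := by
    ext η
    simp only [Set.mem_ofPred_eq, cr_iff (clu_ne _ _ _), Set.mem_inter_iff, Set.mem_iInter,
      Set.mem_union, Set.mem_compl_iff, imp_iff_not_or]
    rfl
  rw [this]
  exact (meas_CI v w).inter (MeasurableSet.iInter fun u =>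
    (meas_CI v u).compl.union (MeasurableSet.const _))

/-- the colouring, clusters taken inside R -/
noncomputable def xi (R : Set V) (x : Om) : Col := fun v => x.2 (crep (clu (bondR x.1) R v))

lemma meas_xi : Measurable (xi Set.univ) := by
  refine measurable_pi_lambda _ fun v => ?_
  refine measurableSet_setOf.1 ?_
  have : {x : Om | xi Set.univ x v} = ⋃ w : V, (fun x : Om => bondR x.1) ⁻¹' {η : Cfg | crep (clu η Set.univ v) = w} ∩
      {x : Om | x.2 w} := by
    ext x
    simp [xi]
  rw [this]
  refine MeasurableSet.iUnion fun w => MeasurableSet.inter ?_ ?_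
  · exact (bondR_meas.comp measurable_fst) (meas_cr v w)
  · exact measurableSet_setOf.2 ((measurable_pi_apply w).comp measurable_snd)

noncomputable def lam (p r : ℝ) : Measure Col := (PP p r).map (xi Set.univ)

instance lam_prob (p r : ℝ) : IsProbabilityMeasure (lam p r) :=
  Measure.isProbabilityMeasure_map meas_xi.aemeasurable

lemma lam_real (p r : ℝ) {A : Set Col} (hA : MeasurableSet A) :
    (lam p r).real A = (PP p r).real {x | xi Set.univ x ∈ A} := by
  rw [lam, map_measureReal_apply meas_xi hA]; rfl

def CLocal (D : Finset V) (A : Set Col) : Prop :=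
  ∀ ξ ξ' : Col, (∀ v ∈ D, (ξ v ↔ ξ' v)) → ξ ∈ A → ξ' ∈ A

lemma CLocal.iff {D : Finset V} {A : Set Col} (h : CLocal D A) {ξ ξ' : Col} (hh : ∀ v ∈ D, (ξ v ↔ ξ' v)) :
    ξ ∈ A ↔ ξ' ∈ A := ⟨h _ _ hh, h _ _ fun v hv => (hh v hv).symm⟩

lemma CLocal.compl {D : Finset V} {A : Set Col} (h : CLocal D A) : CLocal D Aᶜ :=
  fun ξ ξ' hh hξ hξ' => hξ ((h.iff hh).2 hξ')

lemma CLocal.inter {D : Finset V} {A B : Set Col} (h : CLocal D A) (h' : CLocal D B) : CLocal D (A ∩ B) :=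
  fun ξ ξ' hh hξ => ⟨h _ _ hh hξ.1, h' _ _ hh hξ.2⟩

lemma CLocal.mono {D D' : Finset V} {A : Set Col} (h : CLocal D A) (hD : D ⊆ D') : CLocal D' A :=
  fun ξ ξ' hh => h _ _ fun v hv => hh v (hD hv)

lemma CLocal.measurable {D : Finset V} {A : Set Col} (h : CLocal D A) : MeasurableSet A := by
  have : Dep D (fun x : V → Prop => x ∈ A) := fun x y hxy =>
    propext (h.iff fun v hv => by rw [hxy v hv])
  exact measurableSet_setOf.2 this.measurable

/-- bond one-arm probability -/
noncomputable def rho (p : ℝ) (h : ℕ) : ℝ := (Bm (Sym2 V) p).real {ω | bondR ω ∈ Arm h}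

lemma rho_nonneg (p : ℝ) (h : ℕ) : 0 ≤ rho p h := measureReal_nonneg

lemma Bm_inj {α β : Type*} {f : α → β} (hf : Function.Injective f) (p : ℝ) :
    (Bm β p).map (fun ω i => ω (f i)) = Bm α p := Measure.map_infinitePi_infinitePi_of_inj hf

lemma bond_inv {g : V ≃ V} (hg : Iso g) (p : ℝ) {A : Set Cfg} (hA : MeasurableSet A) :
    (Bm (Sym2 V) p).real {ω | pull g (bondR ω) ∈ A} = (Bm (Sym2 V) p).real {ω | bondR ω ∈ A} := by
  conv_rhs => rw [← Bm_inj (Sym2.map.injective g.injective) p]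
  rw [map_measureReal_apply]
  · simp_rw [← bondR_comp hg]; rfl
  · exact measurable_pi_lambda _ fun i => measurable_pi_apply _
  · exact bondR_meas hA

lemma Arm_meas (n : ℤ) : MeasurableSet (Arm n) := (CE_local (D := bx 0 n) (le_refl _)).measurable

/-- the event that the cluster of v leaves R -/
def Bad (D : Finset V) (R : Set V) : Set Om := {x | ∃ v ∈ D, ¬ clu (bondR x.1) Set.univ v ⊆ R}

noncomputable def nbh (D : Finset V) (h : ℕ) : Finset V := D.biUnion fun v => bx v h

lemma PP_fst (p r : ℝ) {A : Set (Sym2 V → Prop)} (hA : MeasurableSet A) :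
    (PP p r).real {x | x.1 ∈ A} = (Bm (Sym2 V) p).real A := by
  have : (PP p r).map Prod.fst = Bm (Sym2 V) p := by
    rw [PP, Measure.map_fst_prod]; simp
  rw [← this, map_measureReal_apply measurable_fst hA]; rfl

lemma bad_le (p r : ℝ) (D : Finset V) (h : ℕ) :
    (PP p r).real (Bad D (nbh D h)) ≤ D.card * rho p h := by
  have h1 : Bad D (nbh D h) ⊆ ⋃ v ∈ D, {x : Om | x.1 ∈ {ω | pull (tr v) (bondR ω) ∈ Arm h}} := by
    rintro x ⟨v, hv, hn⟩
    rw [Set.not_subset] at hn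
    obtain ⟨w, hw, hw'⟩ := hn
    refine Set.mem_iUnion₂.2 ⟨v, hv, ?_⟩
    have : w ∉ bx v h := fun hh => hw' (Finset.mem_coe.2 (Finset.mem_biUnion.2 ⟨v, hv, hh⟩))
    rw [mem_bx] at this
    exact arm_at (bondR_good _) (by omega) hw (by omega)
  refine (measureReal_mono h1 (measure_ne_top _ _)).trans ((measureReal_biUnion_finset_le _ _).trans ?_)
  rw [← nsmul_eq_mul]
  refine Finset.sum_le_card_nsmul _ _ _ fun v hv => ?_
  have hm : MeasurableSet {ω | pull (tr v) (bondR ω) ∈ Arm h} := by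
    simp_rw [← bondR_comp (iso_tr v)]
    exact (bondR_meas.comp (measurable_pi_lambda _ fun i => measurable_pi_apply _)) (Arm_meas _)
  rw [PP_fst p r hm, bond_inv (iso_tr v) p (Arm_meas _)]; rfl

lemma xi_agree {D : Finset V} {R : Set V} {x : Om} (h : x ∉ Bad D R) : ∀ v ∈ D,
    (xi Set.univ x v ↔ xi R x v) := by
  intro v hv
  have hs : clu (bondR x.1) Set.univ v ⊆ R := by
    by_contra hc; exact h ⟨v, hv, hc⟩
  have : clu (bondR x.1) Set.univ v = clu (bondR x.1) R v := by
    refine Set.Subset.antisymm ?_ ?_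
    · intro w hw'
      have hw : CI (bondR x.1) Set.univ v w := hw'
      clear hw'
      show CI (bondR x.1) R v w
      induction hw with
      | refl => exact .refl
      | @tail b c hab hbc ih => exact ih.tail ⟨hbc.1, hs hab, hs (Relation.ReflTransGen.tail hab hbc)⟩
    · intro w hw
      exact CI.mono (Set.subset_univ _) hw
  unfold xi; rw [this]

lemma xi_approx (p r : ℝ) {D : Finset V} {A : Set Col} (hA : CLocal D A) (h : ℕ) :
    |(lam p r).real A - (PP p r).real {x | xi (nbh D h) x ∈ A}| ≤ D.card * rho p h := by
  rw [lam_real p r hA.measurable]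
  have key : ∀ x : Om, x ∉ Bad D (nbh D h) → (xi Set.univ x ∈ A ↔ xi (nbh D h) x ∈ A) :=
    fun x hx => hA.iff (xi_agree hx)
  have hb := bad_le p r D h
  rw [abs_le]
  constructor
  · have : (PP p r).real {x | xi (nbh D h) x ∈ A} ≤
        (PP p r).real ({x | xi Set.univ x ∈ A} ∪ Bad D (nbh D h)) := measureReal_mono fun x hx => by
      by_cases hb : x ∈ Bad D (nbh D h)
      · exact Or.inr hb
      · exact Or.inl ((key x hb).2 hx)
    have := this.trans (measureReal_union_le _ _)
    linarith
  · have : (PP p r).real {x | xi Set.univ x ∈ A} ≤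
        (PP p r).real ({x | xi (nbh D h) x ∈ A} ∪ Bad D (nbh D h)) := measureReal_mono fun x hx => by
      by_cases hb : x ∈ Bad D (nbh D h)
      · exact Or.inr hb
      · exact Or.inl ((key x hb).1 hx)
    have := this.trans (measureReal_union_le _ _)
    linarith

lemma subset_nbh (D : Finset V) (h : ℕ) : D ⊆ nbh D h := fun v hv =>
  Finset.mem_biUnion.2 ⟨v, hv, mem_bx.2 (by omega)⟩

lemma clu_sub (η : Cfg) {R : Finset V} {v : V} (hv : v ∈ R) : clu η R v ⊆ R := fun w hw => by
  rcases hw.cases_tail with h | ⟨b, _, h⟩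
  · rw [h]; exact hv
  · exact h.2.2

lemma xi_dep {D R : Finset V} (hD : D ⊆ R) {A : Set Col} (hA : CLocal D A) :
    Dep2 R.sym2 R (fun x => x ∈ {x : Om | xi R x ∈ A}) := by
  have : ∀ x y : Om, (∀ i ∈ R.sym2, x.1 i = y.1 i) → (∀ i ∈ R, x.2 i = y.2 i) → xi R x ∈ A → xi R y ∈ A := by
    intro x y h1 h2
    refine hA _ _ fun v hv => ?_
    have hc : clu (bondR x.1) R v = clu (bondR y.1) R v := by
      have : ∀ x y : Om, (∀ i ∈ R.sym2, x.1 i = y.1 i) → clu (bondR x.1) R v ⊆ clu (bondR y.1) R v := by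
        intro x y h1 w hw
        refine CI.lift_local (fun a ha b hb hab => ⟨hab.1, ?_⟩) hw
        rw [← h1 _ (Finset.mk_mem_sym2_iff.2 ⟨ha, hb⟩)]; exact hab.2
      exact Set.Subset.antisymm (this x y h1) (this y x fun i hi => (h1 i hi).symm)
    unfold xi
    rw [hc, h2 _ (clu_sub _ (hD hv) (cr_mem (clu_ne _ _ _)))]
  exact fun x y h1 h2 => propext ⟨this x y h1 h2, this y x (fun i hi => (h1 i hi).symm)
    fun i hi => (h2 i hi).symm⟩

end DaC

namespace DaC

def CInc (A : Set Col) : Prop := ∀ ξ ξ' : Col, (∀ v, ξ v → ξ' v) → ξ ∈ A → ξ' ∈ A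

noncomputable def sqE (R : Finset V) : Finset (Sym2 V) := by
  classical exact R.sym2.filter (fun e => ∃ a b, e = s(a, b) ∧ SqAdj a b)

lemma mem_sqE {R : Finset V} {a b : V} : s(a, b) ∈ sqE R ↔ (a ∈ R ∧ b ∈ R) ∧ SqAdj a b := by
  classical
  rw [sqE, Finset.mem_filter, Finset.mk_mem_sym2_iff]
  refine and_congr_right fun _ => ⟨?_, fun h => ⟨a, b, rfl, h⟩⟩
  rintro ⟨c, d, he, h⟩
  rcases Sym2.eq_iff.1 he with ⟨rfl, rfl⟩ | ⟨rfl, rfl⟩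
  · exact h
  · exact h.symm

lemma sqE_in (R : Finset V) : EIn R (sqE R) := by
  intro e he v hv
  induction e using Sym2.ind with
  | _ a b =>
    have h := (mem_sqE.1 he).1
    rcases Sym2.mem_iff.1 hv with rfl | rfl
    · exact h.1
    · exact h.2

lemma clu_Cn {R : Finset V} {η : Finset (Sym2 V)} (hη : η ⊆ sqE R) {v : V} :
    clu (bondR (fun i => i ∈ η)) R v = {w | Cn η v w} := by
  ext w
  constructor
  · intro h
    exact Relation.ReflTransGen.mono (fun a b hab => hab.1.2) _ _ h
  · intro h
    exact Relation.ReflTransGen.mono (fun a b hab => by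
      have := mem_sqE.1 (hη hab)
      exact ⟨⟨this.2, hab⟩, this.1⟩) _ _ h

lemma xi_dep' {D R : Finset V} (hD : D ⊆ R) {A : Set Col} (hA : CLocal D A) :
    Dep2 (sqE R) R (fun x => x ∈ {x : Om | xi R x ∈ A}) := by
  classical
  intro x y h1 h2
  have key : ∀ x : Om, x ∈ {x : Om | xi R x ∈ A} ↔
      ((fun i => i ∈ sqE R ∧ x.1 i, x.2) : Om) ∈ {x : Om | xi R x ∈ A} := by
    intro x
    refine hA.iff fun v hv => ?_
    have : clu (bondR x.1) R v = clu (bondR (fun i => i ∈ sqE R ∧ x.1 i)) R v := by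
      refine Set.Subset.antisymm ?_ ?_
      · intro w hw
        exact CI.lift_local (fun a ha b hb hab => ⟨hab.1, mem_sqE.2 ⟨⟨ha, hb⟩, hab.1⟩, hab.2⟩) hw
      · intro w hw
        exact CI.lift_local (fun a ha b hb hab => ⟨hab.1, hab.2.2⟩) hw
    unfold xi; rw [this]
  refine propext ((key x).trans (Iff.trans ?_ (key y).symm))
  refine iff_of_eq (xi_dep hD hA _ _ (fun i hi => ?_) h2)
  by_cases h : i ∈ sqE R
  · simp only [h, true_and]; exact h1 i h
  · simp [h]

/-- finite volume formula -/
lemma xi_real {p r : ℝ} (hp : 0 ≤ p ∧ p ≤ 1) (hr : 0 ≤ r ∧ r ≤ 1) {D R : Finset V} (hD : D ⊆ R)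
    {A : Set Col} (hA : CLocal D A) :
    (PP p r).real {x | xi R x ∈ A} = wsum (fun _ => p) (sqE R) (fun η => wsum (fun _ => r) R
        (fun B => ind ((fun v => v ∈ {v | v ∈ R ∧ crep {w | Cn η v w} ∈ B}) ∈ A))) := by
  rw [PP_real hp hr (xi_dep' hD hA)]
  refine wsum_congr fun η hη => wsum_congr fun B hB => congrArg ind (propext ?_)
  refine hA.iff fun v hv => ?_
  simp only [xi, Set.mem_ofPred_eq]
  rw [clu_Cn hη]
  exact ⟨fun h => ⟨hD hv, h⟩, fun h => h.2⟩

lemma ind_good {A : Set Col} (h : CInc A) : Good (fun X : Set V => ind ((fun v => v ∈ X) ∈ A)) :=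
  ⟨fun X Y hXY => ind_mono (h _ _ fun v hv => hXY hv), fun X => ind_nonneg _, fun X => ind_le_one _⟩

lemma tends {c : ℝ} {u : ℕ → ℝ} {x : ℝ} {f : ℕ → ℝ} (hf : Filter.Tendsto f Filter.atTop (nhds 0))
    (h : ∀ n, |x - u n| ≤ c * f n) : Filter.Tendsto u Filter.atTop (nhds x) := by
  have h1 : Filter.Tendsto (fun n => c * f n) Filter.atTop (nhds 0) := by
    simpa using hf.const_mul c
  have h2 : Filter.Tendsto (fun n => x - u n) Filter.atTop (nhds 0) :=
    squeeze_zero_norm (fun n => by rw [Real.norm_eq_abs]; exact h n) h1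
  have := h2.const_sub x
  simpa using this

section model
variable {p r : ℝ} (hp : 0 ≤ p ∧ p ≤ 1) (hρ : Filter.Tendsto (rho p) Filter.atTop (nhds 0))
include hp hρ

lemma xi_tends {D : Finset V} {A : Set Col} (hA : CLocal D A) :
    Filter.Tendsto (fun h => (PP p r).real {x | xi (nbh D h) x ∈ A}) Filter.atTop
      (nhds ((lam p r).real A)) := tends hρ (xi_approx p r hA)

lemma lam_fkg (hr : 0 ≤ r ∧ r ≤ 1) {D : Finset V} {A B : Set Col} (hA : CLocal D A) (hB : CLocal D B)
    (iA : CInc A) (iB : CInc B) :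
    (lam p r).real A * (lam p r).real B ≤ (lam p r).real (A ∩ B) := by
  refine le_of_tendsto_of_tendsto ((xi_tends hp hρ hA).mul (xi_tends hp hρ hB))
    (xi_tends hp hρ (hA.inter hB)) (Filter.Eventually.of_forall fun h => ?_)
  have hD := subset_nbh D h
  simp only
  rw [xi_real hp hr hD hA, xi_real hp hr hD hB, xi_real hp hr hD (hA.inter hB)]
  refine (fkg_finite (c := crep) (W := nbh D h) (fun C hC => cr_mem hC) hp hr (ind_good iA) (ind_good iB)
    (sqE_in _)).trans (le_of_eq ?_)
  refine wsum_congr fun η hη => wsum_congr fun B hB => ?_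
  rw [← ind_and]; rfl

lemma lam_fkg' (hr : 0 ≤ r ∧ r ≤ 1) {D : Finset V} {A B : Set Col} (hA : CLocal D A) (hB : CLocal D B)
    (iA : CInc Aᶜ) (iB : CInc Bᶜ) :
    (lam p r).real A * (lam p r).real B ≤ (lam p r).real (A ∩ B) := by
  have h := lam_fkg hp hρ hr hA.compl hB.compl iA iB
  rw [probReal_compl_eq_one_sub hA.measurable, probReal_compl_eq_one_sub hB.measurable,
    ← Set.compl_union, probReal_compl_eq_one_sub (hA.measurable.union hB.measurable)] at h
  have := measureReal_union_add_inter (μ := lam p r) (s := A) hB.measurable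
  nlinarith

lemma lam_mono {s : ℝ} (hr : 0 ≤ r) (hrs : r ≤ s) (hs : s ≤ 1) {D : Finset V} {A : Set Col}
    (hA : CLocal D A) (iA : CInc A) : (lam p r).real A ≤ (lam p s).real A := by
  refine le_of_tendsto_of_tendsto (xi_tends hp hρ hA) (xi_tends hp hρ hA)
    (Filter.Eventually.of_forall fun h => ?_)
  have hD := subset_nbh D h
  simp only
  rw [xi_real hp ⟨hr, hrs.trans hs⟩ hD hA, xi_real hp ⟨hr.trans hrs, hs⟩ hD hA]
  refine wsum_le_wsum (fun _ => hp) fun η hη => ?_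
  refine wsum_mono_p (fun _ => hr) (fun _ => hrs) (fun _ => hs) fun B B' hBB => ?_
  refine ind_mono (iA _ _ fun v hv => ⟨hv.1, hBB hv.2⟩)

lemma lam_cont {D : Finset V} {A : Set Col} (hA : CLocal D A) :
    ContinuousOn (fun r => (lam p r).real A) (Set.Icc 0 1) := by
  have hu : TendstoUniformlyOn (fun (h : ℕ) r => (PP p r).real {x | xi (nbh D h) x ∈ A})
      (fun r => (lam p r).real A) Filter.atTop (Set.Icc 0 1) := by
    rw [Metric.tendstoUniformlyOn_iff]
    intro ε hε
    have h1 : Filter.Tendsto (fun n => D.card * rho p n) Filter.atTop (nhds 0) := by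
      simpa using hρ.const_mul (D.card : ℝ)
    filter_upwards [h1.eventually (gt_mem_nhds hε)] with n hn r hr
    exact lt_of_le_of_lt (xi_approx p r hA n) hn
  refine hu.continuousOn (Filter.Frequently.of_forall fun h => ?_)
  refine ContinuousOn.congr (f := fun r => wsum (fun _ => p) (sqE (nbh D h)) (fun η => wsum (fun _ => r) (nbh D h)
        (fun B => ind ((fun v => v ∈ {v | v ∈ (nbh D h) ∧ crep {w | Cn η v w} ∈ B}) ∈ A)))) ?_
    (fun r hr => xi_real hp hr (subset_nbh D h) hA)
  refine Continuous.continuousOn ?_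
  unfold wsum
  fun_prop

end model

lemma PP_indep {p r : ℝ} (hp : 0 ≤ p ∧ p ≤ 1) (hr : 0 ≤ r ∧ r ≤ 1) {J J' : Finset (Sym2 V)}
    {K K' : Finset V} {A A' : Set Om} (h : Dep2 J K (fun x => x ∈ A)) (h' : Dep2 J' K' (fun x => x ∈ A'))
    (hJ : Disjoint J J') (hK : Disjoint K K') :
    (PP p r).real (A ∩ A') = (PP p r).real A * (PP p r).real A' := by
  classical
  have h2 : Dep2 (J ∪ J') (K ∪ K') (fun x => x ∈ A ∩ A') := by
    intro x y h1 h2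
    have e1 := h x y (fun i hi => h1 i (Finset.mem_union_left _ hi)) (fun i hi => h2 i (Finset.mem_union_left _ hi))
    have e2 := h' x y (fun i hi => h1 i (Finset.mem_union_right _ hi)) (fun i hi => h2 i (Finset.mem_union_right _ hi))
    simp only at e1 e2
    simp only [Set.mem_inter_iff, e1, e2]
  rw [PP_real hp hr h2, PP_real hp hr h, PP_real hp hr h', ← wsum_union_mul _ hJ]
  refine wsum_congr fun η hη => ?_
  rw [← wsum_union_mul _ hK]
  refine wsum_congr fun B hB => ?_
  rw [← ind_and]
  refine congrArg ind (propext (and_congr ?_ ?_))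
  · exact iff_of_eq (h _ _ (fun i hi => by simp [hi]) (fun i hi => by simp [hi]))
  · exact iff_of_eq (h' _ _ (fun i hi => by simp [hi]) (fun i hi => by simp [hi]))

lemma nbh_disj {k h : ℕ} (hk : 2 * h < k) {D D' : Finset V} (hF : Far k D D') :
    Disjoint (nbh D h) (nbh D' h) := by
  rw [Finset.disjoint_left]
  intro v hv hv'
  obtain ⟨a, ha, hva⟩ := Finset.mem_biUnion.1 hv
  obtain ⟨b, hb, hvb⟩ := Finset.mem_biUnion.1 hv'
  have := hF a ha b hb
  rw [mem_bx] at hva hvb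
  omega

lemma sym2_disj {K K' : Finset V} (h : Disjoint K K') : Disjoint K.sym2 K'.sym2 := by
  rw [Finset.disjoint_left] at h ⊢
  intro e he he'
  induction e using Sym2.ind with
  | _ a b => exact h (Finset.mk_mem_sym2_iff.1 he).1 (Finset.mk_mem_sym2_iff.1 he').1

lemma lam_mix0 {p r : ℝ} (hp : 0 ≤ p ∧ p ≤ 1) (hr : 0 ≤ r ∧ r ≤ 1) {D D' : Finset V} {A B : Set Col}
    (hA : CLocal D A) (hB : CLocal D' B) (h : ℕ) (hd : Disjoint (nbh D h) (nbh D' h)) :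
    (lam p r).real (A ∩ B) ≤ (lam p r).real A * (lam p r).real B +
      ((D.card : ℝ) + D'.card) * (2 * rho p h) := by
  have e1 := abs_le.1 (xi_approx p r hA h)
  have e2 := abs_le.1 (xi_approx p r hB h)
  have hi := PP_indep hp hr (xi_dep (subset_nbh D h) hA) (xi_dep (subset_nbh D' h) hB) (sym2_disj hd) hd
  have hu : (lam p r).real (A ∩ B) ≤ (PP p r).real (({x | xi (nbh D h) x ∈ A} ∩ {x | xi (nbh D' h) x ∈ B}) ∪
      (Bad D (nbh D h) ∪ Bad D' (nbh D' h))) := by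
    rw [lam_real p r (hA.measurable.inter hB.measurable)]
    refine measureReal_mono (fun x hx => ?_) (measure_ne_top _ _)
    by_cases h1 : x ∈ Bad D (nbh D h)
    · exact Or.inr (Or.inl h1)
    by_cases h2 : x ∈ Bad D' (nbh D' h)
    · exact Or.inr (Or.inr h2)
    exact Or.inl ⟨(hA.iff (xi_agree h1)).1 hx.1, (hB.iff (xi_agree h2)).1 hx.2⟩
  have hu := hu.trans ((measureReal_union_le _ _).trans (add_le_add_right (measureReal_union_le _ _) _))
  have b1 := bad_le p r D h
  have b2 := bad_le p r D' h
  rw [hi] at hu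
  have x1 : (PP p r).real {x | xi (nbh D h) x ∈ A} ≤ 1 := measureReal_le_one
  have x2 : (lam p r).real B ≤ 1 := measureReal_le_one
  have x3 : 0 ≤ (PP p r).real {x | xi (nbh D h) x ∈ A} := measureReal_nonneg
  have x4 : 0 ≤ (lam p r).real B := measureReal_nonneg
  have hc : 0 ≤ (D.card : ℝ) * rho p h := mul_nonneg (Nat.cast_nonneg _) (rho_nonneg _ _)
  have hc' : 0 ≤ (D'.card : ℝ) * rho p h := mul_nonneg (Nat.cast_nonneg _) (rho_nonneg _ _)
  have k1 : (PP p r).real {x | xi (nbh D h) x ∈ A} * (PP p r).real {x | xi (nbh D' h) x ∈ B} ≤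
      (PP p r).real {x | xi (nbh D h) x ∈ A} * ((lam p r).real B + D'.card * rho p h) :=
    mul_le_mul_of_nonneg_left (by linarith) x3
  have k2 : (PP p r).real {x | xi (nbh D h) x ∈ A} * (lam p r).real B ≤
      ((lam p r).real A + D.card * rho p h) * (lam p r).real B :=
    mul_le_mul_of_nonneg_right (by linarith) x4
  nlinarith [mul_nonneg hc (sub_nonneg.2 x2), mul_nonneg hc' (sub_nonneg.2 x1)]

/-- mixing error -/
noncomputable def er (p : ℝ) (k : ℕ) : ℝ := 2 * rho p ((k - 1) / 2)

lemma rho_zero (p : ℝ) : rho p 0 = 1 := by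
  have : {ω | bondR ω ∈ Arm (0 : ℕ)} = Set.univ := by
    ext ω
    simp only [Set.mem_ofPred_eq, Set.mem_univ, iff_true]
    exact ⟨0, 0, rfl, by simp [sph, supN], .refl⟩
  rw [rho, this]; simp

lemma lam_mix {p r : ℝ} (hp : 0 ≤ p ∧ p ≤ 1) (hr : 0 ≤ r ∧ r ≤ 1) {k : ℕ} {D D' : Finset V} {A B : Set Col}
    (hA : CLocal D A) (hB : CLocal D' B) (hF : Far k D D') :
    (lam p r).real (A ∩ B) ≤ (lam p r).real A * (lam p r).real B +
      ((D.card : ℝ) + D'.card) * er p k := by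
  by_cases hd : Disjoint (nbh D ((k - 1) / 2)) (nbh D' ((k - 1) / 2))
  · exact lam_mix0 hp hr hA hB _ hd
  · have hk : k = 0 := by
      by_contra hk
      exact hd (nbh_disj (k := k) (by omega) hF)
    have hD : D.Nonempty := by
      by_contra hn
      rw [Finset.not_nonempty_iff_eq_empty] at hn
      subst hn
      exact hd (by simp [nbh])
    have h1 : (1:ℝ) ≤ D.card := by exact_mod_cast hD.card_pos
    have h2 : er p k = 2 := by rw [er, hk]; simp [rho_zero]
    have h3 : (lam p r).real (A ∩ B) ≤ 1 := measureReal_le_one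
    have h4 : 0 ≤ (lam p r).real A * (lam p r).real B := mul_nonneg measureReal_nonneg measureReal_nonneg
    have h5 : (0:ℝ) ≤ D'.card := Nat.cast_nonneg _
    rw [h2]; nlinarith

/-! invariance -/

lemma Bm_ker {ρ₁ ρ₂ : V → V} (h : ∀ u v, ρ₁ u = ρ₁ v ↔ ρ₂ u = ρ₂ v) (r : ℝ) {A : Set Col}
    (hA : MeasurableSet A) : (Bm V r).real {l | l ∘ ρ₁ ∈ A} = (Bm V r).real {l | l ∘ ρ₂ ∈ A} := by
  let S : Setoid V := Setoid.ker ρ₁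
  have key : ∀ ρ : V → V, (∀ u v, ρ₁ u = ρ₁ v ↔ ρ u = ρ v) →
      (Bm V r).real {l | l ∘ ρ ∈ A} = (Bm (Quotient S) r).real {m | (fun v => m (Quotient.mk S v)) ∈ A} := by
    intro ρ hρ
    let f : Quotient S → V := Quotient.lift ρ fun a b hab => (hρ a b).1 hab
    have hf : Function.Injective f := by
      intro a b
      induction a using Quotient.inductionOn with | _ a
      induction b using Quotient.inductionOn with | _ b
      exact fun hab => Quotient.sound ((hρ a b).2 hab)
    rw [← Bm_inj hf r, map_measureReal_apply]
    · rfl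
    · exact measurable_pi_lambda _ fun i => measurable_pi_apply _
    · exact (measurable_pi_lambda _ fun i => measurable_pi_apply _ :
        Measurable (fun (m : Quotient S → Prop) (v : V) => m (Quotient.mk S v))) hA
  rw [key ρ₁ fun _ _ => Iff.rfl, key ρ₂ h]

noncomputable def FFl (r : ℝ) (A : Set Col) (η : Cfg) : ℝ :=
  (Bm V r).real {l | l ∘ (fun v => crep (clu η Set.univ v)) ∈ A}

lemma PP_fub (p r : ℝ) {A : Set Om} (hA : MeasurableSet A) :
    (PP p r).real A = ∫ ω, (Bm V r).real {l | (ω, l) ∈ A} ∂(Bm (Sym2 V) p) := by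
  rw [Measure.real, PP, Measure.prod_apply hA, integral_eq_lintegral_of_nonneg_ae]
  · congr 1
    refine lintegral_congr fun ω => ?_
    rw [Measure.real, ENNReal.ofReal_toReal (measure_ne_top _ _)]; rfl
  · exact Filter.Eventually.of_forall fun ω => measureReal_nonneg
  · exact (measurable_measure_prodMk_left hA).ennreal_toReal.aestronglyMeasurable

lemma lam_fub (p r : ℝ) {A : Set Col} (hA : MeasurableSet A) :
    (lam p r).real A = ∫ ω, FFl r A (bondR ω) ∂(Bm (Sym2 V) p) := by
  rw [lam_real p r hA]; exact PP_fub p r (meas_xi hA)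

lemma FF_meas (p r : ℝ) {A : Set Col} (hA : MeasurableSet A) :
    AEStronglyMeasurable (fun ω => FFl r A (bondR ω)) (Bm (Sym2 V) p) :=
  (measurable_measure_prodMk_left (ν := Bm V r) (meas_xi hA)).ennreal_toReal.aestronglyMeasurable

lemma clu_eq_iff {η : Cfg} (h : GoodCfg η) (u v : V) :
    crep (clu η Set.univ u) = crep (clu η Set.univ v) ↔ CI η Set.univ u v := by
  constructor
  · intro he
    have h1 : CI η Set.univ u (crep (clu η Set.univ u)) := cr_mem (clu_ne η Set.univ u)
    have h2 : CI η Set.univ v (crep (clu η Set.univ v)) := cr_mem (clu_ne η Set.univ v)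
    rw [he] at h1
    exact h1.trans (CI.symm h h2)
  · intro hc
    congr 1
    ext w
    exact ⟨fun hw => CI.trans (CI.symm h hc) hw, fun hw => CI.trans hc hw⟩

lemma FF_inv {g : V ≃ V} {η : Cfg} (hη : GoodCfg η) (hη' : GoodCfg (pull g η)) (r : ℝ) {A : Set Col} (hA : MeasurableSet A) :
    FFl r ((fun ξ : Col => ξ ∘ g) ⁻¹' A) η = FFl r A (pull g η) := by
  have h1 : FFl r ((fun ξ : Col => ξ ∘ g) ⁻¹' A) η =
    (Bm V r).real {l | l ∘ (fun v => crep (clu η Set.univ (g v))) ∈ A} := rfl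
  rw [h1, FFl]
  refine Bm_ker (fun u v => ?_) r hA
  rw [clu_eq_iff hη, clu_eq_iff hη']
  constructor
  · intro h
    simpa using h.to_pull (g := g)
  · intro h
    exact h.of_pull (R' := Set.univ) fun _ _ => trivial

lemma lam_inv {p r : ℝ} {g : V ≃ V} (hg : Iso g) {A : Set Col} (hA : MeasurableSet A) :
    (lam p r).real ((fun ξ : Col => ξ ∘ g) ⁻¹' A) = (lam p r).real A := by
  have hm : Measurable (fun ξ : Col => ξ ∘ g) := measurable_pi_lambda _ fun i => measurable_pi_apply _
  rw [lam_fub p r (hm hA), lam_fub p r hA]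
  have : ∀ ω, FFl r ((fun ξ : Col => ξ ∘ g) ⁻¹' A) (bondR ω) = FFl r A (bondR (fun i => ω (Sym2.map g i))) := by
    intro ω
    have hb : bondR (fun i => ω (Sym2.map g i)) = pull g (bondR ω) := bondR_comp hg ω
    rw [hb, ← FF_inv (bondR_good ω) (hb ▸ bondR_good _) r hA]
  simp_rw [this]
  conv_rhs => rw [← Bm_inj (Sym2.map.injective g.injective) p]
  rw [integral_map]
  · exact (measurable_pi_lambda _ fun i => measurable_pi_apply _).aemeasurable
  · rw [Bm_inj (Sym2.map.injective g.injective) p]; exact FF_meas p r hA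

lemma Bm_one {ι : Type*} {r : ℝ} (hr : 0 ≤ r ∧ r ≤ 1) (w : ι) : (Bm ι r).real {l | l w} = r := by
  classical
  rw [Bm_real hr (J := {w}) (A := {l | l w}) (fun x y h => h w (by simp))]
  rw [← insert_empty_eq, wsum_insert _ (by simp), wsum_empty, wsum_empty]
  simp [ind]

lemma lam_one {p r : ℝ} (hr : 0 ≤ r ∧ r ≤ 1) (v : V) : (lam p r).real {ξ | ξ v} = r := by
  rw [lam_fub p r (measurableSet_setOf.2 (measurable_pi_apply v))]
  have : ∀ η : Cfg, FFl r {ξ | ξ v} η = r := fun η => Bm_one hr _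
  simp [this]

end DaC

namespace DaC

lemma blk_clocal {D : Finset V} {A : Set Cfg} (h : Local D A) : CLocal D (blkR ⁻¹' A) :=
  fun ξ ξ' hh => h _ _ fun u hu v hv => by unfold blkR; rw [hh u hu, hh v hv]

lemma wht_clocal {D : Finset V} {A : Set Cfg} (h : Local D A) : CLocal D (whtR ⁻¹' A) :=
  fun ξ ξ' hh => h _ _ fun u hu v hv => by unfold whtR; rw [hh u hu, hh v hv]

lemma blk_cinc {A : Set Cfg} (h : Inc A) : CInc (blkR ⁻¹' A) :=
  fun ξ ξ' hh => h _ _ fun u v huv => ⟨huv.1, hh _ huv.2.1, hh _ huv.2.2⟩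

lemma wht_cinc {A : Set Cfg} (h : Inc A) : CInc (whtR ⁻¹' A)ᶜ :=
  fun ξ ξ' hh hξ hξ' => hξ (h _ _ (fun u v huv => ⟨huv.1, fun hu => huv.2.1 (hh _ hu), fun hu => huv.2.2 (hh _ hu)⟩) hξ')

lemma er_nonneg (p : ℝ) (k : ℕ) : 0 ≤ er p k := mul_nonneg (by norm_num) (rho_nonneg _ _)

lemma er_lim {p : ℝ} (hρ : Filter.Tendsto (rho p) Filter.atTop (nhds 0)) :
    Filter.Tendsto (er p) Filter.atTop (nhds 0) := by
  have h1 : Filter.Tendsto (fun k : ℕ => (k - 1) / 2) Filter.atTop Filter.atTop := by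
    refine Filter.tendsto_atTop.2 fun b => ?_
    filter_upwards [Filter.eventually_ge_atTop (2 * b + 1)] with k hk
    omega
  have := (hρ.comp h1).const_mul 2
  rw [mul_zero] at this
  exact this

lemma GoodCfg_meas : MeasurableSet {η : Cfg | GoodCfg η} := by
  have he : ∀ a b : V, Measurable (fun η : Cfg => η a b) := fun a b =>
    (measurable_pi_apply b).comp (measurable_pi_apply a)
  have : {η : Cfg | GoodCfg η} = {η : Cfg | (∀ a b, η a b → η b a) ∧ (∀ a b, η a b → StarAdj a b) ∧
      ∀ a b c d, η a b → ¬ SqAdj a b → SqAdj a c → SqAdj c b → η c d → η a c} := by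
    ext η
    exact ⟨fun h => ⟨h.1, h.2, h.3⟩, fun h => ⟨h.1, h.2.1, h.2.2⟩⟩
  rw [this]
  refine measurableSet_setOf.2 ((Measurable.forall fun a => Measurable.forall fun b => (he a b).imp (he b a)).and
    ((Measurable.forall fun a => Measurable.forall fun b => (he a b).imp measurable_const).and
    (Measurable.forall fun a => Measurable.forall fun b => Measurable.forall fun c => Measurable.forall fun d =>
      (he a b).imp (measurable_const.imp (measurable_const.imp (measurable_const.imp ((he c d).imp (he a c))))))))

section
variable {p r : ℝ} (hp : 0 ≤ p ∧ p ≤ 1) (hρ : Filter.Tendsto (rho p) Filter.atTop (nhds 0))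
include hp hρ

lemma all_black (hr : 0 < r ∧ r < 1) (D : Finset V) : 0 < (lam p r).real {ξ | ∀ v ∈ D, ξ v} := by
  classical
  induction D using Finset.induction_on with
  | empty => simp
  | insert a D ha ih =>
    have h := lam_fkg hp hρ ⟨hr.1.le, hr.2.le⟩ (D := insert a D) (A := {ξ | ξ a}) (B := {ξ | ∀ v ∈ D, ξ v})
      (fun ξ ξ' hh h => (hh a (by simp)).1 h) (fun ξ ξ' hh h v hv => (hh v (by simp [hv])).1 (h v hv))
      (fun ξ ξ' hh h => hh _ h) (fun ξ ξ' hh h v hv => hh v (h v hv))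
    rw [lam_one ⟨hr.1.le, hr.2.le⟩] at h
    refine lt_of_lt_of_le (mul_pos hr.1 ih) (h.trans (measureReal_mono (fun ξ hξ v hv => ?_) (measure_ne_top _ _)))
    rcases Finset.mem_insert.1 hv with rfl | hv
    · exact hξ.1
    · exact hξ.2 v hv

lemma all_white (hr : 0 < r ∧ r < 1) (D : Finset V) : 0 < (lam p r).real {ξ | ∀ v ∈ D, ¬ ξ v} := by
  classical
  induction D using Finset.induction_on with
  | empty => simp
  | insert a D ha ih =>
    have h := lam_fkg' hp hρ ⟨hr.1.le, hr.2.le⟩ (D := insert a D) (A := {ξ | ξ a}ᶜ) (B := {ξ | ∀ v ∈ D, ¬ ξ v})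
      (fun ξ ξ' hh h h' => h ((hh a (by simp)).2 h'))
      (fun ξ ξ' hh h v hv h' => h v hv ((hh v (by simp [hv])).2 h'))
      (fun ξ ξ' hh h h' => h fun h'' => h' (hh _ h''))
      (fun ξ ξ' hh h h' => h fun v hv h'' => h' v hv (hh _ h''))
    rw [probReal_compl_eq_one_sub (measurableSet_setOf.2 (measurable_pi_apply a)), lam_one ⟨hr.1.le, hr.2.le⟩] at h
    refine lt_of_lt_of_le (mul_pos (by linarith) ih) (h.trans (measureReal_mono (fun ξ hξ v hv => ?_) (measure_ne_top _ _)))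
    rcases Finset.mem_insert.1 hv with rfl | hv
    · exact hξ.1
    · exact hξ.2 v hv

lemma iso_local : Local (bx 0 1) {η : Cfg | ∀ v, StarAdj 0 v → ¬ η 0 v} := by
  intro η η' hh h v hv hη'
  have := hv.near
  refine h v hv ((hh 0 (by simp [mem_bx]) v ?_).2 hη')
  rw [mem_bx]; unfold Near at this; simp only [Prod.fst_zero, Prod.snd_zero] at this ⊢; omega

lemma model_gen {F : Col → Cfg} (hF : Measurable F) (hl : ∀ D A, Local D A → CLocal D (F ⁻¹' A))
    (hr : 0 < r ∧ r < 1) (hgood : ∀ ξ, GoodCfg (F ξ))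
    (hcomp : ∀ (g : V ≃ V), Iso g → ∀ ξ : Col, F (ξ ∘ g) = pull g (F ξ))
    (hfkg : ∀ D A B, Local D A → Local D B → Inc A → Inc B →
      (lam p r).real (F ⁻¹' A) * (lam p r).real (F ⁻¹' B) ≤ (lam p r).real (F ⁻¹' (A ∩ B)))
    (hseed : ∀ m : ℕ, 0 < (lam p r).real (F ⁻¹' (Seed 0 m)))
    (hiso : 0 < (lam p r).real (F ⁻¹' {η | ∀ v, StarAdj 0 v → ¬ η 0 v})) :
    IsModel ((lam p r).map F) (er p) where
  prob := Measure.isProbabilityMeasure_map hF.aemeasurable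
  good := by
    have : ∀ᵐ ξ ∂(lam p r), GoodCfg (F ξ) := Filter.Eventually.of_forall hgood
    exact (ae_map_iff hF.aemeasurable GoodCfg_meas).2 this
  inv := by
    intro g hg D A hA
    have hpm : MeasurableSet (pull g ⁻¹' A) := by
      have : Measurable (pull g) :=
        measurable_pi_lambda _ fun a => measurable_pi_lambda _ fun b =>
          (measurable_pi_apply (g b)).comp (measurable_pi_apply (g a))
      exact this hA.measurable
    rw [map_measureReal_apply hF hpm, map_measureReal_apply hF hA.measurable,
      ← lam_inv (p := p) (r := r) (g := g) hg (hl D A hA).measurable]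
    congr 1
    ext ξ
    simp only [Set.mem_preimage, hcomp g hg]
  fkg := by
    intro D A B hA hB iA iB
    rw [map_measureReal_apply hF hA.measurable, map_measureReal_apply hF hB.measurable,
      map_measureReal_apply hF (hA.inter hB).measurable]
    exact hfkg D A B hA hB iA iB
  mix := by
    intro k D D' A B hA hB hFar
    rw [map_measureReal_apply hF hA.measurable, map_measureReal_apply hF hB.measurable,
      map_measureReal_apply hF (hA.measurable.inter hB.measurable)]
    exact lam_mix hp ⟨hr.1.le, hr.2.le⟩ (hl D A hA) (hl D' B hB) hFar
  e_nonneg := er_nonneg p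
  e_lim := er_lim hρ
  seed := by
    intro m
    rw [map_measureReal_apply hF (Seed_local 0 m).measurable]; exact hseed m
  iso := by
    rw [map_measureReal_apply hF (iso_local hp hρ).measurable]; exact hiso

lemma model_b (hr : 0 < r ∧ r < 1) : IsModel ((lam p r).map blkR) (er p) := by
  refine model_gen hp hρ blkR_meas (fun D A => blk_clocal) hr blkR_good (fun g hg => blkR_comp hg) ?_ ?_ ?_
  · intro D A B hA hB iA iB
    exact lam_fkg hp hρ ⟨hr.1.le, hr.2.le⟩ (blk_clocal hA) (blk_clocal hB) (blk_cinc iA) (blk_cinc iB)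
  · intro m
    refine lt_of_lt_of_le (all_black hp hρ hr (bx 0 m)) (measureReal_mono (fun ξ hξ u hu v hv hs => ?_) (measure_ne_top _ _))
    exact ⟨hs, hξ u hu, hξ v hv⟩
  · refine lt_of_lt_of_le (all_white hp hρ hr {0}) (measureReal_mono (fun ξ hξ v hv hb => ?_) (measure_ne_top _ _))
    exact hξ 0 (by simp) hb.2.1

lemma model_w (hr : 0 < r ∧ r < 1) : IsModel ((lam p r).map whtR) (er p) := by
  refine model_gen hp hρ whtR_meas (fun D A => wht_clocal) hr whtR_good (fun g hg => whtR_comp hg) ?_ ?_ ?_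
  · intro D A B hA hB iA iB
    exact lam_fkg' hp hρ ⟨hr.1.le, hr.2.le⟩ (wht_clocal hA) (wht_clocal hB) (wht_cinc iA) (wht_cinc iB)
  · intro m
    refine lt_of_lt_of_le (all_white hp hρ hr (bx 0 m)) (measureReal_mono (fun ξ hξ u hu v hv hs => ?_) (measure_ne_top _ _))
    exact ⟨hs.star, hξ u hu, hξ v hv⟩
  · refine lt_of_lt_of_le (all_black hp hρ hr {0}) (measureReal_mono (fun ξ hξ v hv hb => ?_) (measure_ne_top _ _))
    exact hb.2.1 (hξ 0 (by simp))

end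
end DaC

namespace DaC

lemma wsum_harris {ι : Type*} [DecidableEq ι] {p : ι → ℝ} (hp : ∀ i, 0 ≤ p i ∧ p i ≤ 1) (E : Finset ι)
    {f g : Finset ι → ℝ} (hf : Monotone f) (hg : Monotone g) :
    wsum p E f * wsum p E g ≤ wsum p E (fun η => f η * g η) := by
  induction E using Finset.induction_on generalizing f g with
  | empty => simp [wsum_empty]
  | insert e E he ih =>
    rw [wsum_insert p he, wsum_insert p he, wsum_insert p he]
    have hf' : Monotone (fun η => f (insert e η)) := fun a b h => hf (Finset.insert_subset_insert _ h)
    have hg' : Monotone (fun η => g (insert e η)) := fun a b h => hg (Finset.insert_subset_insert _ h)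
    have h1 := ih hf' hg'
    have h0 := ih hf hg
    have a1 : wsum p E f ≤ wsum p E (fun η => f (insert e η)) :=
      wsum_le_wsum hp fun η _ => hf (Finset.subset_insert _ _)
    have a2 : wsum p E g ≤ wsum p E (fun η => g (insert e η)) :=
      wsum_le_wsum hp fun η _ => hg (Finset.subset_insert _ _)
    have hpe := hp e
    have h3 := mul_nonneg (mul_nonneg hpe.1 (sub_nonneg.2 hpe.2)) (mul_nonneg (sub_nonneg.2 a1) (sub_nonneg.2 a2))
    have h4 := mul_le_mul_of_nonneg_left h1 hpe.1
    have h5 := mul_le_mul_of_nonneg_left h0 (sub_nonneg.2 hpe.2)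
    nlinarith

lemma wsum_pos {ι : Type*} [DecidableEq ι] {p : ℝ} (hp : 0 < p ∧ p < 1) {E η : Finset ι} (hη : η ⊆ E)
    {f : Finset ι → ℝ} (hf : ∀ η, 0 ≤ f η) (h : 0 < f η) : 0 < wsum (fun _ => p) E f := by
  unfold wsum
  refine Finset.sum_pos' (fun ζ _ => mul_nonneg (mul_nonneg (Finset.prod_nonneg fun i _ => hp.1.le)
    (Finset.prod_nonneg fun i _ => by linarith [hp.2])) (hf _)) ⟨η, Finset.mem_powerset.2 hη, ?_⟩
  exact mul_pos (mul_pos (Finset.prod_pos fun i _ => hp.1) (Finset.prod_pos fun i _ => by linarith [hp.2])) h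

lemma Bm_indep {ι : Type*} [DecidableEq ι] {p : ℝ} (hp : 0 ≤ p ∧ p ≤ 1) {J J' : Finset ι} {A A' : Set (ι → Prop)}
    (h : Dep J (fun x => x ∈ A)) (h' : Dep J' (fun x => x ∈ A')) (hJ : Disjoint J J') :
    (Bm ι p).real (A ∩ A') = (Bm ι p).real A * (Bm ι p).real A' := by
  classical
  have h2 : Dep (J ∪ J') (fun x => x ∈ A ∩ A') := by
    intro x y h1
    have e1 := h x y (fun i hi => h1 i (Finset.mem_union_left _ hi))
    have e2 := h' x y (fun i hi => h1 i (Finset.mem_union_right _ hi))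
    simp only at e1 e2
    simp only [Set.mem_inter_iff, e1, e2]
  rw [Bm_real hp h2, Bm_real hp h, Bm_real hp h', ← wsum_union_mul _ hJ]
  refine wsum_congr fun η hη => ?_
  rw [← ind_and]
  refine congrArg ind (propext (and_congr ?_ ?_))
  · exact iff_of_eq (h _ _ (fun i hi => by simp [hi]))
  · exact iff_of_eq (h' _ _ (fun i hi => by simp [hi]))

lemma bond_mono {A : Set Cfg} (h : Inc A) : Monotone (fun η : Finset (Sym2 V) => ind (bondR (fun i => i ∈ η) ∈ A)) :=
  fun η ζ hh => ind_mono (h _ _ fun u v huv => ⟨huv.1, hh huv.2⟩)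

lemma iso_local' : Local (bx 0 1) {η : Cfg | ∀ v, StarAdj 0 v → ¬ η 0 v} := by
  intro η η' hh h v hv hη'
  have := hv.near
  refine h v hv ((hh 0 (by simp [mem_bx]) v ?_).2 hη')
  rw [mem_bx]; unfold Near at this; simp only [Prod.fst_zero, Prod.snd_zero] at this ⊢; omega

lemma bond_real {p : ℝ} (hp : 0 ≤ p ∧ p ≤ 1) {D : Finset V} {A : Set Cfg} (h : Local D A) :
    (Bm (Sym2 V) p).real (bondR ⁻¹' A) = wsum (fun _ => p) D.sym2 (fun η => ind (bondR (fun i => i ∈ η) ∈ A)) :=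
  Bm_real hp (A := bondR ⁻¹' A) (bond_dep h)

lemma bond_model {p : ℝ} (hp : 0 < p ∧ p < 1) :
    IsModel ((Bm (Sym2 V) p).map bondR) (fun k => if k = 0 then 1 else 0) where
  prob := Measure.isProbabilityMeasure_map bondR_meas.aemeasurable
  good := (ae_map_iff bondR_meas.aemeasurable GoodCfg_meas).2 (Filter.Eventually.of_forall bondR_good)
  inv := by
    intro g hg D A hA
    have hpm : MeasurableSet (pull g ⁻¹' A) := by
      have : Measurable (pull g) :=
        measurable_pi_lambda _ fun a => measurable_pi_lambda _ fun b =>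
          (measurable_pi_apply (g b)).comp (measurable_pi_apply (g a))
      exact this hA.measurable
    rw [map_measureReal_apply bondR_meas hpm, map_measureReal_apply bondR_meas hA.measurable]
    exact bond_inv hg p hA.measurable
  fkg := by
    intro D A B hA hB iA iB
    have hp' : 0 ≤ p ∧ p ≤ 1 := ⟨hp.1.le, hp.2.le⟩
    rw [map_measureReal_apply bondR_meas hA.measurable, map_measureReal_apply bondR_meas hB.measurable,
      map_measureReal_apply bondR_meas (hA.inter hB).measurable, bond_real hp' hA, bond_real hp' hB,
      bond_real hp' (hA.inter hB)]
    refine (wsum_harris (fun _ => hp') _ (bond_mono iA) (bond_mono iB)).trans (le_of_eq ?_)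
    refine wsum_congr fun η _ => ?_
    rw [← ind_and]; rfl
  mix := by
    intro k D D' A B hA hB hFar
    have hp' : 0 ≤ p ∧ p ≤ 1 := ⟨hp.1.le, hp.2.le⟩
    rw [map_measureReal_apply bondR_meas hA.measurable, map_measureReal_apply bondR_meas hB.measurable,
      map_measureReal_apply bondR_meas (hA.measurable.inter hB.measurable)]
    by_cases hd : Disjoint D D'
    · rw [Set.preimage_inter, Bm_indep hp' (A := bondR ⁻¹' A) (A' := bondR ⁻¹' B) (bond_dep hA) (bond_dep hB) (sym2_disj hd)]
      have : (0:ℝ) ≤ if k = 0 then 1 else 0 := by split_ifs <;> norm_num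
      have : 0 ≤ ((D.card : ℝ) + D'.card) * (if k = 0 then 1 else 0) := by positivity
      linarith
    · rw [Finset.not_disjoint_iff] at hd
      obtain ⟨v, hv, hv'⟩ := hd
      have h1 := hFar v hv v hv'
      have hk : k = 0 := by omega
      rw [if_pos hk]
      have h2 : (1:ℝ) ≤ D.card := by exact_mod_cast Finset.card_pos.2 ⟨v, hv⟩
      have h3 : (0:ℝ) ≤ D'.card := by positivity
      have h4 : (Bm (Sym2 V) p).real (bondR ⁻¹' (A ∩ B)) ≤ 1 := measureReal_le_one
      have h5 : 0 ≤ (Bm (Sym2 V) p).real (bondR ⁻¹' A) * (Bm (Sym2 V) p).real (bondR ⁻¹' B) :=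
        mul_nonneg measureReal_nonneg measureReal_nonneg
      linarith
  e_nonneg := by intro k; split_ifs <;> norm_num
  e_lim := by
    refine tendsto_const_nhds.congr' ?_
    filter_upwards [Filter.eventually_ge_atTop 1] with k hk
    rw [if_neg (by omega)]
  seed := by
    intro m
    rw [map_measureReal_apply bondR_meas (Seed_local 0 m).measurable, bond_real ⟨hp.1.le, hp.2.le⟩ (Seed_local 0 m)]
    refine wsum_pos hp (Finset.Subset.refl _) (fun η => ind_nonneg _) ?_
    rw [ind_true]; · norm_num
    intro u hu v hv hs
    exact ⟨hs, Finset.mk_mem_sym2_iff.2 ⟨hu, hv⟩⟩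
  iso := by
    rw [map_measureReal_apply bondR_meas iso_local'.measurable, bond_real ⟨hp.1.le, hp.2.le⟩ iso_local']
    refine wsum_pos hp (Finset.empty_subset _) (fun η => ind_nonneg _) ?_
    rw [ind_true]; · norm_num
    intro v hv h
    simpa using h.2

/-- dual edge map -/
noncomputable def dualE : Sym2 V → Sym2 V := by
  classical
  exact Sym2.lift ⟨fun a b => if SqAdj a b then s((min a.1 b.1, min a.2 b.2), (max a.1 b.1 - 1, max a.2 b.2 - 1)) else s(a, b),
    fun a b => by
      have : SqAdj a b ↔ SqAdj b a := ⟨SqAdj.symm, SqAdj.symm⟩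
      beta_reduce
      by_cases h : SqAdj a b
      · rw [if_pos h, if_pos (this.1 h), min_comm a.1, min_comm a.2, max_comm a.1, max_comm a.2]
      · rw [if_neg h, if_neg (fun h' => h (this.2 h')), Sym2.eq_swap]⟩

lemma dualE_pos {a b : V} (h : SqAdj a b) :
    dualE s(a, b) = s((min a.1 b.1, min a.2 b.2), (max a.1 b.1 - 1, max a.2 b.2 - 1)) := by
  simp [dualE, h]
lemma dualE_neg {a b : V} (h : ¬ SqAdj a b) : dualE s(a, b) = s(a, b) := by
  simp [dualE, h]

lemma dualE_inj : Function.Injective dualE := by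
  intro e f h
  induction e using Sym2.ind with
  | _ a b =>
  induction f using Sym2.ind with
  | _ c d =>
  by_cases h1 : SqAdj a b <;> by_cases h2 : SqAdj c d
  · rw [dualE_pos h1, dualE_pos h2] at h
    rw [sqAdj_iff] at h1 h2; unfold Near at h1 h2
    simp only [Sym2.eq_iff, Prod.ext_iff] at h ⊢
    omega
  · rw [dualE_pos h1, dualE_neg h2] at h
    exfalso
    rw [sqAdj_iff] at h1 h2; unfold Near at h1 h2
    simp only [Sym2.eq_iff, Prod.ext_iff] at h
    omega
  · rw [dualE_neg h1, dualE_pos h2] at h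
    exfalso
    rw [sqAdj_iff] at h1 h2; unfold Near at h1 h2
    simp only [Sym2.eq_iff, Prod.ext_iff] at h
    omega
  · rwa [dualE_neg h1, dualE_neg h2] at h

lemma dualE_spec {a b c d : V} (h1 : SqAdj a b) (h2 : SqAdj c d) (hx : a.1 + b.1 = c.1 + d.1 - 1)
    (hy : a.2 + b.2 = c.2 + d.2 - 1) : dualE s(c, d) = s(a, b) := by
  rw [dualE_pos h2]
  rw [sqAdj_iff] at h1 h2; unfold Near at h1 h2
  simp only [Sym2.eq_iff, Prod.ext_iff]
  omega

noncomputable def dualW (ω : Sym2 V → Prop) : Sym2 V → Prop := fun e => ¬ ω (dualE e)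

lemma dual_real {D : Finset V} {A : Set Cfg} (h : Local D A) :
    (Bm (Sym2 V) (1/2)).real {ω | bondR (dualW ω) ∈ A} = (Bm (Sym2 V) (1/2)).real (bondR ⁻¹' A) := by
  classical
  set S : Set (Sym2 V → Prop) := {ω | bondR (fun e => ¬ ω e) ∈ A} with hS
  have hdep : Dep D.sym2 (fun ω => ω ∈ S) := by
    intro x y hxy
    exact bond_dep h _ _ fun i hi => by simp only [hxy i hi]
  have h1 : (Bm (Sym2 V) (1/2)).real {ω | bondR (dualW ω) ∈ A} = (Bm (Sym2 V) (1/2)).real S := by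
    conv_rhs => rw [← Bm_inj dualE_inj (1/2)]
    rw [map_measureReal_apply (measurable_pi_lambda _ fun i => measurable_pi_apply _) (measurableSet_setOf.2 hdep.measurable)]
    rfl
  rw [h1, Bm_real (by norm_num) hdep, bond_real (by norm_num) h]
  have := wsum_flip (fun _ => (1/2 : ℝ)) D.sym2 (fun η => ind (bondR (fun i => i ∈ η) ∈ A))
  have e : (fun i : Sym2 V => (1:ℝ) - 1/2) = fun _ => 1/2 := by funext; norm_num
  rw [e] at this
  rw [← this]
  refine wsum_congr fun η hη => ?_
  refine congrArg ind ?_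
  refine bond_dep h _ _ fun i hi => ?_
  simp only [Finset.mem_sdiff, hi, true_and]

lemma dual_disj {ω : Sym2 V → Prop} {R1 R2 : Set V} {u v s t : V} {a b c d : ℤ}
    (hR1 : ∀ x ∈ R1, c ≤ x.2 ∧ x.2 ≤ d) (hR2 : ∀ x ∈ R2, a + 1 ≤ x.1 ∧ x.1 ≤ b)
    (h : CI (bondR ω) R1 u v) (hu : u.1 ≤ a) (hv : b ≤ v.1) (hab : a < b)
    (h' : CI (bondR (dualW ω)) R2 s t) (hs : s.2 ≤ c) (ht : d + 1 ≤ t.2) (hcd : c < d) : False := by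
  obtain ⟨k, g, hg0, hgk, hg⟩ := rtg_seq h'
  have hst : s ≠ t := fun h => by subst h; omega
  have hk : 0 < k := Nat.pos_of_ne_zero fun h => by subst h; exact hst (hg0.symm.trans hgk)
  set r : V → V → Prop := fun x y => ∃ a b, bondR ω a b ∧ a ∈ R1 ∧ b ∈ R1 ∧
    (((x.1 = 2 * a.1 ∧ x.2 = 2 * a.2) ∧ (y.1 = a.1 + b.1 ∧ y.2 = a.2 + b.2)) ∨
     ((x.1 = a.1 + b.1 ∧ x.2 = a.2 + b.2) ∧ (y.1 = 2 * b.1 ∧ y.2 = 2 * b.2))) with hr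
  have hpath : Relation.ReflTransGen r (2 * u.1, 2 * u.2) (2 * v.1, 2 * v.2) := by
    clear hu hv
    induction h with
    | refl => exact .refl
    | @tail b c _ hbc ih =>
      refine (ih.tail (b := _) (c := (b.1 + c.1, b.2 + c.2)) ?_).tail ?_
      · exact ⟨b, c, hbc.1, hbc.2.1, hbc.2.2, Or.inl ⟨⟨rfl, rfl⟩, rfl, rfl⟩⟩
      · exact ⟨b, c, hbc.1, hbc.2.1, hbc.2.2, Or.inr ⟨⟨rfl, rfl⟩, rfl, rfl⟩⟩
  set f : ℕ → V := fun i => ((g (i / 2)).1 + (g ((i + 1) / 2)).1 - 1, (g (i / 2)).2 + (g ((i + 1) / 2)).2 - 1) with hf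
  have hgR : ∀ i ≤ k, g i ∈ R2 := fun i hi => by
    rcases hi.eq_or_lt with h2 | h2
    · subst h2; rw [hgk]; exact h'.mem_right hst
    · exact (hg i h2).2.1
  have hn : ∀ i < k, Near (g i) (g (i + 1)) := fun i hi => (hg i hi).1.1.near
  have hits := hits_cross (r := r) (k := 2 * k) (f := f) (u := (2 * u.1, 2 * u.2)) (v := (2 * v.1, 2 * v.2))
    (a := 2 * a) (b := 2 * b) (c := 2 * c) (d := 2 * d) (by
      rintro x y ⟨a, b, hab, -, -, hh⟩
      have := hab.1.near
      unfold Near at *; omega) (by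
      rintro x y ⟨a, b, hab, ha, hb, hh⟩
      have := hR1 a ha
      have := hR1 b hb
      omega) hpath (by dsimp only; omega) (by dsimp only; omega) (by omega) (by
      intro i hi
      simp only [hf]
      rcases Nat.even_or_odd' i with ⟨j, rfl | rfl⟩
      · have e1 : (2 * j) / 2 = j := by omega
        have e2 : (2 * j + 1) / 2 = j := by omega
        have e3 : (2 * j + 1 + 1) / 2 = j + 1 := by omega
        rw [e1, e2, e3]
        have := hn j (by omega)
        unfold Near at *; dsimp only; omega
      · have e2 : (2 * j + 1) / 2 = j := by omega
        have e3 : (2 * j + 1 + 1) / 2 = j + 1 := by omega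
        have e4 : (2 * j + 1 + 1 + 1) / 2 = j + 1 := by omega
        rw [e2, e3, e4]
        have := hn j (by omega)
        unfold Near at *; dsimp only; omega) (by
      intro i hi
      have h1 := hR2 _ (hgR (i / 2) (by omega))
      have h2 := hR2 _ (hgR ((i + 1) / 2) (by omega))
      simp only [hf]; omega) (by
      simp only [hf]; norm_num; rw [hg0]; omega) (by
      simp only [hf]
      have e1 : (2 * k) / 2 = k := by omega
      have e2 : (2 * k + 1) / 2 = k := by omega
      rw [e1, e2, hgk]; omega)
  obtain ⟨x, i, hi, hx, hor⟩ := hits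
  have key : ∀ z : V, z = f i → ¬ ((∃ a : V, z.1 = 2 * a.1 ∧ z.2 = 2 * a.2) ∨
      ∃ a b, bondR ω a b ∧ z.1 = a.1 + b.1 ∧ z.2 = a.2 + b.2) := by
    rintro z rfl hz
    rcases Nat.even_or_odd' i with ⟨j, rfl | rfl⟩
    · have e1 : (2 * j) / 2 = j := by omega
      have e2 : (2 * j + 1) / 2 = j := by omega
      simp only [hf, e1, e2] at hz
      rcases hz with ⟨a, h1, h2⟩ | ⟨a, b, hab, h1, h2⟩
      · omega
      · have := (sqAdj_iff a b).1 hab.1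
        omega
    · have e2 : (2 * j + 1) / 2 = j := by omega
      have e3 : (2 * j + 1 + 1) / 2 = j + 1 := by omega
      simp only [hf, e2, e3] at hz
      have hj := (hg j (by omega)).1
      have hj' := (sqAdj_iff _ _).1 hj.1
      rcases hz with ⟨a, h1, h2⟩ | ⟨a, b, hab, h1, h2⟩
      · omega
      · refine hj.2 ?_
        rw [dualE_spec hab.1 hj.1 h1.symm h2.symm]
        exact hab.2
  have hxr : (∃ a : V, x.1 = 2 * a.1 ∧ x.2 = 2 * a.2) ∨ ∃ a b, bondR ω a b ∧ x.1 = a.1 + b.1 ∧ x.2 = a.2 + b.2 := by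
    rcases hx.cases_tail with h | ⟨w, _, a, b, hab, -, -, hh⟩
    · subst h; exact Or.inl ⟨u, rfl, rfl⟩
    · rcases hh with hh | hh
      · exact Or.inr ⟨a, b, hab, hh.2⟩
      · exact Or.inl ⟨b, hh.2⟩
  rcases hor with h | ⟨y, ⟨a, b, hab, -, -, hh⟩, hy⟩
  · exact key x h hxr
  · have hab' := (sqAdj_iff a b).1 hab.1
    by_cases hxy : x.1 = y.1
    · exact key x (by rw [hy, ← hxy]) hxr
    · have : x.2 = y.2 := by omega
      refine key y (by rw [hy, this]) ?_
      rcases hh with hh | hh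
      · exact Or.inr ⟨a, b, hab, hh.2⟩
      · exact Or.inl ⟨b, hh.2⟩

/-- no percolation at 1/2 -/
lemma bond_half {θ : ℝ} (hθ : 0 < θ) : ∃ n : ℕ, rho (1/2) n < θ := by
  by_contra hcon
  push Not at hcon
  have hm := bond_model (p := 1/2) (by norm_num)
  obtain ⟨n, hn, hq⟩ := hm.Qthm hθ (fun n => by
    rw [map_measureReal_apply bondR_meas (Arm_meas _)]; exact hcon n) (ε := 1/3) (by norm_num) 2
  set g : V ≃ V := (swp).trans (tr (1, 0)) with hg
  have hgi : Iso g := iso_swp.trans (iso_tr _)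
  have hl := LR_local 0 (4 * n) 0 n
  have h1 : 2 / 3 ≤ (Bm (Sym2 V) (1/2)).real (bondR ⁻¹' LR 0 (4 * n) 0 n) := by
    rw [← map_measureReal_apply bondR_meas hl.measurable]; linarith
  have h2 : 2 / 3 ≤ (Bm (Sym2 V) (1/2)).real {ω | bondR (dualW ω) ∈ pull g ⁻¹' LR 0 (4 * n) 0 n} := by
    rw [dual_real (hl.pull g), ← map_measureReal_apply bondR_meas (hl.pull g).measurable, hm.inv _ hgi _ _ hl]
    linarith
  have hmeas : MeasurableSet {ω | bondR (dualW ω) ∈ pull g ⁻¹' LR 0 (4 * n) 0 n} := by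
    have : Measurable (fun ω => bondR (dualW ω)) := bondR_meas.comp (measurable_pi_lambda _ fun i =>
      (measurable_pi_apply (dualE i)).not)
    exact this (hl.pull g).measurable
  have hd : Disjoint (bondR ⁻¹' LR 0 (4 * n) 0 n) {ω | bondR (dualW ω) ∈ pull g ⁻¹' LR 0 (4 * n) 0 n} := by
    rw [Set.disjoint_left]
    rintro ω ⟨u, v, hu, hv, huv⟩ ⟨s, t, hs, ht, hst⟩
    have hst' := hst.of_pull (R' := {x | 1 ≤ x.1 ∧ x.1 ≤ n + 1}) (by
      intro x hx
      have hx : 0 ≤ x.1 ∧ x.1 ≤ 4 * n ∧ 0 ≤ x.2 ∧ x.2 ≤ n := hx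
      show 1 ≤ x.2 + 1 ∧ x.2 + 1 ≤ (n:ℤ) + 1
      omega)
    have hu : u.1 = 0 := hu
    have hv : v.1 = 4 * n := hv
    have hs : s.1 = 0 := hs
    have ht : t.1 = 4 * n := ht
    refine dual_disj (a := 0) (b := 4 * n) (c := 0) (d := n) ?_ ?_ huv ?_ ?_ ?_ hst' ?_ ?_ ?_
    · intro x hx
      have hx : 0 ≤ x.1 ∧ x.1 ≤ 4 * n ∧ 0 ≤ x.2 ∧ x.2 ≤ n := hx
      omega
    · intro x hx
      have hx : 1 ≤ x.1 ∧ x.1 ≤ n + 1 := hx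
      omega
    · omega
    · omega
    · omega
    · show s.1 + 0 ≤ 0
      omega
    · show (n:ℤ) + 1 ≤ t.1 + 0
      omega
    · omega
  have := measureReal_union (μ := Bm (Sym2 V) (1/2)) hd hmeas
  have h3 : (Bm (Sym2 V) (1/2)).real ((bondR ⁻¹' LR 0 (4 * n) 0 n) ∪ {ω | bondR (dualW ω) ∈ pull g ⁻¹' LR 0 (4 * n) 0 n}) ≤ 1 := measureReal_le_one
  linarith
end DaC

namespace DaC

open Classical in
/-- cluster of 0 inside S -/
noncomputable def cS (S : Finset V) (ω : Sym2 V → Prop) : Finset V := S.filter fun v => CI (bondR ω) S 0 v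

open Classical in
/-- vertices not connected to the sphere -/
noncomputable def scal (n : ℤ) (ω : Sym2 V → Prop) : Finset V :=
  (bx 0 n).filter fun v => ¬ ∃ s ∈ sph n, CI (bondR ω) (bx 0 n) v s

open Classical in
noncomputable def touchE (S C : Finset V) : Finset (Sym2 V) := S.sym2.filter fun e => ∃ v ∈ C, v ∈ e

open Classical in
/-- oriented boundary edges -/
noncomputable def bdE (S : Finset V) : Finset (V × V) :=
  (S ×ˢ nbh S 1).filter fun q => SqAdj q.1 q.2 ∧ q.2 ∉ S

lemma mem_bdE {S : Finset V} {x y : V} : (x, y) ∈ bdE S ↔ x ∈ S ∧ SqAdj x y ∧ y ∉ S := by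
  classical
  unfold bdE
  rw [Finset.mem_filter, Finset.mem_product]
  refine ⟨fun h => ⟨h.1.1, h.2⟩, fun h => ⟨⟨h.1, ?_⟩, h.2⟩⟩
  refine Finset.mem_biUnion.2 ⟨x, h.1, ?_⟩
  have := h.2.1.near
  rw [mem_bx]; unfold Near at this; push_cast; omega

lemma mem_cS {S : Finset V} {ω : Sym2 V → Prop} {v : V} : v ∈ cS S ω ↔ v ∈ S ∧ CI (bondR ω) S 0 v := by
  classical
  unfold cS; rw [Finset.mem_filter]

lemma mem_scal {n : ℤ} {ω : Sym2 V → Prop} {v : V} :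
    v ∈ scal n ω ↔ v ∈ bx 0 n ∧ ¬ ∃ s ∈ sph n, CI (bondR ω) (bx 0 n) v s := by
  classical
  unfold scal; rw [Finset.mem_filter]

lemma cS_dep (S C : Finset V) : Dep (touchE S C) (fun ω => cS S ω = C) := by
  classical
  have key : ∀ x y : Sym2 V → Prop, (∀ i ∈ touchE S C, x i = y i) → cS S x = C → cS S y = C := by
    intro x y hxy hC
    have hJ : ∀ a b : V, a ∈ S → b ∈ S → a ∈ C → (x s(a, b) = y s(a, b)) := fun a b ha hb hc =>
      hxy _ (Finset.mem_filter.2 ⟨Finset.mk_mem_sym2_iff.2 ⟨ha, hb⟩, a, hc, by simp⟩)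
    have f1 : ∀ v, CI (bondR x) S 0 v → CI (bondR y) S 0 v := by
      intro v hv
      induction hv with
      | refl => exact .refl
      | @tail b c h0 hbc ih =>
        have hb : b ∈ C := by rw [← hC]; exact mem_cS.2 ⟨hbc.2.1, h0⟩
        exact ih.tail ⟨⟨hbc.1.1, by rw [← hJ b c hbc.2.1 hbc.2.2 hb]; exact hbc.1.2⟩, hbc.2⟩
    have f2 : ∀ v, CI (bondR y) S 0 v → CI (bondR x) S 0 v := by
      intro v hv
      induction hv with
      | refl => exact .refl
      | @tail b c h0 hbc ih =>
        have hb : b ∈ C := by rw [← hC]; exact mem_cS.2 ⟨hbc.2.1, ih⟩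
        exact ih.tail ⟨⟨hbc.1.1, by rw [hJ b c hbc.2.1 hbc.2.2 hb]; exact hbc.1.2⟩, hbc.2⟩
    rw [← hC]
    ext v
    rw [mem_cS, mem_cS]
    exact and_congr_right fun _ => ⟨f2 v, f1 v⟩
  intro x y hxy
  exact propext ⟨key x y hxy, key y x fun i hi => (hxy i hi).symm⟩

lemma scal_dep (n : ℤ) (S : Finset V) : Dep ((bx 0 n).sym2 \ S.sym2) (fun ω => scal n ω = S) := by
  have key : ∀ x y : Sym2 V → Prop, (∀ i ∈ (bx 0 n).sym2 \ S.sym2, x i = y i) → scal n x = S → scal n y = S := by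
    intro x y hxy hC
    have hJ : ∀ a b : V, a ∈ bx 0 n → b ∈ bx 0 n → (a ∉ S ∨ b ∉ S) → (x s(a, b) = y s(a, b)) := fun a b ha hb hc =>
      hxy _ (Finset.mem_sdiff.2 ⟨Finset.mk_mem_sym2_iff.2 ⟨ha, hb⟩, fun h => by
        have := Finset.mk_mem_sym2_iff.1 h
        tauto⟩)
    have hS : ∀ v s, v ∈ bx 0 n → s ∈ sph n → CI (bondR x) (bx 0 n) v s → v ∉ S := by
      intro v s hv hs h hvS
      rw [← hC] at hvS
      exact (mem_scal.1 hvS).2 ⟨s, hs, h⟩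
    have f1 : ∀ v s, s ∈ sph n → CI (bondR x) (bx 0 n) v s → CI (bondR y) (bx 0 n) v s := by
      intro v s hs hv
      induction hv using Relation.ReflTransGen.head_induction_on with
      | refl => exact .refl
      | @head a c hac hc ih =>
        have ha : a ∉ S := hS a s hac.2.1 hs (Relation.ReflTransGen.head hac hc)
        exact Relation.ReflTransGen.head ⟨⟨hac.1.1, by rw [← hJ a c hac.2.1 hac.2.2 (Or.inl ha)]; exact hac.1.2⟩, hac.2⟩ ih
    have f2 : ∀ v s, s ∈ sph n → CI (bondR y) (bx 0 n) v s → CI (bondR x) (bx 0 n) v s := by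
      intro v s hs hv
      induction hv using Relation.ReflTransGen.head_induction_on with
      | refl => exact .refl
      | @head a c hac hc ih =>
        have ha : c ∉ S := hS c s hac.2.2 hs ih
        exact Relation.ReflTransGen.head ⟨⟨hac.1.1, by rw [hJ a c hac.2.1 hac.2.2 (Or.inr ha)]; exact hac.1.2⟩, hac.2⟩ ih
    rw [← hC]
    ext v
    rw [mem_scal, mem_scal]
    refine and_congr_right fun _ => not_congr ⟨?_, ?_⟩
    · rintro ⟨s, hs, h⟩; exact ⟨s, hs, f2 v s hs h⟩
    · rintro ⟨s, hs, h⟩; exact ⟨s, hs, f1 v s hs h⟩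
  intro x y hxy
  exact propext ⟨key x y hxy, key y x fun i hi => (hxy i hi).symm⟩

def Cto (S : Finset V) (x : V) : Set (Sym2 V → Prop) := {ω | CI (bondR ω) S 0 x}

lemma Cto_local (S : Finset V) (x : V) : Local S (CE S {0} {x}) := CE_local (le_refl _)
lemma Cto_eq (S : Finset V) (x : V) : Cto S x = bondR ⁻¹' (CE S {0} {x}) := by
  ext ω
  refine ⟨fun h => ⟨0, x, rfl, rfl, h⟩, ?_⟩
  rintro ⟨u, v, hu, hv, h⟩
  rw [Set.mem_singleton_iff] at hu hv
  subst hu; subst hv; exact h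
lemma Cto_dep (S : Finset V) (x : V) : Dep S.sym2 (fun ω => ω ∈ Cto S x) := by
  rw [Cto_eq]; exact bond_dep (Cto_local S x)

noncomputable def phiS (p : ℝ) (S : Finset V) : ℝ := p * ∑ q ∈ bdE S, (Bm (Sym2 V) p).real (Cto S q.1)

lemma phiS_nonneg {p : ℝ} (hp : 0 ≤ p) (S : Finset V) : 0 ≤ phiS p S :=
  mul_nonneg hp (Finset.sum_nonneg fun _ _ => measureReal_nonneg)

lemma phiS_mono {p q : ℝ} (hp : 0 ≤ p) (hpq : p ≤ q) (hq : q ≤ 1) (S : Finset V) : phiS p S ≤ phiS q S := by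
  unfold phiS
  refine mul_le_mul hpq (Finset.sum_le_sum fun x _ => ?_) (Finset.sum_nonneg fun _ _ => measureReal_nonneg) (hp.trans hpq)
  rw [Cto_eq, bond_real ⟨hp, hpq.trans hq⟩ (Cto_local _ _), bond_real ⟨hp.trans hpq, hq⟩ (Cto_local _ _)]
  exact wsum_mono_p (fun _ => hp) (fun _ => hpq) (fun _ => hq) (bond_mono (CE_inc _ _ _))

lemma last_exit {S : Finset V} {ω : Sym2 V → Prop} {R : Finset V} {a s : V} (hs : s ∉ S)
    (h : CI (bondR ω) R a s) : (a ∉ cS S ω ∧ CI (bondR ω) ((R : Set V) \ cS S ω) a s) ∨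
      ∃ x y, x ∈ cS S ω ∧ SqAdj x y ∧ y ∉ S ∧ ω s(x, y) ∧ CI (bondR ω) ((R : Set V) \ cS S ω) y s := by
  induction h using Relation.ReflTransGen.head_induction_on with
  | refl => exact Or.inl ⟨fun h => hs (mem_cS.1 h).1, .refl⟩
  | @head a c hac hc ih =>
    rcases ih with ⟨hc', ih⟩ | ih
    · by_cases ha : a ∈ cS S ω
      · refine Or.inr ⟨a, c, ha, hac.1.1, fun hcS => hc' (mem_cS.2 ⟨hcS, ?_⟩), hac.1.2, ih⟩
        exact (mem_cS.1 ha).2.tail ⟨hac.1, (mem_cS.1 ha).1, hcS⟩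
      · exact Or.inl ⟨ha, Relation.ReflTransGen.head ⟨hac.1, ⟨hac.2.1, ha⟩, hac.2.2, hc'⟩ ih⟩
    · exact Or.inr ih

lemma Bm_edge {p : ℝ} (hp : 0 ≤ p ∧ p ≤ 1) (e : Sym2 V) : (Bm (Sym2 V) p).real {ω | ω e} = p := by
  classical
  rw [Bm_real hp (A := {ω : Sym2 V → Prop | ω e}) (J := {e}) (fun x y h => h e (by simp))]
  rw [show ({e} : Finset (Sym2 V)) = insert e ∅ from rfl, wsum_insert _ (by simp), wsum_empty, wsum_empty]
  rw [ind_true (by simp), ind_false (by simp)]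
  ring

lemma rho_step {p : ℝ} (hp : 0 ≤ p ∧ p ≤ 1) {S : Finset V} (h0 : (0:V) ∈ S) {L : ℕ} (hS : S ⊆ bx 0 L) (m : ℕ) :
    rho p (m + L + 1) ≤ phiS p S * rho p m := by
  classical
  set n : ℤ := ((m + L + 1 : ℕ) : ℤ) with hn
  set μ := Bm (Sym2 V) p with hμ
  have hsub : {ω | bondR ω ∈ Arm n} ⊆ ⋃ q ∈ bdE S, ⋃ C ∈ S.powerset.filter (fun C => q.1 ∈ C),
      ({ω | cS S ω = C} ∩ {ω | ω s(q.1, q.2)}) ∩ (bondR ⁻¹' CE ((bx 0 n \ C : Finset V) : Set V) {q.2} (sph n)) := by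
    rintro ω ⟨u, s, hu, hs, hc⟩
    rw [Set.mem_singleton_iff] at hu
    subst hu
    have hs' : supN s = n := hs
    have hsS : s ∉ S := fun h => by
      have := supN_le.2 (hS h)
      omega
    rcases last_exit hsS hc with ⟨h1, -⟩ | ⟨x, y, hx, hxy, hy, hω, hc'⟩
    · exact absurd (mem_cS.2 ⟨h0, .refl⟩) h1
    · simp only [Set.mem_iUnion]
      refine ⟨(x, y), mem_bdE.2 ⟨(mem_cS.1 hx).1, hxy, hy⟩, cS S ω, ?_, ⟨rfl, hω⟩, y, s, rfl, hs, ?_⟩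
      · rw [Finset.mem_filter, Finset.mem_powerset]
        exact ⟨fun v hv => (mem_cS.1 hv).1, hx⟩
      · rw [Finset.coe_sdiff]; exact hc'
  have hterm : ∀ q ∈ bdE S, ∀ C ∈ S.powerset.filter (fun C => q.1 ∈ C),
      μ.real (({ω | cS S ω = C} ∩ {ω | ω s(q.1, q.2)}) ∩ (bondR ⁻¹' CE ((bx 0 n \ C : Finset V) : Set V) {q.2} (sph n)))
        ≤ μ.real {ω | cS S ω = C} * (p * rho p m) := by
    rintro ⟨x, y⟩ hq C hC
    obtain ⟨hx, hxy, hy⟩ := mem_bdE.1 hq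
    obtain ⟨hCS, hxC⟩ := Finset.mem_filter.1 hC
    rw [Finset.mem_powerset] at hCS
    simp only at hxC ⊢
    have d1 : Dep (touchE S C) (fun ω => ω ∈ {ω | cS S ω = C}) := cS_dep S C
    have d2 : Dep {s(x, y)} (fun ω : Sym2 V → Prop => ω ∈ {ω : Sym2 V → Prop | ω s(x, y)}) :=
      fun a b h => h _ (by simp)
    have d3 : Dep (bx 0 n \ C).sym2 (fun ω => ω ∈ bondR ⁻¹' CE ((bx 0 n \ C : Finset V) : Set V) {y} (sph n)) :=
      bond_dep (CE_local (le_refl _))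
    have hd12 : Disjoint (touchE S C) {s(x, y)} := by
      rw [Finset.disjoint_singleton_right]
      intro h
      exact hy (Finset.mk_mem_sym2_iff.1 (Finset.mem_filter.1 h).1).2
    have d12 : Dep (touchE S C ∪ {s(x, y)}) (fun ω => ω ∈ {ω | cS S ω = C} ∩ {ω : Sym2 V → Prop | ω s(x, y)}) := by
      intro a b h
      have e1 := d1 a b (fun i hi => h i (Finset.mem_union_left _ hi))
      have e2 := d2 a b (fun i hi => h i (Finset.mem_union_right _ hi))
      simp only at e1 e2
      simp only [Set.mem_inter_iff, e1, e2]
    have hd : Disjoint (touchE S C ∪ {s(x, y)}) (bx 0 n \ C).sym2 := by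
      rw [Finset.disjoint_union_left, Finset.disjoint_singleton_left, Finset.disjoint_left]
      constructor
      · intro e he he'
        obtain ⟨v, hv, hve⟩ := (Finset.mem_filter.1 he).2
        exact (Finset.mem_sdiff.1 (Finset.mem_sym2_iff.1 he' v hve)).2 hv
      · intro h
        exact (Finset.mem_sdiff.1 (Finset.mk_mem_sym2_iff.1 h).1).2 hxC
    rw [Bm_indep hp d12 d3 hd, Bm_indep hp d1 d2 hd12, Bm_edge hp, mul_assoc]
    refine mul_le_mul_of_nonneg_left (mul_le_mul_of_nonneg_left ?_ hp.1) measureReal_nonneg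
    rw [rho, ← bond_inv (iso_tr y) p (Arm_meas _)]
    refine measureReal_mono ?_ (measure_ne_top _ _)
    rintro ω ⟨u, s, hu, hs, hc⟩
    rw [Set.mem_singleton_iff] at hu
    subst hu
    refine arm_at (bondR_good _) (by omega) hc ?_
    have h1 : supN s = n := hs
    have h2 := hS hx
    rw [mem_bx] at h2
    have h3 := hxy.near
    unfold Near at h3; unfold supN at h1
    simp only [Prod.fst_zero, Prod.snd_zero] at h2
    omega
  calc rho p (m + L + 1) ≤ μ.real _ := measureReal_mono hsub (measure_ne_top _ _)
    _ ≤ ∑ q ∈ bdE S, ∑ C ∈ S.powerset.filter (fun C => q.1 ∈ C), μ.real _ :=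
        (measureReal_biUnion_finset_le _ _).trans (Finset.sum_le_sum fun q _ => measureReal_biUnion_finset_le _ _)
    _ ≤ ∑ q ∈ bdE S, ∑ C ∈ S.powerset.filter (fun C => q.1 ∈ C), μ.real {ω | cS S ω = C} * (p * rho p m) :=
        Finset.sum_le_sum fun q hq => Finset.sum_le_sum fun C hC => hterm q hq C hC
    _ ≤ ∑ q ∈ bdE S, μ.real (Cto S q.1) * (p * rho p m) := by
        refine Finset.sum_le_sum fun q hq => ?_
        rw [← Finset.sum_mul]
        refine mul_le_mul_of_nonneg_right ?_ (mul_nonneg hp.1 (rho_nonneg _ _))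
        rw [← measureReal_biUnion_finset]
        · refine measureReal_mono ?_ (measure_ne_top _ _)
          intro ω hω
          simp only [Set.mem_iUnion] at hω
          obtain ⟨C, hC, hω⟩ := hω
          have hω : cS S ω = C := hω
          have := (Finset.mem_filter.1 hC).2
          rw [← hω] at this
          exact (mem_cS.1 this).2
        · intro C _ C' _ hne
          rw [Function.onFun, Set.disjoint_left]
          intro ω h1 h2
          exact hne (Eq.trans (Eq.symm h1) h2)
        · intro C _
          exact measurableSet_setOf.2 (cS_dep S C).measurable
    _ = phiS p S * rho p m := by
        rw [← Finset.sum_mul, phiS]; ring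

lemma Arm_local' (n : ℤ) : Local (bx 0 n) (Arm n) := CE_local (le_refl _)

lemma rho_eq {p : ℝ} (hp : 0 ≤ p ∧ p ≤ 1) (n : ℕ) :
    rho p n = wsum (fun _ => p) (bx 0 n).sym2 (fun η => ind (bondR (fun i => i ∈ η) ∈ Arm n)) :=
  bond_real hp (Arm_local' n)

lemma piv_count (n : ℕ) (η : Finset (Sym2 V)) :
    ∑ S ∈ (bx 0 n).powerset.filter (fun S => (0:V) ∈ S), ∑ q ∈ bdE S,
      ind (scal n (fun i => i ∈ η) = S) * ind ((fun i => i ∈ η) ∈ Cto S q.1) ≤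
    ∑ e ∈ (bx 0 n).sym2, ind (¬ bondR (fun i => i ∈ η) ∈ Arm n ∧ bondR (fun i => i ∈ insert e η) ∈ Arm n) := by
  classical
  set ω : Sym2 V → Prop := fun i => i ∈ η with hω
  set S := scal n ω with hS
  have hnn : 0 ≤ ∑ e ∈ (bx 0 n).sym2, ind (¬ bondR ω ∈ Arm n ∧ bondR (fun i => i ∈ insert e η) ∈ Arm n) :=
    Finset.sum_nonneg fun _ _ => ind_nonneg _
  by_cases h0 : (0:V) ∈ S
  swap
  · refine le_trans (le_of_eq ?_) hnn
    refine Finset.sum_eq_zero fun S' hS' => Finset.sum_eq_zero fun q _ => ?_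
    rw [ind_false, zero_mul]
    rintro rfl
    exact h0 (Finset.mem_filter.1 hS').2
  have hSb : S ∈ (bx 0 n).powerset.filter (fun S => (0:V) ∈ S) :=
    Finset.mem_filter.2 ⟨Finset.mem_powerset.2 fun v hv => (mem_scal.1 hv).1, h0⟩
  rw [Finset.sum_eq_single_of_mem S hSb]
  swap
  · intro S' _ hne
    refine Finset.sum_eq_zero fun q _ => ?_
    rw [ind_false (fun h => hne h.symm), zero_mul]
  have hnot : ¬ bondR ω ∈ Arm n := by
    rintro ⟨u, s, hu, hs, hc⟩
    rw [Set.mem_singleton_iff] at hu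
    subst hu
    exact (mem_scal.1 h0).2 ⟨s, hs, hc⟩
  have hy : ∀ q ∈ bdE S, q.1 ∈ bx 0 n ∧ q.2 ∈ bx 0 n ∧ ∃ s ∈ sph n, CI (bondR ω) (bx 0 n) q.2 s := by
    rintro ⟨x, y⟩ hq
    obtain ⟨hx, hxy, hy⟩ := mem_bdE.1 hq
    obtain ⟨hx1, hx2⟩ := mem_scal.1 hx
    have hyb : y ∈ bx 0 n := by
      have h1 : supN x ≠ n := fun h => hx2 ⟨x, h, .refl⟩
      have h2 := supN_le.2 hx1
      have h3 : supN y ≤ supN x + 1 := by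
        have := hxy.near
        unfold Near at this; unfold supN; omega
      exact supN_le.1 (by omega)
    refine ⟨hx1, hyb, ?_⟩
    by_contra hcon
    exact hy (mem_scal.2 ⟨hyb, hcon⟩)
  have hinj : Set.InjOn (fun q : V × V => s(q.1, q.2)) (bdE S) := by
    rintro ⟨x, y⟩ hq ⟨x', y'⟩ hq' h
    have a1 := mem_bdE.1 hq
    have a2 := mem_bdE.1 hq'
    simp only [Sym2.eq_iff] at h
    rcases h with ⟨h1, h2⟩ | ⟨h1, h2⟩
    · rw [h1, h2]
    · rw [h1] at a1; exact absurd a1.1 a2.2.2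
  calc _ ≤ ∑ q ∈ bdE S, ind (¬ bondR ω ∈ Arm n ∧ bondR (fun i => i ∈ insert s(q.1, q.2) η) ∈ Arm n) := by
        refine Finset.sum_le_sum fun q hq => ?_
        rw [ind_true rfl, one_mul]
        refine ind_mono fun hc => ⟨hnot, ?_⟩
        obtain ⟨hx, hy', s, hs, hc'⟩ := hy q hq
        have hsq := (mem_bdE (x := q.1) (y := q.2)).1 hq
        have hc : CI (bondR ω) S 0 q.1 := hc
        have hm : ∀ a b, bondR ω a b → bondR (fun i => i ∈ insert s(q.1, q.2) η) a b := fun a b h =>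
          ⟨h.1, Finset.mem_insert_of_mem h.2⟩
        refine ⟨0, s, rfl, hs, ?_⟩
        have c1 : CI (bondR (fun i => i ∈ insert s(q.1, q.2) η)) (bx 0 n) 0 q.1 :=
          (hc.mono fun v hv => (mem_scal.1 hv).1).lift_local fun a _ b _ => hm a b
        have c2 := hc'.lift_local fun a _ b _ => hm a b
        exact (c1.tail ⟨⟨hsq.2.1, Finset.mem_insert_self _ _⟩, hx, hy'⟩).trans c2
    _ = ∑ e ∈ (bdE S).image (fun q : V × V => s(q.1, q.2)), ind (¬ bondR ω ∈ Arm n ∧ bondR (fun i => i ∈ insert e η) ∈ Arm n) := by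
        rw [Finset.sum_image hinj]
    _ ≤ _ := by
        refine Finset.sum_le_sum_of_subset_of_nonneg ?_ fun _ _ _ => ind_nonneg _
        intro e he
        obtain ⟨q, hq, rfl⟩ := Finset.mem_image.1 he
        exact Finset.mk_mem_sym2_iff.2 ⟨(hy q hq).1, (hy q hq).2.1⟩

lemma deriv_ge {p : ℝ} (hp : 0 < p ∧ p < 1) (n : ℕ) (hφ : ∀ S : Finset V, (0:V) ∈ S → 1 ≤ phiS p S) :
    1 - rho p n ≤ p * (1 - p) * ∑ e ∈ (bx 0 n).sym2, wsum (fun _ => p) ((bx 0 n).sym2.erase e)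
      (fun η => ind (bondR (fun i => i ∈ insert e η) ∈ Arm n) - ind (bondR (fun i => i ∈ η) ∈ Arm n)) := by
  classical
  have hp' : 0 ≤ p ∧ p ≤ 1 := ⟨hp.1.le, hp.2.le⟩
  set E := (bx 0 n).sym2 with hE
  set μ := Bm (Sym2 V) p with hμ
  have hg : ∀ e ∈ E, (1 - p) * wsum (fun _ => p) (E.erase e)
      (fun η => ind (bondR (fun i => i ∈ insert e η) ∈ Arm n) - ind (bondR (fun i => i ∈ η) ∈ Arm n)) =
      wsum (fun _ => p) E (fun η => ind (¬ bondR (fun i => i ∈ η) ∈ Arm n ∧ bondR (fun i => i ∈ insert e η) ∈ Arm n)) := by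
    intro e he
    rw [wsum_erase _ he]
    have z : wsum (fun _ => p) (E.erase e) (fun η => ind (¬ bondR (fun i => i ∈ insert e η) ∈ Arm n ∧
        bondR (fun i => i ∈ insert e (insert e η)) ∈ Arm n)) = 0 := by
      rw [← wsum_const (fun _ => p) (E.erase e) 0]
      refine wsum_congr fun η _ => ?_
      rw [ind_false]
      rw [Finset.insert_idem]; tauto
    rw [z, mul_zero, zero_add]
    congr 1
    refine wsum_congr fun η _ => ?_
    have hmono : bondR (fun i => i ∈ η) ∈ Arm n → bondR (fun i => i ∈ insert e η) ∈ Arm n :=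
      CE_inc _ _ _ _ _ fun u v h => ⟨h.1, Finset.mem_insert_of_mem h.2⟩
    by_cases h1 : bondR (fun i => i ∈ η) ∈ Arm n
    · rw [ind_true h1, ind_true (hmono h1), ind_false (fun h => h.1 h1)]; norm_num
    · rw [ind_false h1, sub_zero]
      congr 1
      exact propext ⟨fun h => ⟨h1, h⟩, fun h => h.2⟩
  rw [mul_assoc, Finset.mul_sum, Finset.sum_congr rfl hg, ← wsum_sum]
  have h1 := wsum_le_wsum (E := E) (p := fun _ => p) (fun _ => hp') fun η _ => piv_count n η
  refine le_trans ?_ (mul_le_mul_of_nonneg_left h1 hp.1.le)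
  rw [wsum_sum]
  have hterm : ∀ S ∈ (bx 0 n).powerset.filter (fun S => (0:V) ∈ S), μ.real {ω | scal n ω = S} ≤
      p * wsum (fun _ => p) E (fun η => ∑ q ∈ bdE S,
        ind (scal n (fun i => i ∈ η) = S) * ind ((fun i => i ∈ η) ∈ Cto S q.1)) := by
    intro S hS
    obtain ⟨hSb, h0⟩ := Finset.mem_filter.1 hS
    rw [Finset.mem_powerset] at hSb
    have hSE : S.sym2 ⊆ E := Finset.sym2_mono hSb
    have hq : ∀ q ∈ bdE S, wsum (fun _ => p) E (fun η =>
        ind (scal n (fun i => i ∈ η) = S) * ind ((fun i => i ∈ η) ∈ Cto S q.1)) =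
        μ.real {ω | scal n ω = S} * μ.real (Cto S q.1) := by
      intro q _
      have d1 : Dep (E \ S.sym2) (fun ω => ω ∈ {ω | scal n ω = S}) := scal_dep n S
      have d2 := Cto_dep S q.1
      rw [← Bm_indep hp' d1 d2 Finset.sdiff_disjoint]
      have d12 : Dep E (fun ω => ω ∈ {ω | scal n ω = S} ∩ Cto S q.1) := by
        intro a b h
        have e1 := d1 a b (fun i hi => h i (Finset.mem_sdiff.1 hi).1)
        have e2 := d2 a b (fun i hi => h i (hSE hi))
        simp only at e1 e2
        simp only [Set.mem_inter_iff, e1, e2]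
      rw [Bm_real hp' d12]
      refine wsum_congr fun η _ => ?_
      rw [← ind_and]; rfl
    rw [wsum_sum, Finset.sum_congr rfl hq, ← Finset.mul_sum]
    have := hφ S h0
    unfold phiS at this
    have hn : 0 ≤ μ.real {ω | scal n ω = S} := measureReal_nonneg
    calc μ.real {ω | scal n ω = S} = μ.real {ω | scal n ω = S} * 1 := (mul_one _).symm
      _ ≤ μ.real {ω | scal n ω = S} * _ := mul_le_mul_of_nonneg_left this hn
      _ = _ := by ring
  rw [Finset.mul_sum]
  refine le_trans ?_ (Finset.sum_le_sum hterm)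
  rw [← measureReal_biUnion_finset]
  · have hA : MeasurableSet (bondR ⁻¹' Arm n) := bondR_meas (Arm_meas n)
    have : rho p n = μ.real (bondR ⁻¹' Arm n) := rfl
    rw [this, ← probReal_compl_eq_one_sub hA]
    refine measureReal_mono ?_ (measure_ne_top _ _)
    intro ω hω
    simp only [Set.mem_iUnion]
    refine ⟨scal n ω, Finset.mem_filter.2 ⟨Finset.mem_powerset.2 fun v hv => (mem_scal.1 hv).1, ?_⟩, rfl⟩
    refine mem_scal.2 ⟨by rw [mem_bx]; simp, ?_⟩
    rintro ⟨s, hs, hc⟩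
    exact hω ⟨0, s, rfl, hs, hc⟩
  · intro C _ C' _ hne
    rw [Function.onFun, Set.disjoint_left]
    intro ω h1 h2
    exact hne (Eq.trans (Eq.symm h1) h2)
  · intro C _
    exact measurableSet_setOf.2 (scal_dep n C).measurable

end DaC

namespace DaC

lemma rho_le_one (p : ℝ) (n : ℕ) : rho p n ≤ 1 := measureReal_le_one

lemma rho_anti (p : ℝ) {m n : ℕ} (h : m ≤ n) : rho p n ≤ rho p m := by
  refine measureReal_mono ?_ (measure_ne_top _ _)
  rintro ω ⟨u, v, hu, hv, hc⟩
  have hv' : supN v = n := hv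
  exact arm_exit (bondR_good ω) hu (by rw [Set.mem_singleton_iff.1 hu, mem_bx]; simp) (by omega) hc

lemma rho_mono_p {p q : ℝ} (hp : 0 ≤ p) (hpq : p ≤ q) (hq : q ≤ 1) (n : ℕ) : rho p n ≤ rho q n := by
  rw [rho_eq ⟨hp, hpq.trans hq⟩, rho_eq ⟨hp.trans hpq, hq⟩]
  exact wsum_mono_p (fun _ => hp) (fun _ => hpq) (fun _ => hq) (bond_mono (CE_inc _ _ _))

lemma rho_half_ge {p : ℝ} (hp : 0 < p) (hp2 : p < 1/2) (hφ : ∀ S : Finset V, (0:V) ∈ S → 1 ≤ phiS p S) (n : ℕ) :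
    min (1/2) (1 - 2 * p) ≤ rho (1/2) n := by
  by_contra hcon
  push Not at hcon
  have h1 : rho (1/2) n < 1/2 := lt_of_lt_of_le hcon (min_le_left _ _)
  have h2 : rho (1/2) n < 1 - 2 * p := lt_of_lt_of_le hcon (min_le_right _ _)
  set f : ℝ → ℝ := fun q => wsum (fun _ => q) (bx 0 n).sym2 (fun η => ind (bondR (fun i => i ∈ η) ∈ Arm n)) with hf
  have hd := fun q : ℝ => wsum_hasDerivAt (bx 0 n).sym2 (fun η => ind (bondR (fun i => i ∈ η) ∈ Arm n)) q
  obtain ⟨c, hc, hcs⟩ := exists_hasDerivAt_eq_slope f _ hp2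
    (fun q _ => (hd q).continuousAt.continuousWithinAt) (fun q _ => hd q)
  have hge := deriv_ge (p := c) ⟨hp.trans hc.1, by linarith [hc.2]⟩ n fun S hS =>
    (hφ S hS).trans (phiS_mono hp.le hc.1.le (by linarith [hc.2]) S)
  rw [hcs] at hge
  have e1 : f (1/2) = rho (1/2) n := (rho_eq (by norm_num) n).symm
  have e2 : f p = rho p n := (rho_eq ⟨hp.le, by linarith⟩ n).symm
  rw [e1, e2] at hge
  have h3 : rho c n ≤ rho (1/2) n := rho_mono_p (hp.trans hc.1).le hc.2.le (by norm_num) n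
  have h4 := rho_nonneg p n
  have h5 : rho p n ≤ rho (1/2) n := rho_mono_p hp.le hp2.le (by norm_num) n
  have hD : (rho (1/2) n - rho p n) / (1/2 - p) < 2 := by
    rw [div_lt_iff₀ (by linarith)]; linarith
  have hD0 : 0 ≤ (rho (1/2) n - rho p n) / (1/2 - p) := div_nonneg (by linarith) (by linarith)
  have hcc : c * (1 - c) ≤ 1/4 := by nlinarith [sq_nonneg (c - 1/2)]
  have := mul_le_mul_of_nonneg_right hcc hD0
  linarith

lemma exists_phi {p : ℝ} (hp : 0 ≤ p) (hp2 : p < 1/2) : ∃ S : Finset V, (0:V) ∈ S ∧ phiS p S < 1 := by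
  by_contra hcon
  push Not at hcon
  rcases hp.eq_or_lt with rfl | hp'
  · have := hcon {0} (by simp)
    unfold phiS at this; rw [zero_mul] at this; linarith
  · obtain ⟨n, hn⟩ := bond_half (θ := min (1/2) (1 - 2 * p)) (lt_min (by norm_num) (by linarith))
    exact absurd (rho_half_ge hp' hp2 hcon n) (not_le.2 hn)

lemma rho_exp {p : ℝ} (hp : 0 ≤ p) (hp2 : p < 1/2) : ∃ φ : ℝ, 0 ≤ φ ∧ φ < 1 ∧ ∃ M : ℕ, 0 < M ∧ ∀ n, rho p n ≤ φ ^ (n / M) := by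
  obtain ⟨S, h0, hφ⟩ := exists_phi hp hp2
  have hp' : 0 ≤ p ∧ p ≤ 1 := ⟨hp, by linarith⟩
  obtain ⟨L, hL⟩ : ∃ L : ℕ, S ⊆ bx 0 L := by
    refine ⟨∑ v ∈ S, (supN v).toNat, fun v hv => supN_le.1 ?_⟩
    have := Finset.single_le_sum (f := fun v => (supN v).toNat) (fun _ _ => Nat.zero_le _) hv
    have h2 := Int.self_le_toNat (supN v)
    have h3 : (((supN v).toNat : ℕ) : ℤ) ≤ ((∑ v ∈ S, (supN v).toNat : ℕ) : ℤ) := Nat.cast_le.2 this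
    exact h2.trans h3
  refine ⟨phiS p S, phiS_nonneg hp S, hφ, L + 1, by omega, fun n => ?_⟩
  have key : ∀ k : ℕ, rho p (k * (L + 1)) ≤ phiS p S ^ k := by
    intro k
    induction k with
    | zero => simp [rho_le_one]
    | succ k ih =>
      have := rho_step hp' h0 hL (k * (L + 1))
      rw [pow_succ', show (k + 1) * (L + 1) = k * (L + 1) + L + 1 by ring]
      exact this.trans (mul_le_mul_of_nonneg_left ih (phiS_nonneg hp S))
  exact (rho_anti p (Nat.div_mul_le_self n (L + 1))).trans (key _)

lemma rho_tendsto {p : ℝ} (hp : 0 ≤ p) (hp2 : p < 1/2) : Filter.Tendsto (rho p) Filter.atTop (nhds 0) := by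
  obtain ⟨φ, h0, h1, M, hM, h⟩ := rho_exp hp hp2
  refine squeeze_zero (rho_nonneg p) h ((tendsto_pow_atTop_nhds_zero_of_lt_one h0 h1).comp ?_)
  exact Nat.tendsto_div_const_atTop hM.ne'

lemma er_bound {p : ℝ} (hp : 0 ≤ p) (hp2 : p < 1/2) : ∃ C : ℝ, 0 ≤ C ∧ ∀ k : ℕ, 0 < k → er p k ≤ C / (k:ℝ)^3 := by
  obtain ⟨φ, h0, h1, M, hM, h⟩ := rho_exp hp hp2
  obtain ⟨B, hB⟩ := (tendsto_pow_const_mul_const_pow_of_lt_one 3 h0 h1).bddAbove_range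
  have hB' : ∀ j : ℕ, (j:ℝ)^3 * φ^j ≤ B := fun j => hB ⟨j, rfl⟩
  have hB0 : 0 ≤ B := le_trans (by simp) (hB' 0)
  refine ⟨2 * (8 * M^3 * (4 * (B + 1))), by positivity, fun k hk => ?_⟩
  have hk' : (0:ℝ) < k := Nat.cast_pos.2 hk
  rw [le_div_iff₀ (by positivity)]
  set j := ((k - 1) / 2) / M with hj
  have h2 : rho p ((k-1)/2) ≤ φ^j := h _
  have hkj : k ≤ 2 * M * (j + 1) := by
    have e := Nat.div_add_mod ((k-1)/2) M
    have e2 := Nat.mod_lt ((k-1)/2) hM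
    rw [← hj] at e
    have e3 : 2 * M * (j + 1) = 2 * (M * j) + 2 * M := by ring
    omega
  have hkj' : (k:ℝ) ≤ 2 * M * (j + 1) := by exact_mod_cast hkj
  have hk3 : (k:ℝ)^3 ≤ 8 * M^3 * (j+1)^3 := by
    calc (k:ℝ)^3 ≤ (2 * M * (j + 1))^3 := pow_le_pow_left₀ hk'.le hkj' 3
      _ = _ := by ring
  have hj0 : (0:ℝ) ≤ j := Nat.cast_nonneg _
  have hj3 : ((j:ℝ)+1)^3 ≤ 4 * (j^3 + 1) := by nlinarith [mul_nonneg (sq_nonneg ((j:ℝ)-1)) (by linarith : (0:ℝ) ≤ j + 1)]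
  have hφj : 0 ≤ φ^j := pow_nonneg h0 _
  have hφ1 : φ^j ≤ 1 := pow_le_one₀ h0 h1.le
  calc er p k * (k:ℝ)^3 = 2 * (rho p ((k-1)/2) * (k:ℝ)^3) := by unfold er; ring
    _ ≤ 2 * (φ^j * (8 * M^3 * (4 * (j^3+1)))) := by
        refine mul_le_mul_of_nonneg_left (mul_le_mul h2 (hk3.trans ?_) (by positivity) hφj) (by norm_num)
        exact mul_le_mul_of_nonneg_left hj3 (by positivity)
    _ = 2 * (8 * M^3 * (4 * (j^3 * φ^j + φ^j))) := by ring
    _ ≤ _ := by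
        have := hB' j
        gcongr
end DaC

namespace DaC

/-- arms to every distance -/
def InfA (F : Col → Cfg) : Set Col := {ξ | ∀ n : ℕ, F ξ ∈ Arm n}

lemma InfA_eq (F : Col → Cfg) : InfA F = ⋂ n : ℕ, F ⁻¹' Arm n := by
  ext ξ; simp [InfA]

lemma InfA_meas {F : Col → Cfg} (hF : Measurable F) : MeasurableSet (InfA F) := by
  rw [InfA_eq]; exact MeasurableSet.iInter fun n => hF (Arm_meas n)

lemma arm_anti' {m n : ℕ} (h : m ≤ n) {η : Cfg} (hη : GoodCfg η) (ha : η ∈ Arm n) : η ∈ Arm m := by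
  obtain ⟨u, v, hu, hv, hc⟩ := ha
  have hv' : supN v = n := hv
  exact arm_exit hη hu (by rw [Set.mem_singleton_iff.1 hu, mem_bx]; simp) (by omega) hc

lemma InfA_zero {F : Col → Cfg} (hF : Measurable F) {μ : Measure Col} [IsProbabilityMeasure μ]
    (h : ∀ θ : ℝ, 0 < θ → ∃ n : ℕ, (μ.map F).real (Arm n) < θ) : μ (InfA F) = 0 := by
  have : μ.real (InfA F) = 0 := by
    refine le_antisymm (le_of_forall_pos_le_add fun θ hθ => ?_) measureReal_nonneg
    obtain ⟨n, hn⟩ := h θ hθ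
    rw [map_measureReal_apply hF (Arm_meas _)] at hn
    rw [zero_add]
    exact (measureReal_mono (fun ξ (hξ : ξ ∈ InfA F) => hξ n) (measure_ne_top _ _)).trans hn.le
  exact (measureReal_eq_zero_iff (measure_ne_top _ _)).1 this

lemma InfA_pos {F : Col → Cfg} (hF : Measurable F) (hg : ∀ ξ, GoodCfg (F ξ)) {μ : Measure Col} [IsProbabilityMeasure μ]
    {θ : ℝ} (hθ : 0 < θ) (h : ∀ n : ℕ, θ ≤ (μ.map F).real (Arm n)) : μ (InfA F) ≠ 0 := by
  intro h0
  have ht : Filter.Tendsto (fun n : ℕ => μ (F ⁻¹' Arm n)) Filter.atTop (nhds (μ (⋂ n : ℕ, F ⁻¹' Arm n))) :=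
    tendsto_measure_iInter_atTop (fun n => (hF (Arm_meas n)).nullMeasurableSet)
      (fun m n hmn ξ hξ => arm_anti' hmn (hg ξ) hξ) ⟨0, measure_ne_top _ _⟩
  rw [← InfA_eq, h0] at ht
  have ht' : ∀ n : ℕ, ENNReal.ofReal θ ≤ μ (F ⁻¹' Arm n) := fun n => by
    have := h n
    rw [map_measureReal_apply hF (Arm_meas _)] at this
    exact ENNReal.ofReal_le_of_le_toReal this
  have := ge_of_tendsto' ht ht'
  have h2 := ENNReal.ofReal_pos.2 hθ
  exact absurd (le_antisymm this bot_le) h2.ne'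

lemma InfA_zero_iff {F : Col → Cfg} (hF : Measurable F) (hg : ∀ ξ, GoodCfg (F ξ)) {μ : Measure Col} [IsProbabilityMeasure μ] :
    μ (InfA F) ≠ 0 ↔ ∃ θ : ℝ, 0 < θ ∧ ∀ n : ℕ, θ ≤ (μ.map F).real (Arm n) := by
  constructor
  · intro h
    by_contra hcon
    push Not at hcon
    exact h (InfA_zero hF hcon)
  · rintro ⟨θ, hθ, h⟩
    exact InfA_pos hF hg hθ h

instance lam_prob' (p r : ℝ) : IsProbabilityMeasure (lam p r) := lam_prob p r

lemma ann_null {F : Col → Cfg} {P : V → Set Col} (hF : ∀ ξ a b, F ξ a b → ξ ∈ P a) {μ : Measure Col} [IsProbabilityMeasure μ]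
    (hP : ∀ v, μ.real (P v) = 0) {n : ℕ} (hn : 0 < n) : μ.real (F ⁻¹' Ann n) = 0 := by
  refine le_antisymm ?_ measureReal_nonneg
  calc μ.real (F ⁻¹' Ann n) ≤ μ.real (⋃ v ∈ bx 0 (2 * n), P v) := by
        refine measureReal_mono ?_ (measure_ne_top _ _)
        rintro ξ ⟨u, v, hu, hv, hc⟩
        have hv' : supN v = 2 * n := hv
        have hu' := supN_le.2 (Finset.mem_coe.1 hu)
        rcases Relation.ReflTransGen.cases_head hc with rfl | ⟨w, hw, -⟩
        · omega
        · simp only [Set.mem_iUnion]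
          exact ⟨u, hw.2.1, hF _ _ _ hw.1⟩
    _ ≤ ∑ v ∈ bx 0 (2 * n), μ.real (P v) := measureReal_biUnion_finset_le _ _
    _ = 0 := Finset.sum_eq_zero fun v _ => hP v

/-- extraction of nearby parameter -/
lemma near_right {f : ℝ → ℝ} (hf : ContinuousOn f (Set.Icc 0 1)) {r κ : ℝ} (h0 : 0 ≤ r) (h1 : r < 1) (h : f r < κ) :
    ∃ s, r < s ∧ s < 1 ∧ f s < κ := by
  have hc := (hf r ⟨h0, h1.le⟩).mono (show Set.Ioo r 1 ⊆ Set.Icc 0 1 from fun x hx => ⟨h0.trans hx.1.le, hx.2.le⟩)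
  have h2 := hc.eventually (gt_mem_nhds h)
  haveI : (nhdsWithin r (Set.Ioo r 1)).NeBot := by
    rw [← mem_closure_iff_nhdsWithin_neBot, closure_Ioo h1.ne]; exact ⟨le_refl _, h1.le⟩
  obtain ⟨s, hs, hs'⟩ := (h2.and self_mem_nhdsWithin).exists
  exact ⟨s, hs'.1, hs'.2, hs⟩

lemma near_left {f : ℝ → ℝ} (hf : ContinuousOn f (Set.Icc 0 1)) {r κ : ℝ} (h0 : 0 < r) (h1 : r ≤ 1) (h : f r < κ) :
    ∃ s, 0 < s ∧ s < r ∧ f s < κ := by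
  have hc := (hf r ⟨h0.le, h1⟩).mono (show Set.Ioo 0 r ⊆ Set.Icc 0 1 from fun x hx => ⟨hx.1.le, hx.2.le.trans h1⟩)
  have h2 := hc.eventually (gt_mem_nhds h)
  haveI : (nhdsWithin r (Set.Ioo 0 r)).NeBot := by
    rw [← mem_closure_iff_nhdsWithin_neBot, closure_Ioo h0.ne]; exact ⟨h0.le, le_refl _⟩
  obtain ⟨s, hs, hs'⟩ := (h2.and self_mem_nhdsWithin).exists
  exact ⟨s, hs'.1, hs'.2, hs⟩

lemma critical_core {p : ℝ} (hp0 : 0 ≤ p) (hp2 : p < 1/2) {rc : ℝ}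
    (hrc : rc = sSup {r : ℝ | r ∈ Set.Icc (0:ℝ) 1 ∧ lam p r (InfA blkR) = 0}) :
    (0 < rc ∧ rc < 1) ∧ lam p rc (InfA blkR) = 0 ∧ lam p rc (InfA whtR) = 0 ∧
    (∃ c : ℝ, 0 < c ∧ ∃ n1 : ℕ, ∀ n : ℕ, n1 ≤ n → 0 < n → c / n ≤ (lam p rc).real (blkR ⁻¹' Arm n)) ∧
    (∃ c : ℝ, 0 < c ∧ ∃ n1 : ℕ, ∀ n : ℕ, n1 ≤ n → 0 < n → c / n ≤ (lam p rc).real (whtR ⁻¹' Arm n)) := by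
  have hp : 0 ≤ p ∧ p ≤ 1 := ⟨hp0, by linarith⟩
  have hρ := rho_tendsto hp0 hp2
  obtain ⟨C, hC, he⟩ := er_bound hp0 hp2
  set κ : ℝ := 1 / (4 * 41 ^ 4) with hκ
  have hκ0 : 0 < κ := by positivity
  obtain ⟨n1, hn1⟩ := exists_nat_ge (800 * (41:ℝ)^8 * C + 1)
  have hn1' : ∀ n : ℕ, n1 ≤ n → 0 < n ∧ 800 * (41:ℝ)^8 * C ≤ n := by
    intro n hn
    have h1 : (n1:ℝ) ≤ n := Nat.cast_le.2 hn
    have h2 : (0:ℝ) ≤ 800 * (41:ℝ)^8 * C := by positivity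
    exact ⟨by have : (0:ℝ) < n := by linarith
              exact_mod_cast this, by linarith⟩
  set T := {r : ℝ | r ∈ Set.Icc (0:ℝ) 1 ∧ lam p r (InfA blkR) = 0} with hT
  have hTb : BddAbove T := ⟨1, fun r hr => hr.1.2⟩
  have mb : ∀ r n, ((lam p r).map blkR).real (Ann n) = (lam p r).real (blkR ⁻¹' Ann n) := fun r n =>
    map_measureReal_apply blkR_meas (ann_local n).measurable
  have mw : ∀ r n, ((lam p r).map whtR).real (Ann n) = (lam p r).real (whtR ⁻¹' Ann n) := fun r n =>
    map_measureReal_apply whtR_meas (ann_local n).measurable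
  have L1 : ∀ r, 0 < r → r < 1 → ∀ n : ℕ, n1 ≤ n → (lam p r).real (blkR ⁻¹' Ann n) < κ → lam p r (InfA blkR) = 0 := by
    intro r h0 h1 n hn ha
    have hm := model_b hp hρ ⟨h0, h1⟩
    refine InfA_zero blkR_meas fun θ hθ => ?_
    obtain ⟨j, hj⟩ := exists_pow_lt_of_lt_one hθ (by norm_num : (1/2:ℝ) < 1)
    refine ⟨2 * (10 ^ j * n), ?_⟩
    have k1 := hm.arm_le_ann (10 ^ j * n)
    have k2 := hm.criterion hC he (hn1' n hn).1 (hn1' n hn).2 (by rw [mb]; exact ha.le) j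
    have k3 : 1 / (4 * 41 ^ 4) * (1 / 2 : ℝ) ^ j ≤ (1/2:ℝ)^j := by
      have : (0:ℝ) ≤ (1/2)^j := by positivity
      linarith
    refine lt_of_le_of_lt ?_ (lt_of_le_of_lt (k2.trans k3) hj)
    exact_mod_cast k1
  have L2 : ∀ r, 0 < r → r < 1 → ∀ n : ℕ, n1 ≤ n → (lam p r).real (whtR ⁻¹' Ann n) < κ → lam p r (InfA blkR) ≠ 0 := by
    intro r h0 h1 n hn ha
    obtain ⟨θ, hθ, h⟩ := wsmall_perc (model_b hp hρ ⟨h0, h1⟩) (model_w hp hρ ⟨h0, h1⟩) hC he (hn1' n hn).1 (hn1' n hn).2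
      (by rw [mw]; exact ha.le)
    exact InfA_pos blkR_meas blkR_good hθ h
  have L3 : ∀ r s, 0 ≤ r → r ≤ s → s ≤ 1 → lam p r (InfA blkR) ≠ 0 → lam p s (InfA blkR) ≠ 0 := by
    intro r s h0 hrs h1 h
    obtain ⟨θ, hθ, h⟩ := (InfA_zero_iff blkR_meas blkR_good).1 h
    refine InfA_pos blkR_meas blkR_good hθ fun n => (h n).trans ?_
    rw [map_measureReal_apply blkR_meas (Arm_meas _), map_measureReal_apply blkR_meas (Arm_meas _)]
    exact lam_mono hp hρ h0 hrs h1 (blk_clocal (Arm_local' n)) (blk_cinc (CE_inc _ _ _))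
  have cb : ∀ n : ℕ, ContinuousOn (fun r => (lam p r).real (blkR ⁻¹' Ann n)) (Set.Icc 0 1) := fun n =>
    lam_cont hp hρ (blk_clocal (ann_local n))
  have cw : ∀ n : ℕ, ContinuousOn (fun r => (lam p r).real (whtR ⁻¹' Ann n)) (Set.Icc 0 1) := fun n =>
    lam_cont hp hρ (wht_clocal (ann_local n))
  clear_value κ
  have hn1p : 0 < n1 := (hn1' n1 le_rfl).1
  have hpos : 0 < rc := by
    obtain ⟨s, h0, h1, hs⟩ := near_right (cb n1) le_rfl zero_lt_one (κ := κ) (by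
      rw [ann_null (P := fun v => {ξ | ξ v}) (fun ξ a b h => h.2.1) (fun v => lam_one (by norm_num) v) hn1p]; exact hκ0)
    have : s ∈ T := ⟨⟨h0.le, h1.le⟩, L1 s h0 h1 n1 le_rfl hs⟩
    rw [hrc]; exact h0.trans_le (le_csSup hTb this)
  have hTne : T.Nonempty := by
    by_contra h
    rw [Set.not_nonempty_iff_eq_empty] at h
    rw [hrc, h, Real.sSup_empty] at hpos
    exact lt_irrefl _ hpos
  have hlt : rc < 1 := by
    obtain ⟨s, h0, h1, hs⟩ := near_left (cw n1) zero_lt_one le_rfl (κ := κ) (by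
      rw [ann_null (P := fun v => {ξ | ξ v}ᶜ) (fun ξ a b h => h.2.1) (fun v => by
        rw [probReal_compl_eq_one_sub (measurableSet_setOf.2 (measurable_pi_apply v)), lam_one (by norm_num) v]; norm_num) hn1p]
      exact hκ0)
    refine lt_of_le_of_lt ?_ h1
    rw [hrc]
    refine csSup_le hTne fun t ht => ?_
    by_contra hc
    push Not at hc
    exact L3 s t h0.le hc.le ht.1.2 (L2 s h0 h1 n1 le_rfl hs) ht.2
  have ab : ∀ n : ℕ, n1 ≤ n → κ ≤ (lam p rc).real (blkR ⁻¹' Ann n) := by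
    intro n hn
    by_contra hc
    push Not at hc
    obtain ⟨s, h0, h1, hs⟩ := near_right (cb n) hpos.le hlt hc
    have : s ∈ T := ⟨⟨(hpos.trans h0).le, h1.le⟩, L1 s (hpos.trans h0) h1 n hn hs⟩
    have := le_csSup hTb this
    rw [← hrc] at this; linarith
  have aw : ∀ n : ℕ, n1 ≤ n → κ ≤ (lam p rc).real (whtR ⁻¹' Ann n) := by
    intro n hn
    by_contra hc
    push Not at hc
    obtain ⟨s, h0, h1, hs⟩ := near_left (cw n) hpos hlt.le hc
    rw [hrc] at h1
    obtain ⟨t, ht, hst⟩ := exists_lt_of_lt_csSup hTne h1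
    rw [← hrc] at h1
    exact L3 s t h0.le hst.le ht.1.2 (L2 s h0 (h1.trans hlt) n hn hs) ht.2
  have hmb := model_b hp hρ ⟨hpos, hlt⟩
  have hmw := model_w hp hρ ⟨hpos, hlt⟩
  refine ⟨⟨hpos, hlt⟩, ?_, ?_, ?_, ?_⟩
  · by_contra h
    obtain ⟨θ, hθ, h⟩ := (InfA_zero_iff blkR_meas blkR_good).1 h
    obtain ⟨n, hn, hs⟩ := nocross_bw.small hmb hθ h (δ := κ / 2) (by linarith) n1
    rw [mw] at hs
    exact absurd ((aw n hn).trans hs) (not_le.2 (by linarith))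
  · by_contra h
    obtain ⟨θ, hθ, h⟩ := (InfA_zero_iff whtR_meas whtR_good).1 h
    obtain ⟨n, hn, hs⟩ := nocross_wb.small hmw hθ h (δ := κ / 2) (by linarith) n1
    rw [mb] at hs
    exact absurd ((ab n hn).trans hs) (not_le.2 (by linarith))
  · refine ⟨κ / 12, by positivity, n1, fun n hn hn0 => ?_⟩
    have h1 := hmb.ann_le_arm n hn0
    rw [mb, map_measureReal_apply blkR_meas (Arm_meas _)] at h1
    have h2 := (ab n hn).trans h1
    have : (0:ℝ) < n := Nat.cast_pos.2 hn0
    rw [div_le_iff₀ this]; linarith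
  · refine ⟨κ / 12, by positivity, n1, fun n hn hn0 => ?_⟩
    have h1 := hmw.ann_le_arm n hn0
    rw [mw, map_measureReal_apply whtR_meas (Arm_meas _)] at h1
    have h2 := (aw n hn).trans h1
    have : (0:ℝ) < n := Nat.cast_pos.2 hn0
    rw [div_le_iff₀ this]; linarith

end DaC

namespace DaC

lemma boolOf_iff {P : Prop} : boolOf P = true ↔ P := by
  unfold boolOf; exact @decide_eq_true_iff P (Classical.propDecidable P)

lemma base_eq : base = volume.restrict (Set.Ico (0:ℝ) 1) := by
  unfold base; exact (Measure.restrict_congr_set Ico_ae_eq_Ioc).symm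

instance base_prob : IsProbabilityMeasure base := ⟨by simp [base]⟩

/-- the binary digits as propositions -/
def bp (x : ℝ) (n : ℕ) : Prop := bit n x = true

lemma bp_iff (x : ℝ) (n : ℕ) : bp x n ↔ ⌊x * 2 ^ (n + 1)⌋ % 2 = 1 := boolOf_iff

lemma bp_meas : Measurable bp := by
  refine measurable_pi_lambda _ fun n => ?_
  refine measurableSet_setOf.1 ?_
  have : {x | bp x n} = (fun x : ℝ => ⌊x * 2 ^ (n + 1)⌋) ⁻¹' {z | z % 2 = 1} := by
    ext x; exact bp_iff x n
  rw [this]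
  exact (Int.measurable_floor.comp (measurable_id.mul_const _)) (by trivial)

lemma floor_half (x : ℝ) (n : ℕ) : ⌊x * 2 ^ n⌋ = ⌊x * 2 ^ (n + 1)⌋ / 2 := by
  have h := Int.floor_div_natCast (x * 2 ^ (n + 1)) 2
  rw [show x * 2 ^ (n + 1) / ((2:ℕ):ℝ) = x * 2 ^ n by push_cast; rw [pow_succ]; ring] at h
  exact_mod_cast h

open Classical in
noncomputable def kk (η : Finset ℕ) : ℕ → ℤ
  | 0 => 0
  | N + 1 => 2 * kk η N + if N ∈ η then 1 else 0

lemma kk_bd (η : Finset ℕ) (N : ℕ) : 0 ≤ kk η N ∧ kk η N < 2 ^ N := by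
  induction N with
  | zero => simp [kk]
  | succ N ih =>
    rw [kk, pow_succ]
    split_ifs <;> omega

lemma cyl_floor (η : Finset ℕ) (N : ℕ) {x : ℝ} (hx : x ∈ Set.Ico (0:ℝ) 1) :
    bp x ∈ cyl (Finset.range N) η ↔ ⌊x * 2 ^ N⌋ = kk η N := by
  induction N with
  | zero => 
    have : ⌊x⌋ = 0 := Int.floor_eq_zero_iff.2 hx
    simp [cyl, kk, this]
  | succ N ih =>
    have e : bp x ∈ cyl (Finset.range (N+1)) η ↔ bp x ∈ cyl (Finset.range N) η ∧ (bp x N ↔ N ∈ η) := by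
      constructor
      · intro h
        exact ⟨fun i hi => h i (Finset.mem_range.2 (by have := Finset.mem_range.1 hi; omega)),
          h N (Finset.mem_range.2 (by omega))⟩
      · rintro ⟨h1, h2⟩ i hi
        rcases Nat.lt_succ_iff_lt_or_eq.1 (Finset.mem_range.1 hi) with h | h
        · exact h1 i (Finset.mem_range.2 h)
        · rw [h]; exact h2
    rw [e, ih, floor_half, bp_iff, kk]
    by_cases h : N ∈ η <;> simp only [h, if_true, if_false, iff_true, iff_false] <;> omega

lemma base_cyl (η : Finset ℕ) (N : ℕ) : base.real {x | bp x ∈ cyl (Finset.range N) η} = (1/2) ^ N := by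
  have h2 : (0:ℝ) < 2 ^ N := by positivity
  obtain ⟨k0, k1⟩ := kk_bd η N
  have k0' : (0:ℝ) ≤ kk η N := by exact_mod_cast k0
  have k1' : (kk η N : ℝ) + 1 ≤ 2 ^ N := by exact_mod_cast k1
  have hm : MeasurableSet {x | bp x ∈ cyl (Finset.range N) η} := bp_meas (cyl_measurable _ _)
  have e : {x | bp x ∈ cyl (Finset.range N) η} ∩ Set.Ico (0:ℝ) 1 =
      Set.Ico ((kk η N : ℝ) / 2 ^ N) (((kk η N : ℝ) + 1) / 2 ^ N) := by
    ext x
    constructor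
    · rintro ⟨h, hx⟩
      have := Int.floor_eq_iff.1 ((cyl_floor η N hx).1 h)
      exact ⟨(div_le_iff₀ h2).2 this.1, (lt_div_iff₀ h2).2 this.2⟩
    · rintro ⟨ha, hb⟩
      have hx : x ∈ Set.Ico (0:ℝ) 1 := 
        ⟨le_trans (by positivity) ha, lt_of_lt_of_le hb ((div_le_one h2).2 k1')⟩
      exact ⟨(cyl_floor η N hx).2 (Int.floor_eq_iff.2 ⟨(div_le_iff₀ h2).1 ha, (lt_div_iff₀ h2).1 hb⟩), hx⟩
  rw [base_eq, Measure.real, Measure.restrict_apply hm, e, Real.volume_Ico, ENNReal.toReal_ofReal]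
  · rw [← sub_div, add_sub_cancel_left, one_div_pow]
  · rw [← sub_div, add_sub_cancel_left]; positivity

lemma half01 : (0:ℝ) ≤ 1/2 ∧ (1/2:ℝ) ≤ 1 := by norm_num

instance base_map_prob : IsProbabilityMeasure (base.map bp) :=
  Measure.isProbabilityMeasure_map bp_meas.aemeasurable

lemma bits_dep {N : ℕ} {A : Set (ℕ → Prop)} (h : Dep (Finset.range N) (fun x => x ∈ A)) :
    (base.map bp).real A = (Bm ℕ (1/2)).real A := by
  have hA : MeasurableSet A := measurableSet_setOf.2 h.measurable
  have hd : Dep (Finset.range N) (fun x => ind (x ∈ A)) := fun x y hh => congrArg ind (h x y hh)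
  have key : ∀ μ : Measure (ℕ → Prop), IsProbabilityMeasure μ → (∀ η ∈ (Finset.range N).powerset, μ.real (cyl (Finset.range N) η) = (1/2)^N) →
      μ.real A = ∑ η ∈ (Finset.range N).powerset, (1/2)^N * ind ((fun i => i ∈ η) ∈ A) := by
    intro μ hμ hc
    rw [real_eq_integral_ind _ hA, hd.eq_sum, integral_finsetSum]
    · refine Finset.sum_congr rfl fun η hη => ?_
      rw [integral_indicator (cyl_measurable _ η), setIntegral_const, hc η hη, smul_eq_mul]
    · exact fun η hη => (integrable_const _).indicator (cyl_measurable _ η)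
  rw [key _ inferInstance, key _ (Bm_prob ℕ (1/2))]
  · intro η hη
    rw [Bm_cyl half01 (Finset.mem_powerset.1 hη), Finset.prod_const, Finset.prod_const,
      show (1 - 1/2 : ℝ) = 1/2 by norm_num, ← pow_add,
      Finset.card_sdiff_of_subset (Finset.mem_powerset.1 hη), Finset.card_range]
    congr 1
    have := Finset.card_le_card (Finset.mem_powerset.1 hη)
    rw [Finset.card_range] at this
    omega
  · intro η hη
    rw [map_measureReal_apply bp_meas (cyl_measurable _ _)]
    exact base_cyl η N

lemma bits_law : base.map bp = Bm ℕ (1/2) := by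
  refine Measure.eq_infinitePi _ fun s t ht => ?_
  obtain ⟨N, hN⟩ : ∃ N, s ⊆ Finset.range N := ⟨s.sup id + 1, fun i hi => 
    Finset.mem_range.2 (Nat.lt_succ_of_le (Finset.le_sup (f := id) hi))⟩
  have hd : Dep (Finset.range N) (fun x => x ∈ Set.pi (s : Set ℕ) t) := by
    intro x y hxy
    refine propext (forall₂_congr fun i hi => ?_)
    rw [hxy i (hN hi)]
  have := bits_dep hd
  rw [← Measure.infinitePi_pi (fun _ : ℕ => bern (1/2)) (fun i _ => ht i)]
  rw [Measure.real, Measure.real] at this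
  exact (ENNReal.toReal_eq_toReal_iff' (measure_ne_top _ _) (measure_ne_top _ _)).1 this

/-- the real number with given binary digits -/
noncomputable def UU (b : ℕ → Prop) : ℝ := ∑' k : ℕ, ind (b k) * (2⁻¹ : ℝ) ^ (k + 1)

lemma ind_meas : Measurable ind := measurable_of_finite _

lemma UU_sum (b : ℕ → Prop) : Summable (fun k : ℕ => ind (b k) * (2⁻¹ : ℝ) ^ (k + 1)) := by
  refine Summable.of_nonneg_of_le (fun k => mul_nonneg (ind_nonneg _) (by positivity))
    (fun k => mul_le_of_le_one_left (by positivity) (ind_le_one _)) ?_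
  exact (summable_nat_add_iff 1).2 (summable_geometric_of_lt_one (by norm_num) (by norm_num))

lemma UU_meas : Measurable UU := by
  refine measurable_of_tendsto_metrizable
    (f := fun n b => ∑ k ∈ Finset.range n, ind (b k) * (2⁻¹ : ℝ) ^ (k + 1)) ?_ ?_
  · intro n
    refine Finset.measurable_sum _ fun k _ => ?_
    exact (ind_meas.comp (measurable_pi_apply k)).mul_const _
  · exact tendsto_pi_nhds.2 fun b => (UU_sum b).hasSum.tendsto_sum_nat

lemma unif_eq (i : ℕ) (x : ℝ) : unif i x = UU (fun k => bp x (Nat.pair i k)) := by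
  unfold unif UU
  refine tsum_congr fun k => ?_
  by_cases h : bit (Nat.pair i k) x = true
  · have h' : bp x (Nat.pair i k) := h
    beta_reduce
    rw [if_pos h, ind_true h', one_mul]
  · have h' : ¬ bp x (Nat.pair i k) := h
    beta_reduce
    rw [if_neg h, ind_false h', zero_mul]

lemma UU_bp {x : ℝ} (hx : x ∈ Set.Ico (0:ℝ) 1) : UU (bp x) = x := by
  have hs : ∀ N, ∑ k ∈ Finset.range N, ind (bp x k) * (2⁻¹ : ℝ) ^ (k + 1) = ⌊x * 2 ^ N⌋ / 2 ^ N := by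
    intro N
    induction N with
    | zero =>
      have : ⌊x⌋ = 0 := Int.floor_eq_zero_iff.2 hx
      simp [this]
    | succ N ih =>
      rw [Finset.sum_range_succ, ih, floor_half x N]
      have hb := bp_iff x N
      have hdm : (2 * (⌊x * 2 ^ (N+1)⌋ / 2) + ⌊x * 2 ^ (N+1)⌋ % 2 : ℤ) = ⌊x * 2 ^ (N+1)⌋ := by omega
      have hdm' : (2 * ((⌊x * 2 ^ (N+1)⌋ / 2 : ℤ) : ℝ) + ((⌊x * 2 ^ (N+1)⌋ % 2 : ℤ) : ℝ)) = ⌊x * 2 ^ (N+1)⌋ := by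
        exact_mod_cast hdm
      have hi : ind (bp x N) = ((⌊x * 2 ^ (N+1)⌋ % 2 : ℤ) : ℝ) := by
        by_cases h : bp x N
        · rw [ind_true h, hb.1 h]; simp
        · rw [ind_false h, show ⌊x * 2 ^ (N+1)⌋ % 2 = 0 by
            have h3 : ¬ (⌊x * 2 ^ (N+1)⌋ % 2 = 1) := fun h' => h (hb.2 h')
            omega]; simp
      rw [hi, ← hdm', inv_pow, pow_succ]
      field_simp
  have h1 := (UU_sum (bp x)).hasSum.tendsto_sum_nat
  simp_rw [hs] at h1
  refine tendsto_nhds_unique h1 ?_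
  have h0 : Filter.Tendsto (fun N : ℕ => x - ((2:ℝ)⁻¹) ^ N) Filter.atTop (nhds x) := by
    have := (tendsto_pow_atTop_nhds_zero_of_lt_one (r := (2:ℝ)⁻¹) (by norm_num) (by norm_num)).const_sub x
    simpa using this
  refine tendsto_of_tendsto_of_tendsto_of_le_of_le h0 tendsto_const_nhds ?_ ?_
  · intro N
    have h2 : (0:ℝ) < 2 ^ N := by positivity
    show x - ((2:ℝ)⁻¹) ^ N ≤ _
    rw [le_div_iff₀ h2, sub_mul, inv_pow, inv_mul_cancel₀ h2.ne']
    linarith [Int.lt_floor_add_one (x * 2 ^ N)]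
  · intro N
    have h2 : (0:ℝ) < 2 ^ N := by positivity
    show _ ≤ x
    rw [div_le_iff₀ h2]
    exact Int.floor_le _

lemma UU_law : (Bm ℕ (1/2)).map UU = base := by
  rw [← bits_law, Measure.map_map UU_meas bp_meas]
  have : UU ∘ bp =ᵐ[base] id := by
    rw [base_eq]
    filter_upwards [ae_restrict_mem measurableSet_Ico] with x hx using UU_bp hx
  rw [Measure.map_congr this, Measure.map_id]

lemma unif_meas : Measurable (fun x i => unif i x) := by
  refine measurable_pi_lambda _ fun i => ?_
  simp_rw [unif_eq]
  exact UU_meas.comp (measurable_pi_lambda _ fun k => (measurable_pi_apply (Nat.pair i k)).comp bp_meas)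

lemma unif_law : base.map (fun x i => unif i x) = Measure.infinitePi (fun _ : ℕ => base) := by
  have hG : Measurable (fun (b : ℕ → Prop) (i k : ℕ) => b (Nat.pair i k)) :=
    measurable_pi_lambda _ fun i => measurable_pi_lambda _ fun k => measurable_pi_apply _
  have h1 : (Bm ℕ (1/2)).map (fun (b : ℕ → Prop) (i k : ℕ) => b (Nat.pair i k)) = 
      Measure.infinitePi (fun _ : ℕ => Bm ℕ (1/2)) := by
    have hinj : Function.Injective (fun q : ℕ × ℕ => Nat.pair q.1 q.2) := by
      rintro ⟨a, b⟩ ⟨c, d⟩ h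
      obtain ⟨h1, h2⟩ := Nat.pair_eq_pair.1 h
      exact Prod.ext h1 h2
    have h2 := Bm_inj hinj (1/2)
    have h3 := Measure.infinitePi_map_curry (ι := ℕ) (κ := ℕ) (fun _ _ => bern (1/2))
    unfold Bm at h2 ⊢
    rw [← h3, ← h2, Measure.map_map]
    · rfl
    · exact MeasurableEquiv.measurable _
    · exact measurable_pi_lambda _ fun q => measurable_pi_apply _
  have e : (fun x i => unif i x) = (fun (c : ℕ → ℕ → Prop) i => UU (c i)) ∘ 
      (fun (b : ℕ → Prop) (i k : ℕ) => b (Nat.pair i k)) ∘ bp := by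
    funext x i
    exact unif_eq i x
  have hU : Measurable (fun (c : ℕ → ℕ → Prop) i => UU (c i)) :=
    measurable_pi_lambda _ fun i => UU_meas.comp (measurable_pi_apply i)
  rw [e, ← Measure.map_map hU (hG.comp bp_meas), ← Measure.map_map hG bp_meas, bits_law, h1,
    Measure.infinitePi_map_pi _ (fun _ => UU_meas)]
  simp_rw [UU_law]

end DaC

namespace DaC

lemma eIdx_comm (u v : V) : eIdx u v = eIdx v u := by unfold eIdx; exact min_comm _ _

noncomputable def eS : Sym2 V → ℕ := Sym2.lift ⟨eIdx, eIdx_comm⟩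

lemma eS_mk (u v : V) : eS s(u, v) = eIdx u v := rfl

lemma eS_inj : Function.Injective eS := by
  intro e f
  induction e using Sym2.inductionOn with | _ a b => ?_
  induction f using Sym2.inductionOn with | _ c d => ?_
  intro h
  rw [eS_mk, eS_mk] at h
  unfold eIdx at h
  have hh : Encodable.encode (a, b) = Encodable.encode (c, d) ∨ Encodable.encode (a, b) = Encodable.encode (d, c) ∨
      Encodable.encode (b, a) = Encodable.encode (c, d) ∨ Encodable.encode (b, a) = Encodable.encode (d, c) := by omega
  simp only [Encodable.encode_inj, Prod.mk.injEq] at hh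
  rw [Sym2.eq_iff]
  tauto

noncomputable def ix : Sym2 V ⊕ V → ℕ := Sum.elim (fun e => 2 * eS e) (fun v => 2 * Encodable.encode v + 1)

lemma ix_inj : Function.Injective ix := by
  rintro (e | v) (f | w) h
  · have h : 2 * eS e = 2 * eS f := h
    rw [eS_inj (by omega : eS e = eS f)]
  · have h : 2 * eS e = 2 * Encodable.encode w + 1 := h
    omega
  · have h : 2 * Encodable.encode v + 1 = 2 * eS f := h
    omega
  · have h : 2 * Encodable.encode v + 1 = 2 * Encodable.encode w + 1 := h
    rw [Encodable.encode_injective (by omega : Encodable.encode v = Encodable.encode w)]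

lemma lt_meas (p : ℝ) : Measurable (fun x : ℝ => x < p) := measurableSet_setOf.1 measurableSet_Iio

lemma thr_law {p : ℝ} (hp : 0 ≤ p ∧ p ≤ 1) : base.map (fun x => x < p) = bern p := by
  refine Measure.ext_of_singleton fun P => ?_
  rw [Measure.map_apply (lt_meas p) (by trivial), base_eq, Measure.restrict_apply ((lt_meas p) (by trivial))]
  by_cases hP : P
  · have e : (fun x : ℝ => x < p) ⁻¹' {P} ∩ Set.Ico 0 1 = Set.Ico 0 p := by
      ext x
      simp only [hP, Set.mem_inter_iff, Set.mem_preimage, Set.mem_singleton_iff, eq_iff_iff, iff_true, Set.mem_Ico]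
      constructor
      · rintro ⟨h1, h2, h3⟩; exact ⟨h2, h1⟩
      · rintro ⟨h1, h2⟩; exact ⟨h2, h1, by linarith [hp.2]⟩
    rw [e, Real.volume_Ico, eq_true hP, bern_true, cl01_eq hp, sub_zero]
  · have e : (fun x : ℝ => x < p) ⁻¹' {P} ∩ Set.Ico 0 1 = Set.Ico p 1 := by
      ext x
      simp only [hP, Set.mem_inter_iff, Set.mem_preimage, Set.mem_singleton_iff, eq_iff_iff, iff_false, Set.mem_Ico, not_lt]
      constructor
      · rintro ⟨h1, h2, h3⟩; exact ⟨h1, h3⟩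
      · rintro ⟨h1, h2⟩; exact ⟨h1, by linarith [hp.1], h2⟩
    rw [e, Real.volume_Ico, eq_false hP, bern_false, cl01_eq hp]

noncomputable def Ph (p r : ℝ) (x : ℝ) : Om := (fun e => unif (2 * eS e) x < p, fun v => vtxU v x < r)

lemma Ph_meas (p r : ℝ) : Measurable (Ph p r) := by
  refine Measurable.prodMk (measurable_pi_lambda _ fun e => ?_) (measurable_pi_lambda _ fun v => ?_)
  · exact (lt_meas p).comp ((measurable_pi_apply (2 * eS e)).comp unif_meas)
  · exact (lt_meas r).comp ((measurable_pi_apply (2 * Encodable.encode v + 1)).comp unif_meas)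

lemma sum_meas : Measurable (fun (x : Om) => (Sum.elim x.1 x.2 : Sym2 V ⊕ V → Prop)) := by
  refine measurable_pi_lambda _ ?_
  rintro (e | v)
  · exact (measurable_pi_apply e).comp measurable_fst
  · exact (measurable_pi_apply v).comp measurable_snd

instance elim_prob (p r : ℝ) (i : Sym2 V ⊕ V) : IsProbabilityMeasure (bern (Sum.elim (fun _ : Sym2 V => p) (fun _ : V => r) i)) :=
  bern_prob _

lemma sum_law (p r : ℝ) : (PP p r).map (fun (x : Om) => (Sum.elim x.1 x.2 : Sym2 V ⊕ V → Prop)) =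
    Measure.infinitePi (fun i : Sym2 V ⊕ V => bern (Sum.elim (fun _ : Sym2 V => p) (fun _ : V => r) i)) := by
  classical
  refine Measure.eq_infinitePi _ fun s t ht => ?_
  rw [Measure.map_apply sum_meas (.pi s.countable_toSet fun i _ => ht i)]
  have e : (fun (x : Om) => (Sum.elim x.1 x.2 : Sym2 V ⊕ V → Prop)) ⁻¹' (Set.pi (s : Set (Sym2 V ⊕ V)) t) =
      (Set.pi (s.toLeft : Set (Sym2 V)) (fun i => t (Sum.inl i))) ×ˢ (Set.pi (s.toRight : Set V) (fun i => t (Sum.inr i))) := by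
    ext x
    simp only [Set.mem_preimage, Set.mem_pi, Set.mem_prod, Finset.mem_coe, Finset.mem_toLeft, Finset.mem_toRight,
      Sum.forall, Sum.elim_inl, Sum.elim_inr]
  rw [e, PP, Measure.prod_prod, Bm, Bm, Measure.infinitePi_pi _ (fun i _ => ht _), Measure.infinitePi_pi _ (fun i _ => ht _)]
  conv_rhs => rw [← Finset.toLeft_disjSum_toRight (u := s), Finset.prod_disjSum]
  rfl

lemma Ph_law {p r : ℝ} (hp : 0 ≤ p ∧ p ≤ 1) (hr : 0 ≤ r ∧ r ≤ 1) : base.map (Ph p r) = PP p r := by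
  have hS : Measurable (fun (y : ℕ → ℝ) (i : Sym2 V ⊕ V) => y (ix i)) :=
    measurable_pi_lambda _ fun i => measurable_pi_apply _
  let f : Sym2 V ⊕ V → ℝ → Prop := fun i y => y < Sum.elim (fun _ : Sym2 V => p) (fun _ : V => r) i
  have hf : ∀ i, Measurable (f i) := fun i => lt_meas _
  have hF : Measurable (fun (y : Sym2 V ⊕ V → ℝ) i => f i (y i)) :=
    measurable_pi_lambda _ fun i => (hf i).comp (measurable_pi_apply i)
  have h1 : base.map ((fun (x : Om) => (Sum.elim x.1 x.2 : Sym2 V ⊕ V → Prop)) ∘ Ph p r) =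
      Measure.infinitePi (fun i : Sym2 V ⊕ V => bern (Sum.elim (fun _ : Sym2 V => p) (fun _ : V => r) i)) := by
    have e : ((fun (x : Om) => (Sum.elim x.1 x.2 : Sym2 V ⊕ V → Prop)) ∘ Ph p r) =
        (fun (y : Sym2 V ⊕ V → ℝ) i => f i (y i)) ∘ (fun (y : ℕ → ℝ) (i : Sym2 V ⊕ V) => y (ix i)) ∘
          (fun x i => unif i x) := by
      funext x i
      rcases i with i | i <;> rfl
    rw [e, ← Measure.map_map hF (hS.comp unif_meas), ← Measure.map_map hS unif_meas, unif_law,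
      Measure.map_infinitePi_infinitePi_of_inj ix_inj, Measure.infinitePi_map_pi _ hf]
    congr 1
    funext i
    refine thr_law ?_
    rcases i with i | i
    · exact hp
    · exact hr
  rw [← sum_law p r, ← Measure.map_map sum_meas (Ph_meas p r)] at h1
  let g : (Sym2 V ⊕ V → Prop) → Om := fun z => (fun e => z (Sum.inl e), fun v => z (Sum.inr v))
  have hg : Measurable g := Measurable.prodMk (measurable_pi_lambda _ fun e => measurable_pi_apply _)
    (measurable_pi_lambda _ fun e => measurable_pi_apply _)
  have h2 := congrArg (Measure.map g) h1
  rw [Measure.map_map hg sum_meas, Measure.map_map hg sum_meas] at h2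
  have : g ∘ (fun (x : Om) => (Sum.elim x.1 x.2 : Sym2 V ⊕ V → Prop)) = id := by
    funext x; rfl
  rw [this, Measure.map_id, Measure.map_id] at h2
  exact h2

lemma edge_iff (p r x : ℝ) (u v : V) : edgeCfg SqAdj p x u v = true ↔ bondR (Ph p r x).1 u v := by
  unfold edgeCfg
  rw [Bool.and_eq_true, boolOf_iff, boolOf_iff]
  rfl

lemma clu_eq (p r x : ℝ) (v : V) : pCluster (edgeCfg SqAdj p x) v = clu (bondR (Ph p r x).1) Set.univ v := by
  ext w
  constructor
  · intro h
    exact Relation.ReflTransGen.mono (fun a b hab => ⟨(edge_iff p r x a b).1 hab, trivial, trivial⟩) _ _ h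
  · intro h
    exact Relation.ReflTransGen.mono (fun a b hab => (edge_iff p r x a b).2 hab.1) _ _ h

lemma rep_eq (p r x : ℝ) (v : V) : clusterRep (edgeCfg SqAdj p x) v = crep (clu (bondR (Ph p r x).1) Set.univ v) := by
  obtain ⟨w, hw, he⟩ := cr_spec (clu_ne (bondR (Ph p r x).1) Set.univ v)
  unfold clusterRep crep
  rw [clu_eq p r x, ← he, Encodable.encodek]
  rfl

lemma col_eq (p r x : ℝ) : colourCfg SqAdj p r x = fun v => boolOf (xi Set.univ (Ph p r x) v) := by
  funext v
  unfold colourCfg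
  rw [rep_eq p r x]
  rfl

lemma boolOf_meas : Measurable boolOf := measurable_of_finite _

lemma M_meas (p r : ℝ) : Measurable (fun x => ((edgeCfg SqAdj p x, colourCfg SqAdj p r x) : Config)) := by
  refine Measurable.prodMk (measurable_pi_lambda _ fun u => measurable_pi_lambda _ fun v => ?_)
    (measurable_pi_lambda _ fun v => ?_)
  · have : (fun x => edgeCfg SqAdj p x u v) = fun x => boolOf (bondR (Ph p 0 x).1 u v) := by
      funext x
      rw [Bool.eq_iff_iff, boolOf_iff]
      exact edge_iff p 0 x u v
    rw [this]
    refine boolOf_meas.comp ?_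
    exact (measurable_pi_apply v).comp ((measurable_pi_apply u).comp
      (bondR_meas.comp (measurable_fst.comp (Ph_meas p 0))))
  · simp_rw [col_eq]
    exact boolOf_meas.comp ((measurable_pi_apply v).comp (meas_xi.comp (Ph_meas p r)))

def tc (ξ : ColourCfg) : Col := fun v => ξ v = true

lemma tc_meas : Measurable tc := by
  refine measurable_pi_lambda _ fun v => ?_
  exact (measurable_of_finite (fun b : Bool => b = true)).comp (measurable_pi_apply v)

lemma dac_law {p r : ℝ} (hp : 0 ≤ p ∧ p ≤ 1) (hr : 0 ≤ r ∧ r ≤ 1) {A : Set Col} (hA : MeasurableSet A) :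
    DaCMeasure SqAdj p r {ω | tc ω.2 ∈ A} = lam p r A := by
  unfold DaCMeasure
  have hB : MeasurableSet {ω : Config | tc ω.2 ∈ A} := (tc_meas.comp measurable_snd) hA
  rw [Measure.map_apply (M_meas p r) hB, lam, ← Ph_law hp hr,
    Measure.map_apply meas_xi hA, Measure.map_apply (Ph_meas p r) (meas_xi hA)]
  congr 1
  ext x
  have : tc (colourCfg SqAdj p r x) = xi Set.univ (Ph p r x) := by
    funext v
    rw [col_eq]
    exact propext boolOf_iff
  show tc (colourCfg SqAdj p r x) ∈ A ↔ xi Set.univ (Ph p r x) ∈ A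
  rw [this]

end DaC

namespace DaC

lemma sph_cluster {η : Cfg} {n : ℕ} (hn : 0 < n) (h : η ∈ Arm n) :
    ∃ w, supN w = n ∧ w ≠ 0 ∧ CI η Set.univ 0 w := by
  obtain ⟨u, w, hu, hw, hc⟩ := h
  have hw' : supN w = n := hw
  rw [Set.mem_singleton_iff.1 hu] at hc
  refine ⟨w, hw', ?_, hc.mono (Set.subset_univ _)⟩
  rintro rfl
  have h0 : supN (0 : V) = 0 := by simp [supN]
  omega

/-- the relation between clusters and open paths -/
structure CluRel (F : Col → Cfg) (S : ColourCfg → Set V) : Prop where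
  good : ∀ ξ, GoodCfg (F ξ)
  fwd : ∀ ξ w, w ∈ S ξ → CI (F (tc ξ)) Set.univ 0 w
  bwd : ∀ ξ w, w ≠ 0 → CI (F (tc ξ)) Set.univ 0 w → w ∈ S ξ

lemma blk_rel : CluRel blkR (fun ξ => monoCluster SqAdj ξ true origin) where
  good := fun ξ => blkR_good ξ
  fwd := fun ξ w h => Relation.ReflTransGen.mono (fun a b hab => ⟨⟨hab.1, hab.2.1, hab.2.2⟩, trivial, trivial⟩) _ _ h.2
  bwd := fun ξ w hw h => by
    refine ⟨?_, Relation.ReflTransGen.mono (fun a b hab => ⟨hab.1.1, hab.1.2.1, hab.1.2.2⟩) _ _ h⟩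
    rcases Relation.ReflTransGen.cases_head h with h | ⟨c, hc, _⟩
    · exact absurd h.symm hw
    · exact hc.1.2.1

lemma wht_rel : CluRel whtR (fun ξ => monoCluster StarAdj ξ false origin) where
  good := fun ξ => whtR_good ξ
  fwd := fun ξ w h => Relation.ReflTransGen.mono (fun a b hab => ⟨⟨hab.1, by
    show ¬ (ξ a = true); rw [hab.2.1]; simp, by show ¬ (ξ b = true); rw [hab.2.2]; simp⟩, trivial, trivial⟩) _ _ h.2
  bwd := fun ξ w hw h => by
    refine ⟨?_, Relation.ReflTransGen.mono (fun a b hab => ⟨hab.1.1, Bool.eq_false_iff.2 hab.1.2.1, Bool.eq_false_iff.2 hab.1.2.2⟩) _ _ h⟩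
    rcases Relation.ReflTransGen.cases_head h with h | ⟨c, hc, _⟩
    · exact absurd h.symm hw
    · exact Bool.eq_false_iff.2 hc.1.2.1

lemma CluRel.inf_iff {F : Col → Cfg} {S : ColourCfg → Set V} (h : CluRel F S) (ξ : ColourCfg) :
    (S ξ).Infinite ↔ tc ξ ∈ InfA F := by
  constructor
  · intro hi n
    obtain ⟨w, hw, hwn⟩ : ∃ w ∈ S ξ, w ∉ bx 0 (n : ℤ) := by
      by_contra hc
      push Not at hc
      exact hi ((bx 0 (n:ℤ)).finite_toSet.subset fun w hw => hc w hw)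
    refine arm_exit (h.good _) (R := Set.univ) (A := {0}) (u := 0) (v := w) rfl ?_ ?_ (h.fwd ξ w hw)
    · rw [mem_bx]; simp
    · by_contra hlt
      exact hwn (supN_le.1 (by omega))
  · intro hA hf
    have hA' : ∀ n : ℕ, F (tc ξ) ∈ Arm n := hA
    obtain ⟨M, hM⟩ : ∃ M : ℕ, ∀ w ∈ S ξ, (supN w).toNat ≤ M := by
      obtain ⟨M, hM⟩ := (hf.image (fun w => (supN w).toNat)).bddAbove
      exact ⟨M, fun w hw => hM ⟨w, hw, rfl⟩⟩
    obtain ⟨w, h1, h2, h3⟩ := sph_cluster (Nat.succ_pos M) (hA' (M + 1))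
    have := hM w (h.bwd ξ w h2 h3)
    push_cast at h1
    omega

open Classical in
lemma CluRel.size {F : Col → Cfg} {S : ColourCfg → Set V} (h : CluRel F S) (ξ : ColourCfg) (N : ℕ) :
    ∑ n ∈ Finset.Icc 1 N, (if F (tc ξ) ∈ Arm (n : ℤ) then (1 : ℝ≥0∞) else 0) ≤ sizeE (S ξ) := by
  set T := (Finset.Icc 1 N).filter (fun n : ℕ => F (tc ξ) ∈ Arm (n : ℤ)) with hT
  have hex : ∀ n : ℕ, ∃ w, n ∈ T → (supN w = n ∧ w ≠ 0 ∧ CI (F (tc ξ)) Set.univ 0 w) := by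
    intro n
    by_cases hn : n ∈ T
    · rw [hT, Finset.mem_filter, Finset.mem_Icc] at hn
      obtain ⟨w, hw⟩ := sph_cluster (by omega) hn.2
      exact ⟨w, fun _ => hw⟩
    · exact ⟨0, fun h => absurd h hn⟩
  choose w hw using hex
  have hinj : Set.InjOn w (T : Set ℕ) := by
    intro a ha b hb hab
    have h1 := (hw a ha).1
    have h2 := (hw b hb).1
    rw [hab] at h1
    omega
  have hsub : ((T.image w : Finset V) : Set V) ⊆ S ξ := by
    intro v hv
    obtain ⟨n, hn, rfl⟩ := Finset.mem_image.1 (Finset.mem_coe.1 hv)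
    exact h.bwd ξ _ (hw n hn).2.1 (hw n hn).2.2
  have hle := Set.encard_le_encard hsub
  rw [Set.encard_coe_eq_coe_finsetCard, Finset.card_image_of_injOn hinj] at hle
  rw [Finset.sum_ite, Finset.sum_const_zero, add_zero, Finset.sum_const, ← hT, nsmul_eq_mul, mul_one]
  unfold sizeE
  have := ENat.toENNReal_le.2 hle
  simpa using this

lemma CluRel.mean {F : Col → Cfg} {S : ColourCfg → Set V} (h : CluRel F S) (hF : Measurable F) {p r : ℝ}
    (hp : 0 ≤ p ∧ p ≤ 1) (hr : 0 ≤ r ∧ r ≤ 1) 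
    (hc : ∃ c : ℝ, 0 < c ∧ ∃ n1 : ℕ, ∀ n : ℕ, n1 ≤ n → 0 < n → c / n ≤ (lam p r).real (F ⁻¹' Arm n)) :
    (∫⁻ ω, sizeE (S ω.2) ∂(DaCMeasure SqAdj p r)) = ⊤ := by
  classical
  obtain ⟨c, c0, n1, hc⟩ := hc
  have hb : ∀ N : ℕ, ∑ n ∈ Finset.Icc 1 N, lam p r (F ⁻¹' Arm (n:ℤ)) ≤ ∫⁻ ω, sizeE (S ω.2) ∂(DaCMeasure SqAdj p r) := by
    intro N
    refine le_trans (le_of_eq ?_) (lintegral_mono fun ω => h.size ω.2 N)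
    have hm : ∀ n : ℕ, MeasurableSet {ω : Config | tc ω.2 ∈ F ⁻¹' Arm (n:ℤ)} := fun n =>
      (tc_meas.comp measurable_snd) (hF (Arm_meas n))
    have e : ∀ n : ℕ, (fun ω : Config => (if F (tc ω.2) ∈ Arm (n : ℤ) then (1 : ℝ≥0∞) else 0)) =
        {ω : Config | tc ω.2 ∈ F ⁻¹' Arm (n:ℤ)}.indicator 1 := by
      intro n; funext ω
      by_cases hω : F (tc ω.2) ∈ Arm (n : ℤ)
      · rw [if_pos hω, Set.indicator_of_mem (show ω ∈ {ω : Config | tc ω.2 ∈ F ⁻¹' Arm (n:ℤ)} from hω)]; rfl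
      · rw [if_neg hω, Set.indicator_of_notMem (show ω ∉ {ω : Config | tc ω.2 ∈ F ⁻¹' Arm (n:ℤ)} from hω)]
    rw [lintegral_finsetSum]
    · refine Finset.sum_congr rfl fun n _ => ?_
      rw [e n, lintegral_indicator_one (hm n), dac_law hp hr (hF (Arm_meas n))]
    · intro n _
      rw [e n]
      exact measurable_one.indicator (hm n)
  have hb2 : ∀ N : ℕ, ENNReal.ofReal (∑ n ∈ Finset.Icc (n1+1) N, c / n) ≤ ∫⁻ ω, sizeE (S ω.2) ∂(DaCMeasure SqAdj p r) := by
    intro N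
    refine le_trans ?_ (hb N)
    rw [ENNReal.ofReal_sum_of_nonneg (fun n _ => by positivity)]
    refine le_trans (Finset.sum_le_sum fun n hn => ?_) (Finset.sum_le_sum_of_subset (s := Finset.Icc (n1+1) N) fun n hn => ?_)
    · have := Finset.mem_Icc.1 hn
      exact ENNReal.ofReal_le_of_le_toReal (hc n (by omega) (by omega))
    · have := Finset.mem_Icc.1 hn
      exact Finset.mem_Icc.2 ⟨by omega, this.2⟩
  by_contra hne
  set I := ∫⁻ ω, sizeE (S ω.2) ∂(DaCMeasure SqAdj p r) with hI
  have hsum : Summable (fun n : ℕ => c / ((n + (n1 + 1) : ℕ) : ℝ)) := by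
    refine summable_of_sum_range_le (c := I.toReal) (fun n => by positivity) fun k => ?_
    have h1 := ENNReal.toReal_mono hne (hb2 (n1 + k))
    rw [ENNReal.toReal_ofReal (Finset.sum_nonneg fun n _ => by positivity)] at h1
    refine le_trans (le_of_eq ?_) h1
    rw [← Finset.Ico_add_one_right_eq_Icc, Finset.sum_Ico_eq_sum_range]
    rw [show n1 + k + 1 - (n1 + 1) = k by omega]
    refine Finset.sum_congr rfl fun i _ => ?_
    rw [add_comm i]
  have h2 := (summable_nat_add_iff (f := fun n : ℕ => c / (n : ℝ)) (n1 + 1)).1 hsum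
  have h3 := h2.mul_left c⁻¹
  refine Real.not_summable_one_div_natCast (h3.congr fun n => ?_)
  field_simp

lemma theta_eq {p r : ℝ} (hp : 0 ≤ p ∧ p ≤ 1) (hr : 0 ≤ r ∧ r ≤ 1) : thetaSq p r = lam p r (InfA blkR) := by
  unfold thetaSq percProb
  rw [← dac_law hp hr (InfA_meas blkR_meas)]
  congr 1
  ext ω
  exact blk_rel.inf_iff ω.2

lemma thetaS_eq {p r : ℝ} (hp : 0 ≤ p ∧ p ≤ 1) (hr : 0 ≤ r ∧ r ≤ 1) : thetaStarSq p (1 - r) = lam p r (InfA whtR) := by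
  unfold thetaStarSq percProb
  rw [show (1 - (1 - r) : ℝ) = r by ring, ← dac_law hp hr (InfA_meas whtR_meas)]
  congr 1
  ext ω
  exact wht_rel.inf_iff ω.2

lemma crit_final (p : ℝ) (hp0 : 0 ≤ p) (hp : p < 1 / 2) :
    thetaSq p (rcSq p) = 0 ∧ thetaStarSq p (1 - rcSq p) = 0 ∧
    (∫⁻ ω, sizeE (monoCluster SqAdj ω.2 true origin) ∂(DaCMeasure SqAdj p (rcSq p))) = ⊤ ∧
    (∫⁻ ω, sizeE (monoCluster StarAdj ω.2 false origin) ∂(DaCMeasure SqAdj p (rcSq p))) = ⊤ := by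
  have hp' : 0 ≤ p ∧ p ≤ 1 := ⟨hp0, by linarith⟩
  have hrc : rcSq p = sSup {r | r ∈ Set.Icc (0:ℝ) 1 ∧ lam p r (InfA blkR) = 0} := by
    unfold rcSq
    congr 1
    ext r
    refine and_congr_right fun hr => ?_
    rw [theta_eq hp' hr]
  obtain ⟨h0, h1, h2, h3, h4⟩ := critical_core hp0 hp hrc
  have hr : 0 ≤ rcSq p ∧ rcSq p ≤ 1 := ⟨h0.1.le, h0.2.le⟩
  exact ⟨by rw [theta_eq hp' hr]; exact h1, by rw [thetaS_eq hp' hr]; exact h2,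
    blk_rel.mean blkR_meas hp' hr h3, wht_rel.mean whtR_meas hp' hr h4⟩

end DaC

namespace DaC

/-- **Criticality.** For `0 ≤ p < 1/2` the DaC model is critical at
`r = r_c(p)`: there is no black percolation and no white `*`-percolation, and
the mean sizes of the black cluster and of the white `*`-cluster of the origin
are both infinite. -/
theorem critical_at_rc (p : ℝ) (hp0 : 0 ≤ p) (hp : p < 1 / 2) :
    thetaSq p (rcSq p) = 0 ∧ thetaStarSq p (1 - rcSq p) = 0 ∧
    (∫⁻ ω, sizeE (monoCluster SqAdj ω.2 true origin)
        ∂(DaCMeasure SqAdj p (rcSq p))) = ⊤ ∧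
    (∫⁻ ω, sizeE (monoCluster StarAdj ω.2 false origin)
        ∂(DaCMeasure SqAdj p (rcSq p))) = ⊤ :=
  crit_final p hp0 hp

end DaC
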